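/- Let Ω ⊂ ℝ² be a closed polygon, let 0 < α, ᾶ ≤ 1, and let h : Ω → ℝ² be a homeomorphism onto its image with |h|_α < ∞ and with |h⁻¹|_ᾶ < ∞ on h(Ω). Set γ := α⁴ᾶ³ / (3 + 6αᾶ − 6α²ᾶ² − α³ᾶ³ − α⁴ᾶ³). Then for every β with 0 < β < γ there exist constants ε₀ > 0 and D > 0 such that for every ε with 0 < ε ≤ ε₀ there exist a triangulation K of Ω and a homeomorphism f : Ω → f(Ω) ⊂ ℝ², piecewise affine over K, satisfying ‖f − h‖_∞ ≤ ε and |f − h|_β ≤ D · ε^{1 − β/γ}. -/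

import Mathlib

open Set Geometry EuclideanGeometry Metric Real

noncomputable section

abbrev E2 : Type := EuclideanSpace ℝ (Fin 2)

/-- The set of Hölder ratios of exponent `α` of `u` on `S`. -/
def holderRatioSet (α : ℝ) (S : Set E2) (u : E2 → E2) : Set ℝ :=
  {c | ∃ x ∈ S, ∃ y ∈ S, x ≠ y ∧ c = ‖u x - u y‖ / ‖x - y‖ ^ α}

/-- The Hölder seminorm of exponent `α` of `u` on `S`. -/
def holderSeminorm (α : ℝ) (S : Set E2) (u : E2 → E2) : ℝ :=
  sSup (holderRatioSet α S u)

/-- The supremum norm of `u` on `S`. -/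
def supNorm (S : Set E2) (u : E2 → E2) : ℝ :=
  sSup ((fun x => ‖u x‖) '' S)

/-- `f` is a homeomorphism of `S` onto its image `f '' S`. -/
def IsHomeoOn (f : E2 → E2) (S : Set E2) : Prop :=
  ContinuousOn f S ∧ Set.InjOn f S ∧ ContinuousOn (Function.invFunOn f S) (f '' S)

/-- `K` is a triangulation of `Ω`. -/
def IsTriangulation (K : SimplicialComplex ℝ E2) (Ω : Set E2) : Prop :=
  K.faces.Finite ∧ (∀ s ∈ K.faces, s.card ≤ 3) ∧ K.space = Ω ∧
    ∀ s ∈ K.faces, ∃ t ∈ K.faces, s ⊆ t ∧ t.card = 3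

/-- A closed polygon: a compact set admitting a triangulation. -/
def IsClosedPolygon (Ω : Set E2) : Prop :=
  IsCompact Ω ∧ ∃ K : SimplicialComplex ℝ E2, IsTriangulation K Ω

/-- `f` is piecewise affine over the simplicial complex `K`. -/
def PiecewiseAffineOn (f : E2 → E2) (K : SimplicialComplex ℝ E2) : Prop :=
  ∀ s ∈ K.faces, ∃ A : E2 →ᵃ[ℝ] E2, ∀ x ∈ convexHull ℝ (s : Set E2), f x = A x

/-- Every angle of every triangular face of `K` has sine at least `c`. -/
def AngleLB (K : SimplicialComplex ℝ E2) (c : ℝ) : Prop :=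
  ∀ s ∈ K.faces, ∀ p ∈ s, ∀ q ∈ s, ∀ r ∈ s,
    p ≠ q → q ≠ r → p ≠ r → c ≤ Real.sin (∠ p q r)

/-- Length of an edge (a two-element face). -/
def edgeLen (e : Finset E2) : ℝ := Metric.diam (e : Set E2)

/-- `o` is the incenter of the triangle `p₁p₂p₃` with inradius `r`. -/
def IsIncenter (p₁ p₂ p₃ o : E2) (r : ℝ) : Prop :=
  o ∈ interior (convexHull ℝ {p₁, p₂, p₃}) ∧
  Metric.infDist o (affineSpan ℝ ({p₁, p₂} : Set E2) : Set E2) = r ∧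
  Metric.infDist o (affineSpan ℝ ({p₂, p₃} : Set E2) : Set E2) = r ∧
  Metric.infDist o (affineSpan ℝ ({p₃, p₁} : Set E2) : Set E2) = r

open scoped Topology

notation "conv" s:max => convexHull ℝ s

notation "cell" s:max => convexHull ℝ ((s : Finset E2) : Set E2)

/-! ### Closed polygons in the plane and their winding numbers -/

section Polygons

variable {p : ℕ → ℂ} {I : Finset ℕ} {c d : ℕ}

/-- The edges of the cycle that runs through the finite set `I` in increasing order. -/
def cycEdges (I : Finset ℕ) : Finset (ℕ × ℕ) :=
  (I ×ˢ I).filter fun e => (e.1 < e.2 ∧ ∀ k ∈ I, k ≤ e.1 ∨ e.2 ≤ k) ∨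
    (e.2 < e.1 ∧ ∀ k ∈ I, e.2 ≤ k ∧ k ≤ e.1)

theorem mem_cycEdges {i j : ℕ} : (i, j) ∈ cycEdges I ↔ i ∈ I ∧ j ∈ I ∧
    ((i < j ∧ ∀ k ∈ I, k ≤ i ∨ j ≤ k) ∨ (j < i ∧ ∀ k ∈ I, j ≤ k ∧ k ≤ i)) := by
  simp [cycEdges, and_assoc]

theorem exists_cycEdges_fst (hI : 2 ≤ I.card) {i : ℕ} (hi : i ∈ I) : ∃ j, (i, j) ∈ cycEdges I := by
  by_cases h : (I.filter (i < ·)).Nonempty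
  · refine ⟨(I.filter (i < ·)).min' h, ?_⟩
    have h1 := Finset.min'_mem _ h
    rw [Finset.mem_filter] at h1
    refine mem_cycEdges.2 ⟨hi, h1.1, Or.inl ⟨h1.2, fun k hk => ?_⟩⟩
    by_cases hk' : k ≤ i
    · exact Or.inl hk'
    · exact Or.inr (Finset.min'_le _ _ (by simp [hk]; omega))
  · have hne : I.Nonempty := ⟨i, hi⟩
    have hmax : ∀ k ∈ I, k ≤ i := by
      simp_all
    refine ⟨I.min' hne, mem_cycEdges.2 ⟨hi, I.min'_mem hne, Or.inr ⟨?_, fun k hk =>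
      ⟨I.min'_le k hk, hmax k hk⟩⟩⟩⟩
    obtain ⟨k, hk, hki⟩ := Finset.exists_mem_ne (s := I) (by omega) i
    have := I.min'_le k hk
    have := hmax k hk
    omega

theorem exists_cycEdges_snd (hI : 2 ≤ I.card) {i : ℕ} (hi : i ∈ I) : ∃ j, (j, i) ∈ cycEdges I := by
  by_cases h : (I.filter (· < i)).Nonempty
  · refine ⟨(I.filter (· < i)).max' h, ?_⟩
    have h1 := Finset.max'_mem _ h
    rw [Finset.mem_filter] at h1
    refine mem_cycEdges.2 ⟨h1.1, hi, Or.inl ⟨h1.2, fun k hk => ?_⟩⟩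
    by_cases hk' : i ≤ k
    · exact Or.inr hk'
    · exact Or.inl (Finset.le_max' _ _ (by simp [hk]; omega))
  · have hne : I.Nonempty := ⟨i, hi⟩
    have hmin : ∀ k ∈ I, i ≤ k := by
      simp_all
    refine ⟨I.max' hne, mem_cycEdges.2 ⟨I.max'_mem hne, hi, Or.inr ⟨?_, fun k hk =>
      ⟨hmin k hk, I.le_max' k hk⟩⟩⟩⟩
    obtain ⟨k, hk, hki⟩ := Finset.exists_mem_ne (s := I) (by omega) i
    have := I.le_max' k hk
    have := hmin k hk
    omega

theorem cycEdges_fst_inj {i j k : ℕ} (h : (i, j) ∈ cycEdges I)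
    (h' : (i, k) ∈ cycEdges I) : j = k := by
  rw [mem_cycEdges] at h h'
  grind

theorem cycEdges_snd_inj {i j k : ℕ} (h : (j, i) ∈ cycEdges I)
    (h' : (k, i) ∈ cycEdges I) : j = k := by
  rw [mem_cycEdges] at h h'
  grind

theorem sum_cycEdges_fst {A : Type*} [AddCommMonoid A] (hI : 2 ≤ I.card)
    (f : ℕ → A) : ∑ e ∈ cycEdges I, f e.1 = ∑ i ∈ I, f i := by
  refine Finset.sum_bij (fun e _ => e.1) (fun e he => (mem_cycEdges.1 he).1) ?_ ?_ (fun _ _ => rfl)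
  · rintro ⟨i, j⟩ h ⟨i', j'⟩ h' rfl
    rw [cycEdges_fst_inj h h']
  · intro i hi
    obtain ⟨j, hj⟩ := exists_cycEdges_fst hI hi
    exact ⟨_, hj, rfl⟩

theorem sum_cycEdges_snd {A : Type*} [AddCommMonoid A] (hI : 2 ≤ I.card)
    (f : ℕ → A) : ∑ e ∈ cycEdges I, f e.2 = ∑ i ∈ I, f i := by
  refine Finset.sum_bij (fun e _ => e.2) (fun e he => (mem_cycEdges.1 he).2.1) ?_ ?_
    (fun _ _ => rfl)
  · rintro ⟨i, j⟩ h ⟨i', j'⟩ h' rfl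
    rw [cycEdges_snd_inj h h']
  · intro i hi
    obtain ⟨j, hj⟩ := exists_cycEdges_snd hI hi
    exact ⟨_, hj, rfl⟩

/-- The part of a cycle between two of its vertices. -/
def arcIn (I : Finset ℕ) (c d : ℕ) : Finset ℕ := I.filter fun k => c ≤ k ∧ k ≤ d

/-- The complementary part of a cycle between two of its vertices. -/
def arcOut (I : Finset ℕ) (c d : ℕ) : Finset ℕ := I.filter fun k => k ≤ c ∨ d ≤ k

theorem mem_arcIn {c d k : ℕ} : k ∈ arcIn I c d ↔ k ∈ I ∧ c ≤ k ∧ k ≤ d := by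
  simp [arcIn]

theorem mem_arcOut {c d k : ℕ} : k ∈ arcOut I c d ↔ k ∈ I ∧ (k ≤ c ∨ d ≤ k) := by
  simp [arcOut]

theorem chord_mem_arcIn (hc : c ∈ I) (hd : d ∈ I) (hcd : c < d) :
    (d, c) ∈ cycEdges (arcIn I c d) := by
  simp only [mem_cycEdges, mem_arcIn]
  grind

theorem chord_mem_arcOut (hc : c ∈ I) (hd : d ∈ I) (hcd : c < d) :
    (c, d) ∈ cycEdges (arcOut I c d) := by
  simp only [mem_cycEdges, mem_arcOut]
  grind

theorem cycEdges_split (hc : c ∈ I) (hd : d ∈ I)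
    (h1 : ∃ k ∈ I, c < k ∧ k < d) (h2 : ∃ k ∈ I, k < c ∨ d < k) :
    cycEdges I = (cycEdges (arcIn I c d)).erase (d, c) ∪ (cycEdges (arcOut I c d)).erase (c, d) := by
  obtain ⟨u, hu, hcu, hud⟩ := h1
  obtain ⟨v, hv, hv'⟩ := h2
  ext ⟨i, j⟩
  simp only [Finset.mem_union, Finset.mem_erase, mem_cycEdges, mem_arcIn, mem_arcOut, ne_eq,
    Prod.mk.injEq]
  grind

theorem cycEdges_split_disjoint (h1 : ∃ k ∈ I, c < k ∧ k < d) (h2 : ∃ k ∈ I, k < c ∨ d < k) :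
    Disjoint ((cycEdges (arcIn I c d)).erase (d, c)) ((cycEdges (arcOut I c d)).erase (c, d)) := by
  obtain ⟨u, hu, hcu, hud⟩ := h1
  obtain ⟨v, hv, hv'⟩ := h2
  rw [Finset.disjoint_left]
  rintro ⟨i, j⟩ h3 h4
  simp only [Finset.mem_erase, mem_cycEdges, mem_arcIn, mem_arcOut, ne_eq,
    Prod.mk.injEq] at h3 h4
  grind

/-- The union of the edges of a closed polygon. -/
def polyCurve (p : ℕ → ℂ) (I : Finset ℕ) : Set ℂ :=
  {x | ∃ e ∈ cycEdges I, x ∈ segment ℝ (p e.1) (p e.2)}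

/-- The winding number of a closed polygon. -/
def wind (p : ℕ → ℂ) (I : Finset ℕ) (q : ℂ) : ℝ :=
  (∑ e ∈ cycEdges I, Complex.arg ((p e.2 - q) / (p e.1 - q))) / (2 * π)

theorem mem_slitPlane_of_notMem_segment {a b q : ℂ} (h : q ∉ segment ℝ a b) :
    (b - q) / (a - q) ∈ Complex.slitPlane := by
  have ha : a - q ≠ 0 := fun h0 => h (by
    rw [sub_eq_zero] at h0; rw [← h0]; exact left_mem_segment ℝ a b)
  by_contra hn
  rw [Complex.mem_slitPlane_iff_not_le_zero, not_not, Complex.le_def] at hn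
  apply h
  set z := (b - q) / (a - q) with hz
  have hzr : z = ((z.re : ℝ) : ℂ) := Complex.ext rfl (by simpa using hn.2)
  have hb : b - q = z * (a - q) := by rw [hz]; field_simp
  rw [hzr] at hb
  set t := z.re
  have ht : t ≤ 0 := hn.1
  refine ⟨-t / (1 - t), 1 / (1 - t), div_nonneg (by linarith) (by linarith),
    div_nonneg (by norm_num) (by linarith), by grind, ?_⟩
  have h1 : (1 - (t : ℂ)) ≠ 0 := by
    have : (1 - t : ℝ) ≠ 0 := by linarith
    exact_mod_cast this
  have hb' : b = q + t * (a - q) := by rw [← hb]; ring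
  rw [hb']
  simp only [Complex.real_smul]
  push_cast
  field_simp
  ring

theorem sub_ne_zero_of_notMem_segment {a b q : ℂ} (h : q ∉ segment ℝ a b) :
    a - q ≠ 0 ∧ b - q ≠ 0 := by
  constructor
  · intro h0
    rw [sub_eq_zero] at h0
    exact h (h0 ▸ left_mem_segment ℝ a b)
  · intro h0
    rw [sub_eq_zero] at h0
    exact h (h0 ▸ right_mem_segment ℝ a b)

theorem wind_int (hI : 2 ≤ I.card) {q : ℂ} (hq : q ∉ polyCurve p I) : ∃ k : ℤ, wind p I q = k := by
  have h : ((∑ e ∈ cycEdges I, Complex.arg ((p e.2 - q) / (p e.1 - q)) : ℝ) : Real.Angle) = 0 := by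
    have h1 : ∀ e ∈ cycEdges I, ((Complex.arg ((p e.2 - q) / (p e.1 - q)) : ℝ) : Real.Angle) =
        (Complex.arg (p e.2 - q) : Real.Angle) - (Complex.arg (p e.1 - q) : Real.Angle) := by
      intro e he
      have := sub_ne_zero_of_notMem_segment (fun h => hq ⟨e, he, h⟩)
      exact Complex.arg_div_coe_angle this.2 this.1
    have h2 : ((∑ e ∈ cycEdges I, Complex.arg ((p e.2 - q) / (p e.1 - q)) : ℝ) : Real.Angle) =
        ∑ e ∈ cycEdges I, ((Complex.arg ((p e.2 - q) / (p e.1 - q)) : ℝ) : Real.Angle) :=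
      map_sum Real.Angle.coeHom _ _
    rw [h2, Finset.sum_congr rfl h1, Finset.sum_sub_distrib,
      sum_cycEdges_snd hI (fun i => (Complex.arg (p i - q) : Real.Angle)),
      sum_cycEdges_fst hI (fun i => (Complex.arg (p i - q) : Real.Angle)), sub_self]
  rw [Real.Angle.coe_eq_zero_iff] at h
  obtain ⟨k, hk⟩ := h
  refine ⟨k, ?_⟩
  rw [wind, ← hk]
  have := Real.pi_pos
  grind

theorem wind_const {X : Type*} [TopologicalSpace X] (hI : 2 ≤ I.card) {T : Set X}
    (hT : IsPreconnected T) (P : ℕ → X → ℂ) (Q : X → ℂ) (hP : ∀ i ∈ I, ContinuousOn (P i) T)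
    (hQ : ContinuousOn Q T) (h : ∀ t ∈ T, Q t ∉ polyCurve (fun i => P i t) I) {s t : X} (hs : s ∈ T)
    (ht : t ∈ T) : wind (fun i => P i s) I (Q s) = wind (fun i => P i t) I (Q t) := by
  have : DiscreteTopology (Set.range ((↑) : ℤ → ℝ)) :=
    (Int.isClosedEmbedding_coe_real.isEmbedding.toHomeomorph).symm.isEmbedding.discreteTopology
  refine IsPreconnected.constant_of_mapsTo hT (T := Set.range ((↑) : ℤ → ℝ))
    (isDiscrete_iff_discreteTopology.2 this) (f := fun t => wind (fun i => P i t) I (Q t)) ?_ ?_ hs ht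
  · refine ContinuousOn.div_const (continuousOn_finsetSum _ fun e he => ?_) _
    have hm := mem_cycEdges.1 he
    intro x hx
    have hx' : Q x ∉ segment ℝ (P e.1 x) (P e.2 x) := fun hh => h x hx ⟨e, he, hh⟩
    refine (Complex.continuousAt_arg (mem_slitPlane_of_notMem_segment hx')).comp_continuousWithinAt
      (f := fun t => (P e.2 t - Q t) / (P e.1 t - Q t)) ?_
    exact ((hP _ hm.2.1 x hx).sub (hQ x hx)).div ((hP _ hm.1 x hx).sub (hQ x hx))
      (sub_ne_zero_of_notMem_segment hx').1
  · intro x hx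
    obtain ⟨k, hk⟩ := wind_int hI (h x hx)
    exact ⟨k, hk.symm⟩

theorem wind_const_point (hI : 2 ≤ I.card) {T : Set ℂ}
    (hT : IsPreconnected T) (h : ∀ q ∈ T, q ∉ polyCurve p I) {s t : ℂ} (hs : s ∈ T)
    (ht : t ∈ T) : wind p I s = wind p I t :=
  wind_const hI hT (fun i _ => p i) id (fun _ _ => continuousOn_const) continuousOn_id h hs ht

theorem arg_div_of_re_pos {x y : ℂ} (hx : 0 < x.re) (hy : 0 < y.re) :
    Complex.arg (y / x) = Complex.arg y - Complex.arg x := by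
  have hx0 : x ≠ 0 := by rintro rfl; simp at hx
  have hy0 : y ≠ 0 := by rintro rfl; simp at hy
  have h1 := Complex.arg_div_coe_angle hy0 hx0
  have hx1 := Complex.abs_arg_lt_pi_div_two_iff.2 (Or.inl hx)
  have hy1 := Complex.abs_arg_lt_pi_div_two_iff.2 (Or.inl hy)
  rw [abs_lt] at hx1 hy1
  rw [← Real.Angle.coe_sub] at h1
  rw [← Complex.arg_coe_angle_toReal_eq_arg (y / x), h1, Real.Angle.toReal_coe_eq_self_iff]
  constructor <;> linarith

theorem wind_eq_zero_of_halfPlane (hI : 2 ≤ I.card) {q u : ℂ}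
    (h : ∀ i ∈ I, 0 < ((p i - q) * u).re) : wind p I q = 0 := by
  have h1 : ∀ e ∈ cycEdges I, Complex.arg ((p e.2 - q) / (p e.1 - q)) =
        Complex.arg ((p e.2 - q) * u) - Complex.arg ((p e.1 - q) * u) := by
    intro e he
    have hm := mem_cycEdges.1 he
    have hu : u ≠ 0 := by
      rintro rfl
      simpa using h _ hm.1
    rw [← arg_div_of_re_pos (h _ hm.1) (h _ hm.2.1), mul_div_mul_right _ _ hu]
  rw [wind, Finset.sum_congr rfl h1, Finset.sum_sub_distrib,
      sum_cycEdges_snd hI (fun i => (Complex.arg ((p i - q) * u))),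
      sum_cycEdges_fst hI (fun i => (Complex.arg ((p i - q) * u))), sub_self, zero_div]

theorem arg_div_swap {a b q : ℂ} (h : q ∉ segment ℝ a b) :
    Complex.arg ((a - q) / (b - q)) = - Complex.arg ((b - q) / (a - q)) := by
  rw [← inv_div, Complex.arg_inv, if_neg]
  intro hc
  have := Complex.slitPlane_arg_ne_pi (mem_slitPlane_of_notMem_segment h)
  exact this hc

theorem wind_split (hc : c ∈ I) (hd : d ∈ I) (hcd : c < d)
    (h1 : ∃ k ∈ I, c < k ∧ k < d) (h2 : ∃ k ∈ I, k < c ∨ d < k) {q : ℂ}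
    (hq : q ∉ segment ℝ (p c) (p d)) :
    wind p I q = wind p (arcIn I c d) q + wind p (arcOut I c d) q := by
  simp only [wind]
  rw [cycEdges_split hc hd h1 h2, Finset.sum_union (cycEdges_split_disjoint h1 h2),
    ← Finset.add_sum_erase _ _ (chord_mem_arcIn hc hd hcd),
    ← Finset.add_sum_erase _ _ (chord_mem_arcOut hc hd hcd), arg_div_swap hq]
  ring

theorem isClosed_polyCurve (p : ℕ → ℂ) (I : Finset ℕ) : IsClosed (polyCurve p I) := by
  have : polyCurve p I = ⋃ e ∈ cycEdges I, segment ℝ (p e.1) (p e.2) := by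
    ext x; simp [polyCurve]
  rw [this]
  refine Set.Finite.isClosed_biUnion (Finset.finite_toSet _) fun e _ => ?_
  rw [← convexHull_pair]
  exact (Set.toFinite _).isClosed_convexHull ℝ

/-- A closed polygon without self-intersections. -/
structure IsSimplePoly (p : ℕ → ℂ) (I : Finset ℕ) : Prop where
  card : 3 ≤ I.card
  inj : InjOn p I
  meet : ∀ e ∈ cycEdges I, ∀ e' ∈ cycEdges I, e ≠ e' → ∀ x ∈ segment ℝ (p e.1) (p e.2),
    x ∈ segment ℝ (p e'.1) (p e'.2) → ∃ i, (i = e.1 ∨ i = e.2) ∧ (i = e'.1 ∨ i = e'.2) ∧ x = p i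

/-- The points at which the winding number takes the value `ε`. -/
def polyInside (p : ℕ → ℂ) (I : Finset ℕ) (ε : ℝ) : Set ℂ :=
  {q | q ∉ polyCurve p I ∧ wind p I q = ε}

/-- The Jordan curve property of a polygon with orientation `ε`. -/
structure PolyJordan (p : ℕ → ℂ) (I : Finset ℕ) (ε : ℝ) : Prop where
  sign : ε = 1 ∨ ε = -1
  val : ∀ q, q ∉ polyCurve p I → wind p I q = 0 ∨ wind p I q = ε
  conn : IsPreconnected (polyInside p I ε)
  dense : polyCurve p I ⊆ closure (polyInside p I ε)

theorem vertex_mem_polyCurve (hI : 2 ≤ I.card) {i : ℕ} (hi : i ∈ I) : p i ∈ polyCurve p I := by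
  obtain ⟨j, hj⟩ := exists_cycEdges_fst hI hi
  exact ⟨_, hj, left_mem_segment ℝ _ _⟩

theorem IsSimplePoly.vertex_mem (h : IsSimplePoly p I) {k : ℕ}
    (hk : k ∈ I) {e : ℕ × ℕ} (he : e ∈ cycEdges I) (hx : p k ∈ segment ℝ (p e.1) (p e.2)) :
    k = e.1 ∨ k = e.2 := by
  have hI := h.card
  obtain ⟨j, hj⟩ := exists_cycEdges_fst (by omega) hk
  by_cases hje : (k, j) = e
  · grind
  · obtain ⟨i, hi1, hi2, hi3⟩ := h.meet _ hj _ he hje _ (left_mem_segment ℝ _ _) hx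
    have hm := mem_cycEdges.1 he
    have hiI : i ∈ I := by grind
    rw [h.inj hk hiI hi3]
    exact hi2

theorem cycEdges_ne {i j : ℕ} (h : (i, j) ∈ cycEdges I) : i ≠ j := by
  have := mem_cycEdges.1 h
  omega

theorem IsSimplePoly.edge_ne (h : IsSimplePoly p I) {i j : ℕ}
    (he : (i, j) ∈ cycEdges I) : p i ≠ p j := by
  have hm := mem_cycEdges.1 he
  exact fun hc => cycEdges_ne he (h.inj hm.1 hm.2.1 hc)

theorem openSegment_ne {a b x : ℂ} (hab : a ≠ b) (hx : x ∈ openSegment ℝ a b) : x ≠ a ∧ x ≠ b := by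
  aesop

theorem IsSimplePoly.notMem_other (h : IsSimplePoly p I) {i j : ℕ}
    (he : (i, j) ∈ cycEdges I) {x : ℂ} (hx : x ∈ openSegment ℝ (p i) (p j)) :
    ∀ e ∈ cycEdges I, e ≠ (i, j) → x ∉ segment ℝ (p e.1) (p e.2) := by
  intro e he' hne hxe
  obtain ⟨k, hk1, hk2, rfl⟩ := h.meet _ he' _ he hne x hxe (openSegment_subset_segment ℝ _ _ hx)
  have := openSegment_ne (h.edge_ne he) hx
  grind

open Filter Topology in
/-- The winding number increases by one across an edge from right to left. -/
theorem wind_jump (hI : 2 ≤ I.card) {i j : ℕ}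
    (he : (i, j) ∈ cycEdges I) {x : ℂ} (hx : x ∈ openSegment ℝ (p i) (p j))
    (hother : ∀ e ∈ cycEdges I, e ≠ (i, j) → x ∉ segment ℝ (p e.1) (p e.2)) (hne : p i ≠ p j)
    {κ : ℂ} (hκ : 0 < κ.im) : ∀ᶠ s : ℝ in 𝓝[>] 0, x + s * (κ * (p j - p i)) ∉ polyCurve p I ∧
      x - s * (κ * (p j - p i)) ∉ polyCurve p I ∧
      wind p I (x + s * (κ * (p j - p i))) - wind p I (x - s * (κ * (p j - p i))) = 1 := by
  set w := p j - p i with hw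
  have hw0 : w ≠ 0 := sub_ne_zero.2 hne.symm
  set v := κ * w with hv
  rw [openSegment_eq_image_lineMap] at hx
  obtain ⟨τ, ⟨h0, h1⟩, rfl⟩ := hx
  rw [AffineMap.lineMap_apply_module', ← hw] at *
  set x := τ • w + p i with hxd
  have hc1 : Continuous (fun s : ℝ => x + s * v) := by fun_prop
  have hc2 : Continuous (fun s : ℝ => x - s * v) := by fun_prop
  have hother' : ∀ f : ℝ → ℂ, Continuous f → f 0 = x → ∀ᶠ s in 𝓝[>] (0:ℝ), ∀ e ∈ cycEdges I, e ≠ (i, j) →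
      f s ∉ segment ℝ (p e.1) (p e.2) := by
    intro f hf hf0
    rw [Finset.eventually_all]
    intro e he'
    by_cases hee : e = (i, j)
    · simp [hee]
    have hcl : IsClosed (segment ℝ (p e.1) (p e.2)) := by
      rw [← convexHull_pair]
      exact (Set.toFinite _).isClosed_convexHull ℝ
    have : ∀ᶠ s in 𝓝 (0:ℝ), f s ∈ (segment ℝ (p e.1) (p e.2))ᶜ :=
      hf.continuousAt.eventually_mem (by rw [hf0]; exact hcl.isOpen_compl.mem_nhds (hother e he' hee))
    exact (this.filter_mono nhdsWithin_le_nhds).mono fun s hs _ => hs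
  have hself : ∀ s : ℝ, s ≠ 0 → x + s * v ∉ segment ℝ (p i) (p j) := by
    intro s hs hmem
    rw [segment_eq_image_lineMap] at hmem
    obtain ⟨t, ht, hxt⟩ := hmem
    rw [AffineMap.lineMap_apply_module', show p j - p i = w from rfl, hxd, hv] at hxt
    have : ((t : ℂ) - τ - s * κ) * w = 0 := by
      simp only [Complex.real_smul] at hxt
      linear_combination hxt
    rcases mul_eq_zero.1 this with h | h
    · have := congrArg Complex.im h
      simp at this
      grind
    · exact hw0 h
  have hoff1 : ∀ᶠ s : ℝ in 𝓝[>] 0, x + s * v ∉ polyCurve p I := by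
    filter_upwards [hother' _ hc1 (by simp), self_mem_nhdsWithin] with s hs hs0
    rintro ⟨e, he', hxe⟩
    grind
  have hoff2 : ∀ᶠ s : ℝ in 𝓝[>] 0, x - s * v ∉ polyCurve p I := by
    filter_upwards [hother' _ hc2 (by simp), self_mem_nhdsWithin] with s hs hs0
    rintro ⟨e, he', hxe⟩
    by_cases hee : e = (i, j)
    · subst hee
      refine hself (-s) (neg_ne_zero.2 (ne_of_gt hs0)) ?_
      convert hxe using 1
      push_cast; ring
    · exact hs e he' hee hxe
  have hother_lim : ∀ f : ℝ → ℂ, Continuous f → f 0 = x → Tendsto (fun s => ∑ e ∈ (cycEdges I).erase (i, j),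
      Complex.arg ((p e.2 - f s) / (p e.1 - f s))) (𝓝[>] 0) (𝓝 (∑ e ∈ (cycEdges I).erase (i, j),
      Complex.arg ((p e.2 - x) / (p e.1 - x)))) := by
    intro f hf hf0
    refine tendsto_finsetSum _ fun e he' => ?_
    rw [Finset.mem_erase] at he'
    have hx' := hother e he'.2 he'.1
    have h3 := (Complex.continuousAt_arg (mem_slitPlane_of_notMem_segment hx'))
    have hfx : Tendsto f (𝓝[>] 0) (𝓝 x) := by
      rw [← hf0]; exact hf.continuousAt.tendsto.mono_left nhdsWithin_le_nhds
    exact h3.tendsto.comp ((hfx.const_sub _).div (hfx.const_sub _)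
      (sub_ne_zero_of_notMem_segment hx').1)
  have hratio : ∀ s : ℝ, (p j - (x + s * v)) / (p i - (x + s * v)) =
      (1 - τ - s * κ) / (- τ - s * κ) := by
    intro s
    have e1 : p j - (x + s * v) = (1 - τ - s * κ) * w := by
      simp only [hxd, hv, w, Complex.real_smul]; ring
    grind
  have him : ∀ s : ℝ, ((1 - τ - s * κ) / (- τ - s * κ)).im =
      s * κ.im / Complex.normSq (- τ - s * κ) := by
    intro s
    rw [Complex.div_im]
    simp
    ring
  set g : ℝ → ℂ := fun s => (1 - τ - s * κ) / (- τ - s * κ) with hg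
  have hτ : (τ : ℂ) ≠ 0 := mod_cast h0.ne'
  have hgc : ContinuousAt g 0 := by
    refine ContinuousAt.div (by fun_prop) (by fun_prop) ?_
    simpa using hτ
  have hg0re : (g 0).re < 0 := by
    have : g 0 = ((- ((1 - τ) / τ) : ℝ) : ℂ) := by
      simp only [hg]; push_cast; rw [zero_mul, sub_zero, sub_zero, div_neg]
    rw [this, Complex.ofReal_re]
    have := div_pos (sub_pos.2 h1) h0
    linarith
  have hg0im : (g 0).im = 0 := by simp only [hg, him]; simp
  have hnsq : ∀ s : ℝ, s ≠ 0 → 0 < Complex.normSq (- τ - s * κ) := by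
    intro s hs
    rw [Complex.normSq_pos]
    intro hc
    have := congrArg Complex.im hc
    simp at this
    grind
  have hlim1 : Tendsto (fun s => Complex.arg (g s)) (𝓝[>] 0) (𝓝 π) := by
    refine (Complex.tendsto_arg_nhdsWithin_im_nonneg_of_re_neg_of_im_zero hg0re hg0im).comp ?_
    refine tendsto_nhdsWithin_iff.2 ⟨hgc.tendsto.mono_left nhdsWithin_le_nhds, ?_⟩
    filter_upwards [self_mem_nhdsWithin] with s hs
    have hs' : 0 < s := hs
    simp only [hg, him]
    have := hnsq s hs'.ne'
    positivity
  have hlim2 : Tendsto (fun s => Complex.arg (g (-s))) (𝓝[>] 0) (𝓝 (-π)) := by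
    refine (Complex.tendsto_arg_nhdsWithin_im_neg_of_re_neg_of_im_zero hg0re hg0im).comp ?_
    refine tendsto_nhdsWithin_iff.2 ⟨?_, ?_⟩
    · have : Tendsto (fun s : ℝ => -s) (𝓝[>] 0) (𝓝 0) := by
        have : Tendsto (fun s : ℝ => -s) (𝓝 0) (𝓝 (-0)) := tendsto_id.neg
        rw [neg_zero] at this
        exact this.mono_left nhdsWithin_le_nhds
      exact hgc.tendsto.comp this
    · filter_upwards [self_mem_nhdsWithin] with s hs
      have hs' : 0 < s := hs
      simp only [hg, him]
      have := hnsq (-s) (by linarith)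
      apply div_neg_of_neg_of_pos _ this
      nlinarith
  have hlim : Tendsto (fun s : ℝ => wind p I (x + s * v) - wind p I (x - s * v)) (𝓝[>] 0) (𝓝 1) := by
    have h4 := ((hlim1.add (hother_lim _ hc1 (by simp))).div_const (2 * π)).sub
      ((hlim2.add (hother_lim _ hc2 (by simp))).div_const (2 * π))
    have hpi := Real.pi_pos
    refine (h4.congr' ?_).trans_eq ?_
    · refine Eventually.of_forall fun s => ?_
      simp only [wind]
      rw [← Finset.add_sum_erase _ _ he, ← Finset.add_sum_erase _ _ he]
      simp only
      have e3 := hratio (-s)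
      simp only [Complex.ofReal_neg, neg_mul, ← sub_eq_add_neg] at e3
      rw [hratio, e3]
      simp only [hg, Complex.ofReal_neg, neg_mul]
    grind
  have h5 : ∀ᶠ s : ℝ in 𝓝[>] 0, |wind p I (x + s * v) - wind p I (x - s * v) - 1| < 1 := by
    have := hlim.sub_const 1
    rw [sub_self] at this
    have h6 := this.abs
    rw [abs_zero] at h6
    exact h6.eventually_lt_const one_pos
  filter_upwards [hoff1, hoff2, h5] with s hs1 hs2 hs3
  refine ⟨hs1, hs2, ?_⟩
  obtain ⟨m, hm⟩ := wind_int hI hs1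
  obtain ⟨n, hn⟩ := wind_int hI hs2
  rw [hm, hn] at hs3 ⊢
  have : |((m - n - 1 : ℤ) : ℝ)| < 1 := by push_cast; exact hs3
  rw [← Int.cast_abs] at this
  have h7 : |m - n - 1| < 1 := mod_cast this
  rw [Int.abs_lt_one_iff] at h7
  have : m - n = 1 := by omega
  exact_mod_cast this

theorem cycEdges_eq_of_interval {A : Type*} {K : Finset ℕ} {f : ℕ → A} {S : Set ℕ}
    (hE : ∀ i j, (i, j) ∈ cycEdges K → i ∈ S → j ∈ S → f i = f j) (n : ℕ) :
    ∀ a ∈ K, ∀ b ∈ K, a ≤ b → b - a ≤ n → (∀ k ∈ K, a ≤ k → k ≤ b → k ∈ S) → f a = f b := by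
  induction n with
  | zero =>
    grind
  | succ n ih =>
    intro a ha b hb h1 h2 hS
    rcases h1.eq_or_lt with rfl | hlt
    · rfl
    have hK : 2 ≤ K.card := Finset.one_lt_card.2 ⟨a, ha, b, hb, hlt.ne⟩
    obtain ⟨j, hj⟩ := exists_cycEdges_fst hK ha
    obtain ⟨-, hjK, h | h⟩ := mem_cycEdges.1 hj
    · have hjb := h.2 b hb
      have := hE a j hj (hS a ha le_rfl h1) (hS j hjK (by omega) (by omega))
      rw [this]
      exact ih j hjK b hb (by omega) (by omega) fun k hk h3 h4 => hS k hk (by omega) h4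
    grind

theorem cycEdges_eq_of_chain {A : Type*} {K : Finset ℕ} {f : ℕ → A} (hcd : (c, d) ∈ cycEdges K)
    (hE : ∀ i j, (i, j) ∈ cycEdges K → (i ≠ c ∧ i ≠ d) → (j ≠ c ∧ j ≠ d) → f i = f j) :
    ∀ a ∈ K, (a ≠ c ∧ a ≠ d) → ∀ b ∈ K, (b ≠ c ∧ b ≠ d) → f a = f b := by
  have key : ∀ a ∈ K, (a ≠ c ∧ a ≠ d) → ∀ b ∈ K, (b ≠ c ∧ b ≠ d) → a ≤ b → f a = f b := by
    intro a ha ha' b hb hb' hab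
    have hcst := fun a' ha b' hb h1 h2 => cycEdges_eq_of_interval (S := {i | i ≠ c ∧ i ≠ d}) hE
      (b' - a') a' ha b' hb h1 le_rfl h2
    obtain ⟨hc, hd, h | h⟩ := mem_cycEdges.1 hcd
    · have h3 := h.2 a ha
      by_cases hs : a < c ∧ d < b
      · have hK : K.Nonempty := ⟨a, ha⟩
        have hm := K.min'_mem hK
        have hM := K.max'_mem hK
        set m := K.min' hK
        set M := K.max' hK
        have hm1 : ∀ k ∈ K, m ≤ k := fun k hk => K.min'_le k hk
        have hM1 : ∀ k ∈ K, k ≤ M := fun k hk => K.le_max' k hk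
        have hma := hm1 a ha
        have hbM := hM1 b hb
        have e1 : f m = f a := hcst m hm a ha hma fun k hk h5 h6 => by
          constructor <;> omega
        have e2 : f b = f M := hcst b hb M hM hbM fun k hk h5 h6 => by
          constructor <;> omega
        have hE' : (M, m) ∈ cycEdges K :=
          mem_cycEdges.2 ⟨hM, hm, Or.inr ⟨by omega, fun k hk => ⟨hm1 k hk, hM1 k hk⟩⟩⟩
        have e3 := hE M m hE' (by omega) (by omega)
        rw [← e1, ← e3, e2]
      · refine hcst a ha b hb hab fun k hk h5 h6 => ?_
        grind
    · refine hcst a ha b hb hab fun k hk h5 h6 => ?_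
      grind
  grind

open Topology in
theorem wind_eventually_eq (hI : 2 ≤ I.card) {q : ℂ}
    (hq : q ∉ polyCurve p I) : ∀ᶠ y in 𝓝 q, y ∉ polyCurve p I ∧ wind p I y = wind p I q := by
  obtain ⟨r, hr, hb⟩ := Metric.isOpen_iff.1 (isClosed_polyCurve p I).isOpen_compl q hq
  filter_upwards [Metric.ball_mem_nhds q hr] with y hy
  exact ⟨hb hy, wind_const_point hI (convex_ball q r).isPreconnected (fun z hz => hb hz) hy
    (Metric.mem_ball_self hr)⟩

theorem isOpen_polyInside (hI : 2 ≤ I.card) (ε : ℝ) : IsOpen (polyInside p I ε) := by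
  rw [isOpen_iff_eventually]
  intro q hq
  filter_upwards [wind_eventually_eq hI hq.1] with y hy
  exact ⟨hy.1, hy.2.trans hq.2⟩

theorem wind_eq_of_segment (hI : 2 ≤ I.card) {x y : ℂ}
    (h : ∀ z ∈ segment ℝ x y, z ∉ polyCurve p I) : wind p I x = wind p I y :=
  wind_const_point hI (convex_segment x y).isPreconnected h (left_mem_segment ℝ _ _)
    (right_mem_segment ℝ _ _)

theorem eq_of_mem_segment_segment {v w x : ℂ} (h1 : w ∈ segment ℝ v x)
    (h2 : x ∈ segment ℝ v w) : x = w := by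
  exact (Wbtw.swap_right_iff (mem_segment_iff_wbtw.1 h2)).1 (mem_segment_iff_wbtw.1 h1)

/-- If a vertex of `K` outside the shared edge has winding number zero with respect to `J`, then so
does every point of `K` outside the shared edge. -/
theorem wind_zero_of_arc {J K : Finset ℕ} (hJ : 2 ≤ J.card) (hK : IsSimplePoly p K)
    (hcdK : (c, d) ∈ cycEdges K) (hinter : polyCurve p J ∩ polyCurve p K ⊆ segment ℝ (p c) (p d))
    {e : ℕ} (he : e ∈ K) (hec : e ≠ c ∧ e ≠ d) (hwe : wind p J (p e) = 0) :
    ∀ x ∈ polyCurve p K, x ∉ segment ℝ (p c) (p d) → wind p J x = 0 := by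
  have hverts : ∀ b ∈ K, (b ≠ c ∧ b ≠ d) → wind p J (p b) = 0 := by
    intro b hb hb'
    rw [← hwe]
    refine cycEdges_eq_of_chain (f := fun i => wind p J (p i)) hcdK ?_ b hb hb' e he hec
    intro i j hij hi hj
    refine wind_eq_of_segment hJ fun z hz hzJ => ?_
    have hz2 := hinter ⟨hzJ, (i, j), hij, hz⟩
    obtain ⟨k, hk1, hk2, -⟩ := hK.meet _ hij _ hcdK (by
      grind) z hz hz2
    grind
  have key : ∀ x, x ∉ segment ℝ (p c) (p d) → ∀ a ∈ cycEdges K, ∀ v w, a = (v, w) ∨ a = (w, v) →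
      (v ≠ c ∧ v ≠ d) → x ∈ segment ℝ (p v) (p w) → wind p J x = 0 := by
    intro x hx a ha v w hvw hv hxa
    have hvK : v ∈ K := by
      rcases hvw with rfl | rfl
      · exact (mem_cycEdges.1 ha).1
      · exact (mem_cycEdges.1 ha).2.1
    rw [← hverts v hvK hv]
    symm
    refine wind_eq_of_segment hJ fun z hz hzJ => ?_
    have hza : z ∈ segment ℝ (p v) (p w) :=
      (convex_segment _ _).segment_subset (left_mem_segment ℝ _ _) hxa hz
    have hza' : z ∈ segment ℝ (p a.1) (p a.2) := by
      rcases hvw with rfl | rfl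
      · exact hza
      · rw [segment_symm]; exact hza
    have hz2 := hinter ⟨hzJ, a, ha, hza'⟩
    obtain ⟨k, hk1, hk2, hk3⟩ := hK.meet _ ha _ hcdK (by
      grind) z hza' hz2
    have hkw : k = w := by
      grind
    subst hkw
    rw [hk3] at hz
    have := eq_of_mem_segment_segment hz hxa
    grind
  rintro x ⟨⟨i, j⟩, hij, hx⟩ hxc
  by_cases hi : i ≠ c ∧ i ≠ d
  · grind
  by_cases hj : j ≠ c ∧ j ≠ d
  · exact key x hxc _ hij j i (Or.inr rfl) hj (by rw [segment_symm]; exact hx)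
  exfalso
  have hij' := cycEdges_ne hij
  have : (i = c ∧ j = d) ∨ (i = d ∧ j = c) := by omega
  rcases this with ⟨rfl, rfl⟩ | ⟨rfl, rfl⟩
  · exact hxc hx
  · exact hxc (by rw [segment_symm]; exact hx)

open Topology Filter in
/-- Two Jordan polygons on both sides of a common edge do not overlap. -/
theorem PolyJordan.disjoint_of_chord {J K : Finset ℕ} (hJ : IsSimplePoly p J)
    (hK : IsSimplePoly p K) (hcdJ : (d, c) ∈ cycEdges J) (hcdK : (c, d) ∈ cycEdges K)
    (hinter : polyCurve p J ∩ polyCurve p K ⊆ segment ℝ (p c) (p d)) {ε₁ ε₂ : ℝ}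
    (h1 : PolyJordan p J ε₁) (h2 : PolyJordan p K ε₂) {x : ℂ} (hx : x ∈ openSegment ℝ (p c) (p d))
    {w : ℝ} (hw0 : w ≠ 0)
    (hw : ∀ᶠ y in 𝓝 x, y ∉ segment ℝ (p c) (p d) → wind p J y + wind p K y = w)
    {e : ℕ} (he : e ∈ K) (hec : e ≠ c ∧ e ≠ d) (hwe : wind p J (p e) = 0) :
    ε₁ = ε₂ ∧ w = ε₁ ∧ polyInside p J ε₁ ∩ polyCurve p K = ∅ ∧
      Disjoint (polyInside p J ε₁) (polyInside p K ε₂) ∧ polyInside p K ε₂ ∩ polyCurve p J = ∅ := by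
  have hJ2 : 2 ≤ J.card := by have := hJ.card; omega
  have hK2 : 2 ≤ K.card := by have := hK.card; omega
  have hIn : polyInside p J ε₁ ∩ polyCurve p K = ∅ := by
    rw [Set.eq_empty_iff_forall_notMem]
    rintro z ⟨hz1, hz2⟩
    have hzc : z ∉ segment ℝ (p c) (p d) := by
      intro hh
      exact hz1.1 ⟨_, hcdJ, by rw [segment_symm]; exact hh⟩
    have := wind_zero_of_arc hJ2 hK hcdK hinter he hec hwe z hz2 hzc
    have h3 := hz1.2
    rcases h1.sign with h | h <;> linarith
  have hconst : ∀ y ∈ polyInside p J ε₁, ∀ z ∈ polyInside p J ε₁, wind p K y = wind p K z := by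
    intro y hy z hz
    refine wind_const_point hK2 h1.conn (fun q hq hqK => ?_) hy hz
    exact Set.eq_empty_iff_forall_notMem.1 hIn q ⟨hq, hqK⟩
  have hne := hK.edge_ne hcdK
  have hx' : x ∈ openSegment ℝ (p d) (p c) := by rw [openSegment_symm]; exact hx
  have j1 := wind_jump hK2 hcdK hx (hK.notMem_other hcdK hx) hne (κ := Complex.I) (by simp)
  have j2 := wind_jump hJ2 hcdJ hx' (hJ.notMem_other hcdJ hx') hne.symm (κ := Complex.I) (by simp)
  have t1 : Tendsto (fun s : ℝ => x + s * (Complex.I * (p d - p c))) (𝓝[>] 0) (𝓝 x) := by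
    have : Continuous (fun s : ℝ => x + s * (Complex.I * (p d - p c))) := by fun_prop
    have := this.tendsto 0
    simp only [Complex.ofReal_zero, zero_mul, add_zero] at this
    exact this.mono_left nhdsWithin_le_nhds
  have t2 : Tendsto (fun s : ℝ => x - s * (Complex.I * (p d - p c))) (𝓝[>] 0) (𝓝 x) := by
    have : Continuous (fun s : ℝ => x - s * (Complex.I * (p d - p c))) := by fun_prop
    have := this.tendsto 0
    simp only [Complex.ofReal_zero, zero_mul, sub_zero] at this
    exact this.mono_left nhdsWithin_le_nhds
  obtain ⟨s, ⟨a1, a2, a3⟩, ⟨b1, b2, b3⟩, w1, w2⟩ :=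
    (j1.and (j2.and ((t1.eventually hw).and (t2.eventually hw)))).exists
  have r1 : x + s * (Complex.I * (p c - p d)) = x - s * (Complex.I * (p d - p c)) := by ring
  have r2 : x - s * (Complex.I * (p c - p d)) = x + s * (Complex.I * (p d - p c)) := by ring
  rw [r1] at b1 b3
  rw [r2] at b2 b3
  have w2 := w2 fun h => a2 ⟨_, hcdK, h⟩
  set y₁ := x + s * (Complex.I * (p d - p c))
  set y₂ := x - s * (Complex.I * (p d - p c))
  have v1 := h1.val y₁ b2
  have v2 := h1.val y₂ b1
  have v3 := h2.val y₁ a1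
  have v4 := h2.val y₂ a2
  have main : ε₁ = ε₂ ∧ w = ε₁ ∧ ∀ y ∈ polyInside p J ε₁, wind p K y = 0 := by
    rcases h1.sign with s1 | s1 <;> rcases h2.sign with s2 | s2 <;> rw [s1] at v1 v2 <;>
      rw [s2] at v3 v4
    · have e1 : wind p J y₂ = 1 := by grind
      have e2 : wind p K y₂ = 0 := by grind
      refine ⟨by linarith, by linarith, fun y hy => ?_⟩
      rw [← e2]
      exact hconst _ hy _ ⟨b1, by rw [e1, s1]⟩
    · grind
    · grind
    · have e1 : wind p J y₁ = -1 := by grind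
      have e2 : wind p K y₁ = 0 := by grind
      refine ⟨by linarith, by linarith, fun y hy => ?_⟩
      rw [← e2]
      exact hconst _ hy _ ⟨b2, by rw [e1, s1]⟩
  have hdisj : Disjoint (polyInside p J ε₁) (polyInside p K ε₂) := by
    rw [Set.disjoint_left]
    intro y hy hy'
    have h4 := hy'.2
    grind
  refine ⟨main.1, main.2.1, hIn, hdisj, ?_⟩
  rw [Set.eq_empty_iff_forall_notMem]
  rintro z ⟨hz1, hz2⟩
  obtain ⟨y, hy1, hy2⟩ := mem_closure_iff.1 (h1.dense hz2) _ (isOpen_polyInside hK2 ε₂) hz1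
  grind

/-- `c < d` are non-adjacent vertices of a simple polygon and the open chord between them does not
meet the polygon. -/
structure IsChord (p : ℕ → ℂ) (I : Finset ℕ) (c d : ℕ) : Prop where
  left : c ∈ I
  right : d ∈ I
  lt : c < d
  inner : ∃ k ∈ I, c < k ∧ k < d
  outer : ∃ k ∈ I, k < c ∨ d < k
  off : ∀ x ∈ openSegment ℝ (p c) (p d), x ∉ polyCurve p I

theorem segment_cases {a b x : ℂ} (hx : x ∈ segment ℝ a b) :
    x = a ∨ x = b ∨ x ∈ openSegment ℝ a b := by
  rw [← insert_endpoints_openSegment] at hx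
  simpa using hx

theorem IsChord.mem_cycEdges_of (h : IsChord p I c d)
    {e : ℕ × ℕ} : e ∈ cycEdges I ↔ (e ∈ cycEdges (arcIn I c d) ∧ e ≠ (d, c)) ∨
      (e ∈ cycEdges (arcOut I c d) ∧ e ≠ (c, d)) := by
  rw [cycEdges_split h.left h.right h.inner h.outer]
  grind

theorem IsChord.meet_chord (h : IsChord p I c d)
    (hp : IsSimplePoly p I) {e : ℕ × ℕ} (he : e ∈ cycEdges I) {x : ℂ}
    (hx : x ∈ segment ℝ (p e.1) (p e.2)) (hxc : x ∈ segment ℝ (p c) (p d)) :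
    ∃ i, (i = e.1 ∨ i = e.2) ∧ (i = c ∨ i = d) ∧ x = p i := by
  rcases segment_cases hxc with rfl | rfl | h3
  · exact ⟨c, hp.vertex_mem h.left he hx, Or.inl rfl, rfl⟩
  · exact ⟨d, hp.vertex_mem h.right he hx, Or.inr rfl, rfl⟩
  · exact absurd ⟨e, he, hx⟩ (h.off x h3)

theorem IsChord.card_in (h : IsChord p I c d) : 3 ≤ (arcIn I c d).card := by
  obtain ⟨k, hk, h1, h2⟩ := h.inner
  refine Finset.two_lt_card.2 ⟨c, ?_, k, ?_, d, ?_, by omega, by omega, by omega⟩ <;>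
    rw [mem_arcIn]
  exacts [⟨h.left, by omega⟩, ⟨hk, by omega⟩, ⟨h.right, by omega⟩]

theorem IsChord.card_out (h : IsChord p I c d) : 3 ≤ (arcOut I c d).card := by
  obtain ⟨k, hk, h1⟩ := h.outer
  have hlt := h.lt
  refine Finset.two_lt_card.2 ⟨c, ?_, k, ?_, d, ?_, by omega, by omega, by omega⟩ <;>
    rw [mem_arcOut]
  exacts [⟨h.left, by omega⟩, ⟨hk, by omega⟩, ⟨h.right, by omega⟩]

theorem IsChord.card_in_lt (h : IsChord p I c d) : (arcIn I c d).card < I.card := by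
  obtain ⟨k, hk, h1⟩ := h.outer
  refine Finset.card_lt_card (Finset.filter_ssubset.2 ⟨k, hk, by omega⟩)

theorem IsChord.card_out_lt (h : IsChord p I c d) : (arcOut I c d).card < I.card := by
  obtain ⟨k, hk, h1⟩ := h.inner
  refine Finset.card_lt_card (Finset.filter_ssubset.2 ⟨k, hk, by omega⟩)

theorem IsChord.simple_in (h : IsChord p I c d)
    (hp : IsSimplePoly p I) : IsSimplePoly p (arcIn I c d) := by
  refine ⟨h.card_in, hp.inj.mono (Finset.filter_subset _ _), fun e he e' he' hne x hx hx' => ?_⟩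
  by_cases h1 : e = (d, c)
  · subst h1
    obtain ⟨i, hi1, hi2, hi3⟩ := h.meet_chord hp (h.mem_cycEdges_of.2 (Or.inl ⟨he', hne.symm⟩)) hx'
      (by rw [segment_symm]; exact hx)
    grind
  by_cases h2 : e' = (d, c)
  · subst h2
    obtain ⟨i, hi1, hi2, hi3⟩ := h.meet_chord hp (h.mem_cycEdges_of.2 (Or.inl ⟨he, hne⟩)) hx
      (by rw [segment_symm]; exact hx')
    grind
  · exact hp.meet e (h.mem_cycEdges_of.2 (Or.inl ⟨he, h1⟩)) e'
      (h.mem_cycEdges_of.2 (Or.inl ⟨he', h2⟩)) hne x hx hx'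

theorem IsChord.simple_out (h : IsChord p I c d)
    (hp : IsSimplePoly p I) : IsSimplePoly p (arcOut I c d) := by
  refine ⟨h.card_out, hp.inj.mono (Finset.filter_subset _ _), fun e he e' he' hne x hx hx' => ?_⟩
  by_cases h1 : e = (c, d)
  · subst h1
    obtain ⟨i, hi1, hi2, hi3⟩ := h.meet_chord hp (h.mem_cycEdges_of.2 (Or.inr ⟨he', hne.symm⟩)) hx'
      hx
    exact ⟨i, hi2, hi1, hi3⟩
  by_cases h2 : e' = (c, d)
  · subst h2
    obtain ⟨i, hi1, hi2, hi3⟩ := h.meet_chord hp (h.mem_cycEdges_of.2 (Or.inr ⟨he, hne⟩)) hx hx'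
    exact ⟨i, hi1, hi2, hi3⟩
  · exact hp.meet e (h.mem_cycEdges_of.2 (Or.inr ⟨he, h1⟩)) e'
      (h.mem_cycEdges_of.2 (Or.inr ⟨he', h2⟩)) hne x hx hx'

theorem IsChord.curve_in (h : IsChord p I c d) :
    polyCurve p (arcIn I c d) ⊆ polyCurve p I ∪ segment ℝ (p c) (p d) := by
  rintro x ⟨e, he, hx⟩
  by_cases h1 : e = (d, c)
  · subst h1
    exact Or.inr (by rw [segment_symm]; exact hx)
  · exact Or.inl ⟨e, h.mem_cycEdges_of.2 (Or.inl ⟨he, h1⟩), hx⟩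

theorem IsChord.curve_out (h : IsChord p I c d) :
    polyCurve p (arcOut I c d) ⊆ polyCurve p I ∪ segment ℝ (p c) (p d) := by
  rintro x ⟨e, he, hx⟩
  by_cases h1 : e = (c, d)
  · subst h1
    exact Or.inr hx
  · exact Or.inl ⟨e, h.mem_cycEdges_of.2 (Or.inr ⟨he, h1⟩), hx⟩

theorem IsChord.segment_subset_in (h : IsChord p I c d) :
    segment ℝ (p c) (p d) ⊆ polyCurve p (arcIn I c d) := by
  intro x hx
  exact ⟨_, chord_mem_arcIn h.left h.right h.lt, by rw [segment_symm]; exact hx⟩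

theorem IsChord.segment_subset_out (h : IsChord p I c d) :
    segment ℝ (p c) (p d) ⊆ polyCurve p (arcOut I c d) :=
  fun _ hx => ⟨_, chord_mem_arcOut h.left h.right h.lt, hx⟩

theorem IsChord.curve_subset (h : IsChord p I c d) :
    polyCurve p I ⊆ polyCurve p (arcIn I c d) ∪ polyCurve p (arcOut I c d) := by
  rintro x ⟨e, he, hx⟩
  rcases h.mem_cycEdges_of.1 he with h1 | h1
  · exact Or.inl ⟨e, h1.1, hx⟩
  · exact Or.inr ⟨e, h1.1, hx⟩

theorem IsChord.inter_subset (h : IsChord p I c d) (hp : IsSimplePoly p I) :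
    polyCurve p (arcIn I c d) ∩ polyCurve p (arcOut I c d) ⊆ segment ℝ (p c) (p d) := by
  rintro x ⟨⟨e, he, hx⟩, ⟨e', he', hx'⟩⟩
  by_cases h1 : e = (d, c)
  · subst h1
    rw [segment_symm]; exact hx
  by_cases h2 : e' = (c, d)
  · subst h2
    exact hx'
  have hne : e ≠ e' := by
    rintro rfl
    exact Finset.disjoint_left.1 (cycEdges_split_disjoint h.inner h.outer)
      (Finset.mem_erase.2 ⟨h1, he⟩) (Finset.mem_erase.2 ⟨h2, he'⟩)
  obtain ⟨i, hi1, hi2, rfl⟩ := hp.meet e (h.mem_cycEdges_of.2 (Or.inl ⟨he, h1⟩)) e'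
      (h.mem_cycEdges_of.2 (Or.inr ⟨he', h2⟩)) hne x hx hx'
  have m1 := mem_cycEdges.1 he
  have m2 := mem_cycEdges.1 he'
  simp only [mem_arcIn, mem_arcOut] at m1 m2
  have : i = c ∨ i = d := by have := h.lt; omega
  rcases this with rfl | rfl
  · exact left_mem_segment ℝ _ _
  · exact right_mem_segment ℝ _ _

open Topology in
/-- Gluing two Jordan polygons along a chord. -/
theorem IsChord.glue (h : IsChord p I c d)
    (hp : IsSimplePoly p I) {ε₁ ε₂ : ℝ} (h1 : PolyJordan p (arcIn I c d) ε₁)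
    (h2 : PolyJordan p (arcOut I c d) ε₂) (hW : ∃ x ∈ openSegment ℝ (p c) (p d), wind p I x ≠ 0)
    {e : ℕ} (he : e ∈ I) (hec : e ≠ c ∧ e ≠ d)
    (hexp : ∃ u, ∀ i ∈ I, i ≠ e → 0 < ((p i - p e) * u).re) : ε₁ = ε₂ ∧ PolyJordan p I ε₁ ∧
    polyCurve p I ∪ polyInside p I ε₁ =
      (polyCurve p (arcIn I c d) ∪ polyInside p (arcIn I c d) ε₁) ∪
      (polyCurve p (arcOut I c d) ∪ polyInside p (arcOut I c d) ε₁) ∧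
    (polyCurve p (arcIn I c d) ∪ polyInside p (arcIn I c d) ε₁) ∩
      (polyCurve p (arcOut I c d) ∪ polyInside p (arcOut I c d) ε₁) ⊆ segment ℝ (p c) (p d) := by
  have hI2 : 2 ≤ I.card := by have := hp.card; omega
  have hs1 := h.simple_in hp
  have hs2 := h.simple_out hp
  have hc1 := chord_mem_arcIn h.left h.right h.lt
  have hc2 := chord_mem_arcOut h.left h.right h.lt
  obtain ⟨x, hx, hwx⟩ := hW
  have hsplit : ∀ q, q ∉ segment ℝ (p c) (p d) → wind p I q =
      wind p (arcIn I c d) q + wind p (arcOut I c d) q :=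
    fun q hq => wind_split h.left h.right h.lt h.inner h.outer hq
  have hnear : ∀ᶠ y in 𝓝 x, y ∉ segment ℝ (p c) (p d) →
      wind p (arcIn I c d) y + wind p (arcOut I c d) y = wind p I x := by
    filter_upwards [wind_eventually_eq hI2 (h.off x hx)] with y hy hyc
    rw [← hsplit y hyc, hy.2]
  have hcon : ∀ y ∈ openSegment ℝ (p c) (p d), wind p I y = wind p I x := fun y hy =>
    wind_const_point hI2 (convex_openSegment _ _).isPreconnected h.off hy hx
  obtain ⟨u, hu⟩ := hexp
  have main : ε₁ = ε₂ ∧ wind p I x = ε₁ ∧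
      polyInside p (arcIn I c d) ε₁ ∩ polyCurve p (arcOut I c d) = ∅ ∧
      Disjoint (polyInside p (arcIn I c d) ε₁) (polyInside p (arcOut I c d) ε₂) ∧
      polyInside p (arcOut I c d) ε₂ ∩ polyCurve p (arcIn I c d) = ∅ := by
    by_cases hin : c ≤ e ∧ e ≤ d
    · have he' : e ∈ arcIn I c d := mem_arcIn.2 ⟨he, hin⟩
      have hwe : wind p (arcOut I c d) (p e) = 0 := by
        refine wind_eq_zero_of_halfPlane (u := u) (by have := hs2.card; omega) fun i hi => ?_
        rw [mem_arcOut] at hi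
        exact hu i hi.1 (by omega)
      obtain ⟨a1, a2, a3, a4, a5⟩ := PolyJordan.disjoint_of_chord hs2 hs1 hc2 hc1
        (by rw [inter_comm, segment_symm]; exact h.inter_subset hp) h2 h1
        (by rw [openSegment_symm]; exact hx) hwx
        (by rw [segment_symm]; grind)
        he' hec.symm hwe
      grind
    · have he' : e ∈ arcOut I c d := mem_arcOut.2 ⟨he, by omega⟩
      have hwe : wind p (arcIn I c d) (p e) = 0 := by
        refine wind_eq_zero_of_halfPlane (u := u) (by have := hs1.card; omega) fun i hi => ?_
        rw [mem_arcIn] at hi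
        grind
      exact PolyJordan.disjoint_of_chord hs1 hs2 hc1 hc2
        (h.inter_subset hp) h1 h2 hx hwx hnear he' hec hwe
  obtain ⟨rfl, hxe, hd1, hd, hd2⟩ := main
  rw [Set.eq_empty_iff_forall_notMem] at hd1 hd2
  have hends : segment ℝ (p c) (p d) ⊆ polyCurve p I ∪ openSegment ℝ (p c) (p d) := by
    intro y hy
    rcases segment_cases hy with rfl | rfl | hy
    · exact Or.inl (vertex_mem_polyCurve hI2 h.left)
    · exact Or.inl (vertex_mem_polyCurve hI2 h.right)
    · exact Or.inr hy
  have hsub1 : ∀ q, q ∉ polyCurve p I → q ∉ openSegment ℝ (p c) (p d) →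
      q ∉ polyCurve p (arcIn I c d) ∧ q ∉ polyCurve p (arcOut I c d) ∧
      q ∉ segment ℝ (p c) (p d) := by
    intro q hq hqo
    have hqs : q ∉ segment ℝ (p c) (p d) := fun hh => (hends hh).elim hq hqo
    exact ⟨fun hh => (h.curve_in hh).elim hq hqs, fun hh => (h.curve_out hh).elim hq hqs, hqs⟩
  have hInside : polyInside p I ε₁ = polyInside p (arcIn I c d) ε₁ ∪
      openSegment ℝ (p c) (p d) ∪ polyInside p (arcOut I c d) ε₁ := by
    ext q
    constructor
    · rintro ⟨hq, hqw⟩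
      by_cases hqo : q ∈ openSegment ℝ (p c) (p d)
      · exact Or.inl (Or.inr hqo)
      obtain ⟨b1, b2, b3⟩ := hsub1 q hq hqo
      rw [hsplit q b3] at hqw
      rcases h1.val q b1 with v | v
      · rw [v, zero_add] at hqw
        exact Or.inr ⟨b2, hqw⟩
      · exact Or.inl (Or.inl ⟨b1, v⟩)
    · rintro ((hq | hq) | hq)
      · have b2 : q ∉ polyCurve p (arcOut I c d) := fun hh => hd1 q ⟨hq, hh⟩
        refine ⟨fun hh => (h.curve_subset hh).elim hq.1 b2, ?_⟩
        rw [hsplit q fun hh => b2 (h.segment_subset_out hh), hq.2]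
        rcases h2.val q b2 with v | v
        · rw [v, add_zero]
        · exact (Set.disjoint_left.1 hd hq ⟨b2, v⟩).elim
      · exact ⟨h.off q hq, (hcon q hq).trans hxe⟩
      · have b2 : q ∉ polyCurve p (arcIn I c d) := fun hh => hd2 q ⟨hq, hh⟩
        refine ⟨fun hh => (h.curve_subset hh).elim b2 hq.1, ?_⟩
        rw [hsplit q fun hh => b2 (h.segment_subset_in hh), hq.2]
        rcases h1.val q b2 with v | v
        · rw [v, zero_add]
        · exact (Set.disjoint_left.1 hd ⟨b2, v⟩ hq).elim
  have hch1 : openSegment ℝ (p c) (p d) ⊆ closure (polyInside p (arcIn I c d) ε₁) :=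
    (openSegment_subset_segment ℝ _ _).trans (h.segment_subset_in.trans h1.dense)
  have hch2 : openSegment ℝ (p c) (p d) ⊆ closure (polyInside p (arcOut I c d) ε₁) :=
    (openSegment_subset_segment ℝ _ _).trans (h.segment_subset_out.trans h2.dense)
  refine ⟨rfl, ⟨h1.sign, ?_, ?_, ?_⟩, ?_, ?_⟩
  · intro q hq
    by_cases hqo : q ∈ openSegment ℝ (p c) (p d)
    · grind
    obtain ⟨b1, b2, b3⟩ := hsub1 q hq hqo
    rw [hsplit q b3]
    rcases h1.val q b1 with v | v <;> rcases h2.val q b2 with v' | v'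
    · left; rw [v, v', add_zero]
    · right; rw [v, v', zero_add]
    · right; rw [v, v', add_zero]
    · exact (Set.disjoint_left.1 hd ⟨b1, v⟩ ⟨b2, v'⟩).elim
  · have e1 : polyInside p I ε₁ = (polyInside p (arcIn I c d) ε₁ ∪ openSegment ℝ (p c) (p d)) ∪
        (polyInside p (arcOut I c d) ε₁ ∪ openSegment ℝ (p c) (p d)) := by
      grind
    rw [e1]
    refine IsPreconnected.union x (Or.inr hx) (Or.inr hx) ?_ ?_
    · exact h1.conn.subset_closure subset_union_left (union_subset subset_closure hch1)
    · exact h2.conn.subset_closure subset_union_left (union_subset subset_closure hch2)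
  · intro q hq
    rw [hInside]
    rcases h.curve_subset hq with hq | hq
    · exact closure_mono (fun z hz => Or.inl (Or.inl hz)) (h1.dense hq)
    · exact closure_mono (fun z hz => Or.inr hz) (h2.dense hq)
  · rw [hInside]
    ext q
    constructor
    · rintro (hq | (hq | hq) | hq)
      · rcases h.curve_subset hq with hq | hq
        · exact Or.inl (Or.inl hq)
        · exact Or.inr (Or.inl hq)
      · exact Or.inl (Or.inr hq)
      · exact Or.inl (Or.inl (h.segment_subset_in (openSegment_subset_segment ℝ _ _ hq)))
      · exact Or.inr (Or.inr hq)
    grind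
  · rintro q ⟨hq | hq, hq' | hq'⟩
    · exact h.inter_subset hp ⟨hq, hq'⟩
    · exact (hd2 q ⟨hq', hq⟩).elim
    · exact (hd1 q ⟨hq, hq'⟩).elim
    grind

end Polygons

theorem linear_eq_re (f : ℂ →ₗ[ℝ] ℝ) (z : ℂ) : f z = (z * ⟨f 1, -f Complex.I⟩).re := by
  have h : z.re • (1 : ℂ) + z.im • Complex.I = z := by
    apply Complex.ext <;> simp
  have h' := congrArg f h
  rw [map_add, map_smul, map_smul] at h'
  simp_all

theorem wind_eq_zero_of_linear {I : Finset ℕ} (hI : 2 ≤ I.card) {p : ℕ → ℂ} {q : ℂ}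
    (f : ℂ →ₗ[ℝ] ℝ) (h : ∀ i ∈ I, f q < f (p i)) : wind p I q = 0 := by
  refine wind_eq_zero_of_halfPlane hI (u := ⟨f 1, -f Complex.I⟩) fun i hi => ?_
  rw [← linear_eq_re, map_sub]
  linarith [h i hi]

/-- `e` is an exposed vertex of the polygon with neighbours `a` and `b`; the functionals `la`, `lb`
are the coordinates with respect to the two edges at `e`. -/
structure PolyCorner (p : ℕ → ℂ) (I : Finset ℕ) (e a b : ℕ) (la lb : ℂ →ₗ[ℝ] ℝ) : Prop where
  next : (e, a) ∈ cycEdges I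
  prev : (b, e) ∈ cycEdges I
  ne : a ≠ b
  exposed : ∃ u, ∀ i ∈ I, i ≠ e → 0 < ((p i - p e) * u).re
  coord : ∀ z, z = la z • (p a - p e) + lb z • (p b - p e)
  la_a : la (p a - p e) = 1
  la_b : la (p b - p e) = 0
  lb_a : lb (p a - p e) = 0
  lb_b : lb (p b - p e) = 1

theorem exists_exposed {p : ℕ → ℂ} {I : Finset ℕ} (hinj : InjOn p I) (hI : I.Nonempty) (o : ℂ) :
    ∃ e ∈ I, (∀ i ∈ I, ‖p i - o‖ ≤ ‖p e - o‖) ∧ ∃ u, ∀ i ∈ I, i ≠ e → 0 < ((p i - p e) * u).re := by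
  obtain ⟨e, he, hmax⟩ := Finset.exists_max_image I (fun i => ‖p i - o‖) hI
  refine ⟨e, he, hmax, (starRingEnd ℂ) (o - p e), fun i hi hie => ?_⟩
  have hne : p i - p e ≠ 0 := sub_ne_zero.2 fun h => hie (hinj hi he h)
  have h1 := hmax i hi
  have h2 : ‖p i - o‖ ^ 2 ≤ ‖p e - o‖ ^ 2 := by gcongr
  rw [← Complex.normSq_eq_norm_sq, ← Complex.normSq_eq_norm_sq] at h2
  have h3 := Complex.normSq_pos.2 hne
  simp only [Complex.normSq_apply, Complex.sub_re, Complex.sub_im, Complex.mul_re, Complex.conj_re,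
    Complex.conj_im] at *
  nlinarith

theorem cycEdges_two {I : Finset ℕ} {i j k : ℕ} (h : (i, j) ∈ cycEdges I)
    (h' : (j, i) ∈ cycEdges I) (hk : k ∈ I) : k = i ∨ k = j := by
  rw [mem_cycEdges] at h h'
  grind

theorem cycEdges_three {I : Finset ℕ} {i j k l : ℕ} (h : (i, j) ∈ cycEdges I)
    (h' : (j, k) ∈ cycEdges I) (h'' : (k, i) ∈ cycEdges I) (hl : l ∈ I) :
    l = i ∨ l = j ∨ l = k := by
  rw [mem_cycEdges] at h h' h''
  grind

theorem IsSimplePoly.not_two {p : ℕ → ℂ} {I : Finset ℕ} (hp : IsSimplePoly p I) {i j : ℕ}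
    (h : (i, j) ∈ cycEdges I) (h' : (j, i) ∈ cycEdges I) : False := by
  have hI := hp.card
  have : I ⊆ {i, j} := fun k hk => by
    rcases cycEdges_two h h' hk with rfl | rfl <;> simp
  have := Finset.card_le_card this
  grind

theorem IsSimplePoly.exists_corner {p : ℕ → ℂ} {I : Finset ℕ} (hp : IsSimplePoly p I) :
    ∃ e a b la lb, PolyCorner p I e a b la lb := by
  have hI := hp.card
  obtain ⟨e, he, -, u, hu⟩ := exists_exposed hp.inj (Finset.card_pos.1 (by omega)) 0
  obtain ⟨a, ha⟩ := exists_cycEdges_fst (by omega) he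
  obtain ⟨b, hb⟩ := exists_cycEdges_snd (by omega) he
  have haI := (mem_cycEdges.1 ha).2.1
  have hbI := (mem_cycEdges.1 hb).1
  have hae : a ≠ e := (cycEdges_ne ha).symm
  have hbe : b ≠ e := cycEdges_ne hb
  have hab : a ≠ b := by
    rintro rfl
    exact hp.not_two ha hb
  have hua := hu a haI hae
  have hub := hu b hbI hbe
  set A := p a - p e with hA
  set B := p b - p e with hB
  have hD : A.re * B.im - A.im * B.re ≠ 0 := by
    intro h0
    have hA0 : A ≠ 0 := by
      intro h; rw [h] at hua; simp at hua
    have hpar : ∃ t : ℝ, B = t * A := by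
      have hn := Complex.normSq_pos.2 hA0
      refine ⟨(A.re * B.re + A.im * B.im) / Complex.normSq A, ?_⟩
      rw [Complex.normSq_apply] at *
      apply Complex.ext
      · rw [Complex.re_ofReal_mul, div_mul_eq_mul_div, eq_div_iff hn.ne']
        grind
      · rw [Complex.im_ofReal_mul, div_mul_eq_mul_div, eq_div_iff hn.ne']
        linear_combination A.re * h0
    obtain ⟨t, ht⟩ := hpar
    have ht0 : 0 < t := by
      rw [ht, mul_assoc, Complex.re_ofReal_mul] at hub
      nlinarith
    by_cases h1 : t ≤ 1
    · have hmem : p b ∈ segment ℝ (p e) (p a) := by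
        rw [segment_eq_image_lineMap]
        refine ⟨t, ⟨ht0.le, h1⟩, ?_⟩
        rw [AffineMap.lineMap_apply_module', Complex.real_smul, ← hA, ← ht]
        simp [hB]
      rcases hp.vertex_mem hbI ha hmem with h | h
      · exact hbe h
      · exact hab h.symm
    · have hmem : p a ∈ segment ℝ (p b) (p e) := by
        rw [segment_symm, segment_eq_image_lineMap]
        refine ⟨1 / t, ⟨by positivity, by rw [div_le_one ht0]; linarith⟩, ?_⟩
        rw [AffineMap.lineMap_apply_module', Complex.real_smul, ← hB, ht]
        have : (t : ℂ) ≠ 0 := mod_cast ht0.ne'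
        aesop
      rcases hp.vertex_mem haI hb hmem with h | h
      · exact hab h
      · exact hae h
  set D := A.re * B.im - A.im * B.re with hDdef
  let la : ℂ →ₗ[ℝ] ℝ := (B.im / D) • Complex.reLm - (B.re / D) • Complex.imLm
  let lb : ℂ →ₗ[ℝ] ℝ := (A.re / D) • Complex.imLm - (A.im / D) • Complex.reLm
  have hla : ∀ z, la z = B.im / D * z.re - B.re / D * z.im := fun z => rfl
  have hlb : ∀ z, lb z = A.re / D * z.im - A.im / D * z.re := fun z => rfl
  refine ⟨e, a, b, la, lb, ⟨ha, hb, hab, ⟨u, hu⟩, fun z => ?_, ?_, ?_, ?_, ?_⟩⟩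
  · rw [← hA, ← hB, hla, hlb]
    apply Complex.ext
    · simp only [Complex.add_re, Complex.real_smul, Complex.re_ofReal_mul]
      grind
    · simp only [Complex.add_im, Complex.real_smul, Complex.im_ofReal_mul]
      grind
  · grind
  · grind
  · rw [← hA, hlb]; field_simp; ring
  · rw [← hB, hlb]; field_simp; rw [hDdef]

namespace PolyCorner

variable {p : ℕ → ℂ} {I : Finset ℕ} {e a b : ℕ} {la lb : ℂ →ₗ[ℝ] ℝ}

theorem mem_prev_edge (h : PolyCorner p I e a b la lb) {y : ℂ} (h1 : la (y - p e) = 0)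
    (h2 : 0 ≤ lb (y - p e)) (h3 : lb (y - p e) ≤ 1) : y ∈ segment ℝ (p b) (p e) := by
  rw [segment_symm, segment_eq_image_lineMap]
  refine ⟨_, ⟨h2, h3⟩, ?_⟩
  have := h.coord (y - p e)
  rw [h1, zero_smul, zero_add] at this
  rw [AffineMap.lineMap_apply_module', ← this, sub_add_cancel]

theorem mem_next_edge (h : PolyCorner p I e a b la lb) {y : ℂ} (h1 : lb (y - p e) = 0)
    (h2 : 0 ≤ la (y - p e)) (h3 : la (y - p e) ≤ 1) : y ∈ segment ℝ (p e) (p a) := by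
  rw [segment_eq_image_lineMap]
  refine ⟨_, ⟨h2, h3⟩, ?_⟩
  have := h.coord (y - p e)
  rw [h1, zero_smul, add_zero] at this
  rw [AffineMap.lineMap_apply_module', ← this, sub_add_cancel]

theorem next_edge_coord (h : PolyCorner p I e a b la lb) {y : ℂ} (hy : y ∈ segment ℝ (p e) (p a)) :
    lb (y - p e) = 0 ∧ 0 ≤ la (y - p e) := by
  rw [segment_eq_image_lineMap] at hy
  obtain ⟨t, ht, rfl⟩ := hy
  rw [AffineMap.lineMap_apply_module', add_sub_cancel_right, map_smul, map_smul, h.la_a, h.lb_a]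
  simpa using ht.1

theorem prev_edge_coord (h : PolyCorner p I e a b la lb) {y : ℂ} (hy : y ∈ segment ℝ (p b) (p e)) :
    la (y - p e) = 0 ∧ 0 ≤ lb (y - p e) := by
  rw [segment_symm, segment_eq_image_lineMap] at hy
  obtain ⟨t, ht, rfl⟩ := hy
  rw [AffineMap.lineMap_apply_module', add_sub_cancel_right, map_smul, map_smul, h.la_b, h.lb_b]
  simpa using ht.1

theorem leave (la lb : ℂ →ₗ[ℝ] ℝ) {o x v : ℂ} (hx1 : 0 < la (x - o)) (hx2 : 0 < lb (x - o))
    (hv : la (v - o) ≤ 0 ∨ lb (v - o) ≤ 0) :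
    ∃ τ : ℝ, 0 < τ ∧ τ ≤ 1 ∧ 0 ≤ la (x + τ • (v - x) - o) ∧ 0 ≤ lb (x + τ • (v - x) - o) ∧
      (la (x + τ • (v - x) - o) = 0 ∨ lb (x + τ • (v - x) - o) = 0) := by
  have hl : ∀ (f : ℂ →ₗ[ℝ] ℝ) (τ : ℝ), f (x + τ • (v - x) - o) =
      (1 - τ) * f (x - o) + τ * f (v - o) := by
    intro f τ
    simp only [map_sub, map_add, map_smul, smul_eq_mul]
    ring
  simp only [hl]
  generalize la (x - o) = A at *
  generalize lb (x - o) = B at *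
  generalize la (v - o) = A' at *
  generalize lb (v - o) = B' at *
  clear hl
  have hc : Continuous fun τ : ℝ => min ((1 - τ) * A + τ * A')
      ((1 - τ) * B + τ * B') := by fun_prop
  have := intermediate_value_Icc' (zero_le_one (α := ℝ)) hc.continuousOn
  obtain ⟨τ, hτ, h0⟩ := this (show (0 : ℝ) ∈ _ by
    grind)
  simp only at h0
  have h1 : 0 ≤ (1 - τ) * A + τ * A' := h0 ▸ min_le_left _ _
  have h2 : 0 ≤ (1 - τ) * B + τ * B' := h0 ▸ min_le_right _ _
  refine ⟨τ, lt_of_le_of_ne hτ.1 ?_, hτ.2, h1, h2, ?_⟩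
  · rintro rfl
    rw [min_eq_iff] at h0
    rcases h0 with h | h <;> simp at h <;> linarith [h.1]
  · rcases min_choice ((1 - τ) * A + τ * A')
      ((1 - τ) * B + τ * B') with h | h
    · left; rw [← h, h0]
    · right; rw [← h, h0]

theorem mem_segment_of_step {x v : ℂ} {τ : ℝ} (h0 : 0 ≤ τ) (h1 : τ ≤ 1) :
    x + τ • (v - x) ∈ segment ℝ x v := by
  rw [segment_eq_image']
  grind

/-- An edge not containing the corner cannot reach the two corner edges from inside the corner
triangle, except at the far endpoints. -/
theorem no_exit (h : PolyCorner p I e a b la lb) (hp : IsSimplePoly p I) {f : ℕ × ℕ}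
    (hf : f ∈ cycEdges I) (h1 : f.1 ≠ e) (h2 : f.2 ≠ e) {y : ℂ}
    (hy : y ∈ segment ℝ (p f.1) (p f.2)) (ha : 0 ≤ la (y - p e)) (hb : 0 ≤ lb (y - p e))
    (hs : la (y - p e) + lb (y - p e) < 1) (h0 : la (y - p e) = 0 ∨ lb (y - p e) = 0) : False := by
  rcases h0 with h0 | h0
  · obtain ⟨i, hi1, hi2, rfl⟩ := hp.meet f hf _ h.prev (by rintro rfl; exact h2 rfl) y hy
      (h.mem_prev_edge h0 hb (by linarith))
    have : i = b := by
      grind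
    subst this
    have := h.lb_b
    linarith
  · obtain ⟨i, hi1, hi2, rfl⟩ := hp.meet f hf _ h.next (by rintro rfl; exact h1 rfl) y hy
      (h.mem_next_edge h0 ha (by linarith))
    have : i = a := by
      grind
    subst this
    have := h.la_a
    linarith

theorem edge_cases (h : PolyCorner p I e a b la lb) {f : ℕ × ℕ} (hf : f ∈ cycEdges I) :
    f = (e, a) ∨ f = (b, e) ∨ (f.1 ≠ e ∧ f.2 ≠ e) := by
  obtain ⟨i, j⟩ := f
  by_cases hi : i = e
  · subst hi
    left; rw [cycEdges_fst_inj hf h.next]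
  by_cases hj : j = e
  · subst hj
    right; left; rw [cycEdges_snd_inj hf h.prev]
  grind

theorem region_off (h : PolyCorner p I e a b la lb) (hp : IsSimplePoly p I) {μ : ℝ} (hμ : 0 ≤ μ)
    (hv : ∀ i ∈ I, i ≠ e → 0 ≤ la (p i - p e) → 0 ≤ lb (p i - p e) →
      1 - μ ≤ la (p i - p e) + lb (p i - p e)) {x : ℂ} (h1 : 0 < la (x - p e))
    (h2 : 0 < lb (x - p e)) (h3 : la (x - p e) + lb (x - p e) < 1 - μ) : x ∉ polyCurve p I := by
  rintro ⟨f, hf, hx⟩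
  rcases h.edge_cases hf with rfl | rfl | ⟨hf1, hf2⟩
  · have := (h.next_edge_coord hx).1
    linarith
  · have := (h.prev_edge_coord hx).1
    linarith
  have key : ∀ v ∈ I, v ≠ e → segment ℝ x (p v) ⊆ segment ℝ (p f.1) (p f.2) →
      la (p v - p e) + lb (p v - p e) ≤ la (x - p e) + lb (x - p e) → False := by
    intro v hvI hve hsub hle
    have hvout : la (p v - p e) ≤ 0 ∨ lb (p v - p e) ≤ 0 := by
      grind
    obtain ⟨τ, hτ0, hτ1, ha, hb, h0⟩ := leave la lb h1 h2 hvout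
    refine h.no_exit hp hf hf1 hf2 (hsub (mem_segment_of_step hτ0.le hτ1)) ha hb ?_ h0
    have : la (x + τ • (p v - x) - p e) + lb (x + τ • (p v - x) - p e) =
        (1 - τ) * (la (x - p e) + lb (x - p e)) + τ * (la (p v - p e) + lb (p v - p e)) := by
      simp only [map_sub, map_add, map_smul, smul_eq_mul]
      ring
    rw [this]
    nlinarith
  have hm := mem_cycEdges.1 hf
  have hseg := convex_segment (𝕜 := ℝ) (p f.1) (p f.2)
  have hx' := hx
  rw [segment_eq_image'] at hx'
  obtain ⟨t, ht, hxt⟩ := hx'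
  have hsum : la (x - p e) + lb (x - p e) =
        (1 - t) * (la (p f.1 - p e) + lb (p f.1 - p e)) +
          t * (la (p f.2 - p e) + lb (p f.2 - p e)) := by
    rw [← hxt]
    simp only [map_sub, map_add, map_smul, smul_eq_mul]
    ring
  by_cases hle : la (p f.1 - p e) + lb (p f.1 - p e) ≤ la (x - p e) + lb (x - p e)
  · exact key f.1 hm.1 hf1 (hseg.segment_subset hx (left_mem_segment ℝ _ _)) hle
  · refine key f.2 hm.2.1 hf2 (hseg.segment_subset hx (right_mem_segment ℝ _ _)) ?_
    by_contra hc
    push Not at hle hc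
    have h4 := mul_le_mul_of_nonneg_left hle.le (sub_nonneg.2 ht.2)
    have h5 := mul_le_mul_of_nonneg_left hc.le ht.1
    nlinarith

/-- The open triangle cut off at a corner, truncated. -/
def region (o : ℂ) (la lb : ℂ →ₗ[ℝ] ℝ) (μ : ℝ) : Set ℂ :=
  {x | 0 < la (x - o) ∧ 0 < lb (x - o) ∧ la (x - o) + lb (x - o) < 1 - μ}

theorem convex_region (o : ℂ) (la lb : ℂ →ₗ[ℝ] ℝ) (μ : ℝ) : Convex ℝ (region o la lb μ) := by
  intro x hx y hy s t hs ht hst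
  have hl : ∀ f : ℂ →ₗ[ℝ] ℝ, f (s • x + t • y - o) = s * f (x - o) + t * f (y - o) := by
    intro f
    simp only [map_sub, map_add, map_smul, smul_eq_mul]
    grind
  obtain ⟨h1, h2, h3⟩ := hx
  obtain ⟨h4, h5, h6⟩ := hy
  have key : ∀ u v : ℝ, 0 < u → 0 < v → 0 < s * u + t * v := by
    intro u v hu hv
    rcases hs.eq_or_lt with rfl | hs
    · simp_all
    positivity
  refine ⟨by rw [hl]; exact key _ _ h1 h4, by rw [hl]; exact key _ _ h2 h5, ?_⟩
  rw [hl, hl]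
  have := key _ _ (sub_pos.2 h3) (sub_pos.2 h6)
  have h7 : s * (1 - μ) + t * (1 - μ) = 1 - μ := by grind
  linarith

theorem region_wind (h : PolyCorner p I e a b la lb) (hp : IsSimplePoly p I) {μ : ℝ} (hμ : 0 ≤ μ)
    (hμ1 : μ < 1) (hv : ∀ i ∈ I, i ≠ e → 0 ≤ la (p i - p e) → 0 ≤ lb (p i - p e) →
      1 - μ ≤ la (p i - p e) + lb (p i - p e)) :
    ∃ ε : ℝ, (ε = 1 ∨ ε = -1) ∧ ∀ x ∈ region (p e) la lb μ, wind p I x = ε := by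
  have hI : 2 ≤ I.card := by have := hp.card; omega
  have hoff : ∀ x ∈ region (p e) la lb μ, x ∉ polyCurve p I := fun x hx =>
    h.region_off hp hμ hv hx.1 hx.2.1 hx.2.2
  suffices hs : ∃ x ∈ region (p e) la lb μ, wind p I x = 1 ∨ wind p I x = -1 by
    obtain ⟨x, hx, hw⟩ := hs
    exact ⟨_, hw, fun y hy => wind_const_point hI (convex_region _ _ _ _).isPreconnected hoff hy hx⟩
  set A := p a - p e with hA
  set B := p b - p e with hB
  have hneA : p e ≠ p a := hp.edge_ne h.next
  have hA0 : A ≠ 0 := sub_ne_zero.2 hneA.symm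
  have hB0 : B ≠ 0 := sub_ne_zero.2 (hp.edge_ne h.prev)
  have him : (B / A).im ≠ 0 := by
    intro h0
    have h1 : B = (B / A).re • A := by
      rw [Complex.real_smul]
      have : ((B / A).re : ℂ) = B / A := by
        apply Complex.ext <;> simp [h0]
      grind
    have h2 := h.lb_b
    rw [← hB, h1, map_smul, h.lb_a] at h2
    simp at h2
  obtain ⟨r, hr, hball⟩ : ∃ r > 0, ∀ f ∈ cycEdges I, f.1 ≠ e → f.2 ≠ e → ∀ x,
      dist x (p e) < r → x ∉ segment ℝ (p f.1) (p f.2) := by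
    have hC : IsClosed (⋃ f ∈ (cycEdges I).filter fun f => f.1 ≠ e ∧ f.2 ≠ e,
        segment ℝ (p f.1) (p f.2)) :=
      by
      refine Set.Finite.isClosed_biUnion (Finset.finite_toSet _) fun f _ => ?_
      rw [← convexHull_pair]
      exact (Set.toFinite _).isClosed_convexHull ℝ
    have hmem : (⋃ f ∈ (cycEdges I).filter fun f => f.1 ≠ e ∧ f.2 ≠ e,
        segment ℝ (p f.1) (p f.2))ᶜ ∈ 𝓝 (p e) := by
      refine hC.isOpen_compl.mem_nhds ?_
      simp only [mem_compl_iff, mem_iUnion, not_exists, Finset.mem_filter]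
      rintro f ⟨hf, h1, h2⟩ hx
      rcases hp.vertex_mem (mem_cycEdges.1 h.next).1 hf hx with h | h
      · exact h1 h.symm
      · exact h2 h.symm
    obtain ⟨r, hr, hsub⟩ := Metric.mem_nhds_iff.1 hmem
    refine ⟨r, hr, fun f hf h1 h2 x hx hxs => ?_⟩
    refine hsub (Metric.mem_ball.2 hx) ?_
    simp only [mem_iUnion, Finset.mem_filter]
    grind
  have hBn : 0 < ‖B‖ := norm_pos_iff.2 hB0
  obtain ⟨η, hη0, hη⟩ : ∃ η : ℝ, 0 < η ∧ η < 1 - μ ∧ η * ‖A‖ < r / 2 := by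
    refine ⟨min ((1 - μ) / 2) (r / (4 * ‖A‖)), by positivity, ?_, ?_⟩
    · grind
    · have := min_le_right ((1 - μ) / 2) (r / (4 * ‖A‖))
      calc _ ≤ r / (4 * ‖A‖) * ‖A‖ := by gcongr
        _ = r / 4 := by field_simp
        _ < _ := by linarith
  have hη1 : η < 1 := by linarith
  have hx0 : p e + η * A ∈ openSegment ℝ (p e) (p a) := by
    rw [openSegment_eq_image_lineMap]
    refine ⟨η, ⟨hη0, hη1⟩, ?_⟩
    rw [AffineMap.lineMap_apply_module', Complex.real_smul]; ring
  have hoth := hp.notMem_other h.next hx0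
  have hlA : ∀ s t : ℝ, la (p e + t * A + s * B - p e) = t := by
    intro s t
    rw [show p e + t * A + s * B - p e = t • A + s • B by
      rw [Complex.real_smul, Complex.real_smul]; ring, map_add, map_smul, map_smul, h.la_a, h.la_b]
    simp
  have hlB : ∀ s t : ℝ, lb (p e + t * A + s * B - p e) = s := by
    intro s t
    rw [show p e + t * A + s * B - p e = t • A + s • B by
      rw [Complex.real_smul, Complex.real_smul]; ring, map_add, map_smul, map_smul, h.lb_a, h.lb_b]
    simp
  have hsmall : ∀ᶠ s : ℝ in 𝓝[>] 0, 0 < s ∧ s < 1 - μ - η ∧ s * ‖B‖ < r / 2 := by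
    have h1 : ∀ᶠ s : ℝ in 𝓝[>] 0, s < 1 - μ - η :=
      nhdsWithin_le_nhds (gt_mem_nhds (by linarith))
    have h2 : ∀ᶠ s : ℝ in 𝓝[>] 0, s < r / 2 / ‖B‖ :=
      nhdsWithin_le_nhds (gt_mem_nhds (by positivity))
    filter_upwards [h1, h2, self_mem_nhdsWithin] with s h1 h2 h3
    exact ⟨h3, h1, (lt_div_iff₀ hBn).1 h2⟩
  have hreg : ∀ s : ℝ, 0 < s → s < 1 - μ - η → p e + η * A + s * B ∈ region (p e) la lb μ := by
    intro s h0 h1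
    refine ⟨by rw [hlA]; exact hη0, by rw [hlB]; exact h0, by rw [hlA, hlB]; linarith⟩
  have hzero : ∀ s : ℝ, 0 < s → s * ‖B‖ < r / 2 → wind p I (p e + η * A - s * B) = 0 := by
    intro s h0 h1
    have e1 : wind p I (p e - s * B) = 0 := by
      obtain ⟨u, hu⟩ := h.exposed
      have hBu := hu b (mem_cycEdges.1 h.prev).1 (cycEdges_ne h.prev)
      rw [← hB] at hBu
      refine wind_eq_zero_of_halfPlane hI (u := u) fun i hi => ?_
      have : ((p i - (p e - s * B)) * u).re = ((p i - p e) * u).re + s * (B * u).re := by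
        rw [← Complex.re_ofReal_mul, ← Complex.add_re]
        congr 1; ring
      rw [this]
      have h3 := mul_pos h0 hBu
      by_cases hie : i = e
      · subst hie; simpa using h3
      · linarith [hu i hi hie]
    rw [← e1]
    refine (wind_eq_of_segment hI fun z hz => ?_).symm
    rw [segment_eq_image'] at hz
    obtain ⟨τ, ⟨hτ0, hτ1⟩, rfl⟩ := hz
    have hz : p e - s * B + τ • (p e + η * A - s * B - (p e - s * B)) =
        p e + (τ * η : ℝ) * A + (-s : ℝ) * B := by
      rw [Complex.real_smul]; push_cast; ring
    simp only [hz]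
    rintro ⟨f, hf, hx⟩
    have hlb := hlB (-s) (τ * η)
    rcases h.edge_cases hf with rfl | rfl | ⟨hf1, hf2⟩
    · have := (h.next_edge_coord hx).1
      linarith
    · have := (h.prev_edge_coord hx).2
      linarith
    · refine hball f hf hf1 hf2 _ ?_ hx
      rw [dist_eq_norm, add_assoc, add_sub_cancel_left]
      calc _ ≤ ‖((τ * η : ℝ) : ℂ) * A‖ + ‖((-s : ℝ) : ℂ) * B‖ := norm_add_le _ _
        _ = τ * η * ‖A‖ + s * ‖B‖ := by
          rw [norm_mul, norm_mul, Complex.norm_real, Complex.norm_real, Real.norm_eq_abs,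
            Real.norm_eq_abs, abs_neg, abs_of_pos h0, abs_of_nonneg (by positivity)]
        _ ≤ 1 * η * ‖A‖ + s * ‖B‖ := by gcongr
        _ < r := by linarith
  rcases lt_or_gt_of_ne him with him | him
  · have hj := wind_jump hI h.next hx0 hoth hneA (κ := -(B / A)) (by simpa using him)
    obtain ⟨s, ⟨h1, h2, h3⟩, ⟨-, -, h4⟩⟩ := (hsmall.and hj).exists
    rw [← hA] at h4
    have e1 : -(B / A) * A = -B := by grind
    rw [e1, mul_neg, sub_neg_eq_add, ← sub_eq_add_neg, hzero s h1 h3] at h4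
    grind
  · have hj := wind_jump hI h.next hx0 hoth hneA (κ := B / A) him
    obtain ⟨s, ⟨h1, h2, h3⟩, ⟨-, -, h4⟩⟩ := (hsmall.and hj).exists
    rw [← hA] at h4
    have e1 : B / A * A = B := by rw [div_mul_cancel₀ _ hA0]
    grind

theorem linear_step (f : ℂ →ₗ[ℝ] ℝ) (o x v : ℂ) (τ : ℝ) :
    f (x + τ • (v - x) - o) = (1 - τ) * f (x - o) + τ * f (v - o) := by
  simp only [map_sub, map_add, map_smul, smul_eq_mul]
  ring

theorem eq_of_coord (h : PolyCorner p I e a b la lb) {y z : ℂ} (h1 : la (y - p e) = la (z - p e))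
    (h2 : lb (y - p e) = lb (z - p e)) : y = z := by
  have := h.coord (y - p e)
  rw [h1, h2, ← h.coord] at this
  exact sub_left_injective this

/-- If no vertex lies in the corner triangle, the third side of this triangle is a chord. -/
theorem opposite_off (h : PolyCorner p I e a b la lb) (hp : IsSimplePoly p I) (hI : 4 ≤ I.card)
    (hno : ∀ i ∈ I, i ≠ e → i ≠ a → i ≠ b → 0 ≤ la (p i - p e) → 0 ≤ lb (p i - p e) →
      1 < la (p i - p e) + lb (p i - p e)) {x : ℂ} (h1 : 0 < la (x - p e)) (h2 : 0 < lb (x - p e))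
    (h3 : la (x - p e) + lb (x - p e) = 1) : x ∉ polyCurve p I := by
  rintro ⟨f, hf, hx⟩
  have hsum : ∀ i ∈ I, i ≠ e → 0 ≤ la (p i - p e) → 0 ≤ lb (p i - p e) →
      1 ≤ la (p i - p e) + lb (p i - p e) := by
    intro i hi hie ha hb
    by_cases hia : i = a
    · subst hia; rw [h.la_a, h.lb_a]; norm_num
    by_cases hib : i = b
    · subst hib; rw [h.la_b, h.lb_b]; norm_num
    grind
  rcases h.edge_cases hf with rfl | rfl | ⟨hf1, hf2⟩
  · have := (h.next_edge_coord hx).1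
    linarith
  · have := (h.prev_edge_coord hx).1
    linarith
  have hm := mem_cycEdges.1 hf
  have hseg := convex_segment (𝕜 := ℝ) (p f.1) (p f.2)
  have hxv : ∀ v ∈ I, x ≠ p v := by
    rintro v hv rfl
    by_cases hve : v = e
    · subst hve; simp at h1
    by_cases hva : v = a
    · subst hva; rw [h.lb_a] at h2; exact lt_irrefl _ h2
    by_cases hvb : v = b
    · subst hvb; rw [h.la_b] at h1; exact lt_irrefl _ h1
    grind
  have key : ∀ v ∈ I, v ≠ e → p v ∈ segment ℝ (p f.1) (p f.2) →
      1 ≤ la (p v - p e) + lb (p v - p e) := by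
    intro v hv hve hvs
    by_contra! hc
    have hvout : la (p v - p e) ≤ 0 ∨ lb (p v - p e) ≤ 0 := by
      grind
    obtain ⟨τ, hτ0, hτ1, ha, hb, h0⟩ := leave la lb h1 h2 hvout
    refine h.no_exit hp hf hf1 hf2
      (hseg.segment_subset hx hvs (mem_segment_of_step hτ0.le hτ1)) ha hb ?_ h0
    rw [linear_step, linear_step]
    nlinarith
  have hx' : x ∈ openSegment ℝ (p f.1) (p f.2) := by
    rcases segment_cases hx with h | h | h
    · exact (hxv _ hm.1 h).elim
    · exact (hxv _ hm.2.1 h).elim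
    · exact h
  obtain ⟨t, ⟨ht0, ht1⟩, hxt⟩ := (openSegment_eq_image' ℝ (p f.1) (p f.2)).subset hx'
  have hk1 := key f.1 hm.1 hf1 (left_mem_segment ℝ _ _)
  have hk2 := key f.2 hm.2.1 hf2 (right_mem_segment ℝ _ _)
  have hlin1 := linear_step la (p e) (p f.1) (p f.2) t
  have hlin2 := linear_step lb (p e) (p f.1) (p f.2) t
  simp only at hxt
  rw [hxt] at hlin1 hlin2
  have hs1 : la (p f.1 - p e) + lb (p f.1 - p e) = 1 := by nlinarith
  have hs2 : la (p f.2 - p e) + lb (p f.2 - p e) = 1 := by nlinarith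
  have final : ∀ v w, v ∈ I → v ≠ e → v ≠ a → v ≠ b → p v ∈ segment ℝ (p f.1) (p f.2) →
      la (p v - p e) + lb (p v - p e) = 1 → x ∈ segment ℝ (p v) (p w) →
      (v = f.1 ∧ w = f.2 ∨ v = f.2 ∧ w = f.1) → False := by
    intro v w hv hve hva hvb hvs hs hxw hvw
    have hvout : la (p v - p e) ≤ 0 ∨ lb (p v - p e) ≤ 0 := by
      grind
    obtain ⟨τ, hτ0, hτ1, ha, hb, h0⟩ := leave la lb h1 h2 hvout
    have hys : la (x + τ • (p v - x) - p e) + lb (x + τ • (p v - x) - p e) = 1 := by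
      rw [linear_step, linear_step]
      grind
    have hyseg : x + τ • (p v - x) ∈ segment ℝ x (p v) := mem_segment_of_step hτ0.le hτ1
    have hyf := hseg.segment_subset hx hvs hyseg
    have hab : ∃ k, (k = a ∨ k = b) ∧ k ∈ I ∧ x + τ • (p v - x) = p k := by
      rcases h0 with h0 | h0
      · refine ⟨b, Or.inr rfl, (mem_cycEdges.1 h.prev).1, h.eq_of_coord ?_ ?_⟩
        · rw [h0, h.la_b]
        · rw [h.lb_b]; linarith
      · refine ⟨a, Or.inl rfl, (mem_cycEdges.1 h.next).2.1, h.eq_of_coord ?_ ?_⟩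
        · rw [h.la_a]; linarith
        · rw [h0, h.lb_a]
    obtain ⟨k, hk, hkI, hy⟩ := hab
    rw [hy] at hyf hyseg
    have hkw : k = w := by
      rcases hp.vertex_mem hkI hf hyf with h | h <;> rcases hvw with h' | h' <;>
        simp_all
    subst hkw
    exact hxv k hkI (eq_of_mem_segment_segment (by rwa [segment_symm]) hxw)
  have hab : ¬ ((f.1 = a ∨ f.1 = b) ∧ (f.2 = a ∨ f.2 = b)) := by
    rintro ⟨ha | ha, hb | hb⟩
    · grind
    · have hf' : (a, b) ∈ cycEdges I := by rw [← ha, ← hb]; exact hf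
      have : I ⊆ {e, a, b} := fun l hl => by
        rcases cycEdges_three h.next hf' h.prev hl with rfl | rfl | rfl <;> simp
      have := Finset.card_le_card this
      grind
    · have hf' : (b, a) ∈ cycEdges I := by rw [← ha, ← hb]; exact hf
      exact cycEdges_ne h.next (cycEdges_fst_inj h.prev hf')
    grind
  rw [not_and_or, not_or, not_or] at hab
  rcases hab with ⟨ha, hb⟩ | ⟨ha, hb⟩
  · exact final _ _ hm.1 hf1 ha hb (left_mem_segment ℝ _ _) hs1 hx (Or.inl ⟨rfl, rfl⟩)
  · exact final _ _ hm.2.1 hf2 ha hb (right_mem_segment ℝ _ _) hs2 (by rwa [segment_symm])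
      (Or.inr ⟨rfl, rfl⟩)

end PolyCorner

theorem exists_isChord {p : ℕ → ℂ} {I : Finset ℕ} {u v : ℕ} (hu : u ∈ I) (hv : v ∈ I)
    (huv : u ≠ v) (h1 : (u, v) ∉ cycEdges I) (h2 : (v, u) ∉ cycEdges I)
    (hoff : ∀ x ∈ openSegment ℝ (p u) (p v), x ∉ polyCurve p I) :
    ∃ c d, IsChord p I c d ∧ (c = u ∧ d = v ∨ c = v ∧ d = u) := by
  wlog h : u < v generalizing u v
  · obtain ⟨c, d, hc, hcd⟩ := this hv hu huv.symm h2 h1 (by rwa [openSegment_symm]) (by omega)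
    grind
  refine ⟨u, v, ⟨hu, hv, h, ?_, ?_, hoff⟩, Or.inl ⟨rfl, rfl⟩⟩
  · by_contra! hc
    refine h1 (mem_cycEdges.2 ⟨hu, hv, Or.inl ⟨h, fun k hk => ?_⟩⟩)
    have := hc k hk
    omega
  · by_contra! hc
    exact h2 (mem_cycEdges.2 ⟨hv, hu, Or.inr ⟨h, fun k hk => hc k hk⟩⟩)

theorem IsSimplePoly.exists_chord {p : ℕ → ℂ} {I : Finset ℕ} (hp : IsSimplePoly p I)
    (hI : 4 ≤ I.card) : ∃ c d e, IsChord p I c d ∧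
      (∃ x ∈ openSegment ℝ (p c) (p d), wind p I x ≠ 0) ∧ e ∈ I ∧ (e ≠ c ∧ e ≠ d) ∧
      ∃ u, ∀ i ∈ I, i ≠ e → 0 < ((p i - p e) * u).re := by
  obtain ⟨e, a, b, la, lb, h⟩ := hp.exists_corner
  have heI := (mem_cycEdges.1 h.next).1
  have haI := (mem_cycEdges.1 h.next).2.1
  have hbI := (mem_cycEdges.1 h.prev).1
  have hae := (cycEdges_ne h.next).symm
  have hbe := cycEdges_ne h.prev
  by_cases hz : ∃ z ∈ I, z ≠ e ∧ z ≠ a ∧ z ≠ b ∧ 0 ≤ la (p z - p e) ∧ 0 ≤ lb (p z - p e) ∧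
      la (p z - p e) + lb (p z - p e) ≤ 1
  · classical
    set J := I.filter fun z => z ≠ e ∧ z ≠ a ∧ z ≠ b ∧ 0 ≤ la (p z - p e) ∧ 0 ≤ lb (p z - p e) ∧
      la (p z - p e) + lb (p z - p e) ≤ 1 with hJ
    obtain ⟨z0, hz0, hz0'⟩ := hz
    obtain ⟨z, hzJ, hmin⟩ := Finset.exists_min_image J
      (fun z => la (p z - p e) + lb (p z - p e)) ⟨z0, by grind⟩
    rw [hJ, Finset.mem_filter] at hzJ
    obtain ⟨hzI, hze, hza, hzb, h1, h2, h3⟩ := hzJ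
    have hla : 0 < la (p z - p e) := by
      refine lt_of_le_of_ne h1 fun h0 => ?_
      rcases hp.vertex_mem hzI h.prev (h.mem_prev_edge h0.symm h2 (by linarith)) with h | h
      · exact hzb h
      · exact hze h
    have hlb : 0 < lb (p z - p e) := by
      refine lt_of_le_of_ne h2 fun h0 => ?_
      rcases hp.vertex_mem hzI h.next (h.mem_next_edge h0.symm h1 (by linarith)) with h | h
      · exact hze h
      · exact hza h
    have hv : ∀ i ∈ I, i ≠ e → 0 ≤ la (p i - p e) → 0 ≤ lb (p i - p e) →
        1 - (1 - (la (p z - p e) + lb (p z - p e))) ≤ la (p i - p e) + lb (p i - p e) := by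
      intro i hi hie ha hb
      rw [sub_sub_cancel]
      by_cases hia : i = a
      · subst hia; rw [h.la_a, h.lb_a]; linarith
      by_cases hib : i = b
      · subst hib; rw [h.la_b, h.lb_b]; linarith
      grind
    have hreg : ∀ x ∈ openSegment ℝ (p e) (p z),
        x ∈ PolyCorner.region (p e) la lb (1 - (la (p z - p e) + lb (p z - p e))) := by
      intro x hx
      obtain ⟨t, ⟨ht0, ht1⟩, rfl⟩ := (openSegment_eq_image' ℝ (p e) (p z)).subset hx
      simp only [PolyCorner.region, mem_ofPred_eq, PolyCorner.linear_step, sub_self, map_zero]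
      have := mul_pos ht0 hla
      have := mul_pos ht0 hlb
      refine ⟨by linarith, by linarith, by nlinarith⟩
    obtain ⟨ε, hε, hw⟩ := h.region_wind hp (by linarith) (by linarith) hv
    obtain ⟨c, d, hcd, hcd'⟩ := exists_isChord (p := p) heI hzI hze.symm
      (fun hc => hza (cycEdges_fst_inj hc h.next)) (fun hc => hzb (cycEdges_snd_inj hc h.prev))
      (fun x hx => h.region_off hp (by linarith) hv (hreg x hx).1 (hreg x hx).2.1 (hreg x hx).2.2)
    obtain ⟨e', he', hmax, u, hu⟩ := exists_exposed hp.inj ⟨e, heI⟩ (p e)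
    have he'e : e' ≠ e := by
      rintro rfl
      have := hmax a haI
      rw [sub_self, norm_zero, norm_le_zero_iff, sub_eq_zero] at this
      grind
    have he'z : e' ≠ z := by
      rintro rfl
      have ha := mul_pos hla (hu a haI (Ne.symm hza))
      have hb := mul_pos hlb (hu b hbI (Ne.symm hzb))
      have hc := mul_nonneg (sub_nonneg.2 h3) (hu e heI (Ne.symm hze)).le
      have hsum := h.coord (p e' - p e)
      rw [Complex.real_smul, Complex.real_smul] at hsum
      rw [← Complex.re_ofReal_mul] at ha hb hc
      have hz : (((la (p e' - p e) : ℝ) : ℂ) * ((p a - p e') * u) +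
        ((lb (p e' - p e) : ℝ) : ℂ) * ((p b - p e') * u) +
        ((1 - (la (p e' - p e) + lb (p e' - p e)) : ℝ) : ℂ) * ((p e - p e') * u)) = 0 := by
        push_cast
        grind
      have := congrArg Complex.re hz
      simp only [Complex.add_re, Complex.zero_re] at this
      linarith
    refine ⟨c, d, e', hcd, ?_, he', ?_, u, hu⟩
    · have hx : midpoint ℝ (p e) (p z) ∈ openSegment ℝ (p e) (p z) := midpoint_mem_openSegment ..
      refine ⟨midpoint ℝ (p e) (p z), ?_, ?_⟩
      · rcases hcd' with ⟨rfl, rfl⟩ | ⟨rfl, rfl⟩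
        · exact hx
        · rwa [openSegment_symm]
      grind
    grind
  · push Not at hz
    have hseg : ∀ x ∈ openSegment ℝ (p a) (p b), 0 < la (x - p e) ∧ 0 < lb (x - p e) ∧
        la (x - p e) + lb (x - p e) = 1 := by
      intro x hx
      obtain ⟨t, ⟨ht0, ht1⟩, rfl⟩ := (openSegment_eq_image' ℝ (p a) (p b)).subset hx
      simp only [PolyCorner.linear_step, h.la_a, h.la_b, h.lb_a, h.lb_b]
      grind
    have hoff : ∀ x ∈ openSegment ℝ (p a) (p b), x ∉ polyCurve p I := fun x hx =>
      h.opposite_off hp hI hz (hseg x hx).1 (hseg x hx).2.1 (hseg x hx).2.2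
    have hv : ∀ i ∈ I, i ≠ e → 0 ≤ la (p i - p e) → 0 ≤ lb (p i - p e) →
        1 - 0 ≤ la (p i - p e) + lb (p i - p e) := by
      intro i hi hie ha hb
      rw [sub_zero]
      by_cases hia : i = a
      · subst hia; rw [h.la_a, h.lb_a]; linarith
      by_cases hib : i = b
      · subst hib; rw [h.la_b, h.lb_b]; linarith
      grind
    obtain ⟨ε, hε, hw⟩ := h.region_wind hp le_rfl zero_lt_one hv
    have hx : midpoint ℝ (p a) (p b) ∈ openSegment ℝ (p a) (p b) := midpoint_mem_openSegment ..
    obtain ⟨c, d, hcd, hcd'⟩ := exists_isChord (p := p) haI hbI h.ne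
      (fun hc => by
        have : I ⊆ {e, a, b} := fun l hl => by
          rcases cycEdges_three h.next hc h.prev hl with rfl | rfl | rfl <;> simp
        have := Finset.card_le_card this
        grind) (fun hc => hae (cycEdges_fst_inj hc h.prev)) hoff
    refine ⟨c, d, e, hcd, ⟨midpoint ℝ (p a) (p b), ?_, ?_⟩, heI, ?_, h.exposed⟩
    · rcases hcd' with ⟨rfl, rfl⟩ | ⟨rfl, rfl⟩
      · exact hx
      · rwa [openSegment_symm]
    · have hm := hseg _ hx
      set x := midpoint ℝ (p a) (p b)
      have hstep : ∀ y ∈ segment ℝ x (p e + (1 / 2 : ℝ) • (x - p e)), y ∉ polyCurve p I := by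
        intro y hy
        obtain ⟨t, ⟨ht0, ht1⟩, rfl⟩ := (segment_eq_image' ℝ _ _).subset hy
        rcases ht0.eq_or_lt with rfl | ht0
        · simpa using hoff x hx
        · refine h.region_off hp le_rfl hv ?_ ?_ ?_ <;>
            simp only [PolyCorner.linear_step, sub_self, map_zero] <;> nlinarith
      have hI2 : 2 ≤ I.card := by omega
      rw [wind_eq_of_segment hI2 hstep, hw]
      · grind
      · simp only [PolyCorner.region, mem_ofPred_eq, PolyCorner.linear_step, sub_self, map_zero]
        grind
    grind

/-- Piecewise affine functions, described by finitely many affine functionals whose signs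
determine the pieces. -/
def PLOn {E F : Type*} [AddCommGroup E] [Module ℝ E] [AddCommGroup F] [Module ℝ F]
    (f : E → F) (S : Set E) : Prop :=
  ∃ Φ : Set (E →ᵃ[ℝ] ℝ), Φ.Finite ∧ ∀ C ⊆ S, Convex ℝ C →
    (∀ φ ∈ Φ, (∀ x ∈ C, 0 ≤ φ x) ∨ (∀ x ∈ C, φ x ≤ 0)) → ∃ A : E →ᵃ[ℝ] F, ∀ x ∈ C, f x = A x

/-- Twice the signed area of a triangle. -/
def det3 (a b c : ℂ) : ℝ := (b - a).re * (c - a).im - (b - a).im * (c - a).re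

theorem det3_rotate (a b c : ℂ) : det3 b c a = det3 a b c := by
  simp only [det3, Complex.sub_re, Complex.sub_im]; ring

theorem det3_swap (a b c : ℂ) : det3 a c b = - det3 a b c := by
  simp only [det3]; ring

/-- Twice the signed area, as an affine function of the last vertex. -/
def detAff (a b : ℂ) : ℂ →ᵃ[ℝ] ℝ :=
  AffineMap.mk' (fun c => det3 a b c)
    ((b - a).re • Complex.imLm - (b - a).im • Complex.reLm) a (fun c => by
      simp [det3])

theorem detAff_apply (a b c : ℂ) : detAff a b c = det3 a b c := rfl

theorem affine_nonneg_of_hull (f : ℂ →ᵃ[ℝ] ℝ) {S : Set ℂ} (h : ∀ x ∈ S, 0 ≤ f x) :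
    ∀ x ∈ conv S, 0 ≤ f x := by
  have hc : Convex ℝ (f ⁻¹' Ici 0) := (convex_Ici (𝕜 := ℝ) (0 : ℝ)).affine_preimage f
  exact fun x hx => convexHull_min h hc hx

theorem affine_nonpos_of_hull (f : ℂ →ᵃ[ℝ] ℝ) {S : Set ℂ} (h : ∀ x ∈ S, f x ≤ 0) :
    ∀ x ∈ conv S, f x ≤ 0 := by
  have hc : Convex ℝ (f ⁻¹' Iic 0) := (convex_Iic (𝕜 := ℝ) (0 : ℝ)).affine_preimage f
  exact fun x hx => convexHull_min h hc hx

theorem exists_coords {A B : ℂ} (hD : A.re * B.im - A.im * B.re ≠ 0) :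
    ∃ la lb : ℂ →ₗ[ℝ] ℝ, (∀ z, z = la z • A + lb z • B) ∧
      la A = 1 ∧ la B = 0 ∧ lb A = 0 ∧ lb B = 1 ∧
      (∀ z, |la z| ≤ ‖B‖ * ‖z‖ / |A.re * B.im - A.im * B.re|) ∧
      ∀ z, |lb z| ≤ ‖A‖ * ‖z‖ / |A.re * B.im - A.im * B.re| := by
  set D := A.re * B.im - A.im * B.re with hDdef
  let la : ℂ →ₗ[ℝ] ℝ := (B.im / D) • Complex.reLm - (B.re / D) • Complex.imLm
  let lb : ℂ →ₗ[ℝ] ℝ := (A.re / D) • Complex.imLm - (A.im / D) • Complex.reLm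
  have hla : ∀ z, la z = B.im / D * z.re - B.re / D * z.im := fun z => rfl
  have hlb : ∀ z, lb z = A.re / D * z.im - A.im / D * z.re := fun z => rfl
  have hcs : ∀ u v : ℂ, |u.im * v.re - u.re * v.im| ≤ ‖u‖ * ‖v‖ := by
    intro u v
    have h1 : u.im * v.re - u.re * v.im = (u * (starRingEnd ℂ) v).im := by
      simp; ring
    rw [h1]
    refine (Complex.abs_im_le_norm _).trans ?_
    rw [norm_mul, RCLike.norm_conj]
  refine ⟨la, lb, fun z => ?_, ?_, ?_, ?_, ?_, fun z => ?_, fun z => ?_⟩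
  · rw [hla, hlb]
    apply Complex.ext
    · simp only [Complex.add_re, Complex.real_smul, Complex.re_ofReal_mul]
      field_simp
      rw [hDdef]; ring
    · simp only [Complex.add_im, Complex.real_smul, Complex.im_ofReal_mul]
      field_simp
      rw [hDdef]; ring
  · rw [hla]; field_simp; rw [hDdef]; ring
  · rw [hla]; field_simp; ring
  · rw [hlb]; field_simp; ring
  · rw [hlb]; field_simp; rw [hDdef]
  · rw [hla, show B.im / D * z.re - B.re / D * z.im = (B.im * z.re - B.re * z.im) / D by ring,
      abs_div]
    gcongr
    exact hcs B z
  · rw [hlb, show A.re / D * z.im - A.im / D * z.re = -(A.im * z.re - A.re * z.im) / D by ring,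
      abs_div, abs_neg]
    gcongr
    exact hcs A z

/-- A parametrisation of the closed region bounded by a polygon by a convex polygon. -/
structure FillMap (w p : ℕ → ℂ) (I : Finset ℕ) (ε Λ : ℝ) (F : ℂ → ℂ) : Prop where
  lip : ∀ x ∈ conv (w '' I), ∀ y ∈ conv (w '' I), ‖F x - F y‖ ≤ Λ * ‖x - y‖
  pl : PLOn F (conv (w '' I))
  inj : InjOn F (conv (w '' I))
  image : F '' conv (w '' I) = polyCurve p I ∪ polyInside p I ε
  hull : ∀ x ∈ conv (w '' I), F x ∈ conv (p '' I)
  edge : ∀ e ∈ cycEdges I, ∀ t ∈ Icc (0 : ℝ) 1,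
    F (AffineMap.lineMap (w e.1) (w e.2) t) = AffineMap.lineMap (p e.1) (p e.2) t

theorem polyCurve_subset_hull (p : ℕ → ℂ) (I : Finset ℕ) : polyCurve p I ⊆ conv (p '' I) := by
  rintro x ⟨e, he, hx⟩
  have hm := mem_cycEdges.1 he
  exact segment_subset_convexHull (mem_image_of_mem _ hm.1) (mem_image_of_mem _ hm.2.1) hx

theorem PolyCorner.mem_hull_iff {p : ℕ → ℂ} {I : Finset ℕ} {e a b : ℕ} {la lb : ℂ →ₗ[ℝ] ℝ}
    (h : PolyCorner p I e a b la lb) (hI : I = {e, a, b}) {x : ℂ} : x ∈ conv (p '' I) ↔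
      0 ≤ la (x - p e) ∧ 0 ≤ lb (x - p e) ∧ la (x - p e) + lb (x - p e) ≤ 1 := by
  have hset : p '' I = {p e, p a, p b} := by
    rw [hI]; simp [image_insert_eq]
  rw [hset]
  constructor
  · intro hx
    have hc : Convex ℝ {x | 0 ≤ la (x - p e) ∧ 0 ≤ lb (x - p e) ∧
        la (x - p e) + lb (x - p e) ≤ 1} := by
      intro x hx y hy s t hs ht hst
      have hl : ∀ f : ℂ →ₗ[ℝ] ℝ, f (s • x + t • y - p e) = s * f (x - p e) + t * f (y - p e) := by
        intro f
        simp only [map_sub, map_add, map_smul, smul_eq_mul]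
        linear_combination (f (p e)) * hst
      obtain ⟨h1, h2, h3⟩ := hx
      obtain ⟨h4, h5, h6⟩ := hy
      refine ⟨?_, ?_, ?_⟩
      · rw [hl]; positivity
      · rw [hl]; positivity
      · rw [hl, hl]
        nlinarith
    refine convexHull_min ?_ hc hx
    rintro y (rfl | rfl | rfl)
    · simp
    · simp [-map_sub, h.la_a, h.lb_a]
    · simp [-map_sub, h.la_b, h.lb_b]
  · rintro ⟨h1, h2, h3⟩
    have hx := h.coord (x - p e)
    have hx' : x = (1 - la (x - p e) - lb (x - p e)) • p e + la (x - p e) • p a +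
        lb (x - p e) • p b := by
      simp only [Complex.real_smul] at hx ⊢
      push_cast
      linear_combination hx
    rw [hx']
    have hc := convex_convexHull ℝ ({p e, p a, p b} : Set ℂ)
    have hs : ∑ i : Fin 3, ![1 - la (x - p e) - lb (x - p e), la (x - p e), lb (x - p e)] i •
        ![p e, p a, p b] i ∈ conv ({p e, p a, p b} : Set ℂ) := by
      refine hc.sum_mem ?_ ?_ ?_
      · intro i _; fin_cases i <;> simp [-map_sub] <;> linarith
      · simp only [Fin.sum_univ_three, Matrix.cons_val]; ring
      · intro i _; fin_cases i <;> exact subset_convexHull ℝ _ (by simp)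
    simpa [-map_sub, Fin.sum_univ_three] using hs

theorem IsSimplePoly.jordan_three {p : ℕ → ℂ} {I : Finset ℕ} (hp : IsSimplePoly p I)
    (hI : I.card = 3) : ∃ ε, PolyJordan p I ε ∧ polyCurve p I ∪ polyInside p I ε = conv (p '' I) ∧
      ∃ e a b la lb, PolyCorner p I e a b la lb ∧ I = {e, a, b} ∧ (a, b) ∈ cycEdges I := by
  obtain ⟨e, a, b, la, lb, h⟩ := hp.exists_corner
  have heI := (mem_cycEdges.1 h.next).1
  have haI := (mem_cycEdges.1 h.next).2.1
  have hbI := (mem_cycEdges.1 h.prev).1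
  have hae := (cycEdges_ne h.next).symm
  have hbe := cycEdges_ne h.prev
  have hI2 : 2 ≤ I.card := by omega
  have hIs : I = {e, a, b} := by
    refine (Finset.eq_of_subset_of_card_le ?_ ?_).symm
    · grind
    · rw [hI, Finset.card_eq_three.2 ⟨e, a, b, hae.symm, hbe.symm, h.ne, rfl⟩]
  have hab : (a, b) ∈ cycEdges I := by
    obtain ⟨j, hj⟩ := exists_cycEdges_fst hI2 haI
    have hjI := (mem_cycEdges.1 hj).2.1
    have hja := cycEdges_ne hj
    rw [hIs] at hjI
    simp only [Finset.mem_insert, Finset.mem_singleton] at hjI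
    rcases hjI with rfl | rfl | rfl
    · exact (hp.not_two h.next hj).elim
    · exact (hja rfl).elim
    · exact hj
  have hhull : ∀ {x}, x ∈ conv (p '' I) ↔ _ := fun {x} => h.mem_hull_iff hIs
  have hv : ∀ i ∈ I, i ≠ e → 0 ≤ la (p i - p e) → 0 ≤ lb (p i - p e) →
      1 - 0 ≤ la (p i - p e) + lb (p i - p e) := by
    intro i hi hie _ _
    rw [hIs] at hi
    simp only [Finset.mem_insert, Finset.mem_singleton] at hi
    rcases hi with rfl | rfl | rfl
    · exact (hie rfl).elim
    · rw [h.la_a, h.lb_a]; norm_num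
    · rw [h.la_b, h.lb_b]; norm_num
  obtain ⟨ε, hε, hw⟩ := h.region_wind hp le_rfl zero_lt_one hv
  have hout : ∀ q, q ∉ conv (p '' I) → wind p I q = 0 := by
    intro q hq
    rw [hhull, not_and_or, not_and_or] at hq
    have hpt : ∀ i ∈ I, p i ∈ conv (p '' I) := fun i hi =>
      subset_convexHull ℝ _ (mem_image_of_mem _ hi)
    rcases hq with hq | hq | hq
    · refine wind_eq_zero_of_linear hI2 la fun i hi => ?_
      grind
    · refine wind_eq_zero_of_linear hI2 lb fun i hi => ?_
      grind
    · refine wind_eq_zero_of_linear hI2 (-(la + lb)) fun i hi => ?_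
      have := (hhull.1 (hpt i hi)).2.2
      rw [map_sub, map_sub] at this hq
      rw [LinearMap.neg_apply, LinearMap.neg_apply, LinearMap.add_apply, LinearMap.add_apply]
      linarith
  have hin : ∀ q ∈ conv (p '' I), q ∉ polyCurve p I →
      q ∈ PolyCorner.region (p e) la lb 0 := by
    intro q hq hqP
    obtain ⟨h1, h2, h3⟩ := hhull.1 hq
    refine ⟨lt_of_le_of_ne h1 fun h0 => hqP ⟨_, h.prev, h.mem_prev_edge h0.symm h2 (by linarith)⟩,
      lt_of_le_of_ne h2 fun h0 => hqP ⟨_, h.next, h.mem_next_edge h0.symm h1 (by linarith)⟩,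
      lt_of_le_of_ne (by linarith) fun h0 => hqP ⟨_, hab, ?_⟩⟩
    rw [segment_eq_image']
    refine ⟨lb (q - p e), ⟨h2, by linarith⟩, ?_⟩
    have := h.coord (q - p e)
    have h4 : la (q - p e) = 1 - lb (q - p e) := by linarith
    rw [h4] at this
    simp only [Complex.real_smul] at this ⊢
    push_cast at this
    linear_combination - this
  have hinside : polyInside p I ε = PolyCorner.region (p e) la lb 0 := by
    ext q
    constructor
    · rintro ⟨h1, h2⟩
      grind
    · intro hq
      exact ⟨h.region_off hp le_rfl hv hq.1 hq.2.1 hq.2.2, hw q hq⟩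
  refine ⟨ε, ⟨hε, fun q hq => ?_, ?_, ?_⟩, ?_, e, a, b, la, lb, h, hIs, hab⟩
  · grind
  · rw [hinside]
    exact (PolyCorner.convex_region _ _ _ _).isPreconnected
  · intro x hx
    rw [hinside]
    obtain ⟨h1, h2, h3⟩ := hhull.1 (polyCurve_subset_hull p I hx)
    set o := p e + (1 / 3 : ℝ) • (p a - p e) + (1 / 3 : ℝ) • (p b - p e) with ho
    have hoe : o - p e = (1 / 3 : ℝ) • (p a - p e) + (1 / 3 : ℝ) • (p b - p e) := by
      rw [ho]; ring
    have hlao : la (o - p e) = 1 / 3 := by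
      rw [hoe, map_add, map_smul, map_smul, h.la_a, h.la_b]; norm_num
    have hlbo : lb (o - p e) = 1 / 3 := by
      rw [hoe, map_add, map_smul, map_smul, h.lb_a, h.lb_b]; norm_num
    have hcont : Filter.Tendsto (fun t : ℝ => x + t • (o - x)) (𝓝[>] 0) (𝓝 x) := by
      have : Continuous fun t : ℝ => x + t • (o - x) := by fun_prop
      have := (this.tendsto 0).mono_left (nhdsWithin_le_nhds (s := Ioi 0))
      simpa using this
    refine mem_closure_of_tendsto hcont ?_
    have h01 : ∀ᶠ t : ℝ in 𝓝[>] 0, t < 1 := nhdsWithin_le_nhds (gt_mem_nhds zero_lt_one)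
    filter_upwards [h01, self_mem_nhdsWithin] with t ht1 ht0
    have ht0 : 0 < t := ht0
    simp only [PolyCorner.region, mem_ofPred_eq, PolyCorner.linear_step, hlao, hlbo]
    have := mul_nonneg (sub_nonneg.2 ht1.le) h1
    have := mul_nonneg (sub_nonneg.2 ht1.le) h2
    refine ⟨by linarith, by linarith, by nlinarith⟩
  · apply Subset.antisymm
    · rintro x (hx | hx)
      · exact polyCurve_subset_hull p I hx
      grind
    grind

theorem FillMap.base {w p : ℕ → ℂ} {I : Finset ℕ} {κ W D : ℝ} (hp : IsSimplePoly p I)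
    (hI : I.card = 3) (hκ : 0 < κ)
    (hw : ∀ i ∈ I, ∀ j ∈ I, ∀ k ∈ I, i < j → j < k → κ ≤ det3 (w i) (w j) (w k))
    (hW : ∀ i ∈ I, ∀ j ∈ I, ‖w i - w j‖ ≤ W) (hD : ∀ i ∈ I, ∀ j ∈ I, ‖p i - p j‖ ≤ D) :
    ∃ ε F, PolyJordan p I ε ∧ FillMap w p I ε (2 * W * D / κ) F := by
  obtain ⟨ε, hJ, hset, e, a, b, la, lb, h, hIs, hab⟩ := hp.jordan_three hI
  have heI := (mem_cycEdges.1 h.next).1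
  have haI := (mem_cycEdges.1 h.next).2.1
  have hbI := (mem_cycEdges.1 h.prev).1
  have hdet : κ ≤ det3 (w e) (w a) (w b) := by
    have h1 := (mem_cycEdges.1 h.next).2.2
    have h2 := (mem_cycEdges.1 h.prev).2.2
    have h3 := (mem_cycEdges.1 hab).2.2
    have hs : (e < a ∧ a < b) ∨ (b < e ∧ e < a) ∨ (a < b ∧ b < e) := by
      grind
    rcases hs with ⟨h1, h2⟩ | ⟨h1, h2⟩ | ⟨h1, h2⟩
    · grind
    · rw [← det3_rotate, ← det3_rotate]; grind
    · rw [← det3_rotate]; grind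
  have hW0 : 0 ≤ W := (norm_nonneg _).trans (hW e heI a haI)
  set A := w a - w e with hA
  set B := w b - w e with hB
  have hdet' : κ ≤ A.re * B.im - A.im * B.re := hdet
  obtain ⟨ma, mb, hm, maA, maB, mbA, mbB, hma, hmb⟩ := exists_coords
    (A := A) (B := B) (by linarith)
  rw [abs_of_pos (by linarith)] at hma hmb
  set L : ℂ →ₗ[ℝ] ℂ := ma.smulRight (p a - p e) + mb.smulRight (p b - p e)
  have hLapp : ∀ z, L z = ma z • (p a - p e) + mb z • (p b - p e) := fun z => rfl
  let F : ℂ →ᵃ[ℝ] ℂ := AffineMap.mk' (fun z => p e + L (z - w e)) L (w e) (fun z => by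
    simp [add_comm])
  have hF : ∀ z, F z = p e + L (z - w e) := fun z => rfl
  have hFe : F (w e) = p e := by simp [hF]
  have hFa : F (w a) = p a := by rw [hF, hLapp, ← hA, maA, mbA]; simp
  have hFb : F (w b) = p b := by rw [hF, hLapp, ← hB, maB, mbB]; simp
  have hFI : ∀ i ∈ I, F (w i) = p i := by
    intro i hi
    rw [hIs] at hi
    simp only [Finset.mem_insert, Finset.mem_singleton] at hi
    rcases hi with rfl | rfl | rfl <;> assumption
  have himage : F '' conv (w '' I) = conv (p '' I) := by
    rw [F.image_convexHull, image_image]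
    congr 1
    exact image_congr hFI
  refine ⟨ε, F, hJ, ⟨fun x _ y _ => ?_, ?_, ?_, ?_, fun x hx => ?_, fun f hf t _ => ?_⟩⟩
  · rw [hF, hF, add_sub_add_left_eq_sub, ← map_sub, sub_sub_sub_cancel_right, hLapp]
    set z := x - y
    have e1 : |ma z| ≤ W * ‖z‖ / κ := (hma z).trans (by
      gcongr
      exact hW b hbI e heI)
    have e2 : |mb z| ≤ W * ‖z‖ / κ := (hmb z).trans (by
      gcongr
      exact hW a haI e heI)
    calc _ ≤ ‖ma z • (p a - p e)‖ + ‖mb z • (p b - p e)‖ := norm_add_le _ _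
      _ = |ma z| * ‖p a - p e‖ + |mb z| * ‖p b - p e‖ := by
        rw [norm_smul, norm_smul, Real.norm_eq_abs, Real.norm_eq_abs]
      _ ≤ W * ‖z‖ / κ * D + W * ‖z‖ / κ * D := by
        gcongr
        · exact hD a haI e heI
        · exact hD b hbI e heI
      _ = _ := by ring
  · exact ⟨∅, finite_empty, fun C _ _ _ => ⟨F, fun _ _ => rfl⟩⟩
  · intro x _ y _ hxy
    rw [hF, hF, add_right_inj] at hxy
    have key : ∀ z, la (L z) = ma z ∧ lb (L z) = mb z := by
      intro z
      rw [hLapp, map_add, map_add, map_smul, map_smul, map_smul, map_smul, h.la_a, h.la_b, h.lb_a,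
        h.lb_b]
      simp
    have h1 := key (x - w e)
    have h2 := key (y - w e)
    rw [hxy] at h1
    have h3 := hm (x - w e)
    rw [← h1.1, ← h1.2, h2.1, h2.2, ← hm] at h3
    exact sub_left_injective h3
  · rw [himage, hset]
  · rw [← himage]; exact mem_image_of_mem _ hx
  · have hm := mem_cycEdges.1 hf
    rw [F.apply_lineMap, hFI _ hm.1, hFI _ hm.2.1]

/-- Cutting a convex polygon along a chord. -/
theorem convex_cut {w : ℕ → ℂ} {I : Finset ℕ} {c d : ℕ}
    (hw : ∀ i ∈ I, ∀ j ∈ I, ∀ k ∈ I, i < j → j < k → 0 < det3 (w i) (w j) (w k))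
    (hc : c ∈ I) (hd : d ∈ I) (hcd : c < d) (hin : ∃ k ∈ I, c < k ∧ k < d) :
    (∀ x ∈ conv (w '' arcIn I c d), det3 (w c) (w d) x ≤ 0) ∧
    (∀ x ∈ conv (w '' arcOut I c d), 0 ≤ det3 (w c) (w d) x) ∧
    (∀ x ∈ conv (w '' I), det3 (w c) (w d) x = 0 → x ∈ segment ℝ (w c) (w d)) ∧ conv (w '' I) =
      conv (w '' arcIn I c d) ∪ conv (w '' arcOut I c d) := by
  have h1 : ∀ x ∈ conv (w '' arcIn I c d), det3 (w c) (w d) x ≤ 0 := by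
    refine affine_nonpos_of_hull (detAff (w c) (w d)) ?_
    rintro _ ⟨i, hi, rfl⟩
    obtain ⟨hi, h1, h2⟩ := mem_arcIn.1 hi
    rw [detAff_apply]
    rcases h1.eq_or_lt with rfl | h1
    · simp [det3]
    rcases h2.eq_or_lt with rfl | h2
    · simp [det3, mul_comm]
    rw [det3_swap]
    grind
  have h2 : ∀ x ∈ conv (w '' arcOut I c d), 0 ≤ det3 (w c) (w d) x := by
    refine affine_nonneg_of_hull (detAff (w c) (w d)) ?_
    rintro _ ⟨i, hi, rfl⟩
    obtain ⟨hi, h⟩ := mem_arcOut.1 hi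
    rw [detAff_apply]
    rcases h with h | h
    · rcases h.eq_or_lt with rfl | h
      · simp [det3]
      rw [det3_rotate]
      grind
    · rcases h.eq_or_lt with rfl | h
      · simp [det3, mul_comm]
      grind
  have hwcd : w c ≠ w d := by
    obtain ⟨k, hk, hk1, hk2⟩ := hin
    intro h
    have := hw c hc k hk d hd hk1 hk2
    rw [← det3_rotate, ← det3_rotate, h] at this
    simp [det3] at this
  have h3 : ∀ x ∈ conv (w '' I), det3 (w c) (w d) x = 0 → x ∈ segment ℝ (w c) (w d) := by
    intro x hx hx0
    obtain ⟨k0, hk0, hk01, hk02⟩ := hin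
    obtain ⟨t, ht⟩ : ∃ t : ℝ, x - w c = t • (w d - w c) := by
      set z := w d - w c
      have hz0 : z ≠ 0 := sub_ne_zero.2 hwcd.symm
      have hn := Complex.normSq_pos.2 hz0
      have h0 : z.re * (x - w c).im - z.im * (x - w c).re = 0 := hx0
      refine ⟨(z.re * (x - w c).re + z.im * (x - w c).im) / Complex.normSq z, ?_⟩
      rw [Complex.normSq_apply] at *
      rw [Complex.real_smul]
      apply Complex.ext
      · rw [Complex.re_ofReal_mul, div_mul_eq_mul_div, eq_div_iff hn.ne']
        grind
      · rw [Complex.im_ofReal_mul, div_mul_eq_mul_div, eq_div_iff hn.ne']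
        linear_combination z.re * h0
    have hxt : x = w c + t • (w d - w c) := by rw [← ht]; ring
    have ht0 : 0 ≤ t := by
      obtain ⟨k, hkm, hmin⟩ := Finset.exists_min_image (I.filter fun k => c < k) id
        ⟨d, Finset.mem_filter.2 ⟨hd, hcd⟩⟩
      obtain ⟨hkI, hck⟩ := Finset.mem_filter.1 hkm
      have hkd : k < d := (hmin k0 (Finset.mem_filter.2 ⟨hk0, hk01⟩)).trans_lt hk02
      have hpos := hw c hc k hkI d hd hck hkd
      have hge : 0 ≤ det3 (w c) (w k) x := by
        refine affine_nonneg_of_hull (detAff (w c) (w k)) ?_ x hx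
        rintro _ ⟨i, hi, rfl⟩
        rw [detAff_apply]
        rcases lt_trichotomy i c with h | rfl | h
        · rw [det3_rotate]; grind
        · simp [det3]
        · rcases (hmin i (Finset.mem_filter.2 ⟨hi, h⟩) : k ≤ i).eq_or_lt with rfl | h'
          · simp [det3, mul_comm]
          grind
      have : det3 (w c) (w k) x = t * det3 (w c) (w k) (w d) := by
        rw [hxt]; simp [det3]; ring
      rw [this] at hge
      exact nonneg_of_mul_nonneg_left hge hpos
    have ht1 : t ≤ 1 := by
      obtain ⟨k, hkm, hmax⟩ := Finset.exists_max_image (I.filter fun k => k < d) id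
        ⟨c, Finset.mem_filter.2 ⟨hc, hcd⟩⟩
      obtain ⟨hkI, hkd⟩ := Finset.mem_filter.1 hkm
      have hck : c < k := hk01.trans_le (hmax k0 (Finset.mem_filter.2 ⟨hk0, hk02⟩))
      have hpos := hw c hc k hkI d hd hck hkd
      have hge : 0 ≤ det3 (w k) (w d) x := by
        refine affine_nonneg_of_hull (detAff (w k) (w d)) ?_ x hx
        rintro _ ⟨i, hi, rfl⟩
        rw [detAff_apply]
        rcases lt_trichotomy i d with h | rfl | h
        · rcases (hmax i (Finset.mem_filter.2 ⟨hi, h⟩) : i ≤ k).eq_or_lt with rfl | h'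
          · simp [det3]
          · rw [det3_rotate]; grind
        · simp [det3, mul_comm]
        grind
      have : det3 (w k) (w d) x = (1 - t) * det3 (w c) (w k) (w d) := by
        rw [hxt]; simp [det3]; ring
      rw [this] at hge
      linarith [nonneg_of_mul_nonneg_left hge hpos]
    rw [hxt, segment_eq_image']
    grind
  refine ⟨h1, h2, h3, Subset.antisymm ?_ (union_subset ?_ ?_)⟩
  · have hun : (w '' I : Set ℂ) = w '' arcIn I c d ∪ w '' arcOut I c d := by
      rw [← image_union]
      congr 1
      ext k
      simp only [Finset.mem_coe, mem_union, mem_arcIn, mem_arcOut]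
      grind
    have hne1 : (w '' arcIn I c d : Set ℂ).Nonempty :=
      ⟨w c, mem_image_of_mem _ (Finset.mem_coe.2 (mem_arcIn.2 ⟨hc, le_rfl, hcd.le⟩))⟩
    have hne2 : (w '' arcOut I c d : Set ℂ).Nonempty :=
      ⟨w c, mem_image_of_mem _ (Finset.mem_coe.2 (mem_arcOut.2 ⟨hc, Or.inl le_rfl⟩))⟩
    intro x hx
    have hx' := hx
    rw [hun, convexHull_union hne1 hne2, mem_convexJoin] at hx'
    obtain ⟨y1, hy1, y2, hy2, hxy⟩ := hx'
    have hsub1 : segment ℝ (w c) (w d) ⊆ conv (w '' arcIn I c d) :=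
      segment_subset_convexHull
        (mem_image_of_mem _ (Finset.mem_coe.2 (mem_arcIn.2 ⟨hc, le_rfl, hcd.le⟩)))
        (mem_image_of_mem _ (Finset.mem_coe.2 (mem_arcIn.2 ⟨hd, hcd.le, le_rfl⟩)))
    have hsub2 : segment ℝ (w c) (w d) ⊆ conv (w '' arcOut I c d) :=
      segment_subset_convexHull
        (mem_image_of_mem _ (Finset.mem_coe.2 (mem_arcOut.2 ⟨hc, Or.inl le_rfl⟩)))
        (mem_image_of_mem _ (Finset.mem_coe.2 (mem_arcOut.2 ⟨hd, Or.inr le_rfl⟩)))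
    have hline : ∀ s : ℝ, det3 (w c) (w d) (y1 + s • (y2 - y1)) =
        (1 - s) * det3 (w c) (w d) y1 + s * det3 (w c) (w d) y2 := by
      intro s; simp [det3]; ring
    have hL1 := h1 y1 hy1
    have hL2 := h2 y2 hy2
    have hcont : Continuous fun s : ℝ =>
        (1 - s) * det3 (w c) (w d) y1 + s * det3 (w c) (w d) y2 := by fun_prop
    obtain ⟨s, hs, hs0⟩ := intermediate_value_Icc (zero_le_one (α := ℝ)) hcont.continuousOn
      (show (0 : ℝ) ∈ _ by simpa using ⟨hL1, hL2⟩)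
    simp only at hs0
    rw [← hline] at hs0
    have hyI : y1 + s • (y2 - y1) ∈ segment ℝ y1 y2 := by
      rw [segment_eq_image']; exact ⟨s, hs, rfl⟩
    have hmono : ∀ J ⊆ I, conv (w '' J) ⊆ conv (w '' I) := fun J hJ =>
      convexHull_mono (image_mono (Finset.coe_subset.2 hJ))
    have hy := h3 _ ((convex_convexHull ℝ _).segment_subset
      (hmono _ (Finset.filter_subset _ _) hy1) (hmono _ (Finset.filter_subset _ _) hy2) hyI) hs0
    obtain ⟨r, hr, rfl⟩ := (segment_eq_image' ℝ y1 y2).subset hxy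
    rcases le_total r s with h | h
    · left
      refine (convex_convexHull ℝ _).segment_subset hy1 (hsub1 hy) ?_
      rw [segment_eq_image']
      rcases hs.1.eq_or_lt with rfl | hs0'
      · exact ⟨0, by simp, by simp [le_antisymm h hr.1]⟩
      refine ⟨r / s, ⟨by have := hr.1; positivity, by rw [div_le_one hs0']; exact h⟩, ?_⟩
      simp only [add_sub_cancel_left, smul_smul]
      grind
    · right
      refine (convex_convexHull ℝ _).segment_subset (hsub2 hy) hy2 ?_
      rw [segment_eq_image']
      rcases hs.2.eq_or_lt with rfl | hs1
      · exact ⟨0, by simp, by simp [le_antisymm hr.2 h]⟩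
      have h1s : 0 < 1 - s := by linarith
      refine ⟨(r - s) / (1 - s), ⟨div_nonneg (by linarith) h1s.le,
        by rw [div_le_one h1s]; linarith [hr.2]⟩, ?_⟩
      have : y2 - (y1 + s • (y2 - y1)) = (1 - s) • (y2 - y1) := by
        simp only [Complex.real_smul]; push_cast; ring
      simp only [this, smul_smul]
      rw [div_mul_cancel₀ _ h1s.ne', add_assoc, ← add_smul]
      congr 2; ring
  · exact convexHull_mono (image_mono (Finset.coe_subset.2 (Finset.filter_subset _ _)))
  · exact convexHull_mono (image_mono (Finset.coe_subset.2 (Finset.filter_subset _ _)))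

/-- A point of vanishing value of an affine functional on a segment where the sign changes. -/
theorem exists_segment_zero {E : Type*} [AddCommGroup E] [Module ℝ E] (f : E →ᵃ[ℝ] ℝ) {x y : E}
    (hx : f x ≤ 0) (hy : 0 ≤ f y) : ∃ z ∈ segment ℝ x y, f z = 0 := by
  by_cases h : f y - f x = 0
  · exact ⟨x, left_mem_segment ℝ x y, by linarith⟩
  have hpos : 0 < f y - f x := lt_of_le_of_ne (by linarith) (Ne.symm h)
  refine ⟨AffineMap.lineMap x y (-f x / (f y - f x)), ?_, ?_⟩
  · rw [segment_eq_image_lineMap]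
    refine ⟨_, ⟨div_nonneg (by linarith) hpos.le, (div_le_one hpos).2 (by linarith)⟩, rfl⟩
  · rw [f.apply_lineMap, AffineMap.lineMap_apply_module]
    simp only [smul_eq_mul]
    field_simp
    ring

theorem norm_sub_add_of_segment {x y z : ℂ} (hz : z ∈ segment ℝ x y) :
    ‖x - z‖ + ‖z - y‖ = ‖x - y‖ := by
  simpa [dist_eq_norm] using (mem_segment_iff_wbtw.1 hz).dist_add_dist

theorem PLOn.union_cut {E F : Type*} [AddCommGroup E] [Module ℝ E] [AddCommGroup F] [Module ℝ F]
    {f : E → F} {S S1 S2 : Set E} (h1 : PLOn f S1) (h2 : PLOn f S2) (a : E →ᵃ[ℝ] ℝ)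
    (hS1 : ∀ x ∈ S, a x ≤ 0 → x ∈ S1) (hS2 : ∀ x ∈ S, 0 ≤ a x → x ∈ S2) : PLOn f S := by
  obtain ⟨Φ1, hf1, h1⟩ := h1
  obtain ⟨Φ2, hf2, h2⟩ := h2
  refine ⟨insert a (Φ1 ∪ Φ2), (hf1.union hf2).insert a, fun C hCS hC hs => ?_⟩
  rcases hs a (mem_insert _ _) with h | h
  · exact h2 C (fun x hx => hS2 x (hCS hx) (h x hx)) hC
      fun φ hφ => hs φ (mem_insert_of_mem _ (Or.inr hφ))
  · exact h1 C (fun x hx => hS1 x (hCS hx) (h x hx)) hC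
      fun φ hφ => hs φ (mem_insert_of_mem _ (Or.inl hφ))

theorem PLOn.congr {E F : Type*} [AddCommGroup E] [Module ℝ E] [AddCommGroup F] [Module ℝ F]
    {f g : E → F} {S : Set E} (h : PLOn f S) (hfg : ∀ x ∈ S, g x = f x) : PLOn g S := by
  obtain ⟨Φ, hf, h⟩ := h
  refine ⟨Φ, hf, fun C hCS hC hs => ?_⟩
  obtain ⟨A, hA⟩ := h C hCS hC hs
  exact ⟨A, fun x hx => (hfg x (hCS hx)).trans (hA x hx)⟩

theorem FillMap.glue {w p : ℕ → ℂ} {I : Finset ℕ} {c d : ℕ} {ε Λ : ℝ} {F₁ F₂ : ℂ → ℂ}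
    (hch : IsChord p I c d)
    (hw : ∀ i ∈ I, ∀ j ∈ I, ∀ k ∈ I, i < j → j < k → 0 < det3 (w i) (w j) (w k))
    (h1 : FillMap w p (arcIn I c d) ε Λ F₁) (h2 : FillMap w p (arcOut I c d) ε Λ F₂)
    (hunion : polyCurve p I ∪ polyInside p I ε =
      (polyCurve p (arcIn I c d) ∪ polyInside p (arcIn I c d) ε) ∪
      (polyCurve p (arcOut I c d) ∪ polyInside p (arcOut I c d) ε))
    (hinter : (polyCurve p (arcIn I c d) ∪ polyInside p (arcIn I c d) ε) ∩
      (polyCurve p (arcOut I c d) ∪ polyInside p (arcOut I c d) ε) ⊆ segment ℝ (p c) (p d)) :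
    ∃ F, FillMap w p I ε Λ F := by
  classical
  obtain ⟨cut1, cut2, cut3, cut4⟩ := convex_cut hw hch.left hch.right hch.lt hch.inner
  set H1 := conv (w '' arcIn I c d)
  set H2 := conv (w '' arcOut I c d)
  set H := conv (w '' I) with hH
  have hc1 := chord_mem_arcIn hch.left hch.right hch.lt
  have hc2 := chord_mem_arcOut hch.left hch.right hch.lt
  have m1 := mem_cycEdges.1 hc1
  have m2 := mem_cycEdges.1 hc2
  have hseg1 : segment ℝ (w c) (w d) ⊆ H1 :=
    segment_subset_convexHull (mem_image_of_mem _ m1.2.1) (mem_image_of_mem _ m1.1)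
  have hseg2 : segment ℝ (w c) (w d) ⊆ H2 :=
    segment_subset_convexHull (mem_image_of_mem _ m2.1) (mem_image_of_mem _ m2.2.1)
  have hsub1 : H1 ⊆ H := by grind
  have hsub2 : H2 ⊆ H := by grind
  have hF2seg : ∀ t ∈ Icc (0 : ℝ) 1, F₂ (AffineMap.lineMap (w c) (w d) t) =
      AffineMap.lineMap (p c) (p d) t := h2.edge _ hc2
  have hF1seg : ∀ t ∈ Icc (0 : ℝ) 1, F₁ (AffineMap.lineMap (w c) (w d) t) =
      AffineMap.lineMap (p c) (p d) t := by
    intro t ht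
    have := h1.edge _ hc1 (1 - t) ⟨by linarith [ht.2], by linarith [ht.1]⟩
    simpa only [AffineMap.lineMap_apply_one_sub] using this
  have hagree : ∀ x ∈ segment ℝ (w c) (w d), F₁ x = F₂ x := by
    intro x hx
    rw [segment_eq_image_lineMap] at hx
    grind
  let F : ℂ → ℂ := fun x => if x ∈ H1 then F₁ x else F₂ x
  have hmem1 : ∀ x ∈ H, det3 (w c) (w d) x ≤ 0 → x ∈ H1 := by
    grind
  have hmem2 : ∀ x ∈ H, 0 ≤ det3 (w c) (w d) x → x ∈ H2 := by
    grind
  have hFe1 : ∀ x ∈ H1, F x = F₁ x := fun x hx => if_pos hx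
  have hFe2 : ∀ x ∈ H2, F x = F₂ x := by
    grind
  have hcross : ∀ x ∈ H1, ∀ y ∈ H2, ∃ z ∈ segment ℝ x y, z ∈ segment ℝ (w c) (w d) := by
    intro x hx y hy
    obtain ⟨z, hz, hz0⟩ := exists_segment_zero (detAff (w c) (w d)) (cut1 x hx) (cut2 y hy)
    refine ⟨z, hz, cut3 z ?_ hz0⟩
    exact (convex_convexHull ℝ _).segment_subset (hsub1 hx) (hsub2 hy) hz
  have hlip12 : ∀ x ∈ H1, ∀ y ∈ H2, ‖F x - F y‖ ≤ Λ * ‖x - y‖ := by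
    intro x hx y hy
    obtain ⟨z, hz, hzs⟩ := hcross x hx y hy
    have e1 := h1.lip x hx z (hseg1 hzs)
    have e2 := h2.lip z (hseg2 hzs) y hy
    rw [hFe1 x hx, hFe2 y hy, ← norm_sub_add_of_segment hz, mul_add]
    calc ‖F₁ x - F₂ y‖ = ‖(F₁ x - F₁ z) + (F₂ z - F₂ y)‖ := by grind
      _ ≤ _ := (norm_add_le _ _).trans (add_le_add e1 e2)
  have hinj12 : ∀ x ∈ H1, ∀ y ∈ H2, F x = F y → x = y := by
    intro x hx y hy hxy
    rw [hFe1 x hx, hFe2 y hy] at hxy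
    have i1 : F₁ x ∈ polyCurve p (arcIn I c d) ∪ polyInside p (arcIn I c d) ε := by
      rw [← h1.image]; exact mem_image_of_mem _ hx
    have i2 : F₁ x ∈ polyCurve p (arcOut I c d) ∪ polyInside p (arcOut I c d) ε := by
      rw [← h2.image, hxy]; exact mem_image_of_mem _ hy
    have hs := hinter ⟨i1, i2⟩
    rw [segment_eq_image_lineMap] at hs
    obtain ⟨t, ht, hst⟩ := hs
    have hz : AffineMap.lineMap (w c) (w d) t ∈ segment ℝ (w c) (w d) := by
      rw [segment_eq_image_lineMap]; exact ⟨t, ht, rfl⟩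
    have hx' : x = AffineMap.lineMap (w c) (w d) t :=
      h1.inj hx (hseg1 hz) (by rw [hF1seg t ht, hst])
    have hy' : y = AffineMap.lineMap (w c) (w d) t :=
      h2.inj hy (hseg2 hz) (by rw [hF2seg t ht, hst, hxy])
    rw [hx', hy']
  refine ⟨F, ⟨?_, ?_, ?_, ?_, ?_, ?_⟩⟩
  · intro x hx y hy
    rw [← hH, cut4] at hx hy
    rcases hx with hx | hx <;> rcases hy with hy | hy
    · rw [hFe1 x hx, hFe1 y hy]; exact h1.lip x hx y hy
    · exact hlip12 x hx y hy
    · rw [norm_sub_rev, norm_sub_rev x]; exact hlip12 y hy x hx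
    · rw [hFe2 x hx, hFe2 y hy]; exact h2.lip x hx y hy
  · exact (h1.pl.congr hFe1).union_cut (h2.pl.congr hFe2) (detAff (w c) (w d)) hmem1 hmem2
  · intro x hx y hy hxy
    rw [← hH, cut4] at hx hy
    rcases hx with hx | hx <;> rcases hy with hy | hy
    · rw [hFe1 x hx, hFe1 y hy] at hxy; exact h1.inj hx hy hxy
    · exact hinj12 x hx y hy hxy
    · grind
    · rw [hFe2 x hx, hFe2 y hy] at hxy; exact h2.inj hx hy hxy
  · rw [← hH, cut4, image_union, image_congr hFe1, image_congr hFe2, h1.image, h2.image, hunion]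
  · intro x hx
    rw [← hH, cut4] at hx
    rcases hx with hx | hx
    · rw [hFe1 x hx]
      exact convexHull_mono (image_mono fun i hi => (mem_arcIn.1 hi).1) (h1.hull x hx)
    · rw [hFe2 x hx]
      exact convexHull_mono (image_mono fun i hi => (mem_arcOut.1 hi).1) (h2.hull x hx)
  · intro e he t ht
    rcases hch.mem_cycEdges_of.1 he with ⟨h, -⟩ | ⟨h, -⟩
    · have hm := mem_cycEdges.1 h
      rw [hFe1, h1.edge e h t ht]
      refine (convex_convexHull ℝ _).lineMap_mem ?_ ?_ ht <;> apply subset_convexHull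
      · exact mem_image_of_mem _ hm.1
      · exact mem_image_of_mem _ hm.2.1
    · have hm := mem_cycEdges.1 h
      rw [hFe2, h2.edge e h t ht]
      refine (convex_convexHull ℝ _).lineMap_mem ?_ ?_ ht <;> apply subset_convexHull
      · exact mem_image_of_mem _ hm.1
      · exact mem_image_of_mem _ hm.2.1

theorem IsSimplePoly.exists_fillMap {w p : ℕ → ℂ} {κ W D : ℝ} (hκ : 0 < κ) {I : Finset ℕ}
    (hp : IsSimplePoly p I)
    (hw : ∀ i ∈ I, ∀ j ∈ I, ∀ k ∈ I, i < j → j < k → κ ≤ det3 (w i) (w j) (w k))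
    (hW : ∀ i ∈ I, ∀ j ∈ I, ‖w i - w j‖ ≤ W) (hD : ∀ i ∈ I, ∀ j ∈ I, ‖p i - p j‖ ≤ D) :
    ∃ ε F, PolyJordan p I ε ∧ FillMap w p I ε (2 * W * D / κ) F := by
  induction hn : I.card using Nat.strong_induction_on generalizing I with
  | _ n ih =>
  have h3 := hp.card
  by_cases hI : I.card = 3
  · exact FillMap.base hp hI hκ hw hW hD
  obtain ⟨c, d, e, hch, hx, he, hec, hexp⟩ := hp.exists_chord (by omega)
  have s1 : ∀ i ∈ arcIn I c d, i ∈ I := fun i hi => (mem_arcIn.1 hi).1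
  have s2 : ∀ i ∈ arcOut I c d, i ∈ I := fun i hi => (mem_arcOut.1 hi).1
  obtain ⟨ε₁, F₁, hJ1, hF1⟩ := ih _ (hn ▸ hch.card_in_lt) (hch.simple_in hp)
    (fun i hi j hj k hk => hw i (s1 i hi) j (s1 j hj) k (s1 k hk))
    (fun i hi j hj => hW i (s1 i hi) j (s1 j hj)) (fun i hi j hj => hD i (s1 i hi) j (s1 j hj)) rfl
  obtain ⟨ε₂, F₂, hJ2, hF2⟩ := ih _ (hn ▸ hch.card_out_lt) (hch.simple_out hp)
    (fun i hi j hj k hk => hw i (s2 i hi) j (s2 j hj) k (s2 k hk))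
    (fun i hi j hj => hW i (s2 i hi) j (s2 j hj)) (fun i hi j hj => hD i (s2 i hi) j (s2 j hj)) rfl
  obtain ⟨rfl, hJ, hun, hcst⟩ := hch.glue hp hJ1 hJ2 hx he hec hexp
  obtain ⟨F, hF⟩ := FillMap.glue hch
    (fun i hi j hj k hk hij hjk => hκ.trans_le (hw i hi j hj k hk hij hjk)) hF1 hF2 hun hcst
  exact ⟨ε₁, F, hJ, hF⟩

/-- Nearest neighbours in the integer lattice. -/
def LatAdj (z w : ℤ × ℤ) : Prop :=
  (z.1 = w.1 ∧ (z.2 = w.2 + 1 ∨ w.2 = z.2 + 1)) ∨ (z.2 = w.2 ∧ (z.1 = w.1 + 1 ∨ w.1 = z.1 + 1))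

/-- The square box of half side `R` centred at `c`. -/
def InBox (R : ℤ) (c z : ℤ × ℤ) : Prop :=
  -R ≤ z.1 - c.1 ∧ z.1 - c.1 ≤ R ∧ -R ≤ z.2 - c.2 ∧ z.2 - c.2 ≤ R

/-- The boundary of the square box of half side `R` centred at `c`. -/
def OnBox (R : ℤ) (c z : ℤ × ℤ) : Prop :=
  InBox R c z ∧ (z.1 - c.1 = R ∨ z.1 - c.1 = -R ∨ z.2 - c.2 = R ∨ z.2 - c.2 = -R)

/-- The inclusion of the lattice in the plane. -/
def latPt (z : ℤ × ℤ) : ℂ := ⟨z.1, z.2⟩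

/-- The lattice point at the lower left of a point of the plane. -/
def latFloor (x : ℂ) : ℤ × ℤ := (⌊x.re⌋, ⌊x.im⌋)

theorem LatAdj.symm {z w : ℤ × ℤ} (h : LatAdj z w) : LatAdj w z := by
  simp only [LatAdj] at h ⊢; omega

theorem onBox_of_exit {R : ℤ} {c z w : ℤ × ℤ} (hz : InBox R c z) (hw : ¬ InBox R c w)
    (h : LatAdj z w) : OnBox R c z := by
  simp only [LatAdj, InBox, OnBox] at *; omega

theorem norm_le_abs_add_abs (z : ℂ) : ‖z‖ ≤ |z.re| + |z.im| := Complex.norm_le_abs_re_add_abs_im z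

theorem latFloor_near (x : ℂ) : ‖latPt (latFloor x) - x‖ ≤ 2 := by
  refine (norm_le_abs_add_abs _).trans ?_
  simp only [latPt, latFloor, Complex.sub_re, Complex.sub_im]
  have h1 := Int.floor_le x.re
  have h2 := Int.lt_floor_add_one x.re
  have h3 := Int.floor_le x.im
  have h4 := Int.lt_floor_add_one x.im
  grind

/-- The lattice graph restricted to a set. -/
def latGraph (S : Set (ℤ × ℤ)) : SimpleGraph (ℤ × ℤ) where
  Adj z w := LatAdj z w ∧ z ∈ S ∧ w ∈ S
  symm := ⟨fun _ _ h => ⟨h.1.symm, h.2.2, h.2.1⟩⟩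
  loopless := ⟨fun z h => by have := h.1; simp only [LatAdj] at this; omega⟩

theorem latGraph_short_walk {S : Set (ℤ × ℤ)} {z w : ℤ × ℤ} (hz : z ∈ S) (hw : w ∈ S)
    (hm : (w.1, z.2) ∈ S) (h1 : |z.1 - w.1| ≤ 1) (h2 : |z.2 - w.2| ≤ 1) :
    ∃ q : (latGraph S).Walk z w, q.length ≤ 2 := by
  obtain ⟨z1, z2⟩ := z
  obtain ⟨w1, w2⟩ := w
  rw [abs_le] at h1 h2
  simp only at h1 h2 hm
  have step1 : ∃ q : (latGraph S).Walk (z1, z2) (w1, z2), q.length ≤ 1 := by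
    by_cases h : z1 = w1
    · subst h; exact ⟨SimpleGraph.Walk.nil, by simp⟩
    · have : (latGraph S).Adj (z1, z2) (w1, z2) :=
        ⟨Or.inr ⟨rfl, by grind⟩, hz, hm⟩
      exact ⟨this.toWalk, by simp⟩
  have step2 : ∃ q : (latGraph S).Walk (w1, z2) (w1, w2), q.length ≤ 1 := by
    by_cases h : z2 = w2
    · subst h; exact ⟨SimpleGraph.Walk.nil, by simp⟩
    · have : (latGraph S).Adj (w1, z2) (w1, w2) :=
        ⟨Or.inl ⟨rfl, by grind⟩, hm, hw⟩
      exact ⟨this.toWalk, by simp⟩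
  obtain ⟨q1, h1⟩ := step1
  obtain ⟨q2, h2⟩ := step2
  exact ⟨q1.append q2, by rw [SimpleGraph.Walk.length_append]; omega⟩

theorem abs_floor_sub_floor_le {a b : ℝ} (h : |a - b| ≤ 1) : |⌊a⌋ - ⌊b⌋| ≤ 1 := by
  rw [abs_le] at h ⊢
  have h1 := Int.floor_le a
  have h2 := Int.lt_floor_add_one a
  have h3 := Int.floor_le b
  have h4 := Int.lt_floor_add_one b
  constructor
  · by_contra! hc
    have : (⌊a⌋ : ℝ) - ⌊b⌋ ≤ -2 := mod_cast (by omega : ⌊a⌋ - ⌊b⌋ ≤ -2)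
    linarith
  · by_contra! hc
    have : (2 : ℝ) ≤ (⌊a⌋ : ℝ) - ⌊b⌋ := mod_cast (by omega : 2 ≤ ⌊a⌋ - ⌊b⌋)
    linarith

/-- A chain of points of the plane with unit steps is shadowed by an injective lattice path. -/
theorem exists_lattice_walk (X : ℕ → ℂ) (M : ℕ) (hX : ∀ i < M, ‖X i - X (i + 1)‖ ≤ 1) :
    ∃ (l : ℕ) (v : ℕ → ℤ × ℤ), l ≤ 2 * M ∧ v 0 = latFloor (X 0) ∧ v l = latFloor (X M) ∧
      (∀ i ≤ l, ∃ j ≤ M, ‖latPt (v i) - X j‖ ≤ 3) ∧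
      (∀ i ≤ l, ∀ j ≤ l, v i = v j → i = j) ∧ ∀ i < l, LatAdj (v i) (v (i + 1)) := by
  classical
  set S : Set (ℤ × ℤ) := {z | ∃ j ≤ M, ‖latPt z - X j‖ ≤ 3}
  have hfl : ∀ j ≤ M, latFloor (X j) ∈ S := fun j hj =>
    ⟨j, hj, (latFloor_near _).trans (by norm_num)⟩
  have hwalk : ∀ i ≤ M, ∃ q : (latGraph S).Walk (latFloor (X 0)) (latFloor (X i)),
      q.length ≤ 2 * i := by
    intro i
    induction i with
    | zero => exact fun _ => ⟨SimpleGraph.Walk.nil, by simp⟩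
    | succ i ih =>
      intro hi
      obtain ⟨q, hq⟩ := ih (by omega)
      have hx := hX i (by omega)
      have hre : |(X i).re - (X (i + 1)).re| ≤ 1 := by
        have := Complex.abs_re_le_norm (X i - X (i + 1))
        rw [Complex.sub_re] at this; linarith
      have him : |(X i).im - (X (i + 1)).im| ≤ 1 := by
        have := Complex.abs_im_le_norm (X i - X (i + 1))
        rw [Complex.sub_im] at this; linarith
      have hm : ((latFloor (X (i + 1))).1, (latFloor (X i)).2) ∈ S := by
        refine ⟨i, by omega, (norm_le_abs_add_abs _).trans ?_⟩
        simp only [latPt, latFloor, Complex.sub_re, Complex.sub_im]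
        have h1 := Int.floor_le (X (i + 1)).re
        have h2 := Int.lt_floor_add_one (X (i + 1)).re
        have h3 := Int.floor_le (X i).im
        have h4 := Int.lt_floor_add_one (X i).im
        rw [abs_le] at hre
        have : |(⌊(X (i + 1)).re⌋ : ℝ) - (X i).re| ≤ 2 := abs_le.2 ⟨by linarith, by linarith⟩
        have : |(⌊(X i).im⌋ : ℝ) - (X i).im| ≤ 1 := abs_le.2 ⟨by linarith, by linarith⟩
        linarith
      obtain ⟨q', hq'⟩ := latGraph_short_walk (hfl i (by omega)) (hfl (i + 1) hi) hm
        (abs_floor_sub_floor_le hre) (abs_floor_sub_floor_le him)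
      exact ⟨q.append q', by rw [SimpleGraph.Walk.length_append]; omega⟩
  obtain ⟨q, hq⟩ := hwalk M le_rfl
  have hb : q.bypass.length ≤ 2 * M := q.length_bypass_le_length.trans hq
  have hadj : ∀ i < q.bypass.length,
      (latGraph S).Adj (q.bypass.getVert i) (q.bypass.getVert (i + 1)) :=
    fun i hi => q.bypass.adj_getVert_succ hi
  refine ⟨q.bypass.length, q.bypass.getVert, hb, q.bypass.getVert_zero, q.bypass.getVert_length,
    fun i hi => ?_, fun i hi j hj hij => ?_, fun i hi => (hadj i hi).1⟩
  · change q.bypass.getVert i ∈ S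
    rcases hi.eq_or_lt with rfl | hi
    · rw [q.bypass.getVert_length]; exact hfl M le_rfl
    · exact (hadj i hi).2.1
  · exact q.bypass_isPath.getVert_injOn hi hj hij

/-- The part of a lattice path between two disjoint boxes around its endpoints. -/
theorem exists_lattice_path (X : ℕ → ℂ) (M : ℕ) (hX : ∀ i < M, ‖X i - X (i + 1)‖ ≤ 1) {R : ℤ}
    (hR : 0 ≤ R) (hd : ∀ z, InBox R (latFloor (X 0)) z → ¬ InBox R (latFloor (X M)) z) :
    ∃ (k : ℕ) (y : ℕ → ℤ × ℤ), k ≤ 2 * M ∧ (∀ i ≤ k, ∃ j ≤ M, ‖latPt (y i) - X j‖ ≤ 3) ∧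
      (∀ i ≤ k, ∀ j ≤ k, y i = y j → i = j) ∧ (∀ i < k, LatAdj (y i) (y (i + 1))) ∧
      OnBox R (latFloor (X 0)) (y 0) ∧ (∀ i ≤ k, 0 < i → ¬ InBox R (latFloor (X 0)) (y i)) ∧
      OnBox R (latFloor (X M)) (y k) ∧ ∀ i < k, ¬ InBox R (latFloor (X M)) (y i) := by
  classical
  obtain ⟨l, v, hl, hv0, hvl, hnear, hinj, hadj⟩ := exists_lattice_walk X M hX
  have hself : ∀ c : ℤ × ℤ, InBox R c c := fun c => by simp only [InBox]; omega
  set c := latFloor (X 0)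
  set d := latFloor (X M)
  set i₁ := Nat.findGreatest (fun i => InBox R c (v i)) l
  have h1 : InBox R c (v i₁) :=
    Nat.findGreatest_spec (P := fun i => InBox R c (v i)) (Nat.zero_le l) (by
      rw [hv0]; exact hself c)
  have h1l : i₁ ≤ l := Nat.findGreatest_le l
  have h1max : ∀ i, i₁ < i → i ≤ l → ¬ InBox R c (v i) := fun i hi hil =>
    Nat.findGreatest_is_greatest hi hil
  have hex : ∃ j, InBox R d (v (i₁ + j)) := ⟨l - i₁, by
    rw [Nat.add_sub_cancel' h1l, hvl]; exact hself d⟩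
  set k := Nat.find hex
  have hkd : InBox R d (v (i₁ + k)) := Nat.find_spec hex
  have hkmin : ∀ i < k, ¬ InBox R d (v (i₁ + i)) := fun i hi => Nat.find_min hex hi
  have hkl : i₁ + k ≤ l := by
    by_contra! h
    refine hkmin (l - i₁) (by omega) ?_
    rw [Nat.add_sub_cancel' h1l, hvl]; exact hself d
  have hk0 : 0 < k := by
    rcases Nat.eq_zero_or_pos k with h | h
    · rw [h, add_zero] at hkd
      exact absurd hkd (hd _ h1)
    · exact h
  refine ⟨k, fun i => v (i₁ + i), by omega, fun i hi => hnear _ (by omega),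
    fun i hi j hj hij => ?_, fun i hi => hadj _ (by omega), ?_, fun i hi hi0 => ?_, ?_, hkmin⟩
  · have := hinj _ (by omega) _ (by omega) hij
    omega
  · exact onBox_of_exit h1 (h1max _ (lt_add_one _) (by omega)) (hadj _ (by omega))
  · exact h1max _ (by omega) (by omega)
  · have h2 := hadj (i₁ + (k - 1)) (by omega)
    rw [show i₁ + (k - 1) + 1 = i₁ + k by omega] at h2
    exact onBox_of_exit hkd (hkmin _ (by omega)) h2.symm

theorem mem_segment_latPt {z w : ℤ × ℤ} {x : ℂ} (hx : x ∈ segment ℝ (latPt z) (latPt w)) :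
    ∃ t : ℝ, 0 ≤ t ∧ t ≤ 1 ∧ x.re - z.1 = t * (w.1 - z.1) ∧ x.im - z.2 = t * (w.2 - z.2) := by
  rw [segment_eq_image_lineMap] at hx
  obtain ⟨t, ht, rfl⟩ := hx
  refine ⟨t, ht.1, ht.2, ?_, ?_⟩ <;> simp [AffineMap.lineMap_apply, latPt]

theorem latPt_injective : Function.Injective latPt := by
  intro z w h
  have h1 := congrArg Complex.re h
  have h2 := congrArg Complex.im h
  simp only [latPt, Int.cast_inj] at h1 h2
  exact Prod.ext h1 h2

theorem floor_of_frac {x t : ℝ} {n : ℤ} (hx : x = n + t) (h0 : 0 < t) (h1 : t < 1) :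
    ⌊x⌋ = n ∧ (⌊x⌋ : ℝ) < x := by
  have : ⌊x⌋ = n := Int.floor_eq_iff.2 ⟨by linarith, by linarith⟩
  grind

/-- Points of a unit lattice segment. -/
theorem unit_segment_cases {z w : ℤ × ℤ} (h : LatAdj z w) {x : ℂ}
    (hx : x ∈ segment ℝ (latPt z) (latPt w)) : x = latPt z ∨ x = latPt w ∨
    (x.im = ⌊x.im⌋ ∧ (⌊x.re⌋ : ℝ) < x.re ∧ ((z = (⌊x.re⌋, ⌊x.im⌋) ∧ w = (⌊x.re⌋ + 1, ⌊x.im⌋)) ∨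
       (w = (⌊x.re⌋, ⌊x.im⌋) ∧ z = (⌊x.re⌋ + 1, ⌊x.im⌋)))) ∨ (x.re = ⌊x.re⌋ ∧ (⌊x.im⌋ : ℝ) < x.im ∧
      ((z = (⌊x.re⌋, ⌊x.im⌋) ∧ w = (⌊x.re⌋, ⌊x.im⌋ + 1)) ∨
       (w = (⌊x.re⌋, ⌊x.im⌋) ∧ z = (⌊x.re⌋, ⌊x.im⌋ + 1)))) := by
  obtain ⟨t, h0, h1, hre, him⟩ := mem_segment_latPt hx
  rcases h0.eq_or_lt with rfl | h0
  · left
    apply Complex.ext <;> simp only [latPt] <;> linarith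
  rcases h1.eq_or_lt with rfl | h1
  · right; left
    apply Complex.ext <;> simp only [latPt] <;> linarith
  right; right
  obtain ⟨z1, z2⟩ := z
  obtain ⟨w1, w2⟩ := w
  simp only at hre him
  rcases h with ⟨h, h' | h'⟩ | ⟨h, h' | h'⟩ <;> simp only at h h' <;> subst h <;> subst h'
  · right
    push_cast at him hre
    obtain ⟨a, b⟩ := floor_of_frac (x := x.im) (n := w2) (t := 1 - t) (by linarith) (by linarith)
      (by linarith)
    have e : x.re = z1 := by linarith
    simp_all
  · right
    push_cast at him hre
    obtain ⟨a, b⟩ := floor_of_frac (x := x.im) (n := z2) (t := t) (by linarith) h0 h1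
    have e : x.re = z1 := by linarith
    simp_all
  · left
    push_cast at him hre
    obtain ⟨a, b⟩ := floor_of_frac (x := x.re) (n := w1) (t := 1 - t) (by linarith) (by linarith)
      (by linarith)
    have e : x.im = z2 := by linarith
    simp_all
  · left
    push_cast at him hre
    obtain ⟨a, b⟩ := floor_of_frac (x := x.re) (n := z1) (t := t) (by linarith) h0 h1
    have e : x.im = z2 := by linarith
    simp_all

theorem latPt_mem_unit_segment {z w a : ℤ × ℤ} (h : LatAdj z w)
    (hx : latPt a ∈ segment ℝ (latPt z) (latPt w)) : a = z ∨ a = w := by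
  rcases unit_segment_cases h hx with h | h | ⟨-, h, -⟩ | ⟨-, h, -⟩
  · exact Or.inl (latPt_injective h)
  · exact Or.inr (latPt_injective h)
  · simp [latPt] at h
  · simp [latPt] at h

/-- Two unit lattice segments meet in common endpoints unless they agree. -/
theorem unit_segments_meet {z w z' w' : ℤ × ℤ} (h : LatAdj z w) (h' : LatAdj z' w') {x : ℂ}
    (hx : x ∈ segment ℝ (latPt z) (latPt w)) (hx' : x ∈ segment ℝ (latPt z') (latPt w')) :
    ((x = latPt z ∨ x = latPt w) ∧ (x = latPt z' ∨ x = latPt w')) ∨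
      (z = z' ∧ w = w') ∨ (z = w' ∧ w = z') := by
  have key : ∀ a, x = latPt a → (a = z ∨ a = w) → (a = z' ∨ a = w') →
      ((x = latPt z ∨ x = latPt w) ∧ (x = latPt z' ∨ x = latPt w')) := by
    grind
  rcases unit_segment_cases h hx with h1 | h1 | h1
  · left
    rw [h1] at hx'
    exact key z h1 (Or.inl rfl) (latPt_mem_unit_segment h' hx')
  · left
    rw [h1] at hx'
    exact key w h1 (Or.inr rfl) (latPt_mem_unit_segment h' hx')
  rcases unit_segment_cases h' hx' with h2 | h2 | h2
  · left
    rw [h2] at hx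
    exact key z' h2 (latPt_mem_unit_segment h hx) (Or.inl rfl)
  · left
    rw [h2] at hx
    exact key w' h2 (latPt_mem_unit_segment h hx) (Or.inr rfl)
  right
  rcases h1 with ⟨a1, b1, h1⟩ | ⟨a1, b1, h1⟩ <;> rcases h2 with ⟨a2, b2, h2⟩ | ⟨a2, b2, h2⟩
  · rcases h1 with ⟨e1, e2⟩ | ⟨e1, e2⟩ <;> rcases h2 with ⟨e3, e4⟩ | ⟨e3, e4⟩ <;>
      simp only [e1, e2, e3, e4, and_self, true_or, or_true]
  · exact absurd a1 b2.ne'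
  · exact absurd a2 b1.ne'
  · rcases h1 with ⟨e1, e2⟩ | ⟨e1, e2⟩ <;> rcases h2 with ⟨e3, e4⟩ | ⟨e3, e4⟩ <;>
      simp only [e1, e2, e3, e4, and_self, true_or, or_true]

theorem box_param_le {R : ℤ} (hR : 0 < R) {c a b : ℤ × ℤ} (ha : OnBox R c a) (hb : InBox R c b)
    {s t : ℝ} (ht : 0 ≤ t) (h1 : s * ((a.1 : ℝ) - c.1) = t * ((b.1 : ℝ) - c.1))
    (h2 : s * ((a.2 : ℝ) - c.2) = t * ((b.2 : ℝ) - c.2)) : s ≤ t := by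
  have hR' : (0 : ℝ) < R := mod_cast hR
  obtain ⟨b1, b2, b3, b4⟩ := hb
  have b1' : -(R : ℝ) ≤ b.1 - c.1 := mod_cast b1
  have b2' : (b.1 : ℝ) - c.1 ≤ R := mod_cast b2
  have b3' : -(R : ℝ) ≤ b.2 - c.2 := mod_cast b3
  have b4' : (b.2 : ℝ) - c.2 ≤ R := mod_cast b4
  refine le_of_mul_le_mul_right ?_ hR'
  rcases ha.2 with h | h | h | h
  · have e : (a.1 : ℝ) - c.1 = R := mod_cast h
    rw [e] at h1; nlinarith
  · have e : (a.1 : ℝ) - c.1 = -R := mod_cast h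
    rw [e] at h1; nlinarith
  · have e : (a.2 : ℝ) - c.2 = R := mod_cast h
    rw [e] at h2; nlinarith
  · have e : (a.2 : ℝ) - c.2 = -R := mod_cast h
    rw [e] at h2; nlinarith

/-- Two radial segments of a box meet only in the centre. -/
theorem radial_segments_meet {R : ℤ} (hR : 0 < R) {c a b : ℤ × ℤ} (ha : OnBox R c a)
    (hb : OnBox R c b) (hab : a ≠ b) {x : ℂ} (hx : x ∈ segment ℝ (latPt c) (latPt a))
    (hx' : x ∈ segment ℝ (latPt c) (latPt b)) : x = latPt c := by
  obtain ⟨s, hs0, -, hs1, hs2⟩ := mem_segment_latPt hx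
  obtain ⟨t, ht0, -, ht1, ht2⟩ := mem_segment_latPt hx'
  have h1 := box_param_le hR ha hb.1 ht0 (hs1.symm.trans ht1) (hs2.symm.trans ht2)
  have h2 := box_param_le hR hb ha.1 hs0 (ht1.symm.trans hs1) (ht2.symm.trans hs2)
  have h3 : s = t := le_antisymm h1 h2
  subst h3
  have hs : s = 0 := by
    by_contra hne
    apply hab
    exact Prod.ext (by simp_all) (by simp_all)
  rw [hs, zero_mul, sub_eq_zero] at hs1 hs2
  exact Complex.ext hs1 hs2

/-- A radial segment meets a unit segment outside the box only in its outer endpoint. -/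
theorem radial_unit_meet {R : ℤ} (hR : 0 < R) {c a z w : ℤ × ℤ} (ha : OnBox R c a)
    (h : LatAdj z w) (hz : ¬ InBox (R - 1) c z) (hw : ¬ InBox (R - 1) c w) {x : ℂ}
    (hx : x ∈ segment ℝ (latPt c) (latPt a)) (hx' : x ∈ segment ℝ (latPt z) (latPt w)) :
    x = latPt a ∧ (a = z ∨ a = w) := by
  suffices hxa : x = latPt a from ⟨hxa, latPt_mem_unit_segment h (hxa ▸ hx')⟩
  obtain ⟨t, ht0, ht1, hre, him⟩ := mem_segment_latPt hx
  obtain ⟨s, hs0, hs1, hre', him'⟩ := mem_segment_latPt hx'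
  have hR' : (0 : ℝ) < R := mod_cast hR
  obtain ⟨⟨b1, b2, b3, b4⟩, -⟩ := ha
  have b1' : -(R : ℝ) ≤ a.1 - c.1 := mod_cast b1
  have b2' : (a.1 : ℝ) - c.1 ≤ R := mod_cast b2
  have b3' : -(R : ℝ) ≤ a.2 - c.2 := mod_cast b3
  have b4' : (a.2 : ℝ) - c.2 ≤ R := mod_cast b4
  have ht : t = 1 := by
    have hcase : (R ≤ z.1 - c.1 ∧ R ≤ w.1 - c.1) ∨ (z.1 - c.1 ≤ -R ∧ w.1 - c.1 ≤ -R) ∨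
        (R ≤ z.2 - c.2 ∧ R ≤ w.2 - c.2) ∨ (z.2 - c.2 ≤ -R ∧ w.2 - c.2 ≤ -R) := by
      simp only [LatAdj, InBox] at h hz hw
      omega
    refine le_antisymm ht1 (le_of_mul_le_mul_right ?_ hR')
    rcases hcase with ⟨h1, h2⟩ | ⟨h1, h2⟩ | ⟨h1, h2⟩ | ⟨h1, h2⟩
    · have h1' : (R : ℝ) ≤ z.1 - c.1 := mod_cast h1
      have h2' : (R : ℝ) ≤ w.1 - c.1 := mod_cast h2
      nlinarith
    · have h1' : (z.1 : ℝ) - c.1 ≤ -R := mod_cast h1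
      have h2' : (w.1 : ℝ) - c.1 ≤ -R := mod_cast h2
      nlinarith
    · have h1' : (R : ℝ) ≤ z.2 - c.2 := mod_cast h1
      have h2' : (R : ℝ) ≤ w.2 - c.2 := mod_cast h2
      nlinarith
    · have h1' : (z.2 : ℝ) - c.2 ≤ -R := mod_cast h1
      have h2' : (w.2 : ℝ) - c.2 ≤ -R := mod_cast h2
      nlinarith
  rw [ht, one_mul, sub_left_inj] at hre him
  exact Complex.ext hre him

theorem InBox.of_norm_lt {R : ℤ} {c z : ℤ × ℤ} (h : ‖latPt z - latPt c‖ < R) :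
    InBox (R - 1) c z := by
  have h1 := (Complex.abs_re_le_norm _).trans_lt h
  have h2 := (Complex.abs_im_le_norm _).trans_lt h
  simp only [latPt, Complex.sub_re, Complex.sub_im] at h1 h2
  rw [abs_lt] at h1 h2
  have e1 : -R < z.1 - c.1 := mod_cast h1.1
  have e2 : z.1 - c.1 < R := mod_cast h1.2
  have e3 : -R < z.2 - c.2 := mod_cast h2.1
  have e4 : z.2 - c.2 < R := mod_cast h2.2
  simp only [InBox]; omega

theorem InBox.norm_le {R : ℤ} {c z : ℤ × ℤ} (h : InBox R c z) : ‖latPt z - latPt c‖ ≤ 2 * R := by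
  refine (norm_le_abs_add_abs _).trans ?_
  obtain ⟨b1, b2, b3, b4⟩ := h
  have h1 : |(latPt z - latPt c).re| ≤ R := by
    simp only [latPt, Complex.sub_re]
    exact abs_le.2 ⟨by exact_mod_cast b1, by exact_mod_cast b2⟩
  have h2 : |(latPt z - latPt c).im| ≤ R := by
    simp only [latPt, Complex.sub_im]
    exact abs_le.2 ⟨by exact_mod_cast b3, by exact_mod_cast b4⟩
  linarith

theorem norm_sub_le_of_segment {x y z : ℂ} (hz : z ∈ segment ℝ x y) : ‖z - x‖ ≤ ‖y - x‖ := by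
  have := norm_sub_add_of_segment hz
  rw [norm_sub_rev x z, norm_sub_rev x y] at this
  linarith [norm_nonneg (z - y)]

theorem LatAdj.norm_le {z w : ℤ × ℤ} (h : LatAdj z w) : ‖latPt w - latPt z‖ ≤ 1 := by
  refine (norm_le_abs_add_abs _).trans ?_
  simp only [latPt, Complex.sub_re, Complex.sub_im]
  rcases h with ⟨h, h' | h'⟩ | ⟨h, h' | h'⟩ <;> rw [h, h'] <;> simp

/-- A polygonal arc which follows lattice edges outside of two boxes around its endpoints. -/
structure LatArc (R : ℤ) (T : Set ℂ) (c d : ℤ × ℤ) (n : ℕ) (y : ℕ → ℤ × ℤ) : Prop where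
  two_le : 2 ≤ n
  start : y 0 = c
  finish : y n = d
  near : ∀ i, 0 < i → i < n → ∃ x ∈ T, ‖latPt (y i) - x‖ ≤ 3
  inj : ∀ i j, 0 < i → i < n → 0 < j → j < n → y i = y j → i = j
  adj : ∀ i, 0 < i → i + 1 < n → LatAdj (y i) (y (i + 1))
  on_start : OnBox R c (y 1)
  out_start : ∀ i, 1 < i → i < n → ¬ InBox R c (y i)
  on_finish : OnBox R d (y (n - 1))
  out_finish : ∀ i, 0 < i → i + 1 < n → ¬ InBox R d (y i)

/-- A system of lattice arcs shadowing the images of the edges of a graph. -/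
structure ArcSystem (R : ℤ) (H : E2 → ℂ) (G : Set (E2 × E2)) (c : E2 → ℤ × ℤ) (n : E2 × E2 → ℕ)
    (y : E2 × E2 → ℕ → ℤ × ℤ) : Prop where
  large : 20 ≤ R
  arc : ∀ e ∈ G, LatArc R (H '' segment ℝ e.1 e.2) (c e.1) (c e.2) (n e) (y e)
  ne : ∀ e ∈ G, e.1 ≠ e.2
  center : ∀ v, ‖latPt (c v) - H v‖ ≤ 2
  far : ∀ e ∈ G, ∀ e' ∈ G, ∀ v, (v = e'.1 ∨ v = e'.2) → v ≠ e.1 → v ≠ e.2 →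
    ∀ x ∈ segment ℝ e.1 e.2, 10 * (R : ℝ) ≤ ‖H x - H v‖
  far_vertex : ∀ e ∈ G, ∀ e' ∈ G, ∀ v w, (v = e.1 ∨ v = e.2) → (w = e'.1 ∨ w = e'.2) → v ≠ w →
    10 * (R : ℝ) ≤ ‖H v - H w‖
  close : ∀ e ∈ G, ∀ e' ∈ G, e ≠ e' → ∀ x ∈ segment ℝ e.1 e.2, ∀ x' ∈ segment ℝ e'.1 e'.2,
    ‖H x - H x'‖ ≤ 10 → ∃ v, (v = e.1 ∨ v = e.2) ∧ (v = e'.1 ∨ v = e'.2) ∧ ‖H x - H v‖ ≤ R / 2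

namespace ArcSystem

variable {R : ℤ} {H : E2 → ℂ} {G : Set (E2 × E2)} {c : E2 → ℤ × ℤ} {n : E2 × E2 → ℕ}
  {y : E2 × E2 → ℕ → ℤ × ℤ}

theorem large' (h : ArcSystem R H G c n y) : (20 : ℝ) ≤ R := mod_cast h.large

theorem outside (h : ArcSystem R H G c n y) {e : E2 × E2} (he : e ∈ G) {v : E2}
    (hv : v = e.1 ∨ v = e.2) {i : ℕ} (h0 : 0 < i) (hi : i < n e) :
    ¬ InBox (R - 1) (c v) (y e i) := by
  have ha := h.arc e he
  have hon : ∀ c z : ℤ × ℤ, OnBox R c z → ¬ InBox (R - 1) c z := fun c z h => by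
    simp only [OnBox, InBox] at *; omega
  have hout : ∀ c z : ℤ × ℤ, ¬ InBox R c z → ¬ InBox (R - 1) c z := fun c z h => by
    simp only [InBox] at *; omega
  rcases hv with rfl | rfl
  · by_cases h1 : i = 1
    · rw [h1]; exact hon _ _ ha.on_start
    · exact hout _ _ (ha.out_start i (by omega) hi)
  · by_cases h1 : i + 1 = n e
    · rw [show i = n e - 1 by omega]; exact hon _ _ ha.on_finish
    · exact hout _ _ (ha.out_finish i h0 (by omega))

theorem mid_inj (h : ArcSystem R H G c n y) {e e' : E2 × E2} (he : e ∈ G) (he' : e' ∈ G) {i j : ℕ}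
    (h0 : 0 < i) (hi : i < n e) (h0' : 0 < j) (hj : j < n e') (heq : y e i = y e' j) :
    e = e' ∧ i = j := by
  by_cases hee : e = e'
  · subst hee
    exact ⟨rfl, (h.arc e he).inj i j h0 hi h0' hj heq⟩
  exfalso
  have hR := h.large'
  obtain ⟨_, ⟨x, hx, rfl⟩, hxn⟩ := (h.arc e he).near i h0 hi
  obtain ⟨_, ⟨x', hx', rfl⟩, hxn'⟩ := (h.arc e' he').near j h0' hj
  rw [← heq] at hxn'
  have hd : ‖H x - H x'‖ ≤ 10 := by
    calc ‖H x - H x'‖ = ‖(latPt (y e i) - H x') - (latPt (y e i) - H x)‖ := by congr 1; ring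
      _ ≤ _ := norm_sub_le _ _
      _ ≤ 10 := by linarith
  obtain ⟨v, hv, -, hxv⟩ := h.close e he e' he' hee x hx x' hx' hd
  refine h.outside he hv h0 hi (InBox.of_norm_lt ?_)
  calc ‖latPt (y e i) - latPt (c v)‖
      = ‖(latPt (y e i) - H x) + (H x - H v) - (latPt (c v) - H v)‖ := by congr 1; ring
    _ ≤ ‖latPt (y e i) - H x‖ + ‖H x - H v‖ + ‖latPt (c v) - H v‖ :=
      (norm_sub_le _ _).trans (by gcongr; exact norm_add_le _ _)
    _ ≤ 3 + R / 2 + 2 := by gcongr; exact h.center v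
    _ < R := by linarith

theorem vertex_inj (h : ArcSystem R H G c n y) {e e' : E2 × E2} (he : e ∈ G) (he' : e' ∈ G)
    {v w : E2} (hv : v = e.1 ∨ v = e.2) (hw : w = e'.1 ∨ w = e'.2) (heq : c v = c w) : v = w := by
  by_contra hne
  have h1 := h.far_vertex e he e' he' v w hv hw hne
  have hR := h.large'
  have h2 := h.center v
  have h3 := h.center w
  rw [heq] at h2
  have : ‖H v - H w‖ ≤ 4 := by
    calc ‖H v - H w‖ = ‖(latPt (c w) - H w) - (latPt (c w) - H v)‖ := by congr 1; ring
      _ ≤ _ := norm_sub_le _ _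
      _ ≤ 4 := by linarith
  linarith

theorem far_mid (h : ArcSystem R H G c n y) {e e' : E2 × E2} (he : e ∈ G) (he' : e' ∈ G)
    {v : E2} (hv : v = e'.1 ∨ v = e'.2) (h1 : v ≠ e.1) (h2 : v ≠ e.2) {i : ℕ}
    (h0 : 0 < i) (hi : i < n e) : 9 * (R : ℝ) ≤ ‖latPt (y e i) - latPt (c v)‖ := by
  obtain ⟨_, ⟨x, hx, rfl⟩, hxn⟩ := (h.arc e he).near i h0 hi
  have hf := h.far e he e' he' v hv h1 h2 x hx
  have hR := h.large'
  have hc := h.center v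
  have : ‖H x - H v‖ ≤ 3 + ‖latPt (y e i) - latPt (c v)‖ + 2 := by
    calc ‖H x - H v‖ = ‖(latPt (y e i) - latPt (c v)) - (latPt (y e i) - H x) +
          (latPt (c v) - H v)‖ := by congr 1; ring
      _ ≤ ‖latPt (y e i) - latPt (c v)‖ + ‖latPt (y e i) - H x‖ + ‖latPt (c v) - H v‖ :=
        (norm_add_le _ _).trans (by gcongr; exact norm_sub_le _ _)
      _ ≤ _ := by linarith
  linarith

theorem mid_ne_vertex (h : ArcSystem R H G c n y) {e e' : E2 × E2} (he : e ∈ G) (he' : e' ∈ G)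
    {v : E2} (hv : v = e'.1 ∨ v = e'.2) {i : ℕ} (h0 : 0 < i) (hi : i < n e) : y e i ≠ c v := by
  intro heq
  have hR := h.large
  by_cases hve : v = e.1 ∨ v = e.2
  · refine h.outside he hve h0 hi ?_
    rw [heq]; simp only [InBox]; omega
  · push Not at hve
    have := h.far_mid he he' hv hve.1 hve.2 h0 hi
    rw [heq, sub_self, norm_zero] at this
    linarith [h.large']

/-- Equal nodes come from equal points of the graph. -/
theorem node_eq (h : ArcSystem R H G c n y) {e e' : E2 × E2} (he : e ∈ G) (he' : e' ∈ G) {i j : ℕ}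
    (hi : i ≤ n e) (hj : j ≤ n e') (heq : y e i = y e' j) :
    AffineMap.lineMap e.1 e.2 ((i : ℝ) / n e) = AffineMap.lineMap e'.1 e'.2 ((j : ℝ) / n e') := by
  have hcase : ∀ e ∈ G, ∀ i ≤ n e, (0 < i ∧ i < n e) ∨
      ∃ v, (v = e.1 ∨ v = e.2) ∧ y e i = c v ∧ AffineMap.lineMap e.1 e.2 ((i : ℝ) / n e) = v := by
    intro e he i hi
    have ha := h.arc e he
    rcases Nat.eq_zero_or_pos i with rfl | h0
    · exact Or.inr ⟨e.1, Or.inl rfl, ha.start, by simp⟩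
    rcases hi.eq_or_lt with rfl | hi
    · refine Or.inr ⟨e.2, Or.inr rfl, ha.finish, ?_⟩
      rw [div_self (by positivity), AffineMap.lineMap_apply_one]
    · exact Or.inl ⟨h0, hi⟩
  rcases hcase e he i hi with ⟨h0, hi⟩ | ⟨v, hv, hyv, hv'⟩ <;>
    rcases hcase e' he' j hj with ⟨h0', hj⟩ | ⟨w, hw, hyw, hw'⟩
  · obtain ⟨rfl, rfl⟩ := h.mid_inj he he' h0 hi h0' hj heq
    rfl
  · exact absurd (heq.trans hyw) (h.mid_ne_vertex he he' hw h0 hi)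
  · exact absurd (heq.symm.trans hyv) (h.mid_ne_vertex he' he hv h0' hj)
  · rw [hv', hw']
    exact h.vertex_inj he he' hv hw (by rw [← hyv, heq, hyw])

theorem node_succ_ne (h : ArcSystem R H G c n y) {e : E2 × E2} (he : e ∈ G) {i : ℕ}
    (hi : i < n e) : y e i ≠ y e (i + 1) := by
  intro heq
  have := h.node_eq he he hi.le hi heq
  have hn : (0 : ℝ) < n e := by have := (h.arc e he).two_le; positivity
  rw [AffineMap.lineMap_eq_lineMap_iff] at this
  rcases this with h1 | h1
  · exact h.ne e he h1
  grind

/-- The `i`-th segment of an arc. -/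
def seg (y : E2 × E2 → ℕ → ℤ × ℤ) (e : E2 × E2) (i : ℕ) : Set ℂ :=
  segment ℝ (latPt (y e i)) (latPt (y e (i + 1)))

theorem seg_cases (h : ArcSystem R H G c n y) {e : E2 × E2} (he : e ∈ G) {i : ℕ} (hi : i < n e) :
    (0 < i ∧ i + 1 < n e) ∨ ∃ v k, 0 < k ∧ k < n e ∧ OnBox R (c v) (y e k) ∧
      seg y e i = segment ℝ (latPt (c v)) (latPt (y e k)) ∧
      (({y e i, y e (i + 1)} : Set (ℤ × ℤ)) = {c v, y e k}) ∧
      ((v = e.1 ∧ k = 1 ∧ i = 0) ∨ (v = e.2 ∧ k = n e - 1 ∧ i = n e - 1)) := by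
  have ha := h.arc e he
  have hn := ha.two_le
  rcases Nat.eq_zero_or_pos i with rfl | h0
  · exact Or.inr ⟨e.1, 1, one_pos, by omega, ha.on_start, by rw [seg, ha.start], by rw [ha.start],
      Or.inl ⟨rfl, rfl, rfl⟩⟩
  by_cases h1 : i + 1 < n e
  · exact Or.inl ⟨h0, h1⟩
  · have hi1 : i + 1 = n e := by omega
    have hi2 : n e - 1 = i := by omega
    refine Or.inr ⟨e.2, i, h0, hi, ?_, ?_, ?_, Or.inr ⟨rfl, hi2.symm, hi2.symm⟩⟩
    · rw [← hi2]; exact ha.on_finish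
    · rw [seg, hi1, ha.finish, segment_symm]
    · rw [hi1, ha.finish, pair_comm]

theorem pair_image {a b a' b' : ℤ × ℤ} (h : ({a, b} : Set (ℤ × ℤ)) = {a', b'}) {x : ℂ}
    (hx : x = latPt a' ∨ x = latPt b') : x = latPt a ∨ x = latPt b := by
  have h1 : a' ∈ ({a, b} : Set (ℤ × ℤ)) := by rw [h]; simp
  grind

theorem meet_radial_mid (h : ArcSystem R H G c n y) {e e' : E2 × E2} (he : e ∈ G) (he' : e' ∈ G)
    {v : E2} {k j : ℕ} (hv : v = e.1 ∨ v = e.2) (hon : OnBox R (c v) (y e k))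
    (h0 : 0 < j) (hj : j + 1 < n e') {x : ℂ}
    (hx : x ∈ segment ℝ (latPt (c v)) (latPt (y e k))) (hx' : x ∈ seg y e' j) :
    x = latPt (y e k) ∧ (x = latPt (y e' j) ∨ x = latPt (y e' (j + 1))) := by
  have hR := h.large
  have hadj := (h.arc e' he').adj j h0 hj
  by_cases hve : v = e'.1 ∨ v = e'.2
  · obtain ⟨h1, h2⟩ := radial_unit_meet (by omega) hon hadj
      (h.outside he' hve h0 (by omega)) (h.outside he' hve (by omega) hj) hx hx'
    grind
  · exfalso
    push Not at hve
    have h1 := h.far_mid he' he hv hve.1 hve.2 h0 (by omega)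
    have h2 := (norm_sub_le_of_segment hx).trans hon.1.norm_le
    have h3 := (norm_sub_le_of_segment hx').trans hadj.norm_le
    have : ‖latPt (y e' j) - latPt (c v)‖ ≤ 2 * R + 1 := by
      calc _ = ‖(x - latPt (c v)) - (x - latPt (y e' j))‖ := by congr 1; ring
        _ ≤ _ := norm_sub_le _ _
        _ ≤ _ := by linarith
    linarith [h.large']

/-- Different segments of an arc system meet only in common nodes. -/
theorem meet (h : ArcSystem R H G c n y) {e e' : E2 × E2} (he : e ∈ G) (he' : e' ∈ G) {i j : ℕ}
    (hi : i < n e) (hj : j < n e') {x : ℂ} (hx : x ∈ seg y e i) (hx' : x ∈ seg y e' j) :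
    (e = e' ∧ i = j) ∨ ((x = latPt (y e i) ∨ x = latPt (y e (i + 1))) ∧
      (x = latPt (y e' j) ∨ x = latPt (y e' (j + 1)))) := by
  have hR := h.large
  rcases h.seg_cases he hi with ⟨h0, h1⟩ | ⟨v, k, hk0, hk, hon, hseg, hset, hpos⟩ <;>
    rcases h.seg_cases he' hj with ⟨h0', h1'⟩ | ⟨v', k', hk0', hk', hon', hseg', hset', hpos'⟩
  · rcases unit_segments_meet ((h.arc e he).adj i h0 h1) ((h.arc e' he').adj j h0' h1') hx hx' with
      hm | ⟨hm, -⟩ | ⟨hm, hm'⟩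
    · exact Or.inr hm
    · exact Or.inl (h.mid_inj he he' h0 (by omega) h0' (by omega) hm)
    · obtain ⟨-, e1⟩ := h.mid_inj he he' h0 (by omega) (by omega) h1' hm
      obtain ⟨-, e2⟩ := h.mid_inj he he' (by omega) h1 h0' (by omega) hm'
      omega
  · right
    rw [hseg'] at hx'
    have hv' : v' = e'.1 ∨ v' = e'.2 := hpos'.imp And.left And.left
    obtain ⟨e1, e2⟩ := h.meet_radial_mid he' he hv' hon' h0 h1 hx' hx
    grind
  · right
    rw [hseg] at hx
    have hv : v = e.1 ∨ v = e.2 := hpos.imp And.left And.left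
    obtain ⟨e1, e2⟩ := h.meet_radial_mid he he' hv hon h0' h1' hx hx'
    grind
  · rw [hseg] at hx
    rw [hseg'] at hx'
    have hv : v = e.1 ∨ v = e.2 := hpos.imp And.left And.left
    have hv' : v' = e'.1 ∨ v' = e'.2 := hpos'.imp And.left And.left
    by_cases hvv : v = v'
    · subst hvv
      by_cases ha : y e k = y e' k'
      · left
        obtain ⟨rfl, rfl⟩ := h.mid_inj he he' hk0 hk hk0' hk' ha
        have hne := h.ne e he
        grind
      · right
        have hxc := radial_segments_meet (by omega) hon hon' ha hx hx'
        exact ⟨pair_image hset (Or.inl hxc), pair_image hset' (Or.inl hxc)⟩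
    · exfalso
      have h1 := h.far_vertex e he e' he' v v' hv hv' hvv
      have h2 := (norm_sub_le_of_segment hx).trans hon.1.norm_le
      have h3 := (norm_sub_le_of_segment hx').trans hon'.1.norm_le
      have h4 := h.center v
      have h5 := h.center v'
      have : ‖H v - H v'‖ ≤ 4 * R + 4 := by
        calc ‖H v - H v'‖ = ‖(latPt (c v') - H v') - (latPt (c v) - H v) +
              ((x - latPt (c v')) - (x - latPt (c v)))‖ := by congr 1; ring
          _ ≤ (‖latPt (c v') - H v'‖ + ‖latPt (c v) - H v‖) +
              (‖x - latPt (c v')‖ + ‖x - latPt (c v)‖) :=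
            (norm_add_le _ _).trans (add_le_add (norm_sub_le _ _) (norm_sub_le _ _))
          _ ≤ _ := by linarith
      linarith [h.large']

/-- The point at parameter `s` of the `i`-th segment of an arc. -/
def pt (y : E2 × E2 → ℕ → ℤ × ℤ) (e : E2 × E2) (i : ℕ) (s : ℝ) : ℂ :=
  AffineMap.lineMap (latPt (y e i)) (latPt (y e (i + 1))) s

theorem pt_mem_seg {e : E2 × E2} {i : ℕ} {s : ℝ} (hs : s ∈ Icc (0 : ℝ) 1) :
    pt y e i s ∈ seg y e i := by
  rw [seg, segment_eq_image_lineMap]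
  exact ⟨s, hs, rfl⟩

theorem pt_eq_node {e : E2 × E2} {i k : ℕ} {s : ℝ} (hs : s ∈ Icc (0 : ℝ) 1)
    (h : (i : ℝ) + s = k) : pt y e i s = latPt (y e k) := by
  rcases hs.1.eq_or_lt with h0 | h0
  · have : i = k := by rw [← h0, add_zero] at h; exact_mod_cast h
    rw [← this, ← h0, pt, AffineMap.lineMap_apply_zero]
  · have h1 : i < k := by have : (i : ℝ) < k := by linarith
                          exact_mod_cast this
    have h2 : k < i + 2 := by
      have : (k : ℝ) < i + 2 := by linarith [hs.2]
      exact_mod_cast this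
    have h3 : k = i + 1 := by omega
    have h4 : s = 1 := by simp_all
    rw [h3, h4, pt, AffineMap.lineMap_apply_one]

theorem pt_congr {e : E2 × E2} {i j : ℕ} {s t : ℝ} (hs : s ∈ Icc (0 : ℝ) 1)
    (ht : t ∈ Icc (0 : ℝ) 1) (h : (i : ℝ) + s = j + t) : pt y e i s = pt y e j t := by
  rcases lt_trichotomy i j with hij | hij | hij
  · have h1 : (i : ℝ) + 1 ≤ j := mod_cast hij
    have h2 : t = 0 := by linarith [hs.2, ht.1]
    rw [pt_eq_node hs (k := j) (by linarith), pt_eq_node ht (k := j) (by linarith)]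
  · grind
  · have h1 : (j : ℝ) + 1 ≤ i := mod_cast hij
    have h2 : s = 0 := by linarith [hs.1, ht.2]
    rw [pt_eq_node hs (k := i) (by linarith), pt_eq_node ht (k := i) (by linarith)]

theorem n_pos (h : ArcSystem R H G c n y) {e : E2 × E2} (he : e ∈ G) : (0 : ℝ) < n e := by
  have := (h.arc e he).two_le; positivity

theorem pt_ne (h : ArcSystem R H G c n y) {e : E2 × E2} (he : e ∈ G) {i : ℕ} (hi : i < n e) :
    latPt (y e i) ≠ latPt (y e (i + 1)) :=
  fun h' => h.node_succ_ne he hi (latPt_injective h')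

theorem pt_node (h : ArcSystem R H G c n y) {e : E2 × E2} (he : e ∈ G) {i : ℕ} {s : ℝ}
    (hi : i < n e) (hp : pt y e i s = latPt (y e i) ∨ pt y e i s = latPt (y e (i + 1))) :
    ∃ k ≤ n e, (i : ℝ) + s = k ∧ pt y e i s = latPt (y e k) := by
  rcases hp with hp | hp
  · refine ⟨i, hi.le, ?_, hp⟩
    rw [pt] at hp
    conv_rhs at hp => rw [← AffineMap.lineMap_apply_zero (k := ℝ) (latPt (y e i)) (latPt (y e (i + 1)))]
    rcases AffineMap.lineMap_eq_lineMap_iff.1 hp with h1 | h1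
    · exact absurd h1 (h.pt_ne he hi)
    · rw [h1, add_zero]
  · refine ⟨i + 1, hi, ?_, hp⟩
    rw [pt] at hp
    conv_rhs at hp => rw [← AffineMap.lineMap_apply_one (k := ℝ) (latPt (y e i)) (latPt (y e (i + 1)))]
    rcases AffineMap.lineMap_eq_lineMap_iff.1 hp with h1 | h1
    · exact absurd h1 (h.pt_ne he hi)
    · rw [h1]; push_cast; rfl

theorem pt_inj (h : ArcSystem R H G c n y) {e e' : E2 × E2} (he : e ∈ G) (he' : e' ∈ G) {i j : ℕ}
    (hi : i < n e) (hj : j < n e') {s t : ℝ} (hs : s ∈ Icc (0 : ℝ) 1) (ht : t ∈ Icc (0 : ℝ) 1)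
    (heq : pt y e i s = pt y e' j t) : AffineMap.lineMap e.1 e.2 (((i : ℝ) + s) / n e) =
      AffineMap.lineMap e'.1 e'.2 (((j : ℝ) + t) / n e') := by
  have hx := pt_mem_seg (y := y) (e := e) (i := i) hs
  have hx' := pt_mem_seg (y := y) (e := e') (i := j) ht
  rw [← heq] at hx'
  rcases h.meet he he' hi hj hx hx' with ⟨rfl, rfl⟩ | ⟨h1, h2⟩
  · rcases AffineMap.lineMap_eq_lineMap_iff.1 heq with h1 | h1
    · exact absurd h1 (h.pt_ne he hi)
    · rw [h1]
  · rw [heq] at h2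
    obtain ⟨k, hk, e1, e2⟩ := h.pt_node he hi h1
    obtain ⟨k', hk', e1', e2'⟩ := h.pt_node he' hj h2
    rw [e1, e1']
    refine h.node_eq he he' hk hk' (latPt_injective ?_)
    rw [← e2, ← e2', heq]

theorem pt_well (h : ArcSystem R H G c n y)
    (inter : ∀ e ∈ G, ∀ e' ∈ G, e ≠ e' → ∀ x ∈ segment ℝ e.1 e.2, x ∈ segment ℝ e'.1 e'.2 →
      (x = e.1 ∨ x = e.2) ∧ (x = e'.1 ∨ x = e'.2))
    {e e' : E2 × E2} (he : e ∈ G) (he' : e' ∈ G) {i j : ℕ}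
    (hi : i < n e) (hj : j < n e') {s t : ℝ} (hs : s ∈ Icc (0 : ℝ) 1) (ht : t ∈ Icc (0 : ℝ) 1)
    (heq : (AffineMap.lineMap e.1 e.2 (((i : ℝ) + s) / n e) : E2) =
      AffineMap.lineMap e'.1 e'.2 (((j : ℝ) + t) / n e')) : pt y e i s = pt y e' j t := by
  have hmem : ∀ e ∈ G, ∀ i < n e, ∀ s ∈ Icc (0 : ℝ) 1,
      (AffineMap.lineMap e.1 e.2 (((i : ℝ) + s) / n e) : E2) ∈ segment ℝ e.1 e.2 := by
    intro e he i hi s hs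
    rw [segment_eq_image_lineMap]
    have hn := h.n_pos he
    have hi' : (i : ℝ) + 1 ≤ n e := mod_cast hi
    exact ⟨_, ⟨by have := hs.1; positivity, by rw [div_le_one hn]; linarith [hs.2]⟩, rfl⟩
  by_cases hee : e = e'
  · subst hee
    rcases AffineMap.lineMap_eq_lineMap_iff.1 heq with h1 | h1
    · exact absurd h1 (h.ne e he)
    · have hn := h.n_pos he
      rw [div_left_inj' hn.ne'] at h1
      exact pt_congr hs ht h1
  · have hv : ∀ e ∈ G, ∀ i < n e, ∀ s ∈ Icc (0 : ℝ) 1, ∀ v,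
        (AffineMap.lineMap e.1 e.2 (((i : ℝ) + s) / n e) : E2) = v → (v = e.1 ∨ v = e.2) →
        pt y e i s = latPt (c v) := by
      rintro e he i hi s hs v hv (hv1 | hv1)
      · rw [hv1] at hv
        conv_rhs at hv => rw [← AffineMap.lineMap_apply_zero (k := ℝ) e.1 e.2]
        rcases AffineMap.lineMap_eq_lineMap_iff.1 hv with h1 | h1
        · exact absurd h1 (h.ne e he)
        · rw [div_eq_zero_iff, or_iff_left (h.n_pos he).ne'] at h1
          rw [pt_eq_node hs (k := 0) (by push_cast; exact h1), (h.arc e he).start, hv1]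
      · rw [hv1] at hv
        conv_rhs at hv => rw [← AffineMap.lineMap_apply_one (k := ℝ) e.1 e.2]
        rcases AffineMap.lineMap_eq_lineMap_iff.1 hv with h1 | h1
        · exact absurd h1 (h.ne e he)
        · rw [div_eq_one_iff_eq (h.n_pos he).ne'] at h1
          rw [pt_eq_node hs (k := n e) h1, (h.arc e he).finish, hv1]
    obtain ⟨h1, h2⟩ := inter e he e' he' hee _ (hmem e he i hi s hs)
      (by rw [heq]; exact hmem e' he' j hj t ht)
    rw [hv e he i hi s hs _ rfl h1, hv e' he' j hj t ht _ heq.symm h2]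

theorem exists_param (h : ArcSystem R H G c n y) {e : E2 × E2} (he : e ∈ G) {x : E2}
    (hx : x ∈ segment ℝ e.1 e.2) : ∃ i < n e, ∃ s ∈ Icc (0 : ℝ) 1,
      x = AffineMap.lineMap e.1 e.2 (((i : ℝ) + s) / n e) := by
  have hn := h.n_pos he
  rw [segment_eq_image_lineMap] at hx
  obtain ⟨t, ht, rfl⟩ := hx
  rcases ht.2.eq_or_lt with h1 | h1
  · have : 0 < n e := mod_cast hn
    refine ⟨n e - 1, by omega, 1, by simp, ?_⟩
    rw [h1, Nat.cast_sub (by omega)]; grind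
  · have h0 : 0 ≤ t * n e := mul_nonneg ht.1 hn.le
    refine ⟨⌊t * n e⌋₊, ?_, t * n e - ⌊t * n e⌋₊, ⟨by linarith [Nat.floor_le h0],
      by linarith [Nat.lt_floor_add_one (t * n e)]⟩, ?_⟩
    · rw [Nat.floor_lt h0]; nlinarith
    grind

theorem exists_draw (h : ArcSystem R H G c n y)
    (inter : ∀ e ∈ G, ∀ e' ∈ G, e ≠ e' → ∀ x ∈ segment ℝ e.1 e.2, x ∈ segment ℝ e'.1 e'.2 →
      (x = e.1 ∨ x = e.2) ∧ (x = e'.1 ∨ x = e'.2)) :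
    ∃ D : E2 → ℂ, (∀ e ∈ G, ∀ i < n e, ∀ s ∈ Icc (0 : ℝ) 1,
      D (AffineMap.lineMap e.1 e.2 (((i : ℝ) + s) / n e)) = pt y e i s) ∧
      ∀ e ∈ G, ∀ e' ∈ G, ∀ x ∈ segment ℝ e.1 e.2, ∀ x' ∈ segment ℝ e'.1 e'.2,
        D x = D x' → x = x' := by
  classical
  let P : E2 → ℂ → Prop := fun x z => ∃ e ∈ G, ∃ i < n e, ∃ s ∈ Icc (0 : ℝ) 1,
    x = AffineMap.lineMap e.1 e.2 (((i : ℝ) + s) / n e) ∧ z = pt y e i s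
  have hD : ∀ e ∈ G, ∀ i < n e, ∀ s ∈ Icc (0 : ℝ) 1,
      (fun x => if hx : ∃ z, P x z then hx.choose else 0)
        (AffineMap.lineMap e.1 e.2 (((i : ℝ) + s) / n e)) = pt y e i s := by
    intro e he i hi s hs
    have hx : ∃ z, P (AffineMap.lineMap e.1 e.2 (((i : ℝ) + s) / n e)) z :=
      ⟨_, e, he, i, hi, s, hs, rfl, rfl⟩
    simp only [dif_pos hx]
    obtain ⟨e', he', j, hj, t, ht, h1, h2⟩ := hx.choose_spec
    rw [h2]
    exact (h.pt_well inter he he' hi hj hs ht h1).symm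
  refine ⟨fun x => if hx : ∃ z, P x z then hx.choose else 0, hD, ?_⟩
  intro e he e' he' x hx x' hx' heq
  obtain ⟨i, hi, s, hs, rfl⟩ := h.exists_param he hx
  obtain ⟨j, hj, t, ht, rfl⟩ := h.exists_param he' hx'
  rw [hD e he i hi s hs, hD e' he' j hj t ht] at heq
  exact h.pt_inj he he' hi hj hs ht heq

end ArcSystem

/-- A plane drawing `D` of a straight-line graph, close to `H`, with polygonal edges. -/
structure Drawing (Adj : E2 → E2 → Prop) (H : E2 → ℂ) (R : ℝ) (N : ℕ) (D : E2 → ℂ)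
    (len : E2 → E2 → ℕ) : Prop where
  inj : ∀ a b a' b' x x', Adj a b → Adj a' b' → x ∈ segment ℝ a b → x' ∈ segment ℝ a' b' →
    D x = D x' → x = x'
  pos : ∀ a b, Adj a b → 0 < len a b
  le : ∀ a b, Adj a b → len a b ≤ N
  lin : ∀ a b, Adj a b → ∀ i < len a b, ∀ s ∈ Icc (0 : ℝ) 1,
    D (AffineMap.lineMap a b (((i : ℝ) + s) / len a b)) =
      AffineMap.lineMap (D (AffineMap.lineMap a b ((i : ℝ) / len a b)))
        (D (AffineMap.lineMap a b (((i : ℝ) + 1) / len a b))) s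
  near : ∀ a b, Adj a b → ∀ i ≤ len a b, ∃ x ∈ segment ℝ a b,
    ‖D (AffineMap.lineMap a b ((i : ℝ) / len a b)) - H x‖ ≤ 3
  vertex : ∀ a b, Adj a b → ‖D a - H a‖ ≤ 2
  step : ∀ a b, Adj a b → ∀ i < len a b,
    ‖D (AffineMap.lineMap a b ((i : ℝ) / len a b)) -
      D (AffineMap.lineMap a b (((i : ℝ) + 1) / len a b))‖ ≤ 2 * R

theorem ArcSystem.drawing {R : ℤ} {H : E2 → ℂ} {G : Set (E2 × E2)} {c : E2 → ℤ × ℤ}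
    {n : E2 × E2 → ℕ} {y : E2 × E2 → ℕ → ℤ × ℤ} (h : ArcSystem R H G c n y)
    (inter : ∀ e ∈ G, ∀ e' ∈ G, e ≠ e' → ∀ x ∈ segment ℝ e.1 e.2, x ∈ segment ℝ e'.1 e'.2 →
      (x = e.1 ∨ x = e.2) ∧ (x = e'.1 ∨ x = e'.2)) {N : ℕ} (hN : ∀ e ∈ G, n e ≤ N) :
    ∃ D len, Drawing (fun a b => (a, b) ∈ G ∨ (b, a) ∈ G) H R N D len := by
  classical
  obtain ⟨D, hD, hinj⟩ := h.exists_draw inter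
  have hR := h.large'
  have hnode : ∀ e ∈ G, ∀ i ≤ n e,
      D (AffineMap.lineMap e.1 e.2 ((i : ℝ) / n e)) = latPt (y e i) := by
    intro e he i hi
    rcases hi.eq_or_lt with rfl | hi
    · have h0 : 0 < n e := by have := (h.arc e he).two_le; omega
      have := hD e he (n e - 1) (by omega) 1 (by simp)
      rw [show ((n e - 1 : ℕ) : ℝ) + 1 = n e by rw [Nat.cast_sub (by omega)]; simp] at this
      rw [this, ArcSystem.pt_eq_node (k := n e) (by simp)]
      rw [Nat.cast_sub (by omega)]; simp
    · have := hD e he i hi 0 (by simp)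
      rw [add_zero] at this
      rw [this, ArcSystem.pt_eq_node (k := i) (by simp) (by simp)]
  have hlin : ∀ e ∈ G, ∀ i < n e, ∀ s ∈ Icc (0 : ℝ) 1,
      D (AffineMap.lineMap e.1 e.2 (((i : ℝ) + s) / n e)) =
      AffineMap.lineMap (D (AffineMap.lineMap e.1 e.2 ((i : ℝ) / n e)))
        (D (AffineMap.lineMap e.1 e.2 (((i : ℝ) + 1) / n e))) s := by
    intro e he i hi s hs
    have h1 := hnode e he (i + 1) hi
    push_cast at h1
    rw [hD e he i hi s hs, hnode e he i hi.le, h1, ArcSystem.pt]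
  have hnear : ∀ e ∈ G, ∀ i ≤ n e, ∃ x ∈ segment ℝ e.1 e.2,
      ‖D (AffineMap.lineMap e.1 e.2 ((i : ℝ) / n e)) - H x‖ ≤ 3 := by
    intro e he i hi
    rw [hnode e he i hi]
    rcases Nat.eq_zero_or_pos i with rfl | h0
    · refine ⟨e.1, left_mem_segment _ _ _, ?_⟩
      rw [(h.arc e he).start]; linarith [h.center e.1]
    rcases hi.eq_or_lt with rfl | hi
    · refine ⟨e.2, right_mem_segment _ _ _, ?_⟩
      rw [(h.arc e he).finish]; linarith [h.center e.2]
    · obtain ⟨_, ⟨x, hx, rfl⟩, hx2⟩ := (h.arc e he).near i h0 hi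
      exact ⟨x, hx, hx2⟩
  have hstep : ∀ e ∈ G, ∀ i < n e,
      ‖D (AffineMap.lineMap e.1 e.2 ((i : ℝ) / n e)) -
      D (AffineMap.lineMap e.1 e.2 (((i : ℝ) + 1) / n e))‖ ≤ 2 * R := by
    intro e he i hi
    have h1 := hnode e he (i + 1) hi
    push_cast at h1
    rw [hnode e he i hi.le, h1]
    have ha := h.arc e he
    have hin : ∀ c z : ℤ × ℤ, OnBox R c z → InBox R c z := fun c z h => by
      simp only [OnBox, InBox] at *; omega
    rcases Nat.eq_zero_or_pos i with rfl | h0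
    · rw [ha.start, norm_sub_rev]; exact (hin _ _ ha.on_start).norm_le
    by_cases h2 : i + 1 = n e
    · rw [h2, ha.finish]
      have := ha.on_finish
      rw [← h2, Nat.add_sub_cancel] at this
      exact (hin _ _ this).norm_le
    · have := (ha.adj i h0 (by omega)).norm_le
      rw [norm_sub_rev] at this
      linarith
  have hrev : ∀ e : E2 × E2, e ∈ G → ∀ i ≤ n e, ∀ t : ℝ,
      (AffineMap.lineMap e.2 e.1 (((i : ℝ) + t) / n e) : E2) =
        AffineMap.lineMap e.1 e.2 ((((n e - i : ℕ) : ℝ) - t) / n e) := by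
    intro e he i hi t
    rw [← AffineMap.lineMap_apply_one_sub, Nat.cast_sub hi]
    congr 1
    have := (h.n_pos he).ne'
    field_simp; ring
  let len : E2 → E2 → ℕ := fun a b => if (a, b) ∈ G then n (a, b) else n (b, a)
  have hlen : ∀ a b, ((a, b) ∈ G ∨ (b, a) ∈ G) →
      ((a, b) ∈ G ∧ len a b = n (a, b)) ∨ ((b, a) ∈ G ∧ len a b = n (b, a)) := by
    intro a b hab
    by_cases h1 : (a, b) ∈ G
    · exact Or.inl ⟨h1, if_pos h1⟩
    · exact Or.inr ⟨hab.resolve_left h1, if_neg h1⟩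
  refine ⟨D, len, ?_, ?_, ?_, ?_, ?_, ?_, ?_⟩
  · have hseg : ∀ a b x, ((a, b) ∈ G ∨ (b, a) ∈ G) → x ∈ segment ℝ a b →
        ∃ e ∈ G, x ∈ segment ℝ e.1 e.2 := by
      rintro a b x (h1 | h1) hx
      · exact ⟨_, h1, hx⟩
      · exact ⟨_, h1, by rw [segment_symm]; exact hx⟩
    intro a b a' b' x x' hab hab' hx hx' heq
    obtain ⟨e, he, hx⟩ := hseg a b x hab hx
    obtain ⟨e', he', hx'⟩ := hseg a' b' x' hab' hx'
    exact hinj e he e' he' x hx x' hx' heq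
  · intro a b hab
    rcases hlen a b hab with ⟨h1, h2⟩ | ⟨h1, h2⟩ <;>
    · rw [h2]; have := (h.arc _ h1).two_le; omega
  · intro a b hab
    rcases hlen a b hab with ⟨h1, h2⟩ | ⟨h1, h2⟩ <;>
    · rw [h2]; exact hN _ h1
  · intro a b hab i hi s hs
    rcases hlen a b hab with ⟨h1, h2⟩ | ⟨h1, h2⟩ <;> rw [h2] at hi ⊢
    · exact hlin _ h1 i hi s hs
    · have e0 := hrev _ h1 i hi.le 0
      have e1 := hrev _ h1 i hi.le 1
      have es := hrev _ h1 i hi.le s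
      simp only [add_zero, sub_zero] at e0 e1 es
      rw [es, e0, e1]
      have hc : ((n (b, a) - i : ℕ) : ℝ) = ((n (b, a) - i - 1 : ℕ) : ℝ) + 1 := by
        have : n (b, a) - i = n (b, a) - i - 1 + 1 := by omega
        conv_lhs => rw [this]
        push_cast; rfl
      have := hlin _ h1 (n (b, a) - i - 1) (by omega) (1 - s)
        ⟨by linarith [hs.2], by linarith [hs.1]⟩
      rw [hc, add_sub_cancel_right, add_sub_assoc]
      simp only at this
      rw [this, AffineMap.lineMap_apply_one_sub]
  · intro a b hab i hi
    rcases hlen a b hab with ⟨h1, h2⟩ | ⟨h1, h2⟩ <;> rw [h2] at hi ⊢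
    · exact hnear _ h1 i hi
    · have e0 := hrev _ h1 i hi 0
      simp only [add_zero, sub_zero] at e0
      rw [e0, segment_symm]
      exact hnear _ h1 _ (Nat.sub_le _ _)
  · intro a b hab
    rcases hlen a b hab with ⟨h1, h2⟩ | ⟨h1, h2⟩
    · have := hnode _ h1 0 (Nat.zero_le _)
      rw [Nat.cast_zero, zero_div, AffineMap.lineMap_apply_zero, (h.arc _ h1).start] at this
      rw [this]; exact h.center _
    · have := hnode _ h1 _ le_rfl
      rw [div_self (h.n_pos h1).ne', AffineMap.lineMap_apply_one, (h.arc _ h1).finish] at this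
      rw [this]; exact h.center _
  · intro a b hab i hi
    rcases hlen a b hab with ⟨h1, h2⟩ | ⟨h1, h2⟩ <;> rw [h2] at hi ⊢
    · exact hstep _ h1 i hi
    · have e0 := hrev _ h1 i hi.le 0
      have e1 := hrev _ h1 i hi.le 1
      simp only [add_zero, sub_zero] at e0 e1
      rw [e0, e1]
      have hc : ((n (b, a) - i : ℕ) : ℝ) = ((n (b, a) - i - 1 : ℕ) : ℝ) + 1 := by
        have : n (b, a) - i = n (b, a) - i - 1 + 1 := by omega
        conv_lhs => rw [this]
        push_cast; rfl
      rw [hc, add_sub_cancel_right, norm_sub_rev]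
      exact hstep _ h1 _ (by omega)

/-- Existence of the arc from a chain of points. -/
theorem exists_latArc {R : ℤ} (hR : 20 ≤ R) {H : E2 → ℂ} {a b : E2} {M : ℕ} (hM : 0 < M)
    (step : ∀ i < M, ‖H (AffineMap.lineMap a b ((i : ℝ) / M)) -
      H (AffineMap.lineMap a b (((i : ℝ) + 1) / M))‖ ≤ 1) (sep : 10 * (R : ℝ) ≤ ‖H a - H b‖) :
    ∃ n y, n ≤ 2 * M + 2 ∧ LatArc R (H '' segment ℝ a b) (latFloor (H a)) (latFloor (H b)) n y := by
  have hM' : (M : ℝ) ≠ 0 := by positivity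
  have hR' : (20 : ℝ) ≤ R := mod_cast hR
  let X : ℕ → ℂ := fun i => H (AffineMap.lineMap a b ((i : ℝ) / M))
  have h0 : X 0 = H a := by simp [X]
  have h1 : X M = H b := by simp [X, hM']
  obtain ⟨k, y, hk, hnear, hinj, hadj, hs, hso, hf, hfo⟩ := exists_lattice_path (R := R) X M
    (fun i hi => by simpa [X] using step i hi) (by omega) (by
      intro z hz hz'
      have e1 := hz.norm_le
      have e2 := hz'.norm_le
      have e3 := latFloor_near (X 0)
      have e4 := latFloor_near (X M)
      rw [h0] at e1 e3
      rw [h1] at e2 e4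
      have : ‖H a - H b‖ ≤ 2 + 2 * R + 2 * R + 2 := by
        calc ‖H a - H b‖ = ‖(latPt z - latPt (latFloor (H a))) + (latPt (latFloor (H a)) - H a) -
            ((latPt z - latPt (latFloor (H b))) + (latPt (latFloor (H b)) - H b))‖ := by
              rw [← norm_neg]; congr 1; ring
          _ ≤ (2 * R + 2) + (2 * R + 2) := (norm_sub_le _ _).trans (add_le_add
              ((norm_add_le _ _).trans (add_le_add e1 e3)) ((norm_add_le _ _).trans (add_le_add e2 e4)))
          _ = _ := by ring
      linarith)
  rw [h0] at hs hso
  rw [h1] at hf hfo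
  refine ⟨k + 2, fun i => if i = 0 then latFloor (H a) else if i = k + 2 then latFloor (H b)
    else y (i - 1), by omega, ?_⟩
  have hy : ∀ i, 0 < i → i < k + 2 → (if i = 0 then latFloor (H a) else if i = k + 2
      then latFloor (H b) else y (i - 1)) = y (i - 1) := fun i h h' => by
    rw [if_neg (by omega), if_neg (by omega)]
  constructor
  · omega
  · simp
  · simp
  · intro i hi hi'
    obtain ⟨j, hj, hj'⟩ := hnear (i - 1) (by omega)
    refine ⟨X j, ⟨_, ?_, rfl⟩, by simp only [hy i hi hi']; exact hj'⟩
    rw [segment_eq_image_lineMap]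
    exact ⟨_, ⟨by positivity, by rw [div_le_one (by positivity)]; exact_mod_cast hj⟩, rfl⟩
  · intro i j hi hi' hj hj' h
    simp only [hy i hi hi', hy j hj hj'] at h
    have := hinj (i - 1) (by omega) (j - 1) (by omega) h
    omega
  · intro i hi hi'
    simp only [hy i hi (by omega), hy (i + 1) (by omega) hi']
    grind
  · grind
  · intro i hi hi'
    simp only [hy i (by omega) hi']
    exact hso (i - 1) (by omega) (by omega)
  · grind
  · intro i hi hi'
    simp only [hy i hi (by omega)]
    exact hfo (i - 1) (by omega)

theorem exists_drawing {Adj : E2 → E2 → Prop} (hsymm : ∀ a b, Adj a b → Adj b a)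
    (hirr : ∀ a, ¬ Adj a a)
    (inter : ∀ a b a' b', Adj a b → Adj a' b' → ¬ (a = a' ∧ b = b') → ¬ (a = b' ∧ b = a') →
      ∀ x ∈ segment ℝ a b, x ∈ segment ℝ a' b' → (x = a ∨ x = b) ∧ (x = a' ∨ x = b'))
    {H : E2 → ℂ} {R : ℤ} (hR : 20 ≤ R) {M : ℕ} (hM : 0 < M)
    (step : ∀ a b, Adj a b → ∀ i < M, ‖H (AffineMap.lineMap a b ((i : ℝ) / M)) -
      H (AffineMap.lineMap a b (((i : ℝ) + 1) / M))‖ ≤ 1)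
    (sep : ∀ a b, Adj a b → 10 * (R : ℝ) ≤ ‖H a - H b‖)
    (far : ∀ a b v w, Adj a b → Adj v w → v ≠ a → v ≠ b → ∀ x ∈ segment ℝ a b,
      10 * (R : ℝ) ≤ ‖H x - H v‖)
    (close : ∀ a b a' b', Adj a b → Adj a' b' → ¬ (a = a' ∧ b = b') → ¬ (a = b' ∧ b = a') →
      ∀ x ∈ segment ℝ a b, ∀ x' ∈ segment ℝ a' b', ‖H x - H x'‖ ≤ 10 →
        ∃ v, (v = a ∨ v = b) ∧ (v = a' ∨ v = b') ∧ ‖H x - H v‖ ≤ R / 2) :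
    ∃ D len, Drawing Adj H R (2 * M + 2) D len := by
  classical
  let G : Set (E2 × E2) := {e | Adj e.1 e.2 ∧ WellOrderingRel e.1 e.2}
  have hG : ∀ e ∈ G, Adj e.1 e.2 := fun e he => he.1
  have hGne : ∀ e ∈ G, ∀ e' ∈ G, e ≠ e' →
      ¬ (e.1 = e'.1 ∧ e.2 = e'.2) ∧ ¬ (e.1 = e'.2 ∧ e.2 = e'.1) := by
    intro e he e' he' hne
    refine ⟨fun h => hne (Prod.ext h.1 h.2), fun h => ?_⟩
    have h1 := he.2
    have h2 := he'.2
    rw [h.1, h.2] at h1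
    exact asymm h1 h2
  have harc : ∀ e : E2 × E2, ∃ n y, e ∈ G → n ≤ 2 * M + 2 ∧
      LatArc R (H '' segment ℝ e.1 e.2) (latFloor (H e.1)) (latFloor (H e.2)) n y := by
    intro e
    by_cases he : e ∈ G
    · obtain ⟨n, y, h⟩ := exists_latArc hR hM (step _ _ (hG e he)) (sep _ _ (hG e he))
      exact ⟨n, y, fun _ => h⟩
    · exact ⟨0, fun _ => 0, fun h => absurd h he⟩
  choose n y hny using harc
  have hsys : ArcSystem R H G (fun v => latFloor (H v)) n y := by
    have hfar : ∀ e ∈ G, ∀ e' ∈ G, ∀ v, (v = e'.1 ∨ v = e'.2) → v ≠ e.1 → v ≠ e.2 →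
        ∀ x ∈ segment ℝ e.1 e.2, 10 * (R : ℝ) ≤ ‖H x - H v‖ := by
      rintro e he e' he' v (rfl | rfl) h1 h2 x hx
      · exact far _ _ _ _ (hG e he) (hG e' he') h1 h2 x hx
      · exact far _ _ _ _ (hG e he) (hsymm _ _ (hG e' he')) h1 h2 x hx
    refine ⟨hR, fun e he => (hny e he).2, ?_, fun v => latFloor_near _, hfar, ?_, ?_⟩
    · intro e he h
      have := hG e he
      rw [h] at this
      exact hirr _ this
    · rintro e he e' he' v w hv hw hvw
      have hs := sep _ _ (hG e he)
      by_cases h1 : w = e.1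
      · rcases hv with rfl | rfl
        · exact absurd h1.symm hvw
        · rw [h1, norm_sub_rev]; exact hs
      by_cases h2 : w = e.2
      · rcases hv with rfl | rfl
        · rw [h2]; exact hs
        · exact absurd h2.symm hvw
      · refine hfar e he e' he' w hw h1 h2 v ?_
        rcases hv with rfl | rfl
        · exact left_mem_segment _ _ _
        · exact right_mem_segment _ _ _
    · intro e he e' he' hne
      exact close _ _ _ _ (hG e he) (hG e' he') (hGne e he e' he' hne).1 (hGne e he e' he' hne).2
  obtain ⟨D, len, hD⟩ := hsys.drawing
    (fun e he e' he' hne => inter _ _ _ _ (hG e he) (hG e' he') (hGne e he e' he' hne).1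
      (hGne e he e' he' hne).2) (fun e he => (hny e he).1)
  refine ⟨D, len, ?_⟩
  convert hD using 1
  funext a b
  apply propext
  refine ⟨fun h => ?_, ?_⟩
  · rcases trichotomous_of WellOrderingRel a b with h1 | h1 | h1
    · exact Or.inl ⟨h, h1⟩
    · rw [h1] at h; exact absurd h (hirr _)
    · exact Or.inr ⟨hsymm _ _ h, h1⟩
  · rintro (h | h)
    · exact hG _ h
    · exact hsymm _ _ (hG _ h)

theorem mem_cycEdges_range {m i j : ℕ} (hm : 2 ≤ m) : (i, j) ∈ cycEdges (Finset.range m) ↔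
    i < m ∧ j < m ∧ ((i + 1 < m ∧ j = i + 1) ∨ (i + 1 = m ∧ j = 0)) := by
  rw [mem_cycEdges]
  simp only [Finset.mem_range]
  refine and_congr_right fun hi => and_congr_right fun hj => ?_
  constructor
  · rintro (⟨h1, h2⟩ | ⟨h1, h2⟩)
    · have := h2 (i + 1) (by omega); omega
    · have := h2 0 (by omega); have := h2 (m - 1) (by omega); omega
  grind

/-- A closed path made of `m` pieces, each parametrised by the unit interval. -/
structure PathLoop {E : Type*} (m : ℕ) (X : ℕ → ℝ → E) : Prop where
  three_le : 3 ≤ m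
  next : ∀ i, i + 1 < m → X i 1 = X (i + 1) 0
  last : X (m - 1) 1 = X 0 0
  inj : ∀ i j, i < m → j < m → ∀ s t, 0 ≤ s → s < 1 → 0 ≤ t → t < 1 → X i s = X j t → i = j ∧ s = t

namespace PathLoop

variable {E : Type*} {m : ℕ} {X : ℕ → ℝ → E}

theorem edge (h : PathLoop m X) {e : ℕ × ℕ} (he : e ∈ cycEdges (Finset.range m)) :
    e.1 < m ∧ e.2 < m ∧ X e.1 1 = X e.2 0 := by
  have hm := h.three_le
  obtain ⟨h1, h2, ⟨h3, h4⟩ | ⟨h3, h4⟩⟩ := (mem_cycEdges_range (by omega)).1 he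
  · exact ⟨h1, h2, by rw [h.next _ h3, h4]⟩
  · refine ⟨h1, h2, ?_⟩
    rw [h4, ← h.last]
    congr 1; omega

theorem exists_edge (h : PathLoop m X) {i : ℕ} (hi : i < m) :
    ∃ e ∈ cycEdges (Finset.range m), e.1 = i := by
  have := h.three_le
  obtain ⟨j, hj⟩ := exists_cycEdges_fst (I := Finset.range m) (by simp; omega)
    (Finset.mem_range.2 hi)
  exact ⟨_, hj, rfl⟩

theorem isSimplePoly (h : PathLoop m X) {D : E → ℂ}
    (hD : ∀ i j, i < m → j < m → ∀ s ∈ Icc (0 : ℝ) 1, ∀ t ∈ Icc (0 : ℝ) 1,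
      D (X i s) = D (X j t) → X i s = X j t) (lin : ∀ i < m, ∀ s ∈ Icc (0 : ℝ) 1,
      D (X i s) = AffineMap.lineMap (D (X i 0)) (D (X i 1)) s) :
    IsSimplePoly (fun i => D (X i 0)) (Finset.range m) := by
  have hm := h.three_le
  have key : ∀ e ∈ cycEdges (Finset.range m), ∀ x ∈ segment ℝ (D (X e.1 0)) (D (X e.2 0)),
      ∃ s ∈ Icc (0 : ℝ) 1, x = D (X e.1 s) := by
    intro e he x hx
    obtain ⟨h1, h2, h3⟩ := h.edge he
    rw [segment_eq_image_lineMap, ← h3] at hx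
    obtain ⟨s, hs, rfl⟩ := hx
    grind
  have key2 : ∀ e ∈ cycEdges (Finset.range m), ∀ s ∈ Icc (0 : ℝ) 1, ∃ i t, i < m ∧ 0 ≤ t ∧ t < 1 ∧
      X e.1 s = X i t ∧ ((i = e.1 ∧ t = s) ∨ (i = e.2 ∧ t = 0)) := by
    intro e he s hs
    obtain ⟨h1, h2, h3⟩ := h.edge he
    rcases hs.2.eq_or_lt with rfl | hs1
    · exact ⟨e.2, 0, h2, le_rfl, one_pos, h3, Or.inr ⟨rfl, rfl⟩⟩
    · exact ⟨e.1, s, h1, hs.1, hs1, rfl, Or.inl ⟨rfl, rfl⟩⟩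
  refine ⟨by simpa using hm, ?_, ?_⟩
  · intro i hi j hj hij
    have hi := Finset.mem_range.1 (Finset.mem_coe.1 hi)
    have hj := Finset.mem_range.1 (Finset.mem_coe.1 hj)
    exact (h.inj i j hi hj 0 0 le_rfl one_pos le_rfl one_pos
      (hD i j hi hj 0 (by simp) 0 (by simp) hij)).1
  · intro e he e' he' hne x hx hx'
    obtain ⟨s, hs, rfl⟩ := key e he x hx
    obtain ⟨s', hs', h2⟩ := key e' he' _ hx'
    have hX := hD _ _ (h.edge he).1 (h.edge he').1 s hs s' hs' h2
    obtain ⟨i, t, hi, ht0, ht1, h3, h4⟩ := key2 e he s hs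
    obtain ⟨j, t', hj, ht0', ht1', h3', h4'⟩ := key2 e' he' s' hs'
    obtain ⟨rfl, rfl⟩ := h.inj i j hi hj t t' ht0 ht1 ht0' ht1' (by rw [← h3, hX, h3'])
    have hne1 : e.1 ≠ e'.1 := by
      intro h1
      apply hne
      have g1 := (mem_cycEdges_range (by omega : 2 ≤ m)).1 (show (e.1, e.2) ∈ _ from he)
      have g2 := (mem_cycEdges_range (by omega : 2 ≤ m)).1 (show (e'.1, e'.2) ∈ _ from he')
      exact Prod.ext h1 (by omega)
    refine ⟨i, h4.imp And.left And.left, h4'.imp And.left And.left, ?_⟩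
    have ht : t = 0 := by
      grind
    rw [h3, ht]

theorem polyCurve_eq (h : PathLoop m X) {D : E → ℂ} (lin : ∀ i < m, ∀ s ∈ Icc (0 : ℝ) 1,
      D (X i s) = AffineMap.lineMap (D (X i 0)) (D (X i 1)) s) :
    polyCurve (fun i => D (X i 0)) (Finset.range m) =
      {z | ∃ i < m, ∃ s ∈ Icc (0 : ℝ) 1, z = D (X i s)} := by
  ext z
  constructor
  · rintro ⟨e, he, hx⟩
    obtain ⟨h1, h2, h3⟩ := h.edge he
    simp only at hx
    rw [segment_eq_image_lineMap, ← h3] at hx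
    grind
  · rintro ⟨i, hi, s, hs, rfl⟩
    obtain ⟨e, he, rfl⟩ := h.exists_edge hi
    refine ⟨e, he, ?_⟩
    obtain ⟨h1, h2, h3⟩ := h.edge he
    simp only
    rw [segment_eq_image_lineMap, ← h3]
    grind

end PathLoop

/-- The boundary of a triangle, with its sides divided into `n₁`, `n₂`, `n₃` equal pieces. -/
def sidePt {E : Type*} [AddCommGroup E] [Module ℝ E] (a b c : E) (n₁ n₂ n₃ : ℕ) (i : ℕ) (s : ℝ) :
    E :=
  if i < n₁ then AffineMap.lineMap a b (((i : ℝ) + s) / n₁)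
  else if i < n₁ + n₂ then AffineMap.lineMap b c ((((i - n₁ : ℕ) : ℝ) + s) / n₂)
  else AffineMap.lineMap c a ((((i - n₁ - n₂ : ℕ) : ℝ) + s) / n₃)

section sidePt

variable {E : Type*} [AddCommGroup E] [Module ℝ E] {a b c : E} {n₁ n₂ n₃ : ℕ}

theorem sidePt_cases {i : ℕ} (hi : i < n₁ + n₂ + n₃) :
    (∃ j < n₁, i = j ∧ ∀ s, sidePt a b c n₁ n₂ n₃ i s = AffineMap.lineMap a b (((j : ℝ) + s) / n₁)) ∨
    (∃ j < n₂, i = n₁ + j ∧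
      ∀ s, sidePt a b c n₁ n₂ n₃ i s = AffineMap.lineMap b c (((j : ℝ) + s) / n₂)) ∨
    (∃ j < n₃, i = n₁ + n₂ + j ∧
      ∀ s, sidePt a b c n₁ n₂ n₃ i s = AffineMap.lineMap c a (((j : ℝ) + s) / n₃)) := by
  by_cases g1 : i < n₁
  · exact Or.inl ⟨i, g1, rfl, fun s => by rw [sidePt, if_pos g1]⟩
  by_cases g2 : i < n₁ + n₂
  · exact Or.inr (Or.inl ⟨i - n₁, by omega, by omega, fun s => by
      rw [sidePt, if_neg g1, if_pos g2]⟩)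
  · exact Or.inr (Or.inr ⟨i - n₁ - n₂, by omega, by omega, fun s => by
      rw [sidePt, if_neg g1, if_neg g2]⟩)

theorem param_mem {n j : ℕ} (hj : j < n) {s : ℝ} (hs : s ∈ Icc (0 : ℝ) 1) :
    ((j : ℝ) + s) / n ∈ Icc (0 : ℝ) 1 := by
  have hn : (0 : ℝ) < n := by have : 0 < n := by omega
                              exact_mod_cast this
  have hj' : (j : ℝ) + 1 ≤ n := mod_cast hj
  exact ⟨by have := hs.1; positivity, by rw [div_le_one hn]; linarith [hs.2]⟩

theorem param_lt {n j : ℕ} (hj : j < n) {s : ℝ} (hs : s < 1) : ((j : ℝ) + s) / n < 1 := by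
  have hn : (0 : ℝ) < n := by have : 0 < n := by omega
                              exact_mod_cast this
  have hj' : (j : ℝ) + 1 ≤ n := mod_cast hj
  rw [div_lt_one hn]; linarith

theorem param_surj {n : ℕ} (hn : 0 < n) {t : ℝ} (ht : t ∈ Icc (0 : ℝ) 1) :
    ∃ j < n, ∃ s ∈ Icc (0 : ℝ) 1, t = ((j : ℝ) + s) / n := by
  have hn' : (0 : ℝ) < n := mod_cast hn
  rcases ht.2.eq_or_lt with h1 | h1
  · refine ⟨n - 1, by omega, 1, by simp, ?_⟩
    rw [h1, Nat.cast_sub (by omega)]; grind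
  · have h0 : 0 ≤ t * n := mul_nonneg ht.1 hn'.le
    refine ⟨⌊t * n⌋₊, ?_, t * n - ⌊t * n⌋₊, ⟨by linarith [Nat.floor_le h0],
      by linarith [Nat.lt_floor_add_one (t * n)]⟩, ?_⟩
    · rw [Nat.floor_lt h0]; nlinarith
    grind

theorem sidePt_image (h1 : 0 < n₁) (h2 : 0 < n₂) (h3 : 0 < n₃) {x : E} :
    (∃ i < n₁ + n₂ + n₃, ∃ s ∈ Icc (0 : ℝ) 1, x = sidePt a b c n₁ n₂ n₃ i s) ↔
      x ∈ segment ℝ a b ∨ x ∈ segment ℝ b c ∨ x ∈ segment ℝ c a := by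
  simp only [segment_eq_image_lineMap]
  constructor
  · rintro ⟨i, hi, s, hs, rfl⟩
    rcases sidePt_cases (a := a) (b := b) (c := c) hi with
      ⟨j, hj, -, h⟩ | ⟨j, hj, -, h⟩ | ⟨j, hj, -, h⟩ <;> rw [h s]
    · exact Or.inl ⟨_, param_mem hj hs, rfl⟩
    · exact Or.inr (Or.inl ⟨_, param_mem hj hs, rfl⟩)
    · exact Or.inr (Or.inr ⟨_, param_mem hj hs, rfl⟩)
  · rintro (⟨t, ht, rfl⟩ | ⟨t, ht, rfl⟩ | ⟨t, ht, rfl⟩)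
    · obtain ⟨j, hj, s, hs, rfl⟩ := param_surj h1 ht
      exact ⟨j, by omega, s, hs, by rw [sidePt, if_pos hj]⟩
    · obtain ⟨j, hj, s, hs, rfl⟩ := param_surj h2 ht
      exact ⟨n₁ + j, by omega, s, hs, by
        rw [sidePt, if_neg (by omega), if_pos (by omega), Nat.add_sub_cancel_left]⟩
    · obtain ⟨j, hj, s, hs, rfl⟩ := param_surj h3 ht
      exact ⟨n₁ + n₂ + j, by omega, s, hs, by
        rw [sidePt, if_neg (by omega), if_neg (by omega), show n₁ + n₂ + j - n₁ - n₂ = j by omega]⟩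

theorem sidePt_map {F : Type*} [AddCommGroup F] [Module ℝ F] (T : E →ᵃ[ℝ] F) (i : ℕ) (s : ℝ) :
    T (sidePt a b c n₁ n₂ n₃ i s) = sidePt (T a) (T b) (T c) n₁ n₂ n₃ i s := by
  simp only [sidePt]; split_ifs <;> exact AffineMap.apply_lineMap _ _ _ _

theorem param_inj {n i j : ℕ} (hn : 0 < n) {s t : ℝ} (hs0 : 0 ≤ s) (hs1 : s < 1) (ht0 : 0 ≤ t)
    (ht1 : t < 1) (h : ((i : ℝ) + s) / n = ((j : ℝ) + t) / n) : i = j ∧ s = t := by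
  have hn' : (n : ℝ) ≠ 0 := by positivity
  rw [div_left_inj' hn'] at h
  have : i = j := by
    rcases lt_trichotomy i j with h1 | h1 | h1
    · have : (i : ℝ) + 1 ≤ j := mod_cast h1
      linarith
    · exact h1
    · have : (j : ℝ) + 1 ≤ i := mod_cast h1
      linarith
  grind

theorem sidePt_pathLoop (h1 : 0 < n₁) (h2 : 0 < n₂) (h3 : 0 < n₃) (T : E →ᵃ[ℝ] ℂ)
    (ha : T a = 0) (hb : T b = 1) (hc : T c = Complex.I) :
    PathLoop (n₁ + n₂ + n₃) (sidePt a b c n₁ n₂ n₃) := by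
  have q2 : (n₂ : ℝ) ≠ 0 := by positivity
  have q3 : (n₃ : ℝ) ≠ 0 := by positivity
  refine ⟨by omega, ?_, ?_, ?_⟩
  · intro i hi
    rcases lt_trichotomy (i + 1) n₁ with g | g | g
    · rw [sidePt, sidePt, if_pos (by omega), if_pos g]; push_cast; rw [add_zero]
    · rw [sidePt, sidePt, if_pos (by omega), if_neg (by omega), if_pos (by omega), ← g]
      have : ((i : ℝ) + 1) ≠ 0 := by positivity
      simp [this]
    rcases lt_trichotomy (i + 1) (n₁ + n₂) with g' | g' | g'
    · rw [sidePt, sidePt, if_neg (by omega), if_pos (by omega), if_neg (by omega),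
        if_pos (by omega), show i + 1 - n₁ = i - n₁ + 1 by omega]; push_cast; rw [add_zero]
    · rw [sidePt, sidePt, if_neg (by omega), if_pos (by omega), if_neg (by omega),
        if_neg (by omega), show i + 1 - n₁ - n₂ = 0 by omega]
      have : ((i - n₁ : ℕ) : ℝ) + 1 = n₂ := by
        have : i - n₁ + 1 = n₂ := by omega
        exact_mod_cast this
      rw [this]; simp [q2]
    · rw [sidePt, sidePt, if_neg (by omega), if_neg (by omega), if_neg (by omega),
        if_neg (by omega), show i + 1 - n₁ - n₂ = i - n₁ - n₂ + 1 by omega]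
      push_cast; rw [add_zero]
  · rw [sidePt, sidePt, if_neg (by omega), if_neg (by omega), if_pos h1]
    have : ((n₁ + n₂ + n₃ - 1 - n₁ - n₂ : ℕ) : ℝ) + 1 = n₃ := by
      have : n₁ + n₂ + n₃ - 1 - n₁ - n₂ + 1 = n₃ := by omega
      exact_mod_cast this
    rw [this]; simp [q3]
  · intro i j hi hj s t hs0 hs1 ht0 ht1 heq
    have he := congrArg T heq
    have e1 : ∀ r : ℝ, T (AffineMap.lineMap a b r) = r := by
      intro r; rw [AffineMap.apply_lineMap, ha, hb]; simp [AffineMap.lineMap_apply]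
    have e2 : ∀ r : ℝ, T (AffineMap.lineMap b c r) = (1 - r : ℝ) + r * Complex.I := by
      intro r; rw [AffineMap.apply_lineMap, hb, hc]; simp [AffineMap.lineMap_apply]; ring
    have e3 : ∀ r : ℝ, T (AffineMap.lineMap c a r) = (1 - r : ℝ) * Complex.I := by
      intro r; rw [AffineMap.apply_lineMap, hc, ha]; simp [AffineMap.lineMap_apply]; ring
    rcases sidePt_cases (a := a) (b := b) (c := c) hi with
      ⟨k, hk, rfl, h⟩ | ⟨k, hk, rfl, h⟩ | ⟨k, hk, rfl, h⟩ <;>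
    rcases sidePt_cases (a := a) (b := b) (c := c) hj with
      ⟨l, hl, rfl, h'⟩ | ⟨l, hl, rfl, h'⟩ | ⟨l, hl, rfl, h'⟩ <;>
    (rw [h, h'] at he
     simp only [e1, e2, e3, Complex.ext_iff, Complex.add_re, Complex.add_im, Complex.ofReal_re,
       Complex.ofReal_im, Complex.mul_re, Complex.mul_im, Complex.I_re, Complex.I_im, mul_zero,
       mul_one, zero_add, add_zero, sub_zero] at he
     have b1 := param_lt hk hs1
     have b2 := param_lt hl ht1
     obtain ⟨he1, he2⟩ := he
     try (exfalso; linarith))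
    · exact param_inj h1 hs0 hs1 ht0 ht1 he1
    · obtain ⟨r1, r2⟩ := param_inj h2 hs0 hs1 ht0 ht1 he2
      exact ⟨by rw [r1], r2⟩
    · obtain ⟨r1, r2⟩ := param_inj h3 hs0 hs1 ht0 ht1 (sub_right_injective he2)
      exact ⟨by rw [r1], r2⟩

end sidePt

section PLOn

variable {E F G : Type*} [AddCommGroup E] [Module ℝ E] [AddCommGroup F] [Module ℝ F]
  [AddCommGroup G] [Module ℝ G]

theorem PLOn.of_affine (A : E →ᵃ[ℝ] F) (S : Set E) : PLOn A S :=
  ⟨∅, finite_empty, fun _ _ _ _ => ⟨A, fun _ _ => rfl⟩⟩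

theorem PLOn.prodMk {f : E → F} {g : E → G} {S : Set E} (hf : PLOn f S) (hg : PLOn g S) :
    PLOn (fun x => (f x, g x)) S := by
  obtain ⟨Φ, h1, h2⟩ := hf
  obtain ⟨Ψ, h3, h4⟩ := hg
  refine ⟨Φ ∪ Ψ, h1.union h3, fun C hCS hC hs => ?_⟩
  obtain ⟨A, hA⟩ := h2 C hCS hC fun φ hφ => hs φ (Or.inl hφ)
  obtain ⟨B, hB⟩ := h4 C hCS hC fun φ hφ => hs φ (Or.inr hφ)
  exact ⟨A.prod B, fun x hx => by simp [hA x hx, hB x hx]⟩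

theorem PLOn.comp {f : E → F} {g : F → G} {S : Set E} {S' : Set F} (hg : PLOn g S')
    (hf : PLOn f S) (hS : Convex ℝ S) (hm : MapsTo f S S') : PLOn (fun x => g (f x)) S := by
  classical
  obtain ⟨Φ, h1, h2⟩ := hf
  obtain ⟨Ψ, h3, h4⟩ := hg
  let C : Set (E →ᵃ[ℝ] ℝ) → Set E := fun σ =>
    S ∩ {x | ∀ φ ∈ Φ, (φ ∈ σ → 0 ≤ φ x) ∧ (φ ∉ σ → φ x ≤ 0)}
  have hC : ∀ σ, Convex ℝ (C σ) := by
    intro σ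
    refine hS.inter ?_
    have : {x : E | ∀ φ ∈ Φ, (φ ∈ σ → 0 ≤ φ x) ∧ (φ ∉ σ → φ x ≤ 0)} =
        ⋂ φ ∈ Φ, if φ ∈ σ then φ ⁻¹' Ici 0 else φ ⁻¹' Iic 0 := by
      ext x
      simp only [mem_iInter, mem_ofPred_eq]
      grind
    rw [this]
    refine convex_iInter₂ fun φ _ => ?_
    split_ifs
    · exact (convex_Ici (𝕜 := ℝ) (0 : ℝ)).affine_preimage φ
    · exact (convex_Iic (𝕜 := ℝ) (0 : ℝ)).affine_preimage φ
  have hA : ∀ σ, ∃ A : E →ᵃ[ℝ] F, ∀ x ∈ C σ, f x = A x := by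
    intro σ
    refine h2 (C σ) inter_subset_left (hC σ) fun φ hφ => ?_
    grind
  choose A hA using hA
  refine ⟨Φ ∪ image2 (fun σ (φ : F →ᵃ[ℝ] ℝ) => φ.comp (A σ)) (𝒫 Φ) Ψ,
    h1.union (h1.finite_subsets.image2 _ h3), fun K hKS hK hs => ?_⟩
  let σ : Set (E →ᵃ[ℝ] ℝ) := {φ ∈ Φ | ∀ x ∈ K, 0 ≤ φ x}
  have hKC : K ⊆ C σ := by
    refine fun x hx => ⟨hKS hx, fun φ hφ => ⟨fun h => h.2 x hx, fun h => ?_⟩⟩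
    grind
  obtain ⟨B, hB⟩ := h4 (A σ '' K) (by
      rintro _ ⟨x, hx, rfl⟩
      rw [← hA σ x (hKC hx)]; exact hm (hKS hx)) (hK.affine_image (A σ)) (by
      intro φ hφ
      rcases hs (φ.comp (A σ)) (Or.inr ⟨σ, sep_subset _ _, φ, hφ, rfl⟩) with h | h
      · exact Or.inl (by rintro _ ⟨x, hx, rfl⟩; exact h x hx)
      · exact Or.inr (by rintro _ ⟨x, hx, rfl⟩; exact h x hx))
  refine ⟨B.comp (A σ), fun x hx => ?_⟩
  simp only [AffineMap.comp_apply]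
  grind

theorem PLOn.affine_comp {f : E → F} {S : Set E} (hf : PLOn f S) (A : F →ᵃ[ℝ] G) :
    PLOn (fun x => A (f x)) S := by
  obtain ⟨Φ, h1, h2⟩ := hf
  refine ⟨Φ, h1, fun C hCS hC hs => ?_⟩
  obtain ⟨B, hB⟩ := h2 C hCS hC hs
  exact ⟨A.comp B, fun x hx => by simp [hB x hx]⟩

theorem PLOn.add {f g : E → F} {S : Set E} (hf : PLOn f S) (hg : PLOn g S) :
    PLOn (fun x => f x + g x) S :=
  (hf.prodMk hg).affine_comp ((LinearMap.fst ℝ F F + LinearMap.snd ℝ F F).toAffineMap)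

theorem PLOn.min {f g : E → ℝ} {S : Set E} (hf : PLOn f S) (hg : PLOn g S) (hS : Convex ℝ S) :
    PLOn (fun x => min (f x) (g x)) S := by
  refine PLOn.comp (g := fun q : ℝ × ℝ => Min.min q.1 q.2) (S' := univ) ?_
    (hf.prodMk hg) hS (mapsTo_univ _ _)
  refine ⟨{(LinearMap.fst ℝ ℝ ℝ - LinearMap.snd ℝ ℝ ℝ).toAffineMap}, finite_singleton _,
    fun C _ _ hs => ?_⟩
  rcases hs _ rfl with h | h
  · refine ⟨(LinearMap.snd ℝ ℝ ℝ).toAffineMap, fun x hx => ?_⟩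
    have := h x hx
    simp only [LinearMap.coe_toAffineMap, LinearMap.sub_apply, LinearMap.fst_apply,
      LinearMap.snd_apply] at this ⊢
    grind
  · refine ⟨(LinearMap.fst ℝ ℝ ℝ).toAffineMap, fun x hx => ?_⟩
    have := h x hx
    simp only [LinearMap.coe_toAffineMap, LinearMap.sub_apply, LinearMap.fst_apply,
      LinearMap.snd_apply] at this ⊢
    grind

end PLOn

/-- A piecewise affine bump of the standard triangle onto a strictly convex polygon. -/
structure Bump (n₁ n₂ n₃ : ℕ) (κ : ℝ) (φ : ℂ → ℂ) : Prop where
  lip : ∀ x ∈ conv {(0 : ℂ), 1, Complex.I}, ∀ y ∈ conv {(0 : ℂ), 1, Complex.I},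
    ‖φ x - φ y‖ ≤ 2 * ‖x - y‖
  inj : InjOn φ (conv {(0 : ℂ), 1, Complex.I})
  pl : PLOn φ (conv {(0 : ℂ), 1, Complex.I})
  lin : ∀ i < n₁ + n₂ + n₃, ∀ s ∈ Icc (0 : ℝ) 1, φ (sidePt 0 1 Complex.I n₁ n₂ n₃ i s) =
    AffineMap.lineMap (φ (sidePt 0 1 Complex.I n₁ n₂ n₃ i 0))
      (φ (sidePt 0 1 Complex.I n₁ n₂ n₃ i 1)) s
  hull : ∀ x ∈ conv {(0 : ℂ), 1, Complex.I}, φ x ∈ convexHull ℝ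
    ((fun i => φ (sidePt 0 1 Complex.I n₁ n₂ n₃ i 0)) '' (Finset.range (n₁ + n₂ + n₃)))
  det : ∀ i j k, i < j → j < k → k < n₁ + n₂ + n₃ →
    κ ≤ det3 (φ (sidePt 0 1 Complex.I n₁ n₂ n₃ i 0)) (φ (sidePt 0 1 Complex.I n₁ n₂ n₃ j 0))
      (φ (sidePt 0 1 Complex.I n₁ n₂ n₃ k 0))

theorem sidePt_mem {E : Type*} [AddCommGroup E] [Module ℝ E] {a b c : E} {n₁ n₂ n₃ : ℕ}
    (h1 : 0 < n₁) (h2 : 0 < n₂) (h3 : 0 < n₃) {i : ℕ} (hi : i < n₁ + n₂ + n₃) {s : ℝ}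
    (hs : s ∈ Icc (0 : ℝ) 1) : sidePt a b c n₁ n₂ n₃ i s ∈ conv {a, b, c} := by
  rcases (sidePt_image (a := a) (b := b) (c := c) h1 h2 h3).1 ⟨i, hi, s, hs, rfl⟩ with h | h | h <;>
    exact segment_subset_convexHull (by simp) (by simp) h

theorem Drawing.lin_sidePt {Adj : E2 → E2 → Prop} {H : E2 → ℂ} {R : ℝ} {N : ℕ} {D : E2 → ℂ}
    {len : E2 → E2 → ℕ} (h : Drawing Adj H R N D len) {a b c : E2} (hab : Adj a b) (hbc : Adj b c)
    (hca : Adj c a) {i : ℕ} (hi : i < len a b + len b c + len c a) {s : ℝ}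
    (hs : s ∈ Icc (0 : ℝ) 1) : D (sidePt a b c (len a b) (len b c) (len c a) i s) =
    AffineMap.lineMap (D (sidePt a b c (len a b) (len b c) (len c a) i 0))
      (D (sidePt a b c (len a b) (len b c) (len c a) i 1)) s := by
  rcases sidePt_cases (a := a) (b := b) (c := c) hi with ⟨j, hj, -, g⟩ | ⟨j, hj, -, g⟩ |
    ⟨j, hj, -, g⟩ <;> rw [g, g, g, add_zero]
  · exact h.lin _ _ hab j hj s hs
  · exact h.lin _ _ hbc j hj s hs
  · exact h.lin _ _ hca j hj s hs

theorem Drawing.mem_edge {Adj : E2 → E2 → Prop} {H : E2 → ℂ} {R : ℝ} {N : ℕ} {D : E2 → ℂ}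
    {len : E2 → E2 → ℕ} (h : Drawing Adj H R N D len) {a b c : E2} (hab : Adj a b) (hbc : Adj b c)
    (hca : Adj c a) {i : ℕ} (hi : i < len a b + len b c + len c a) {s : ℝ}
    (hs : s ∈ Icc (0 : ℝ) 1) : ∃ u v, Adj u v ∧
    sidePt a b c (len a b) (len b c) (len c a) i s ∈ segment ℝ u v := by
  rcases (sidePt_image (a := a) (b := b) (c := c) (h.pos _ _ hab) (h.pos _ _ hbc)
    (h.pos _ _ hca)).1 ⟨i, hi, s, hs, rfl⟩ with
    g | g | g
  · exact ⟨_, _, hab, g⟩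
  · exact ⟨_, _, hbc, g⟩
  · exact ⟨_, _, hca, g⟩

/-- The image of the boundary of a triangle in a drawing is a simple polygon, which the triangle
fills. -/
theorem Drawing.exists_cellMap {Adj : E2 → E2 → Prop} {H : E2 → ℂ} {R : ℝ} {N : ℕ} {D : E2 → ℂ}
    {len : E2 → E2 → ℕ} (h : Drawing Adj H R N D len) {a b c : E2} (hab : Adj a b) (hbc : Adj b c)
    (hca : Adj c a) (T : E2 →ᵃ[ℝ] ℂ) (hTa : T a = 0) (hTb : T b = 1) (hTc : T c = Complex.I)
    (hT : Function.Injective T) {κ : ℝ} (hκ : 0 < κ) {φ : ℂ → ℂ}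
    (hφ : Bump (len a b) (len b c) (len c a) κ φ) {L : ℝ}
    (hL : ∀ i < len a b + len b c + len c a, ∀ j < len a b + len b c + len c a,
      ‖D (sidePt a b c (len a b) (len b c) (len c a) i 0) -
        D (sidePt a b c (len a b) (len b c) (len c a) j 0)‖ ≤ L)
    {p : ℕ → ℂ} (hp : p = fun i => D (sidePt a b c (len a b) (len b c) (len c a) i 0))
    {I : Finset ℕ} (hI : I = Finset.range (len a b + len b c + len c a)) : IsSimplePoly p I ∧
    (polyCurve p I = D '' {x | x ∈ segment ℝ a b ∨ x ∈ segment ℝ b c ∨ x ∈ segment ℝ c a}) ∧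
    ∃ ε f, PolyJordan p I ε ∧ PLOn f (conv {a, b, c}) ∧ InjOn f (conv {a, b, c}) ∧
      (∀ x ∈ conv {a, b, c}, f x ∈ polyCurve p I ∪ polyInside p I ε) ∧
      (∀ x, x ∈ segment ℝ a b ∨ x ∈ segment ℝ b c ∨ x ∈ segment ℝ c a → f x = D x) ∧
      (∀ x ∈ conv {a, b, c}, f x ∈ conv (p '' I)) ∧ ∀ x ∈ conv {a, b, c}, ∀ y ∈ conv {a, b, c},
        ‖f x - f y‖ ≤ 32 * L / κ * ‖T x - T y‖ := by
  set m := len a b + len b c + len c a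
  have p1 := h.pos _ _ hab
  have p2 := h.pos _ _ hbc
  have p3 := h.pos _ _ hca
  set X : ℕ → ℝ → E2 := sidePt a b c (len a b) (len b c) (len c a) with hX
  set X0 : ℕ → ℝ → ℂ := sidePt 0 1 Complex.I (len a b) (len b c) (len c a) with hX0
  have hloop : PathLoop m X := sidePt_pathLoop p1 p2 p3 T hTa hTb hTc
  have hTX : ∀ i s, T (X i s) = X0 i s := fun i s => by
    rw [hX, sidePt_map, hTa, hTb, hTc]
  have hDinj : ∀ i j, i < m → j < m → ∀ s ∈ Icc (0 : ℝ) 1, ∀ t ∈ Icc (0 : ℝ) 1,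
      D (X i s) = D (X j t) → X i s = X j t := by
    intro i j hi hj s hs t ht heq
    obtain ⟨u, v, huv, hx⟩ := h.mem_edge hab hbc hca hi hs
    obtain ⟨u', v', huv', hx'⟩ := h.mem_edge hab hbc hca hj ht
    exact h.inj _ _ _ _ _ _ huv huv' hx hx' heq
  have hDlin : ∀ i < m, ∀ s ∈ Icc (0 : ℝ) 1,
      D (X i s) = AffineMap.lineMap (D (X i 0)) (D (X i 1)) s :=
    fun i hi s hs => h.lin_sidePt hab hbc hca hi hs
  have hsimple : IsSimplePoly p I := by
    rw [hp, hI]; exact hloop.isSimplePoly hDinj hDlin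
  have hcurve : polyCurve p I =
      D '' {x | x ∈ segment ℝ a b ∨ x ∈ segment ℝ b c ∨ x ∈ segment ℝ c a} := by
    rw [hp, hI, hloop.polyCurve_eq hDlin]
    ext z
    constructor
    · rintro ⟨i, hi, s, hs, rfl⟩
      exact ⟨_, (sidePt_image p1 p2 p3).1 ⟨i, hi, s, hs, rfl⟩, rfl⟩
    · rintro ⟨x, hx, rfl⟩
      obtain ⟨i, hi, s, hs, rfl⟩ := (sidePt_image p1 p2 p3).2 hx
      exact ⟨i, hi, s, hs, rfl⟩
  have hmem0 : ∀ i < m, ∀ s ∈ Icc (0 : ℝ) 1, X0 i s ∈ conv {(0 : ℂ), 1, Complex.I} :=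
    fun i hi s hs => sidePt_mem p1 p2 p3 hi hs
  have hW : ∀ i ∈ I, ∀ j ∈ I, ‖φ (X0 i 0) - φ (X0 j 0)‖ ≤ 4 := by
    intro i hi j hj
    rw [hI, Finset.mem_range] at hi hj
    have hb : ∀ x ∈ conv {(0 : ℂ), 1, Complex.I}, ∀ y ∈ conv {(0 : ℂ), 1, Complex.I},
        ‖x - y‖ ≤ 2 := by
      intro x hx y hy
      obtain ⟨x', hx', y', hy', hxy⟩ := convexHull_exists_dist_ge2 hx hy
      rw [← dist_eq_norm]
      refine hxy.trans ?_
      rw [dist_eq_norm]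
      refine (norm_sub_le _ _).trans ?_
      have hn : ∀ x ∈ ({0, 1, Complex.I} : Set ℂ), ‖x‖ ≤ 1 := by
        rintro x (rfl | rfl | rfl) <;> simp
      linarith [hn _ hx', hn _ hy']
    have := hφ.lip _ (hmem0 i hi 0 (by simp)) _ (hmem0 j hj 0 (by simp))
    have := hb _ (hmem0 i hi 0 (by simp)) _ (hmem0 j hj 0 (by simp))
    linarith
  obtain ⟨ε, F, hJ, hF⟩ := hsimple.exists_fillMap (w := fun i => φ (X0 i 0)) (W := 4) (D := L) hκ
    (fun i _ j _ k hk hij hjk => hφ.det i j k hij hjk (by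
      rw [hI, Finset.mem_range] at hk; exact hk)) hW
    (fun i hi j hj => by
      rw [hI, Finset.mem_range] at hi hj; rw [hp]; exact hL i hi j hj)
  set Q := conv ((fun i => φ (X0 i 0)) '' (I : Set ℕ)) with hQ
  have hφQ : ∀ x ∈ conv {(0 : ℂ), 1, Complex.I}, φ x ∈ Q := by
    rw [hQ, hI]; exact hφ.hull
  have hTΔ : ∀ x ∈ conv {a, b, c}, T x ∈ conv {(0 : ℂ), 1, Complex.I} := by
    intro x hx
    have : T '' conv {a, b, c} = conv {(0 : ℂ), 1, Complex.I} := by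
      rw [T.image_convexHull, image_insert_eq, image_pair, hTa, hTb, hTc]
    rw [← this]
    exact mem_image_of_mem _ hx
  have hedge : ∀ i < m, ∀ s ∈ Icc (0 : ℝ) 1, F (φ (X0 i s)) = D (X i s) := by
    intro i hi s hs
    obtain ⟨e, he, rfl⟩ := hloop.exists_edge hi
    obtain ⟨-, -, h3⟩ := hloop.edge he
    rw [← hI] at he
    have := hF.edge e he s hs
    rw [hp] at this
    rw [hφ.lin _ hi s hs, hDlin _ hi s hs, h3, ← this]
    simp only [← hX0]
    rw [← hTX _ 1, h3, hTX]
  refine ⟨hsimple, hcurve, ε, fun x => F (φ (T x)), hJ, ?_, ?_, ?_, ?_, ?_, ?_⟩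
  · exact (hF.pl.comp (hφ.pl.comp (PLOn.of_affine T _) (convex_convexHull ℝ _) hTΔ)
      (convex_convexHull ℝ _) fun x hx => hφQ _ (hTΔ x hx))
  · intro x hx y hy hxy
    exact hT (hφ.inj (hTΔ x hx) (hTΔ y hy) (hF.inj (hφQ _ (hTΔ x hx)) (hφQ _ (hTΔ y hy)) hxy))
  · intro x hx
    rw [← hF.image]
    exact ⟨_, hφQ _ (hTΔ x hx), rfl⟩
  · intro x hx
    obtain ⟨i, hi, s, hs, rfl⟩ := (sidePt_image p1 p2 p3).2 hx
    rw [← hX]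
    simp only [hTX]
    exact hedge i hi s hs
  · exact fun x hx => hF.hull _ (hφQ _ (hTΔ x hx))
  · intro x hx y hy
    have h1 := hF.lip _ (hφQ _ (hTΔ x hx)) _ (hφQ _ (hTΔ y hy))
    have h2 := hφ.lip _ (hTΔ x hx) _ (hTΔ y hy)
    have hL0 : 0 ≤ L := by
      have : 0 < m := by omega
      exact (norm_nonneg _).trans (hL 0 this 0 this)
    have : 0 ≤ 2 * 4 * L / κ := by positivity
    calc _ ≤ 2 * 4 * L / κ * (2 * ‖T x - T y‖) := h1.trans (by gcongr)
      _ ≤ 32 * L / κ * ‖T x - T y‖ := by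
        have : 0 ≤ L / κ * ‖T x - T y‖ := by positivity
        ring_nf at this ⊢
        linarith

theorem closure_polyInside_subset {p : ℕ → ℂ} {I : Finset ℕ} (hI : 2 ≤ I.card) (ε : ℝ) :
    closure (polyInside p I ε) ⊆ polyCurve p I ∪ polyInside p I ε := by
  intro q hq
  by_contra hn
  rw [mem_union, not_or] at hn
  have h1 := wind_eventually_eq hI hn.1
  obtain ⟨y, hy, hy'⟩ := mem_closure_iff_nhds.1 hq _ h1
  exact hn.2 ⟨hn.1, hy.2.symm.trans hy'.2⟩

/-- Two polygons, each in the closed exterior of the other one, have disjoint interiors. -/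
theorem PolyJordan.disjoint {p₁ p₂ : ℕ → ℂ} {I₁ I₂ : Finset ℕ} {ε₁ ε₂ : ℝ}
    (hI₁ : 2 ≤ I₁.card) (h1 : PolyJordan p₁ I₁ ε₁) (h2 : PolyJordan p₂ I₂ ε₂)
    (h12 : ∀ x ∈ polyCurve p₂ I₂, x ∉ polyCurve p₁ I₁ → wind p₁ I₁ x = 0)
    (h21 : ∀ x ∈ polyCurve p₁ I₁, x ∉ polyCurve p₂ I₂ → wind p₂ I₂ x = 0)
    {z : ℂ} (hz : z ∈ polyCurve p₂ I₂) (hz' : z ∉ polyCurve p₁ I₁) :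
    (polyCurve p₁ I₁ ∪ polyInside p₁ I₁ ε₁) ∩ (polyCurve p₂ I₂ ∪ polyInside p₂ I₂ ε₂) ⊆
      polyCurve p₁ I₁ ∩ polyCurve p₂ I₂ := by
  have e1 : ε₁ ≠ 0 := by rcases h1.sign with h | h <;> rw [h] <;> norm_num
  have e2 : ε₂ ≠ 0 := by rcases h2.sign with h | h <;> rw [h] <;> norm_num
  have d12 : ∀ x ∈ polyInside p₁ I₁ ε₁, x ∉ polyCurve p₂ I₂ := fun x hx hx' =>
    e1 (hx.2.symm.trans (h12 x hx' hx.1))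
  have d21 : ∀ x ∈ polyInside p₂ I₂ ε₂, x ∉ polyCurve p₁ I₁ := fun x hx hx' =>
    e2 (hx.2.symm.trans (h21 x hx' hx.1))
  have dd : ∀ x ∈ polyInside p₁ I₁ ε₁, x ∉ polyInside p₂ I₂ ε₂ := by
    intro x hx hx'
    have hsub : polyInside p₂ I₂ ε₂ ⊆ polyInside p₁ I₁ ε₁ := fun y hy =>
      ⟨d21 y hy, (wind_const_point hI₁ h2.conn d21 hy hx').trans hx.2⟩
    have hz2 := closure_polyInside_subset hI₁ ε₁ (closure_mono hsub (h2.dense hz))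
    grind
  grind

theorem wind_const_poly {I : Finset ℕ} (w q : ℂ) : wind (fun _ => w) I q = 0 := by
  have : ∀ z : ℂ, Complex.arg (z / z) = 0 := fun z => by
    simp_all
  simp [wind, this]

section Drawing

variable {Adj : E2 → E2 → Prop} {H : E2 → ℂ} {R : ℝ} {N : ℕ} {D : E2 → ℂ} {len : E2 → E2 → ℕ}

theorem Drawing.continuousOn (h : Drawing Adj H R N D len) {a b : E2} (hab : Adj a b) :
    ContinuousOn (fun t : ℝ => D (AffineMap.lineMap a b t)) (Icc 0 1) := by
  have hn := h.pos _ _ hab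
  set n := len a b with hnd
  have hn' : (0 : ℝ) < n := mod_cast hn
  have hpiece : ∀ i : Fin n, ContinuousOn (fun t : ℝ => D (AffineMap.lineMap a b t))
      (Icc ((i : ℝ) / n) (((i : ℝ) + 1) / n)) := by
    intro i
    have : ContinuousOn (fun t : ℝ => (AffineMap.lineMap (D (AffineMap.lineMap a b ((i : ℝ) / n)))
        (D (AffineMap.lineMap a b (((i : ℝ) + 1) / n))) (t * n - i) : ℂ))
        (Icc ((i : ℝ) / n) (((i : ℝ) + 1) / n)) := by
      refine Continuous.continuousOn ?_
      exact AffineMap.lineMap_continuous.comp (by fun_prop)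
    refine this.congr fun t ht => ?_
    rw [mem_Icc, div_le_iff₀ hn', le_div_iff₀ hn'] at ht
    have := h.lin _ _ hab i i.2 (t * n - i) ⟨by linarith [ht.1], by linarith [ht.2]⟩
    simp only [← hnd] at this
    rw [add_sub_cancel, mul_div_cancel_right₀ _ hn'.ne'] at this
    exact this
  have hu : Icc (0 : ℝ) 1 ⊆ ⋃ i : Fin n, Icc ((i : ℝ) / n) (((i : ℝ) + 1) / n) := by
    intro t ht
    obtain ⟨j, hj, s, hs, rfl⟩ := param_surj hn ht
    refine mem_iUnion.2 ⟨⟨j, hj⟩, ?_⟩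
    constructor
    · simp only; gcongr; linarith [hs.1]
    · simp only; gcongr; exact hs.2
  exact (LocallyFinite.continuousOn_iUnion (locallyFinite_of_finite _) (fun _ => isClosed_Icc)
    hpiece).mono hu

theorem Drawing.preconnected (h : Drawing Adj H R N D len) {a b y : E2} (hab : Adj a b)
    (hy : y ∈ segment ℝ a b) : IsPreconnected (D '' segment ℝ y b) := by
  rw [segment_eq_image_lineMap] at hy
  obtain ⟨t, ht, rfl⟩ := hy
  have hmaps : ∀ s ∈ Icc (0 : ℝ) 1, (AffineMap.lineMap (AffineMap.lineMap a b t : E2) b s : E2) =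
      AffineMap.lineMap a b (AffineMap.lineMap t 1 s) := fun s _ => by
    rw [AffineMap.apply_lineMap, AffineMap.lineMap_apply_one]
  have : D '' segment ℝ (AffineMap.lineMap a b t) b =
      (fun s : ℝ => D (AffineMap.lineMap a b s)) '' Icc t 1 := by
    rw [segment_eq_image_lineMap, ← segment_eq_Icc ht.2, segment_eq_image_lineMap, image_image,
      image_image]
    exact image_congr fun s hs => by rw [hmaps s hs]
  rw [this]
  exact isPreconnected_Icc.image _ ((h.continuousOn hab).mono (Icc_subset_Icc_left ht.1))

theorem Drawing.step_sidePt (h : Drawing Adj H R N D len) {a b c : E2} (hab : Adj a b)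
    (hbc : Adj b c) (hca : Adj c a) {i : ℕ} (hi : i < len a b + len b c + len c a) :
    ‖D (sidePt a b c (len a b) (len b c) (len c a) i 0) -
      D (sidePt a b c (len a b) (len b c) (len c a) i 1)‖ ≤ 2 * R := by
  rcases sidePt_cases (a := a) (b := b) (c := c) hi with ⟨j, hj, -, g⟩ | ⟨j, hj, -, g⟩ |
    ⟨j, hj, -, g⟩ <;> rw [g, g, add_zero]
  · exact h.step _ _ hab j hj
  · exact h.step _ _ hbc j hj
  · exact h.step _ _ hca j hj

theorem Drawing.near_sidePt (h : Drawing Adj H R N D len) {a b c : E2} (hab : Adj a b)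
    (hbc : Adj b c) (hca : Adj c a) {i : ℕ} (hi : i < len a b + len b c + len c a) :
    ∃ x ∈ conv {a, b, c}, ‖D (sidePt a b c (len a b) (len b c) (len c a) i 0) - H x‖ ≤ 3 := by
  rcases sidePt_cases (a := a) (b := b) (c := c) hi with ⟨j, hj, -, g⟩ | ⟨j, hj, -, g⟩ |
    ⟨j, hj, -, g⟩ <;> rw [g, add_zero]
  · obtain ⟨x, hx, h1⟩ := h.near _ _ hab j hj.le
    exact ⟨x, segment_subset_convexHull (by simp) (by simp) hx, h1⟩
  · obtain ⟨x, hx, h1⟩ := h.near _ _ hbc j hj.le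
    exact ⟨x, segment_subset_convexHull (by simp) (by simp) hx, h1⟩
  · obtain ⟨x, hx, h1⟩ := h.near _ _ hca j hj.le
    exact ⟨x, segment_subset_convexHull (by simp) (by simp) hx, h1⟩

theorem notMem_segment_of_far {q u v w : ℂ} {r s : ℝ} (hu : ‖u - v‖ ≤ s) (hw : ‖w - v‖ ≤ s)
    (hq : r ≤ ‖v - q‖) (hrs : s < r) : q ∉ segment ℝ u w := by
  intro hqs
  have hu' : u ∈ closedBall v s := by rwa [mem_closedBall, dist_eq_norm]
  have hw' : w ∈ closedBall v s := by rwa [mem_closedBall, dist_eq_norm]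
  have := (convex_closedBall v s).segment_subset hu' hw' hqs
  rw [mem_closedBall, dist_comm, dist_eq_norm] at this
  linarith

/-- The vertices outside a triangle have winding number zero. -/
theorem Drawing.wind_vertex (h : Drawing Adj H R N D len) (hR : 20 ≤ R) {a b c v w : E2}
    (hab : Adj a b) (hbc : Adj b c) (hca : Adj c a) (hvw : Adj v w)
    {T : E2 →ᵃ[ℝ] ℂ} (hTa : T a = 0) (hTb : T b = 1) (hTc : T c = Complex.I)
    (hH : ContinuousOn H (conv {a, b, c})) {ρ : ℝ} (hρ : 100 * R ≤ ρ)
    (far : ∀ x ∈ conv {a, b, c}, ρ ≤ ‖H x - H v‖)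
    (contr : ∀ x ∈ conv {a, b, c}, ∀ y ∈ conv {a, b, c}, ‖H x - H y‖ ≤ 3 * R → ∀ s ∈ Icc (0 : ℝ) 1,
        ‖H (AffineMap.lineMap x a s) - H (AffineMap.lineMap y a s)‖ ≤ ρ / 8)
    {p : ℕ → ℂ} (hp : p = fun i => D (sidePt a b c (len a b) (len b c) (len c a) i 0))
    {I : Finset ℕ} (hI : I = Finset.range (len a b + len b c + len c a)) : wind p I (D v) = 0 := by
  have hloop := sidePt_pathLoop (a := a) (b := b) (c := c) (h.pos _ _ hab) (h.pos _ _ hbc)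
    (h.pos _ _ hca) T hTa hTb hTc
  have hcard : 2 ≤ I.card := by rw [hI, Finset.card_range]; linarith [hloop.three_le]
  have hnear : ∀ i, ∃ x, i ∈ I → x ∈ conv {a, b, c} ∧ ‖p i - H x‖ ≤ 3 := by
    intro i
    by_cases hi : i ∈ I
    · obtain ⟨x, hx, h1⟩ := h.near_sidePt hab hbc hca (i := i) (by rw [hI] at hi; simpa using hi)
      exact ⟨x, fun _ => ⟨hx, by rw [hp]; exact h1⟩⟩
    grind
  choose x hx using hnear
  have hedge : ∀ e ∈ cycEdges I, e.1 ∈ I ∧ e.2 ∈ I ∧ ‖p e.1 - p e.2‖ ≤ 2 * R := by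
    intro e he
    have he' := he
    rw [hI] at he
    obtain ⟨h1, h2, h3⟩ := hloop.edge he
    have hm := mem_cycEdges.1 he'
    refine ⟨hm.1, hm.2.1, ?_⟩
    rw [hp]
    simp only
    rw [← h3]
    exact h.step_sidePt hab hbc hca h1
  have hxx : ∀ e ∈ cycEdges I, ‖H (x e.1) - H (x e.2)‖ ≤ 2 * R + 6 := by
    intro e he
    obtain ⟨h1, h2, h3⟩ := hedge e he
    have g1 := (hx _ h1).2
    have g2 := (hx _ h2).2
    calc ‖H (x e.1) - H (x e.2)‖ =
          ‖(p e.1 - p e.2) - (p e.1 - H (x e.1)) + (p e.2 - H (x e.2))‖ := by congr 1; ring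
      _ ≤ ‖p e.1 - p e.2‖ + ‖p e.1 - H (x e.1)‖ + ‖p e.2 - H (x e.2)‖ :=
        (norm_add_le _ _).trans (by gcongr; exact norm_sub_le _ _)
      _ ≤ _ := by linarith
  have hDv : ‖D v - H v‖ ≤ 2 := h.vertex _ _ hvw
  have hfar : ∀ y ∈ conv {a, b, c}, ρ - 2 ≤ ‖H y - D v‖ := by
    intro y hy
    have := far y hy
    have h1 : ‖H y - H v‖ ≤ ‖H y - D v‖ + ‖D v - H v‖ := norm_sub_le_norm_sub_add_norm_sub _ _ _
    linarith
  have ha : a ∈ conv {a, b, c} := subset_convexHull ℝ _ (by simp)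
  have s1 := wind_const (I := I) hcard (T := Icc (0 : ℝ) 1) isPreconnected_Icc
    (fun i t => AffineMap.lineMap (p i) (H (x i)) t) (fun _ => D v)
    (fun i _ => AffineMap.lineMap_continuous.continuousOn) continuousOn_const (by
      rintro t ht ⟨e, he, hz⟩
      obtain ⟨h1, h2, h3⟩ := hedge e he
      have g0 := hxx e he
      have gen : ∀ i ∈ I, ‖(AffineMap.lineMap (p i) (H (x i)) t : ℂ) - H (x i)‖ ≤ 3 := by
        intro i hi
        have : (AffineMap.lineMap (p i) (H (x i)) t : ℂ) - H (x i) =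
            ((1 - t : ℝ) : ℂ) * (p i - H (x i)) := by
          rw [AffineMap.lineMap_apply]; simp; ring
        rw [this, norm_mul, Complex.norm_real, Real.norm_of_nonneg (by linarith [ht.2])]
        have := (hx i hi).2
        nlinarith [ht.1, ht.2, norm_nonneg (p i - H (x i))]
      have g1 := gen _ h1
      have g2 := gen _ h2
      refine notMem_segment_of_far (v := H (x e.1)) (s := 2 * R + 9) (r := ρ - 2) (by linarith) ?_
        (hfar _ (hx _ h1).1) (by linarith) hz
      calc _ ≤ ‖(AffineMap.lineMap (p e.2) (H (x e.2)) t : ℂ) - H (x e.2)‖ +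
            ‖H (x e.2) - H (x e.1)‖ := norm_sub_le_norm_sub_add_norm_sub _ _ _
        _ ≤ _ := by rw [norm_sub_rev (H (x e.2))]; linarith)
    (s := 0) (t := 1) (by simp) (by simp)
  have s2 := wind_const (I := I) hcard (T := Icc (0 : ℝ) 1) isPreconnected_Icc
    (fun i t => H (AffineMap.lineMap (x i) a t)) (fun _ => D v)
    (fun i hi => hH.comp AffineMap.lineMap_continuous.continuousOn fun t ht =>
      (convex_convexHull ℝ _).segment_subset (hx i hi).1 ha (by
        rw [segment_eq_image_lineMap]; exact mem_image_of_mem _ ht)) continuousOn_const (by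
      rintro t ht ⟨e, he, hz⟩
      obtain ⟨h1, h2, h3⟩ := hedge e he
      have g0 := contr _ (hx _ h1).1 _ (hx _ h2).1 (by linarith [hxx e he]) t ht
      refine notMem_segment_of_far (v := H (AffineMap.lineMap (x e.1) a t)) (s := ρ / 8)
        (r := ρ - 2) (by rw [sub_self, norm_zero]; linarith) (by rw [norm_sub_rev]; exact g0)
        (hfar _ ?_) (by linarith) hz
      exact (convex_convexHull ℝ _).segment_subset (hx _ h1).1 ha (by
        rw [segment_eq_image_lineMap]; exact mem_image_of_mem _ ht))
    (s := 0) (t := 1) (by simp) (by simp)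
  simp only [AffineMap.lineMap_apply_zero, AffineMap.lineMap_apply_one] at s1 s2
  rw [wind_const_poly] at s2
  exact s1.trans s2

end Drawing

open Geometry.SimplicialComplex

/-- The union of the edges spanned by a finite set of points. -/
def edges (s : Finset E2) : Set E2 := {x | ∃ u ∈ s, ∃ v ∈ s, u ≠ v ∧ x ∈ segment ℝ u v}

theorem edges_triple {a b c : E2} (hab : a ≠ b) (hbc : b ≠ c) (hca : c ≠ a) :
    edges {a, b, c} = {x | x ∈ segment ℝ a b ∨ x ∈ segment ℝ b c ∨ x ∈ segment ℝ c a} := by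
  ext x
  simp only [edges, Finset.mem_insert, Finset.mem_singleton, mem_ofPred_eq]
  constructor
  · rintro ⟨u, rfl | rfl | rfl, v, rfl | rfl | rfl, huv, hx⟩ <;>
      first
        | exact absurd rfl huv
        | (first | exact Or.inl hx | exact Or.inr (Or.inl hx) | exact Or.inr (Or.inr hx) |
            (rw [segment_symm] at hx
             simp_all))
  grind

theorem edges_subset (s : Finset E2) : edges s ⊆ cell s := by
  rintro x ⟨u, hu, v, hv, -, hx⟩
  exact (convex_convexHull ℝ _).segment_subset (subset_convexHull ℝ _ hu)
    (subset_convexHull ℝ _ hv) hx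

theorem mem_edges_of_mem {s : Finset E2} (hs : s.card = 3) {u : E2} (hu : u ∈ s) : u ∈ edges s := by
  obtain ⟨v, hv, hne⟩ := Finset.exists_mem_ne (by omega : 1 < s.card) u
  exact ⟨u, hu, v, hv, hne.symm, left_mem_segment ℝ _ _⟩

namespace Geometry.SimplicialComplex

variable (K : SimplicialComplex ℝ E2)

/-- Adjacency of vertices in a complex. -/
def EdgeAdj (u v : E2) : Prop := u ≠ v ∧ {u, v} ∈ K.faces

variable {K}

theorem edgeAdj_of_mem {s : Finset E2} (hs : s ∈ K.faces) {u v : E2} (hu : u ∈ s) (hv : v ∈ s)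
    (huv : u ≠ v) : K.EdgeAdj u v :=
  ⟨huv, K.down_closed hs (by simp [Finset.insert_subset_iff, hu, hv]) (by simp)⟩

theorem mem_hull_inter {s t : Finset E2} (hs : s ∈ K.faces) (ht : t ∈ K.faces) {x : E2}
    (hx : x ∈ cell s) (hx' : x ∈ cell t) : x ∈ conv ((s ∩ t : Finset E2) : Set E2) := by
  rw [Finset.coe_inter, ← K.convexHull_inter_convexHull hs ht]
  exact ⟨hx, hx'⟩

theorem mem_edges_of_inter {s t : Finset E2} (hs : s ∈ K.faces) (ht : t ∈ K.faces)
    (hs3 : s.card = 3) (ht3 : t.card = 3) (hst : s ≠ t) {x : E2}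
    (hx : x ∈ cell s) (hx' : x ∈ cell t) : x ∈ edges s := by
  have h := mem_hull_inter hs ht hx hx'
  have hc : (s ∩ t).card < 3 := by
    by_contra hc
    have h1 : s ∩ t = s := Finset.eq_of_subset_of_card_le Finset.inter_subset_left (by omega)
    exact hst (Finset.eq_of_subset_of_card_le (Finset.inter_eq_left.1 h1) (by omega))
  have hsub : s ∩ t ⊆ s := Finset.inter_subset_left
  have h0 : (s ∩ t).Nonempty := by
    rw [← Finset.coe_nonempty, ← convexHull_nonempty_iff (𝕜 := ℝ)]; exact ⟨x, h⟩
  have hpos := h0.card_pos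
  rcases (by omega : (s ∩ t).card = 1 ∨ (s ∩ t).card = 2) with h1 | h1
  · obtain ⟨u, hu⟩ := Finset.card_eq_one.1 h1
    rw [hu, Finset.coe_singleton, convexHull_singleton, mem_singleton_iff] at h
    rw [h]
    exact mem_edges_of_mem hs3 (hsub (by rw [hu]; simp))
  · obtain ⟨u, v, huv, hu⟩ := Finset.card_eq_two.1 h1
    rw [hu, Finset.coe_pair, convexHull_pair] at h
    exact ⟨u, hsub (by rw [hu]; simp), v, hsub (by rw [hu]; simp), huv, h⟩

theorem vertex_notMem_edges {s : Finset E2} (hs : s ∈ K.faces) {v : E2} (hv : {v} ∈ K.faces)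
    (hvs : v ∉ s) : v ∉ cell s := by
  intro hx
  have := mem_hull_inter hs hv hx (by simp)
  simp_all

end Geometry.SimplicialComplex

theorem eq_left_of_mem_segments {u v y : E2} (h1 : y ∈ segment ℝ u v) (h2 : u ∈ segment ℝ y v) :
    y = u := by
  rw [mem_segment_iff_wbtw] at h1 h2
  exact (h1.swap_left_iff.1 h2).symm

/-- A piecewise affine map of a triangle onto a polygon extending the drawing of its edges. -/
structure CellMap (K : SimplicialComplex ℝ E2) (D : E2 → ℂ) (s : Finset E2) (f : E2 → ℂ)
    (p : ℕ → ℂ) (I : Finset ℕ) (ε : ℝ) : Prop where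
  card : 2 ≤ I.card
  jordan : PolyJordan p I ε
  curve : polyCurve p I = D '' edges s
  pl : PLOn f (cell s)
  inj : InjOn f (cell s)
  maps : ∀ x ∈ cell s, f x ∈ polyCurve p I ∪ polyInside p I ε
  edge : ∀ x ∈ edges s, f x = D x
  wind : ∀ v w, K.EdgeAdj v w → v ∉ s → wind p I (D v) = 0

section

variable {K : SimplicialComplex ℝ E2} {H D : E2 → ℂ} {R : ℝ} {N : ℕ} {len : E2 → E2 → ℕ}
  {s t : Finset E2} {f g : E2 → ℂ} {p q : ℕ → ℂ} {I J : Finset ℕ} {ε δ : ℝ}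

theorem Drawing.inj_edges (h : Drawing K.EdgeAdj H R N D len) (hs : s ∈ K.faces)
    (ht : t ∈ K.faces) {x y : E2} (hx : x ∈ edges s) (hy : y ∈ edges t) (hxy : D x = D y) :
    x = y := by
  obtain ⟨u, hu, v, hv, huv, hx⟩ := hx
  obtain ⟨u', hu', v', hv', huv', hy⟩ := hy
  exact h.inj _ _ _ _ _ _ (edgeAdj_of_mem hs hu hv huv) (edgeAdj_of_mem ht hu' hv' huv') hx hy hxy

theorem CellMap.wind_eq_zero (h : Drawing K.EdgeAdj H R N D len) (hs : s ∈ K.faces)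
    (ht : t ∈ K.faces) (hs3 : s.card = 3) (hf : CellMap K D s f p I ε) :
    ∀ x ∈ D '' edges t, x ∉ polyCurve p I → _root_.wind p I x = 0 := by
  rintro _ ⟨y, ⟨u, hu, v, hv, huv, hy⟩, rfl⟩ hnot
  rw [hf.curve] at hnot
  have hys : y ∉ edges s := fun hys => hnot (mem_image_of_mem _ hys)
  have main : ∀ u ∈ t, ∀ v ∈ t, u ≠ v → y ∈ segment ℝ u v → v ∉ s →
      _root_.wind p I (D y) = 0 := by
    intro u hu v hv huv hy hvs
    have hadj := edgeAdj_of_mem ht hu hv huv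
    have hsub : segment ℝ y v ⊆ segment ℝ u v :=
      (convex_segment u v).segment_subset hy (right_mem_segment ℝ _ _)
    have havoid : ∀ z ∈ D '' segment ℝ y v, z ∉ polyCurve p I := by
      rintro _ ⟨z, hz, rfl⟩ hzc
      rw [hf.curve] at hzc
      obtain ⟨z', hz', hzz⟩ := hzc
      have hzt : z ∈ edges t := ⟨u, hu, v, hv, huv, hsub hz⟩
      rw [h.inj_edges hs ht hz' hzt hzz] at hz'
      have hzi := mem_hull_inter hs hadj.2 (edges_subset s hz') (by
        rw [Finset.coe_pair, convexHull_pair]; exact hsub hz)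
      have hsing : s ∩ {u, v} ⊆ {u} := by
        intro w hw
        simp only [Finset.mem_inter, Finset.mem_insert, Finset.mem_singleton] at hw ⊢
        grind
      have hzu := convexHull_mono (𝕜 := ℝ) (Finset.coe_subset.2 hsing) hzi
      rw [Finset.coe_singleton, convexHull_singleton, mem_singleton_iff] at hzu
      have hus : u ∈ s := by
        by_contra hus
        simp_all
      rw [hzu] at hz
      exact hys (eq_left_of_mem_segments hy hz ▸ mem_edges_of_mem hs3 hus)
    rw [wind_const_point hf.card (h.preconnected hadj hy) havoid
      (mem_image_of_mem D (left_mem_segment ℝ y v)) (mem_image_of_mem D (right_mem_segment ℝ y v))]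
    exact hf.wind v u (edgeAdj_of_mem ht hv hu huv.symm) hvs
  by_cases hvs : v ∈ s
  · by_cases hus : u ∈ s
    · exact absurd ⟨u, hus, v, hvs, huv, hy⟩ hys
    · exact main v hv u hu huv.symm (by rwa [segment_symm]) hus
  grind

theorem CellMap.eq_of_eq (h : Drawing K.EdgeAdj H R N D len) (hs : s ∈ K.faces)
    (ht : t ∈ K.faces) (hs3 : s.card = 3) (ht3 : t.card = 3) (hst : s ≠ t)
    (hf : CellMap K D s f p I ε) (hg : CellMap K D t g q J δ) {x y : E2}
    (hx : x ∈ cell s) (hy : y ∈ cell t) (hxy : f x = g y) : x = y := by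
  have hex : ∃ v ∈ t, v ∉ s := by
    by_contra! hc
    exact hst (Finset.eq_of_subset_of_card_le hc (by omega)).symm
  obtain ⟨v, hv, hvs⟩ := hex
  have hv1 : {v} ∈ K.faces := K.down_closed ht (by simpa using hv) (by simp)
  have hz : D v ∈ polyCurve q J := by
    rw [hg.curve]; exact mem_image_of_mem _ (mem_edges_of_mem ht3 hv)
  have hz' : D v ∉ polyCurve p I := by
    rw [hf.curve]
    rintro ⟨w, hw, hwv⟩
    have := h.inj_edges hs ht hw (mem_edges_of_mem ht3 hv) hwv
    rw [this] at hw
    exact vertex_notMem_edges hs hv1 hvs (edges_subset s hw)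
  have h1 := PolyJordan.disjoint hf.card hf.jordan hg.jordan
    (by rw [hg.curve]; exact hf.wind_eq_zero h hs ht hs3)
    (by rw [hf.curve]; exact hg.wind_eq_zero h ht hs ht3) hz hz'
    ⟨hf.maps x hx, by rw [hxy]; exact hg.maps y hy⟩
  rw [hf.curve, hg.curve] at h1
  obtain ⟨⟨x', hx', hxx⟩, ⟨y', hy', hyy⟩⟩ := h1
  have e1 : x' = x := hf.inj (edges_subset s hx') hx ((hf.edge x' hx').trans hxx)
  have e2 : y' = y := hg.inj (edges_subset t hy') hy
    ((hg.edge y' hy').trans (hyy.trans hxy))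
  rw [← e1, ← e2]
  exact h.inj_edges hs ht hx' hy' (hxx.trans hyy.symm)

/-- Gluing the polygonal fillings of the triangles of a complex. -/
theorem Drawing.exists_glue (h : Drawing K.EdgeAdj H R N D len) (hR : 20 ≤ R)
    (hpure : ∀ s ∈ K.faces, ∃ t ∈ K.faces, s ⊆ t ∧ t.card = 3)
    (hH : ContinuousOn H K.space) {ρ : ℝ} (hρ : 100 * R ≤ ρ)
    (far : ∀ s ∈ K.faces, ∀ v, {v} ∈ K.faces → v ∉ s → ∀ x ∈ cell s, ρ ≤ ‖H x - H v‖)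
    (contr : ∀ s ∈ K.faces, ∀ a ∈ s, ∀ x ∈ cell s,
      ∀ y ∈ cell s, ‖H x - H y‖ ≤ 3 * R → ∀ t ∈ Icc (0 : ℝ) 1,
        ‖H (AffineMap.lineMap x a t) - H (AffineMap.lineMap y a t)‖ ≤ ρ / 8)
    {κ L Λ : ℝ} (hκ : 0 < κ)
    (bump : ∀ n₁ n₂ n₃, 0 < n₁ → 0 < n₂ → 0 < n₃ → n₁ ≤ N → n₂ ≤ N → n₃ ≤ N →
      ∃ φ, Bump n₁ n₂ n₃ κ φ) (hL : ∀ s ∈ K.faces, ∀ x ∈ cell s, ∀ y ∈ cell s, ‖H x - H y‖ ≤ L)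
    (hT : ∀ a b c, a ≠ b → b ≠ c → c ≠ a → {a, b, c} ∈ K.faces → ∃ T : E2 →ᵃ[ℝ] ℂ, T a = 0 ∧
      T b = 1 ∧ T c = Complex.I ∧ Function.Injective T ∧ ∀ x ∈ conv {a, b, c},
        ∀ y ∈ conv {a, b, c}, ‖T x - T y‖ ≤ Λ * ‖x - y‖) :
    ∃ f : E2 → ℂ, InjOn f K.space ∧ (∀ x ∈ K.space, ‖f x - H x‖ ≤ L + 3) ∧
      ∀ s ∈ K.faces, s.card = 3 → PLOn f (cell s) ∧ ∀ x ∈ cell s, ∀ y ∈ cell s,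
          ‖f x - f y‖ ≤ 32 * (L + 6) / κ * (Λ * ‖x - y‖) := by
  have hsub : ∀ s ∈ K.faces, cell s ⊆ K.space := fun s hs =>
    K.convexHull_subset_space hs
  have hcells : ∀ s : Finset E2, ∃ f : E2 → ℂ, s ∈ K.faces → s.card = 3 →
      (∃ p I ε, CellMap K D s f p I ε) ∧ (∀ x ∈ cell s, ‖f x - H x‖ ≤ L + 3) ∧
        ∀ x ∈ cell s, ∀ y ∈ cell s,
          ‖f x - f y‖ ≤ 32 * (L + 6) / κ * (Λ * ‖x - y‖) := by
    intro s
    by_cases hs : s ∈ K.faces ∧ s.card = 3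
    swap
    · exact ⟨0, fun h1 h2 => absurd ⟨h1, h2⟩ hs⟩
    obtain ⟨hs, hs3⟩ := hs
    obtain ⟨a, b, c, hab, hac, hbc, rfl⟩ := Finset.card_eq_three.1 hs3
    have hca := hac.symm
    obtain ⟨T, hTa, hTb, hTc, hTi, hTl⟩ := hT a b c hab hbc hca hs
    have jab := edgeAdj_of_mem hs (by simp) (by simp) hab
    have jbc := edgeAdj_of_mem hs (by simp) (by simp) hbc
    have jca := edgeAdj_of_mem hs (by simp) (by simp) hca
    obtain ⟨φ, hφ⟩ := bump _ _ _ (h.pos _ _ jab) (h.pos _ _ jbc) (h.pos _ _ jca) (h.le _ _ jab)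
      (h.le _ _ jbc) (h.le _ _ jca)
    have hset : (({a, b, c} : Finset E2) : Set E2) = {a, b, c} := by simp
    have hL' := hL _ hs
    have contr' := contr _ hs a (by simp)
    have far' := far _ hs
    have hHc := hH.mono (hsub _ hs)
    rw [hset] at hL' contr' far' hHc ⊢
    have hnode : ∀ i < len a b + len b c + len c a, ∀ x ∈ conv {a, b, c},
        ‖D (sidePt a b c (len a b) (len b c) (len c a) i 0) - H x‖ ≤ L + 3 := by
      intro i hi x hx
      obtain ⟨y, hy, hyi⟩ := h.near_sidePt jab jbc jca hi
      have := hL' y hy x hx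
      have h1 := norm_sub_le_norm_sub_add_norm_sub
        (D (sidePt a b c (len a b) (len b c) (len c a) i 0)) (H y) (H x)
      linarith
    obtain ⟨hsim, hcur, ε, f, hj, hpl, hinj, hmaps, hbd, hhull, hlip⟩ :=
      h.exists_cellMap jab jbc jca T hTa hTb hTc hTi hκ hφ (L := L + 6) (by
        intro i hi j hj
        obtain ⟨y, hy, hyi⟩ := h.near_sidePt jab jbc jca hj
        have h2 := hnode i hi y hy
        have h1 := norm_sub_le_norm_sub_add_norm_sub
          (D (sidePt a b c (len a b) (len b c) (len c a) i 0)) (H y)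
          (D (sidePt a b c (len a b) (len b c) (len c a) j 0))
        rw [norm_sub_rev (H y)] at h1
        linarith) rfl rfl
    refine ⟨f, fun _ _ => ⟨⟨_, _, ε, ?_, hj, ?_, ?_, ?_, ?_, ?_, ?_⟩, ?_, ?_⟩⟩
    · exact (by norm_num : 2 ≤ 3).trans hsim.card
    · rw [hcur, edges_triple hab hbc hca]
    · rwa [hset]
    · rwa [hset]
    · rwa [hset]
    · rwa [edges_triple hab hbc hca]
    · intro v w hvw hv
      refine h.wind_vertex hR jab jbc jca hvw hTa hTb hTc hHc hρ ?_ contr' rfl rfl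
      exact far' v (K.down_closed hvw.2 (by simp) (by simp)) hv
    · intro x hx
      have hb : (fun i => D (sidePt a b c (len a b) (len b c) (len c a) i 0)) ''
          (Finset.range (len a b + len b c + len c a)) ⊆ closedBall (H x) (L + 3) := by
        rintro _ ⟨i, hi, rfl⟩
        rw [mem_closedBall, dist_eq_norm]
        exact hnode i (by simpa using hi) x hx
      have := convexHull_min hb (convex_closedBall _ _) (hhull x hx)
      rwa [mem_closedBall, dist_eq_norm] at this
    · intro x hx y hy
      have hL0 : 0 ≤ L := (norm_nonneg _).trans (hL' x hx x hx)
      exact (hlip x hx y hy).trans (mul_le_mul_of_nonneg_left (hTl x hx y hy) (by positivity))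
  choose F hF using hcells
  classical
  have hcov : ∀ x ∈ K.space, ∃ s ∈ K.faces, s.card = 3 ∧ x ∈ cell s := by
    intro x hx
    obtain ⟨s, hs, hxs⟩ := K.mem_space_iff.1 hx
    obtain ⟨t, ht, hst, ht3⟩ := hpure s hs
    exact ⟨t, ht, ht3, convexHull_mono (Finset.coe_subset.2 hst) hxs⟩
  have hS : ∀ x, ∃ s, x ∈ K.space → s ∈ K.faces ∧ s.card = 3 ∧ x ∈ cell s := by
    intro x
    by_cases hx : x ∈ K.space
    · obtain ⟨s, hs⟩ := hcov x hx
      exact ⟨s, fun _ => hs⟩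
    · exact ⟨∅, fun h => absurd h hx⟩
  choose S hS using hS
  have hval : ∀ s ∈ K.faces, s.card = 3 → ∀ x ∈ cell s, F (S x) x = F s x := by
    intro s hs hs3 x hx
    obtain ⟨h1, h2, h3⟩ := hS x (hsub s hs hx)
    by_cases hne : S x = s
    · rw [hne]
    obtain ⟨_, _, _, c1⟩ := (hF _ h1 h2).1
    obtain ⟨_, _, _, c2⟩ := (hF _ hs hs3).1
    rw [c1.edge x (mem_edges_of_inter h1 hs h2 hs3 hne h3 hx),
      c2.edge x (mem_edges_of_inter hs h1 hs3 h2 (Ne.symm hne) hx h3)]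
  refine ⟨fun x => F (S x) x, ?_, ?_, ?_⟩
  · intro x hx y hy hxy
    obtain ⟨h1, h2, h3⟩ := hS x hx
    obtain ⟨g1, g2, g3⟩ := hS y hy
    simp only at hxy
    obtain ⟨_, _, _, c1⟩ := (hF _ h1 h2).1
    obtain ⟨_, _, _, c2⟩ := (hF _ g1 g2).1
    by_cases hne : S x = S y
    · rw [← hne] at hxy g3
      exact c1.inj h3 g3 hxy
    · exact c1.eq_of_eq h h1 g1 h2 g2 hne c2 h3 g3 hxy
  · intro x hx
    obtain ⟨h1, h2, h3⟩ := hS x hx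
    exact (hF _ h1 h2).2.1 x h3
  · intro s hs hs3
    obtain ⟨_, _, _, c1⟩ := (hF _ hs hs3).1
    refine ⟨c1.pl.congr fun x hx => hval s hs hs3 x hx, fun x hx y hy => ?_⟩
    simp only
    rw [hval s hs hs3 x hx, hval s hs hs3 y hy]
    exact (hF _ hs hs3).2.2 x hx y hy

end

/-- The homogenised secant of `x (1 - x)` between `i / n` and `(i + 1) / n`. -/
def secant (n i : ℕ) (s t : ℝ) : ℝ :=
  (i : ℝ) / n * (((i : ℝ) + 1) / n) * s + (1 - (i : ℝ) / n) * (1 - ((i : ℝ) + 1) / n) * t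

/-- The minimum of the first `k + 1` secants. -/
def tent (n : ℕ) : ℕ → ℝ → ℝ → ℝ
  | 0 => secant n 0
  | k + 1 => fun s t => min (tent n k s t) (secant n (k + 1) s t)

theorem tent_le {n k i : ℕ} (hi : i ≤ k) (s t : ℝ) : tent n k s t ≤ secant n i s t := by
  induction k with
  | zero => rw [Nat.le_zero.1 hi]; rfl
  | succ k ih =>
    rcases hi.eq_or_lt with rfl | h
    · exact min_le_right _ _
    · exact (min_le_left _ _).trans (ih (by omega))

theorem le_tent {n k : ℕ} {s t v : ℝ} (h : ∀ i ≤ k, v ≤ secant n i s t) : v ≤ tent n k s t := by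
  induction k with
  | zero => exact h 0 le_rfl
  | succ k ih => exact le_min (ih fun i hi => h i (by omega)) (h _ le_rfl)

theorem secant_coeff {n i : ℕ} (hi : i < n) : 0 ≤ (i : ℝ) / n ∧ ((i : ℝ) + 1) / n ≤ 1 ∧
    (i : ℝ) / n ≤ ((i : ℝ) + 1) / n := by
  have hn : (0 : ℝ) < n := mod_cast (by omega : 0 < n)
  have : (i : ℝ) + 1 ≤ n := mod_cast hi
  refine ⟨by positivity, by rw [div_le_one hn]; exact this, by gcongr; linarith⟩

theorem secant_nonneg {n i : ℕ} (hi : i < n) {s t : ℝ} (hs : 0 ≤ s) (ht : 0 ≤ t) :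
    0 ≤ secant n i s t := by
  obtain ⟨h1, h2, h3⟩ := secant_coeff hi
  have h5 : 0 ≤ 1 - (i : ℝ) / n := by linarith
  unfold secant
  positivity

theorem tent_smul (n k : ℕ) {r : ℝ} (hr : 0 ≤ r) (s t : ℝ) :
    tent n k (r * s) (r * t) = r * tent n k s t := by
  have hs : ∀ i, secant n i (r * s) (r * t) = r * secant n i s t := fun i => by
    unfold secant; ring
  induction k with
  | zero => exact hs 0
  | succ k ih =>
    change min _ _ = r * min _ _
    rw [ih, hs, mul_min_of_nonneg _ _ hr]

theorem tent_left {n : ℕ} (hn : 0 < n) {t : ℝ} (ht : 0 ≤ t) : tent n (n - 1) 0 t = 0 := by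
  refine le_antisymm ((tent_le le_rfl _ _).trans ?_)
    (le_tent fun i hi => secant_nonneg (by omega) le_rfl ht)
  have : ((n - 1 : ℕ) : ℝ) + 1 = n := mod_cast Nat.sub_add_cancel hn
  have hn' : (n : ℝ) ≠ 0 := by positivity
  rw [secant, this, div_self hn']
  simp

theorem tent_right {n : ℕ} (hn : 0 < n) {s : ℝ} (hs : 0 ≤ s) : tent n (n - 1) s 0 = 0 := by
  refine le_antisymm ((tent_le (Nat.zero_le _) _ _).trans ?_)
    (le_tent fun i hi => secant_nonneg (by omega) hs le_rfl)
  simp [secant]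

theorem tent_lip {n k : ℕ} (hk : k < n) (s t s' t' : ℝ) :
    |tent n k s t - tent n k s' t'| ≤ |s - s'| + |t - t'| := by
  have hs : ∀ i < n, |secant n i s t - secant n i s' t'| ≤ |s - s'| + |t - t'| := by
    intro i hi
    obtain ⟨h1, h2, h3⟩ := secant_coeff hi
    have e : secant n i s t - secant n i s' t' = (i : ℝ) / n * (((i : ℝ) + 1) / n) * (s - s') +
        (1 - (i : ℝ) / n) * (1 - ((i : ℝ) + 1) / n) * (t - t') := by unfold secant; ring
    have g1 : |(i : ℝ) / n * (((i : ℝ) + 1) / n)| ≤ 1 := by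
      rw [abs_of_nonneg (mul_nonneg h1 (h1.trans h3))]
      exact mul_le_one₀ (h3.trans h2) (h1.trans h3) h2
    have g2 : |(1 - (i : ℝ) / n) * (1 - ((i : ℝ) + 1) / n)| ≤ 1 := by
      rw [abs_of_nonneg (mul_nonneg (by linarith) (by linarith))]
      exact mul_le_one₀ (by linarith) (by linarith) (by linarith)
    rw [e]
    refine (abs_add_le _ _).trans ?_
    rw [abs_mul _ (s - s'), abs_mul _ (t - t')]
    exact add_le_add (mul_le_of_le_one_left (abs_nonneg _) g1)
      (mul_le_of_le_one_left (abs_nonneg _) g2)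
  induction k with
  | zero => exact hs 0 hk
  | succ k ih => exact (abs_min_sub_min_le_max _ _ _ _).trans (max_le (ih (by omega)) (hs _ hk))

theorem tent_eq {n j : ℕ} (hj : j < n) {x : ℝ} (h1 : (j : ℝ) / n ≤ x) (h2 : x ≤ ((j : ℝ) + 1) / n) :
    tent n (n - 1) (1 - x) x = secant n j (1 - x) x := by
  have hn : (0 : ℝ) < n := mod_cast (by omega : 0 < n)
  refine le_antisymm (tent_le (by omega) _ _) (le_tent fun i _ => ?_)
  have e : secant n i (1 - x) x - secant n j (1 - x) x =
      ((i : ℝ) - j) / n * (((i : ℝ) + j + 1) / n - 2 * x) := by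
    unfold secant; field_simp; ring
  rw [← sub_nonneg, e]
  rw [div_le_iff₀ hn] at h1
  rw [le_div_iff₀ hn] at h2
  have e2 : ((i : ℝ) + j + 1) / n - 2 * x = ((i : ℝ) + j + 1 - 2 * (x * n)) / n := by
    field_simp
  rw [e2]
  rcases lt_trichotomy i j with h | h | h
  · have : (i : ℝ) + 1 ≤ j := mod_cast h
    exact mul_nonneg_of_nonpos_of_nonpos (div_nonpos_of_nonpos_of_nonneg (by linarith) hn.le)
      (div_nonpos_of_nonpos_of_nonneg (by linarith) hn.le)
  · simp_all
  · have : (j : ℝ) + 1 ≤ i := mod_cast h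
    exact mul_nonneg (div_nonneg (by linarith) hn.le) (div_nonneg (by linarith) hn.le)

theorem PLOn.tent {E : Type*} [AddCommGroup E] [Module ℝ E] {f g : E → ℝ} {S : Set E}
    (hf : PLOn f S) (hg : PLOn g S) (hS : Convex ℝ S) (n k : ℕ) :
    PLOn (fun x => _root_.tent n k (f x) (g x)) S := by
  have hs : ∀ i, PLOn (fun x => secant n i (f x) (g x)) S := fun i => by
    have := (hf.prodMk hg).affine_comp
      (((((i : ℝ) / n * (((i : ℝ) + 1) / n)) • LinearMap.fst ℝ ℝ ℝ +
        ((1 - (i : ℝ) / n) * (1 - ((i : ℝ) + 1) / n)) • LinearMap.snd ℝ ℝ ℝ)).toAffineMap)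
    refine this.congr fun x _ => ?_
    simp [secant]
  induction k with
  | zero => exact hs 0
  | succ k ih => exact ih.min (hs _) hS

/-- The smallest barycentric coordinate in the model triangle. -/
def minBary (x : ℂ) : ℝ := min (1 - x.re - x.im) (min x.re x.im)

/-- The map pushing the sides of the model triangle outwards into convex polygonal arcs. -/
def bumpMap (n₁ n₂ n₃ : ℕ) (x : ℂ) : ℂ :=
  x + ((1 / 100 * tent n₁ (n₁ - 1) (1 - x.re - x.im - minBary x) (x.re - minBary x) : ℝ) *
      (1 - 2 * Complex.I) +
    ((1 / 100 * tent n₂ (n₂ - 1) (x.re - minBary x) (x.im - minBary x) : ℝ) * (1 + Complex.I) +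
    (1 / 100 * tent n₃ (n₃ - 1) (x.im - minBary x) (1 - x.re - x.im - minBary x) : ℝ) *
      (-2 + Complex.I)))

section bumpMap

variable {n₁ n₂ n₃ : ℕ}

theorem bumpMap_side₁ (h2 : 0 < n₂) (h3 : 0 < n₃) {a b : ℝ} (ha : 0 ≤ a) (hb : 0 ≤ b) :
    bumpMap n₁ n₂ n₃ (((1 - a - b) / 3 : ℝ) * (1 + Complex.I) + b) =
      ((1 - a - b) / 3 : ℝ) * (1 + Complex.I) + b +
      (1 / 100 * tent n₁ (n₁ - 1) a b : ℝ) * (1 - 2 * Complex.I) := by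
  set x : ℂ := ((1 - a - b) / 3 : ℝ) * (1 + Complex.I) + b with hx
  have hre : x.re = (1 - a - b) / 3 + b := by rw [hx]; simp
  have him : x.im = (1 - a - b) / 3 := by rw [hx]; simp
  have hm : minBary x = (1 - a - b) / 3 := by
    rw [minBary, hre, him, min_eq_right (by linarith : (1 - a - b) / 3 ≤ (1 - a - b) / 3 + b)]
    grind
  have e0 : 1 - x.re - x.im - minBary x = a := by rw [hm, hre, him]; ring
  have e1 : x.re - minBary x = b := by rw [hm, hre]; ring
  have e2 : x.im - minBary x = 0 := by rw [hm, him]; ring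
  rw [bumpMap, e0, e1, e2, tent_right h2 hb, tent_left h3 ha]
  simp

theorem bumpMap_side₂ (h1 : 0 < n₁) (h3 : 0 < n₃) {a b : ℝ} (ha : 0 ≤ a) (hb : 0 ≤ b) :
    bumpMap n₁ n₂ n₃ (((1 - a - b) / 3 : ℝ) * (1 + Complex.I) + (a + b * Complex.I)) =
      ((1 - a - b) / 3 : ℝ) * (1 + Complex.I) + (a + b * Complex.I) +
      (1 / 100 * tent n₂ (n₂ - 1) a b : ℝ) * (1 + Complex.I) := by
  set x : ℂ := ((1 - a - b) / 3 : ℝ) * (1 + Complex.I) + (a + b * Complex.I) with hx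
  have hre : x.re = (1 - a - b) / 3 + a := by rw [hx]; simp
  have him : x.im = (1 - a - b) / 3 + b := by rw [hx]; simp
  have hm : minBary x = (1 - a - b) / 3 := by
    rw [minBary, hre, him]
    grind
  have e0 : 1 - x.re - x.im - minBary x = 0 := by rw [hm, hre, him]; ring
  have e1 : x.re - minBary x = a := by rw [hm, hre]; ring
  have e2 : x.im - minBary x = b := by rw [hm, him]; ring
  rw [bumpMap, e0, e1, e2, tent_right h3 hb, tent_left h1 ha]
  simp

theorem bumpMap_side₃ (h1 : 0 < n₁) (h2 : 0 < n₂) {a b : ℝ} (ha : 0 ≤ a) (hb : 0 ≤ b) :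
    bumpMap n₁ n₂ n₃ (((1 - a - b) / 3 : ℝ) * (1 + Complex.I) + a * Complex.I) =
      ((1 - a - b) / 3 : ℝ) * (1 + Complex.I) + a * Complex.I +
      (1 / 100 * tent n₃ (n₃ - 1) a b : ℝ) * (-2 + Complex.I) := by
  set x : ℂ := ((1 - a - b) / 3 : ℝ) * (1 + Complex.I) + a * Complex.I with hx
  have hre : x.re = (1 - a - b) / 3 := by rw [hx]; simp
  have him : x.im = (1 - a - b) / 3 + a := by rw [hx]; simp
  have hm : minBary x = (1 - a - b) / 3 := by
    rw [minBary, hre, him, min_eq_left (by linarith : (1 - a - b) / 3 ≤ (1 - a - b) / 3 + a)]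
    grind
  have e0 : 1 - x.re - x.im - minBary x = b := by rw [hm, hre, him]; ring
  have e1 : x.re - minBary x = 0 := by rw [hm, hre]; ring
  have e2 : x.im - minBary x = a := by rw [hm, him]; ring
  rw [bumpMap, e0, e1, e2, tent_right h1 hb, tent_left h2 ha]
  simp

end bumpMap

/-- A point of the bumped first side of the model triangle. -/
def arcPt (s : ℝ) : ℂ := ⟨s + s * (1 - s) / 100, -(s * (1 - s) / 50)⟩

/-- The rotation of the model triangle. -/
def triRot (z : ℂ) : ℂ := ⟨1 - z.re - z.im, z.re⟩

theorem det3_triRot (a b c : ℂ) : det3 (triRot a) (triRot b) (triRot c) = det3 a b c := by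
  simp only [det3, triRot, Complex.sub_re, Complex.sub_im]; ring

theorem triRot_triRot_triRot (a : ℂ) : triRot (triRot (triRot a)) = a := by
  apply Complex.ext <;> simp only [triRot] <;> ring

theorem det3_arc₁ {s t r δ : ℝ} (hδ : 0 < δ) (hst : δ ≤ t - s) (htr : δ ≤ r - t) :
    δ ^ 3 / 50 ≤ det3 (arcPt s) (arcPt t) (arcPt r) := by
  have : det3 (arcPt s) (arcPt t) (arcPt r) = (t - s) * (r - t) * (r - s) / 50 := by
    simp only [det3, arcPt, Complex.sub_re, Complex.sub_im]; ring
  rw [this]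
  have h3 : δ ≤ r - s := by linarith
  have : δ ^ 3 = δ * δ * δ := by ring
  rw [this]
  have : 0 ≤ t - s := by linarith
  have : 0 ≤ r - t := by linarith
  gcongr

theorem det3_arc₂ {s t r δ : ℝ} (hδ : 0 < δ) (hs : 0 ≤ s) (hst : δ ≤ t - s) (ht : δ ≤ 1 - t)
    (hr : 0 ≤ r) (hr' : r ≤ 1) : δ ^ 3 / 50 ≤ det3 (arcPt s) (arcPt t) (triRot (arcPt r)) := by
  have : det3 (arcPt s) (arcPt t) (triRot (arcPt r)) = (t - s) * ((1 - t) * (1 - s) / 50 +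
      (r * (1 - (1 - s - t) / 100) + r * (1 - r) / 100 * (1 + 3 * (1 - s - t) / 100))) := by
    simp only [det3, arcPt, triRot, Complex.sub_re, Complex.sub_im]; ring
  rw [this]
  have e1 : 0 ≤ r * (1 - (1 - s - t) / 100) := mul_nonneg hr (by linarith)
  have e2 : 0 ≤ r * (1 - r) / 100 * (1 + 3 * (1 - s - t) / 100) :=
    mul_nonneg (div_nonneg (mul_nonneg hr (by linarith)) (by norm_num)) (by linarith)
  have h3 : δ * δ / 50 ≤ (1 - t) * (1 - s) / 50 := by gcongr <;> linarith
  have : δ ^ 3 / 50 = δ * (δ * δ / 50) := by ring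
  rw [this]
  exact mul_le_mul hst (by linarith) (by positivity) (by linarith)

theorem det3_arc₃ {s t r δ : ℝ} (hδ : 0 < δ) (hδ1 : δ ≤ 1) (hs : 0 ≤ s) (hst : δ ≤ t - s)
    (ht : t ≤ 1) (hr : 0 ≤ r) (hr' : δ ≤ 1 - r) :
    δ ^ 3 / 50 ≤ det3 (arcPt r) (triRot (arcPt s)) (triRot (arcPt t)) := by
  have : det3 (arcPt r) (triRot (arcPt s)) (triRot (arcPt t)) = (t - s) * (t * s / 50 +
      ((1 - r) * (1 - (s + t - 1) / 100) +
        (1 - r) * r / 100 * (1 + 3 * (s + t - 1) / 100))) := by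
    simp only [det3, arcPt, triRot, Complex.sub_re, Complex.sub_im]; ring
  rw [this]
  have e1 : δ / 50 ≤ (1 - r) * (1 - (s + t - 1) / 100) := by nlinarith
  have e2 : 0 ≤ (1 - r) * r / 100 * (1 + 3 * (s + t - 1) / 100) :=
    mul_nonneg (div_nonneg (mul_nonneg (by linarith) hr) (by norm_num)) (by linarith)
  have e3 : 0 ≤ t * s / 50 := div_nonneg (mul_nonneg (by linarith) hs) (by norm_num)
  have : δ ^ 3 / 50 = δ * (δ * δ / 50) := by ring
  rw [this]
  have : δ * δ ≤ δ := by nlinarith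
  exact mul_le_mul hst (by linarith) (by positivity) (by linarith)

theorem det3_arc₄ {s t r δ : ℝ} (hδ : 0 < δ) (hs : 0 ≤ s) (hs' : δ ≤ 1 - s)
    (ht : 0 ≤ t) (ht' : δ ≤ 1 - t) (hr : 0 ≤ r) (hr' : δ ≤ 1 - r) :
    δ ^ 3 / 50 ≤ det3 (arcPt s) (triRot (arcPt t)) (triRot (triRot (arcPt r))) := by
  have e : det3 (arcPt s) (triRot (arcPt t)) (triRot (triRot (arcPt r))) =
      (1 - s) * (1 - t) * (1 - r) + (s * t * r + s * (1 - s) / 100 * (r + (1 - t)) +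
        t * (1 - t) / 100 * (s + (1 - r)) + r * (1 - r) / 100 * (t + (1 - s)) +
        3 * (s * (1 - s) / 100 * (t * (1 - t) / 100) + t * (1 - t) / 100 * (r * (1 - r) / 100) +
          r * (1 - r) / 100 * (s * (1 - s) / 100))) := by
    simp only [det3, arcPt, triRot, Complex.sub_re, Complex.sub_im]; ring
  rw [e]
  have a1 : 0 ≤ 1 - s := by linarith
  have a2 : 0 ≤ 1 - t := by linarith
  have a3 : 0 ≤ 1 - r := by linarith
  have h1 : δ ^ 3 ≤ (1 - s) * (1 - t) * (1 - r) := by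
    have : δ ^ 3 = δ * δ * δ := by ring
    rw [this]; gcongr
  have h2 : 0 ≤ s * t * r + s * (1 - s) / 100 * (r + (1 - t)) +
        t * (1 - t) / 100 * (s + (1 - r)) + r * (1 - r) / 100 * (t + (1 - s)) +
        3 * (s * (1 - s) / 100 * (t * (1 - t) / 100) + t * (1 - t) / 100 * (r * (1 - r) / 100) +
          r * (1 - r) / 100 * (s * (1 - s) / 100)) := by positivity
  have : 0 < δ ^ 3 := by positivity
  linarith

theorem secant_node {n j : ℕ} (s : ℝ) (hs : s = (j : ℝ) / n) :
    secant n j (1 - s) s = s * (1 - s) := by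
  rw [secant, ← hs, add_div, ← hs]; ring

theorem tent_segment {P Q v : ℂ} {n j : ℕ} (hj : j < n) {s : ℝ} (hs : s ∈ Icc (0 : ℝ) 1)
    {F : ℝ → ℂ} (hF : ∀ x ∈ Icc (0 : ℝ) 1, F x = AffineMap.lineMap P Q x +
      (1 / 100 * tent n (n - 1) (1 - x) x : ℝ) * v) :
    F (((j : ℝ) + s) / n) = AffineMap.lineMap (F (((j : ℝ) + 0) / n)) (F (((j : ℝ) + 1) / n)) s := by
  have key : ∀ t ∈ Icc (0 : ℝ) 1, F (((j : ℝ) + t) / n) = AffineMap.lineMap P Q (((j : ℝ) + t) / n) +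
      (1 / 100 * secant n j (1 - ((j : ℝ) + t) / n) (((j : ℝ) + t) / n) : ℝ) * v := by
    intro t ht
    obtain ⟨h1, h2, h3⟩ := secant_coeff hj
    have g1 : (j : ℝ) / n ≤ ((j : ℝ) + t) / n := by gcongr; linarith [ht.1]
    have g2 : ((j : ℝ) + t) / n ≤ ((j : ℝ) + 1) / n := by gcongr; exact ht.2
    rw [hF _ ⟨h1.trans g1, g2.trans h2⟩, tent_eq hj g1 g2]
  rw [key s hs, key 0 (by simp), key 1 (by simp)]
  simp only [AffineMap.lineMap_apply, secant, vsub_eq_sub, vadd_eq_add, Complex.real_smul]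
  push_cast
  ring

section

variable {n₁ n₂ n₃ : ℕ} (h1 : 0 < n₁) (h2 : 0 < n₂) (h3 : 0 < n₃)

include h1 h2 h3

theorem bumpMap_edge {x : ℝ} (hx : x ∈ Icc (0 : ℝ) 1) :
    bumpMap n₁ n₂ n₃ (AffineMap.lineMap 0 1 x) = AffineMap.lineMap 0 1 x +
      (1 / 100 * tent n₁ (n₁ - 1) (1 - x) x : ℝ) * (1 - 2 * Complex.I) ∧
    bumpMap n₁ n₂ n₃ (AffineMap.lineMap 1 Complex.I x) = AffineMap.lineMap 1 Complex.I x +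
      (1 / 100 * tent n₂ (n₂ - 1) (1 - x) x : ℝ) * (1 + Complex.I) ∧
    bumpMap n₁ n₂ n₃ (AffineMap.lineMap Complex.I 0 x) = AffineMap.lineMap Complex.I 0 x +
      (1 / 100 * tent n₃ (n₃ - 1) (1 - x) x : ℝ) * (-2 + Complex.I) := by
  have ha : 0 ≤ 1 - x := by linarith [hx.2]
  have g1 := bumpMap_side₁ (n₁ := n₁) h2 h3 ha hx.1
  have g2 := bumpMap_side₂ (n₂ := n₂) h1 h3 ha hx.1
  have g3 := bumpMap_side₃ (n₃ := n₃) h1 h2 ha hx.1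
  have e : ((1 - (1 - x) - x) / 3 : ℝ) = 0 := by ring
  rw [e, Complex.ofReal_zero, zero_mul, zero_add] at g1 g2 g3
  have e1 : (AffineMap.lineMap (0 : ℂ) 1 x : ℂ) = x := by simp [AffineMap.lineMap_apply]
  have e2 : (AffineMap.lineMap (1 : ℂ) Complex.I x : ℂ) = (1 - x : ℝ) + x * Complex.I := by
    simp [AffineMap.lineMap_apply]; ring
  have e3 : (AffineMap.lineMap Complex.I 0 x : ℂ) = (1 - x : ℝ) * Complex.I := by
    simp [AffineMap.lineMap_apply]; ring
  grind

theorem bumpMap_lin {i : ℕ} (hi : i < n₁ + n₂ + n₃) {s : ℝ} (hs : s ∈ Icc (0 : ℝ) 1) :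
    bumpMap n₁ n₂ n₃ (sidePt 0 1 Complex.I n₁ n₂ n₃ i s) =
    AffineMap.lineMap (bumpMap n₁ n₂ n₃ (sidePt 0 1 Complex.I n₁ n₂ n₃ i 0))
      (bumpMap n₁ n₂ n₃ (sidePt 0 1 Complex.I n₁ n₂ n₃ i 1)) s := by
  rcases sidePt_cases (a := (0 : ℂ)) (b := 1) (c := Complex.I) hi with ⟨j, hj, -, g⟩ |
    ⟨j, hj, -, g⟩ | ⟨j, hj, -, g⟩ <;> simp only [g]
  · exact tent_segment (F := fun x => bumpMap n₁ n₂ n₃ (AffineMap.lineMap 0 1 x)) hj hs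
      fun x hx => (bumpMap_edge h1 h2 h3 hx).1
  · exact tent_segment (F := fun x => bumpMap n₁ n₂ n₃ (AffineMap.lineMap 1 Complex.I x)) hj hs
      fun x hx => (bumpMap_edge h1 h2 h3 hx).2.1
  · exact tent_segment (F := fun x => bumpMap n₁ n₂ n₃ (AffineMap.lineMap Complex.I 0 x)) hj hs
      fun x hx => (bumpMap_edge h1 h2 h3 hx).2.2

theorem bumpMap_node {i : ℕ} (hi : i < n₁ + n₂ + n₃) :
    (∃ j < n₁, i = j ∧ bumpMap n₁ n₂ n₃ (sidePt 0 1 Complex.I n₁ n₂ n₃ i 0) =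
      arcPt ((j : ℝ) / n₁)) ∨
    (∃ j < n₂, i = n₁ + j ∧ bumpMap n₁ n₂ n₃ (sidePt 0 1 Complex.I n₁ n₂ n₃ i 0) =
      triRot (arcPt ((j : ℝ) / n₂))) ∨
    (∃ j < n₃, i = n₁ + n₂ + j ∧ bumpMap n₁ n₂ n₃ (sidePt 0 1 Complex.I n₁ n₂ n₃ i 0) =
      triRot (triRot (arcPt ((j : ℝ) / n₃)))) := by
  have val : ∀ {n j : ℕ}, j < n → (j : ℝ) / n ∈ Icc (0 : ℝ) 1 ∧
      tent n (n - 1) (1 - (j : ℝ) / n) ((j : ℝ) / n) = (j : ℝ) / n * (1 - (j : ℝ) / n) := by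
    intro n j hj
    obtain ⟨a, b, c⟩ := secant_coeff hj
    exact ⟨⟨a, c.trans b⟩, by rw [tent_eq hj le_rfl c, secant_node _ rfl]⟩
  rcases sidePt_cases (a := (0 : ℂ)) (b := 1) (c := Complex.I) hi with ⟨j, hj, g', g⟩ |
    ⟨j, hj, g', g⟩ | ⟨j, hj, g', g⟩ <;> obtain ⟨v1, v2⟩ := val hj
  · refine Or.inl ⟨j, hj, g', ?_⟩
    rw [g, add_zero, (bumpMap_edge h1 h2 h3 v1).1, v2]
    apply Complex.ext <;> simp [arcPt, AffineMap.lineMap_apply, -Complex.ofReal_div] <;> ring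
  · refine Or.inr (Or.inl ⟨j, hj, g', ?_⟩)
    rw [g, add_zero, (bumpMap_edge h1 h2 h3 v1).2.1, v2]
    apply Complex.ext <;> simp [arcPt, triRot, AffineMap.lineMap_apply, -Complex.ofReal_div] <;> ring
  · refine Or.inr (Or.inr ⟨j, hj, g', ?_⟩)
    rw [g, add_zero, (bumpMap_edge h1 h2 h3 v1).2.2, v2]
    apply Complex.ext <;> simp [arcPt, triRot, AffineMap.lineMap_apply, -Complex.ofReal_div] <;> ring

theorem bumpMap_det {N : ℕ} (k1 : n₁ ≤ N) (k2 : n₂ ≤ N) (k3 : n₃ ≤ N) {i j k : ℕ} (hij : i < j)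
    (hjk : j < k) (hk : k < n₁ + n₂ + n₃) : (1 / (N : ℝ)) ^ 3 / 50 ≤
      det3 (bumpMap n₁ n₂ n₃ (sidePt 0 1 Complex.I n₁ n₂ n₃ i 0))
        (bumpMap n₁ n₂ n₃ (sidePt 0 1 Complex.I n₁ n₂ n₃ j 0))
        (bumpMap n₁ n₂ n₃ (sidePt 0 1 Complex.I n₁ n₂ n₃ k 0)) := by
  have hN : 0 < N := by omega
  have hδ : 0 < 1 / (N : ℝ) := by positivity
  have hδ1 : 1 / (N : ℝ) ≤ 1 := by
    rw [div_le_one (by positivity)]; exact_mod_cast hN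
  have gap : ∀ {n a b : ℕ}, 0 < n → n ≤ N → a < b → 1 / (N : ℝ) ≤ (b : ℝ) / n - (a : ℝ) / n := by
    intro n a b hn hnN hab
    have hn' : (0 : ℝ) < n := mod_cast hn
    have h1 : (a : ℝ) + 1 ≤ b := mod_cast hab
    calc 1 / (N : ℝ) ≤ 1 / n := one_div_le_one_div_of_le hn' (mod_cast hnN)
      _ ≤ _ := by rw [← sub_div]; gcongr; linarith
  have end' : ∀ {n a : ℕ}, a < n → n ≤ N → 1 / (N : ℝ) ≤ 1 - (a : ℝ) / n := by
    intro n a ha hnN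
    have := gap (by omega) hnN ha
    rwa [div_self (by have : 0 < n := by omega
                      positivity)] at this
  have nn : ∀ n a : ℕ, 0 ≤ (a : ℝ) / n := fun n a => by positivity
  have le1 : ∀ {n a : ℕ}, a < n → (a : ℝ) / n ≤ 1 := fun {n a} h => by
    obtain ⟨p, q, r⟩ := secant_coeff h
    exact r.trans q
  rcases bumpMap_node h1 h2 h3 (by omega : i < _) with ⟨a, ha, ia, ea⟩ | ⟨a, ha, ia, ea⟩ |
      ⟨a, ha, ia, ea⟩ <;>
    rcases bumpMap_node h1 h2 h3 (by omega : j < _) with ⟨b, hb, ib, eb⟩ | ⟨b, hb, ib, eb⟩ |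
      ⟨b, hb, ib, eb⟩ <;> (try omega) <;>
    rcases bumpMap_node h1 h2 h3 hk with ⟨c, hc, ic, ec⟩ | ⟨c, hc, ic, ec⟩ |
      ⟨c, hc, ic, ec⟩ <;> (try omega) <;> rw [ea, eb, ec]
  · exact det3_arc₁ hδ (gap h1 k1 (by omega)) (gap h1 k1 (by omega))
  · exact det3_arc₂ hδ (nn _ _) (gap h1 k1 (by omega)) (end' hb k1) (nn _ _) (le1 hc)
  · rw [← det3_rotate, ← det3_rotate, ← det3_triRot, triRot_triRot_triRot]
    exact det3_arc₃ hδ hδ1 (nn _ _) (gap h1 k1 (by omega)) (le1 hb) (nn _ _) (end' hc k3)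
  · exact det3_arc₃ hδ hδ1 (nn _ _) (gap h2 k2 (by omega)) (le1 hc) (nn _ _) (end' ha k1)
  · exact det3_arc₄ hδ (nn _ _) (end' ha k1) (nn _ _) (end' hb k2) (nn _ _) (end' hc k3)
  · rw [← det3_rotate, ← det3_triRot, triRot_triRot_triRot, triRot_triRot_triRot]
    exact det3_arc₂ hδ (nn _ _) (gap h3 k3 (by omega)) (end' hc k3) (nn _ _) (le1 ha)
  · rw [det3_triRot]
    exact det3_arc₁ hδ (gap h2 k2 (by omega)) (gap h2 k2 (by omega))
  · rw [det3_triRot]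
    exact det3_arc₂ hδ (nn _ _) (gap h2 k2 (by omega)) (end' hb k2) (nn _ _) (le1 hc)
  · rw [det3_triRot]
    exact det3_arc₃ hδ hδ1 (nn _ _) (gap h3 k3 (by omega)) (le1 hc) (nn _ _) (end' ha k2)
  · rw [det3_triRot, det3_triRot]
    exact det3_arc₁ hδ (gap h3 k3 (by omega)) (gap h3 k3 (by omega))

theorem bumpMap_hull {x : ℂ} (hx : x ∈ conv {(0 : ℂ), 1, Complex.I}) :
    bumpMap n₁ n₂ n₃ x ∈ conv ((fun i => bumpMap n₁ n₂ n₃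
      (sidePt 0 1 Complex.I n₁ n₂ n₃ i 0)) '' (Finset.range (n₁ + n₂ + n₃))) := by
  set W := conv ((fun i => bumpMap n₁ n₂ n₃
      (sidePt 0 1 Complex.I n₁ n₂ n₃ i 0)) '' (Finset.range (n₁ + n₂ + n₃))) with hW
  have hWc : Convex ℝ W := convex_convexHull ℝ _
  have hloop : PathLoop (n₁ + n₂ + n₃) (sidePt (0 : ℂ) 1 Complex.I n₁ n₂ n₃) :=
    sidePt_pathLoop h1 h2 h3 (AffineMap.id ℝ ℂ) rfl rfl rfl
  have hnode : ∀ i < n₁ + n₂ + n₃, bumpMap n₁ n₂ n₃ (sidePt 0 1 Complex.I n₁ n₂ n₃ i 0) ∈ W :=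
    fun i hi => subset_convexHull ℝ _ ⟨i, by simpa using hi, rfl⟩
  have hbd : ∀ y, (y ∈ segment ℝ (0 : ℂ) 1 ∨ y ∈ segment ℝ (1 : ℂ) Complex.I ∨
      y ∈ segment ℝ Complex.I (0 : ℂ)) → bumpMap n₁ n₂ n₃ y ∈ W := by
    intro y hy
    obtain ⟨i, hi, s, hs, rfl⟩ := (sidePt_image h1 h2 h3).2 hy
    rw [bumpMap_lin h1 h2 h3 hi hs]
    refine hWc.lineMap_mem (hnode i hi) ?_ hs
    by_cases hi' : i + 1 < n₁ + n₂ + n₃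
    · rw [hloop.next i hi']; exact hnode _ hi'
    · rw [show i = n₁ + n₂ + n₃ - 1 by omega, hloop.last]; exact hnode 0 (by omega)
  have hz : (0 : ℝ) ∈ Icc (0 : ℝ) 1 := by simp
  have v0 : (0 : ℂ) ∈ W := by
    have := hbd 0 (Or.inl (left_mem_segment ℝ _ _))
    have e := (bumpMap_edge h1 h2 h3 hz).1
    rw [sub_zero, tent_right h1 zero_le_one, AffineMap.lineMap_apply_zero] at e
    rw [e] at this; simpa using this
  have v1 : (1 : ℂ) ∈ W := by
    have := hbd 1 (Or.inr (Or.inl (left_mem_segment ℝ _ _)))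
    have e := (bumpMap_edge h1 h2 h3 hz).2.1
    rw [sub_zero, tent_right h2 zero_le_one, AffineMap.lineMap_apply_zero] at e
    rw [e] at this; simpa using this
  have v2 : Complex.I ∈ W := by
    have := hbd Complex.I (Or.inr (Or.inr (left_mem_segment ℝ _ _)))
    have e := (bumpMap_edge h1 h2 h3 hz).2.2
    rw [sub_zero, tent_right h3 zero_le_one, AffineMap.lineMap_apply_zero] at e
    rw [e] at this; simpa using this
  have ho : ((1 / 3 : ℝ) : ℂ) * (1 + Complex.I) ∈ W := by
    have g1 := hWc v1 v2 (by norm_num : (0 : ℝ) ≤ 1 / 2) (by norm_num : (0 : ℝ) ≤ 1 / 2)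
      (by norm_num)
    have g2 := hWc v0 g1 (by norm_num : (0 : ℝ) ≤ 1 / 3) (by norm_num : (0 : ℝ) ≤ 2 / 3)
      (by norm_num)
    convert g2 using 1
    apply Complex.ext <;> norm_num
  have cone : ∀ (P Q v : ℂ) (n : ℕ) (a b : ℝ), 0 ≤ a → 0 ≤ b → a + b ≤ 1 →
      (∀ t ∈ Icc (0 : ℝ) 1, AffineMap.lineMap P Q t +
        (1 / 100 * tent n (n - 1) (1 - t) t : ℝ) * v ∈ W) →
      ((1 - a - b) / 3 : ℝ) * (1 + Complex.I) + (a * P + b * Q) +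
        (1 / 100 * tent n (n - 1) a b : ℝ) * v ∈ W := by
    intro P Q v n a b ha hb hab hF
    rcases (add_nonneg ha hb).eq_or_lt with h0 | h0
    · obtain ⟨rfl, rfl⟩ : a = 0 ∧ b = 0 := ⟨by linarith, by linarith⟩
      have : tent n (n - 1) 0 0 = 0 := by
        have := tent_smul n (n - 1) le_rfl 0 0
        grind
      rw [this]
      simpa using ho
    · have g1 := hF (b / (a + b)) ⟨by positivity, by rw [div_le_one h0]; linarith⟩
      have g2 := hWc ho g1 (by linarith : 0 ≤ 1 - (a + b)) h0.le (by ring)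
      have e := tent_smul n (n - 1) h0.le (1 - b / (a + b)) (b / (a + b))
      have e1 : (a + b) * (1 - b / (a + b)) = a := by field_simp; ring
      have e2 : (a + b) * (b / (a + b)) = b := by field_simp
      rw [e1, e2] at e
      convert g2 using 1
      rw [e, smul_add, Complex.real_smul, Complex.real_smul, Complex.real_smul,
        AffineMap.lineMap_apply, vsub_eq_sub, vadd_eq_add, Complex.real_smul]
      have e1' : ((a : ℂ) + b) * (1 - (b / (a + b) : ℝ)) = a := mod_cast e1
      have e2' : ((a : ℂ) + b) * (b / (a + b) : ℝ) = b := mod_cast e2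
      push_cast at e1' e2' ⊢
      grind
  obtain ⟨hr, hi, hs⟩ : 0 ≤ x.re ∧ 0 ≤ x.im ∧ x.re + x.im ≤ 1 := by
    have hsub : conv {(0 : ℂ), 1, Complex.I} ⊆
        {z | 0 ≤ z.re} ∩ ({z | 0 ≤ z.im} ∩ {z | z.re + z.im ≤ 1}) := by
      refine convexHull_min ?_ ?_
      · rintro z (rfl | rfl | rfl) <;> simp
      · refine (convex_halfSpace_ge Complex.reCLM.isLinear 0).inter
          ((convex_halfSpace_ge Complex.imCLM.isLinear 0).inter
            (convex_halfSpace_le (Complex.reCLM + Complex.imCLM).isLinear 1))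
    exact hsub hx
  have m1 : minBary x ≤ 1 - x.re - x.im := min_le_left _ _
  have m2 : minBary x ≤ x.re := (min_le_right _ _).trans (min_le_left _ _)
  have m3 : minBary x ≤ x.im := (min_le_right _ _).trans (min_le_right _ _)
  have mm : minBary x = x.im ∨ minBary x = 1 - x.re - x.im ∨ minBary x = x.re := by
    unfold minBary
    grind
  rcases mm with h | h | h
  · set a := 1 - x.re - x.im - minBary x with ha
    set b := x.re - minBary x with hb
    have e : x = ((1 - a - b) / 3 : ℝ) * (1 + Complex.I) + b := by
      apply Complex.ext <;> simp [ha, hb, h] <;> ring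
    rw [e, bumpMap_side₁ h2 h3 (by linarith) (by linarith)]
    have := cone 0 1 (1 - 2 * Complex.I) n₁ a b (by linarith) (by linarith) (by linarith)
      fun t ht => by
        rw [← (bumpMap_edge h1 h2 h3 ht).1]
        exact hbd _ (Or.inl (by rw [segment_eq_image_lineMap]; exact ⟨t, ht, rfl⟩))
    simpa using this
  · set a := x.re - minBary x with ha
    set b := x.im - minBary x with hb
    have e : x = ((1 - a - b) / 3 : ℝ) * (1 + Complex.I) + (a + b * Complex.I) := by
      apply Complex.ext <;> simp [ha, hb, h] <;> ring
    rw [e, bumpMap_side₂ h1 h3 (by linarith) (by linarith)]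
    have := cone 1 Complex.I (1 + Complex.I) n₂ a b (by linarith) (by linarith) (by linarith)
      fun t ht => by
        rw [← (bumpMap_edge h1 h2 h3 ht).2.1]
        exact hbd _ (Or.inr (Or.inl (by rw [segment_eq_image_lineMap]; exact ⟨t, ht, rfl⟩)))
    simpa using this
  · set a := x.im - minBary x with ha
    set b := 1 - x.re - x.im - minBary x with hb
    have e : x = ((1 - a - b) / 3 : ℝ) * (1 + Complex.I) + a * Complex.I := by
      apply Complex.ext <;> simp [ha, hb, h] <;> ring
    rw [e, bumpMap_side₃ h1 h2 (by linarith) (by linarith)]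
    have := cone Complex.I 0 (-2 + Complex.I) n₃ a b (by linarith) (by linarith) (by linarith)
      fun t ht => by
        rw [← (bumpMap_edge h1 h2 h3 ht).2.2]
        exact hbd _ (Or.inr (Or.inr (by rw [segment_eq_image_lineMap]; exact ⟨t, ht, rfl⟩)))
    simpa using this

theorem bumpMap_dist (x y : ℂ) :
    ‖bumpMap n₁ n₂ n₃ x - bumpMap n₁ n₂ n₃ y - (x - y)‖ ≤ 54 / 100 * ‖x - y‖ := by
  set d := ‖x - y‖
  have r1 : |x.re - y.re| ≤ d := by rw [← Complex.sub_re]; exact Complex.abs_re_le_norm _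
  have r2 : |x.im - y.im| ≤ d := by rw [← Complex.sub_im]; exact Complex.abs_im_le_norm _
  have r0 : |(1 - x.re - x.im) - (1 - y.re - y.im)| ≤ 2 * d := by
    grind
  have rm : |minBary x - minBary y| ≤ 2 * d := by
    have hd0 : 0 ≤ d := norm_nonneg _
    exact (abs_min_sub_min_le_max _ _ _ _).trans (max_le r0
      ((abs_min_sub_min_le_max _ _ _ _).trans (max_le (by linarith) (by linarith))))
  have sub : ∀ {a b c e A B : ℝ}, |a - b| ≤ A → |c - e| ≤ B → |(a - c) - (b - e)| ≤ A + B := by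
    grind
  have t1 := tent_lip (by omega : n₁ - 1 < n₁) (1 - x.re - x.im - minBary x) (x.re - minBary x)
    (1 - y.re - y.im - minBary y) (y.re - minBary y)
  have t2 := tent_lip (by omega : n₂ - 1 < n₂) (x.re - minBary x) (x.im - minBary x)
    (y.re - minBary y) (y.im - minBary y)
  have t3 := tent_lip (by omega : n₃ - 1 < n₃) (x.im - minBary x) (1 - x.re - x.im - minBary x)
    (y.im - minBary y) (1 - y.re - y.im - minBary y)
  have s1 := sub r0 rm
  have s2 := sub r1 rm
  have s3 := sub r2 rm
  have nrm : ∀ (A B K c : ℝ) (v : ℂ), |A - B| ≤ K → ‖v‖ ≤ c →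
      ‖((1 / 100 * A : ℝ) : ℂ) * v - ((1 / 100 * B : ℝ) : ℂ) * v‖ ≤ K * c / 100 := by
    intro A B K c v h1 h2
    rw [← sub_mul, norm_mul, ← Complex.ofReal_sub, Complex.norm_real, Real.norm_eq_abs, ← mul_sub,
      abs_mul, abs_of_pos (by norm_num : (0 : ℝ) < 1 / 100)]
    have := mul_le_mul h1 h2 (norm_nonneg _) ((abs_nonneg _).trans h1)
    linarith
  have w1 : ‖(1 : ℂ) - 2 * Complex.I‖ ≤ 3 := by
    refine (norm_sub_le _ _).trans ?_; simp; norm_num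
  have w2 : ‖(1 : ℂ) + Complex.I‖ ≤ 2 := by
    refine (norm_add_le _ _).trans ?_; simp; norm_num
  have w3 : ‖(-2 : ℂ) + Complex.I‖ ≤ 3 := by
    refine (norm_add_le _ _).trans ?_; simp; norm_num
  have q1 := nrm _ _ _ _ _ t1 w1
  have q2 := nrm _ _ _ _ _ t2 w2
  have q3 := nrm _ _ _ _ _ t3 w3
  have split : ∀ A B C A' B' C' : ℂ, (x + (A + (B + C))) - (y + (A' + (B' + C'))) - (x - y) =
    (A - A') + ((B - B') + (C - C')) := fun _ _ _ _ _ _ => by ring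
  rw [bumpMap, bumpMap, split]
  refine (norm_add_le _ _).trans ?_
  have := norm_add_le
    (((1 / 100 * tent n₂ (n₂ - 1) (x.re - minBary x) (x.im - minBary x) : ℝ) : ℂ) *
      (1 + Complex.I) - ((1 / 100 * tent n₂ (n₂ - 1) (y.re - minBary y) (y.im - minBary y) : ℝ) :
        ℂ) * (1 + Complex.I)) (((1 / 100 * tent n₃ (n₃ - 1) (x.im - minBary x)
        (1 - x.re - x.im - minBary x) : ℝ) : ℂ) * (-2 + Complex.I) - ((1 / 100 * tent n₃ (n₃ - 1)
        (y.im - minBary y) (1 - y.re - y.im - minBary y) : ℝ) : ℂ) * (-2 + Complex.I))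
  linarith

omit h1 h2 h3 in
theorem bumpMap_pl : PLOn (bumpMap n₁ n₂ n₃) (conv {(0 : ℂ), 1, Complex.I}) := by
  set S := conv {(0 : ℂ), 1, Complex.I}
  have hS : Convex ℝ S := convex_convexHull ℝ _
  have re : PLOn (fun x : ℂ => x.re) S := .of_affine Complex.reLm.toAffineMap S
  have im : PLOn (fun x : ℂ => x.im) S := .of_affine Complex.imLm.toAffineMap S
  have neg : ∀ {f : ℂ → ℝ}, PLOn f S → PLOn (fun x => -f x) S := fun hf =>
    hf.affine_comp (-(LinearMap.id : ℝ →ₗ[ℝ] ℝ)).toAffineMap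
  have l0 : PLOn (fun x : ℂ => 1 - x.re - x.im) S :=
    (((PLOn.of_affine (AffineMap.const ℝ ℂ (1 : ℝ)) S).add (neg re)).add (neg im)).congr
      fun x _ => by simp [sub_eq_add_neg]
  have m : PLOn minBary S := l0.min (re.min im hS) hS
  have sub : ∀ {f : ℂ → ℝ}, PLOn f S → PLOn (fun x => f x - minBary x) S := fun hf =>
    (hf.add (neg m)).congr fun x _ => by simp [sub_eq_add_neg]
  have term : ∀ (n : ℕ) {f g : ℂ → ℝ} (v : ℂ), PLOn f S → PLOn g S →
      PLOn (fun x => ((1 / 100 * tent n (n - 1) (f x - minBary x) (g x - minBary x) : ℝ) : ℂ) * v)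
        S := fun n f g v hf hg =>
    (((sub hf).tent (sub hg) hS n (n - 1)).affine_comp
      ((LinearMap.toSpanSingleton ℝ ℂ ((1 / 100 : ℝ) • v)).toAffineMap)).congr fun x _ => by
        simp [LinearMap.toSpanSingleton_apply]; ring
  exact (PLOn.of_affine (AffineMap.id ℝ ℂ) S).add
    ((term n₁ _ l0 re).add ((term n₂ _ re im).add (term n₃ _ im l0)))

theorem exists_bump {N : ℕ} (k1 : n₁ ≤ N) (k2 : n₂ ≤ N) (k3 : n₃ ≤ N) :
    ∃ φ, Bump n₁ n₂ n₃ ((1 / (N : ℝ)) ^ 3 / 50) φ := by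
  refine ⟨bumpMap n₁ n₂ n₃, ⟨fun x _ y _ => ?_, fun x _ y _ hxy => ?_, bumpMap_pl,
    fun i hi s hs => bumpMap_lin h1 h2 h3 hi hs, fun x hx => bumpMap_hull h1 h2 h3 hx,
    fun i j k hij hjk hk => bumpMap_det h1 h2 h3 k1 k2 k3 hij hjk hk⟩⟩
  · have := bumpMap_dist h1 h2 h3 x y
    have h := norm_add_le (bumpMap n₁ n₂ n₃ x - bumpMap n₁ n₂ n₃ y - (x - y)) (x - y)
    rw [sub_add_cancel] at h
    linarith [norm_nonneg (x - y)]
  · have := bumpMap_dist h1 h2 h3 x y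
    rw [hxy, sub_self, zero_sub, norm_neg] at this
    rw [← sub_eq_zero, ← norm_le_zero_iff]
    grind

end

/-- `w` is a system of barycentric coordinates of `x` in a member of `𝓕`. -/
structure BRep (V : Finset E2) (𝓕 : Set (Finset E2)) (w : E2 → ℝ) (x : E2) : Prop where
  supp : ∃ s ∈ 𝓕, ∀ v ∉ s, w v = 0
  nonneg : ∀ v, 0 ≤ w v
  sum : ∑ v ∈ V, w v = 1
  pos : ∑ v ∈ V, w v • v = x

/-- Barycentric coordinates in the members of `𝓕`, subsets of `V`, are unique. -/
structure UniqRep (V : Finset E2) (𝓕 : Set (Finset E2)) : Prop where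
  sub : ∀ s ∈ 𝓕, s ⊆ V
  uniq : ∀ w w' x, BRep V 𝓕 w x → BRep V 𝓕 w' x → w = w'

theorem mem_hull_iff_weights {s V : Finset E2} (hs : s ⊆ V) {x : E2} :
    x ∈ cell s ↔ ∃ w : E2 → ℝ, (∀ v ∉ s, w v = 0) ∧ (∀ v, 0 ≤ w v) ∧
      ∑ v ∈ V, w v = 1 ∧ ∑ v ∈ V, w v • v = x := by
  classical
  rw [Finset.mem_convexHull']
  constructor
  · rintro ⟨w, h0, h1, hx⟩
    refine ⟨fun v => if v ∈ s then w v else 0, fun v hv => by simp [hv], fun v => ?_, ?_, ?_⟩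
    · dsimp only; split_ifs with h
      exacts [h0 v h, le_rfl]
    · rw [← h1, Finset.sum_ite_mem, Finset.inter_eq_right.2 hs]
    · rw [← hx]
      simp only [ite_smul, zero_smul]
      rw [Finset.sum_ite_mem, Finset.inter_eq_right.2 hs]
  · rintro ⟨w, hw, h0, h1, hx⟩
    refine ⟨w, fun v _ => h0 v, ?_, ?_⟩
    · rw [← h1]; exact Finset.sum_subset hs fun v _ hv => hw v hv
    · rw [← hx]; exact Finset.sum_subset hs fun v _ hv => by rw [hw v hv, zero_smul]

section

variable {V : Finset E2} {𝓕 : Set (Finset E2)} {s t : Finset E2} {w w' d : E2 → ℝ} {x : E2}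

theorem BRep.mem_hull (h : BRep V 𝓕 w x) (hs : s ⊆ V) (hw : ∀ v ∉ s, w v = 0) : x ∈ cell s :=
  (mem_hull_iff_weights hs).2 ⟨w, hw, h.nonneg, h.sum, h.pos⟩

theorem UniqRep.exists_rep (h : UniqRep V 𝓕) (hs : s ∈ 𝓕) (hx : x ∈ cell s) :
    ∃ w, BRep V 𝓕 w x ∧ ∀ v ∉ s, w v = 0 := by
  obtain ⟨w, h1, h2, h3, h4⟩ := (mem_hull_iff_weights (h.sub s hs)).1 hx
  exact ⟨w, ⟨⟨s, hs, h1⟩, h2, h3, h4⟩, h1⟩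

theorem UniqRep.cone (h : UniqRep V 𝓕) (hs : s ∈ 𝓕) (ht : t ∈ 𝓕) (h1 : ∀ v ∉ s, d v ≤ 0)
    (h2 : ∀ v ∉ t, 0 ≤ d v) (h3 : ∑ v ∈ V, d v = 0) (h4 : ∑ v ∈ V, d v • v = 0) : d = 0 := by
  have hoff : ∀ v ∉ V, d v = 0 := fun v hv =>
    le_antisymm (h1 v fun h' => hv (h.sub s hs h')) (h2 v fun h' => hv (h.sub t ht h'))
  have hd : ∀ v, max (d v) 0 - max (-d v) 0 = d v := fun v => by
    grind
  set m := ∑ v ∈ V, max (d v) 0 with hm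
  have hm' : ∑ v ∈ V, max (-d v) 0 = m := by
    have : ∑ v ∈ V, (max (d v) 0 - max (-d v) 0) = 0 :=
      (Finset.sum_congr rfl fun v _ => hd v).trans h3
    rw [Finset.sum_sub_distrib] at this
    linarith
  have hp : ∑ v ∈ V, max (-d v) 0 • v = ∑ v ∈ V, max (d v) 0 • v := by
    have : ∑ v ∈ V, (max (d v) 0 • v - max (-d v) 0 • v) = 0 :=
      (Finset.sum_congr rfl fun v _ => by rw [← sub_smul, hd v]).trans h4
    rw [Finset.sum_sub_distrib] at this
    exact (sub_eq_zero.1 this).symm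
  have hm0 : 0 ≤ m := Finset.sum_nonneg fun v _ => le_max_right _ _
  rcases hm0.eq_or_lt with h0 | h0
  · funext v
    by_cases hv : v ∈ V
    · have e1 := (Finset.sum_eq_zero_iff_of_nonneg fun v _ => le_max_right (d v) 0).1
        (hm ▸ h0.symm) v hv
      have e2 := (Finset.sum_eq_zero_iff_of_nonneg fun v _ => le_max_right (-d v) 0).1
        (hm'.trans h0.symm) v hv
      have := hd v
      rw [e1, e2] at this
      simpa using this.symm
    · exact hoff v hv
  · have key := h.uniq (fun v => m⁻¹ * max (d v) 0) (fun v => m⁻¹ * max (-d v) 0)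
      (m⁻¹ • ∑ v ∈ V, max (d v) 0 • v)
      ⟨⟨s, hs, fun v hv => by simp [max_eq_right (h1 v hv)]⟩,
        fun v => mul_nonneg (inv_nonneg.2 hm0) (le_max_right _ _),
        by rw [← Finset.mul_sum]; grind,
        by rw [Finset.smul_sum]; exact Finset.sum_congr rfl fun v _ => mul_smul _ _ _⟩
      ⟨⟨t, ht, fun v hv => by simp [h2 v hv]⟩,
        fun v => mul_nonneg (inv_nonneg.2 hm0) (le_max_right _ _),
        by rw [← Finset.mul_sum, hm']; grind,
        by rw [← hp, Finset.smul_sum]; exact Finset.sum_congr rfl fun v _ => mul_smul _ _ _⟩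
    funext v
    have e := mul_left_cancel₀ (inv_ne_zero h0.ne') (congrFun key v)
    rw [← hd v, e, sub_self]; rfl

/-- The simplicial complex with a given family of faces. -/
def UniqRep.complex (h : UniqRep V 𝓕) (h0 : ∀ s ∈ 𝓕, s.Nonempty)
    (hdown : ∀ s ∈ 𝓕, ∀ t ⊆ s, t.Nonempty → t ∈ 𝓕) : SimplicialComplex ℝ E2 where
  faces := 𝓕
  isRelLowerSet_faces := fun s hs => ⟨h0 s hs, fun t ht ht0 => hdown s hs t ht ht0⟩
  indep := by
    classical
    intro s hs
    rw [affineIndependent_iff]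
    intro I w hw hw' e he
    have hsV := h.sub s hs
    set d : E2 → ℝ := fun v => if hv : v ∈ s then if ⟨v, hv⟩ ∈ I then w ⟨v, hv⟩ else 0 else 0
    have hd : ∀ v ∉ s, d v = 0 := fun v hv => by simp [d, hv]
    have hd' : ∀ v : s, d v = if v ∈ I then w v else 0 := fun v => by simp [d]
    have := congrFun (h.cone (d := d) hs hs (fun v hv => (hd v hv).le) (fun v hv => (hd v hv).ge)
      (by
        rw [← Finset.sum_subset hsV fun v _ hv => hd v hv, ← Finset.sum_coe_sort]
        simp only [hd', Finset.sum_ite_mem, Finset.univ_inter, hw])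
      (by
        rw [← Finset.sum_subset hsV fun v _ hv => by rw [hd v hv, zero_smul],
          ← Finset.sum_coe_sort]
        simp only [hd', ite_smul, zero_smul, Finset.sum_ite_mem, Finset.univ_inter, hw'])) e
    simpa [hd', he] using this
  inter_subset_convexHull := by
    classical
    rintro s t hs ht x ⟨hx, hx'⟩
    obtain ⟨w, hw, hw0⟩ := h.exists_rep hs hx
    obtain ⟨w', hw', hw0'⟩ := h.exists_rep ht hx'
    obtain rfl := h.uniq _ _ _ hw hw'
    rw [← Finset.coe_inter]
    refine hw.mem_hull (Finset.inter_subset_left.trans (h.sub s hs)) fun v hv => ?_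
    rw [Finset.mem_inter, not_and_or] at hv
    grind

theorem eq_of_indep (hi : AffineIndependent ℝ ((↑) : s → E2)) (hs : s ⊆ V)
    (hw : ∀ v ∉ s, w v = 0) (hw' : ∀ v ∉ s, w' v = 0) (h1 : ∑ v ∈ V, w v = ∑ v ∈ V, w' v)
    (h2 : ∑ v ∈ V, w v • v = ∑ v ∈ V, w' v • v) : w = w' := by
  rw [affineIndependent_iff] at hi
  have e := hi Finset.univ (fun v => w v - w' v) (by
    rw [Finset.sum_coe_sort s fun v => w v - w' v,
      Finset.sum_subset hs fun v _ hv => by grind,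
      Finset.sum_sub_distrib, h1, sub_self]) (by
    rw [Finset.sum_coe_sort s fun v => (w v - w' v) • v,
      Finset.sum_subset hs fun v _ hv => by rw [hw v hv, hw' v hv, sub_self, zero_smul]]
    simp only [sub_smul, Finset.sum_sub_distrib, h2, sub_self])
  funext v
  by_cases hv : v ∈ s
  · exact sub_eq_zero.1 (e ⟨v, hv⟩ (Finset.mem_univ _))
  · rw [hw v hv, hw' v hv]

theorem uniqRep_faces (K : SimplicialComplex ℝ E2) (hV : ∀ s ∈ K.faces, s ⊆ V) :
    UniqRep V K.faces := by
  classical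
  refine ⟨hV, fun w w' x h h' => ?_⟩
  obtain ⟨s, hs, hw⟩ := h.supp
  obtain ⟨t, ht, hw'⟩ := h'.supp
  have hi := (mem_hull_iff_weights (Finset.inter_subset_left.trans (hV s hs))).1
    (mem_hull_inter hs ht (h.mem_hull (hV s hs) hw) (h'.mem_hull (hV t ht) hw'))
  obtain ⟨u, hu, -, hu1, hux⟩ := hi
  have e1 := eq_of_indep (K.indep hs) (hV s hs) hw
    (fun v hv => hu v fun h => hv (Finset.mem_inter.1 h).1) (h.sum.trans hu1.symm)
    (h.pos.trans hux.symm)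
  have e2 := eq_of_indep (K.indep ht) (hV t ht) hw'
    (fun v hv => hu v fun h => hv (Finset.mem_inter.1 h).2) (h'.sum.trans hu1.symm)
    (h'.pos.trans hux.symm)
  rw [e1, e2]

theorem card_le_three (K : SimplicialComplex ℝ E2) (hs : s ∈ K.faces) : s.card ≤ 3 := by
  have := (K.indep hs).card_le_finrank_succ
  rw [Fintype.card_coe] at this
  have h2 := Submodule.finrank_le (vectorSpan ℝ (Set.range ((↑) : s → E2)))
  rw [finrank_euclideanSpace_fin] at h2
  omega

end

/-- The faces of the stellar subdivision of `K` at an interior point `x` of the edge `{u, v}`. -/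
def stellarFaces (K : SimplicialComplex ℝ E2) (x u v : E2) : Set (Finset E2) :=
  {s | s ∈ K.faces ∧ ¬ (u ∈ s ∧ v ∈ s)} ∪
    {r | ∃ s, ¬ (u ∈ s ∧ v ∈ s) ∧ s ∪ {u, v} ∈ K.faces ∧ r = insert x s}

section

variable {K : SimplicialComplex ℝ E2} {x u v : E2} {θ : ℝ} {s : Finset E2} {p : E2}

theorem split_hull_aux (hu : u ∈ s) (hv : v ∈ s) (huv : u ≠ v) (h0 : 0 < θ) (h1 : θ < 1)
    (hx : θ • u + (1 - θ) • v = x) (hxs : x ∉ s) {w : E2 → ℝ} (hw : ∀ q ∉ s, w q = 0)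
    (hw0 : ∀ q, 0 ≤ w q) (hw1 : ∑ q ∈ s, w q = 1) (hwp : ∑ q ∈ s, w q • q = p)
    (hle : w u / θ ≤ w v / (1 - θ)) : p ∈ conv ((insert x (s.erase u) : Finset E2) : Set E2) := by
  classical
  set m := w u / θ
  have hm : 0 ≤ m := div_nonneg (hw0 u) h0.le
  have hmu : m * θ = w u := div_mul_cancel₀ _ h0.ne'
  have hmv : m * (1 - θ) ≤ w v := (le_div_iff₀ (by linarith)).1 hle
  rw [mem_hull_iff_weights (V := insert x s) (Finset.insert_subset_insert _ (s.erase_subset u))]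
  refine ⟨fun q => if q = x then m else w q - m * (if q = u then θ else 0)
    - m * (if q = v then 1 - θ else 0), fun q hq => ?_, fun q => ?_, ?_, ?_⟩
  · rw [Finset.mem_insert, Finset.mem_erase] at hq
    grind
  · dsimp only
    split_ifs with h h2 h3 h3
    · exact hm
    · grind
    · rw [h2, hmu]; simp
    · rw [h3]; linarith
    · simpa using hw0 q
  · rw [Finset.sum_insert hxs, if_pos rfl, Finset.sum_congr rfl (g := fun q => w q -
      m * (if q = u then θ else 0) - m * (if q = v then 1 - θ else 0))
      fun q hq => if_neg (ne_of_mem_of_not_mem hq hxs)]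
    rw [Finset.sum_sub_distrib, Finset.sum_sub_distrib, ← Finset.mul_sum, ← Finset.mul_sum,
      Finset.sum_ite_eq', Finset.sum_ite_eq', if_pos hu, if_pos hv, hw1]
    ring
  · rw [Finset.sum_insert hxs]
    dsimp only
    rw [if_pos rfl, Finset.sum_congr rfl (g := fun q => w q • q -
      (if q = u then m * θ else 0) • q - (if q = v then m * (1 - θ) else 0) • q)
      fun q hq => by
        rw [if_neg (ne_of_mem_of_not_mem hq hxs), sub_smul, sub_smul, mul_ite, mul_ite, mul_zero]]
    simp only [ite_smul, zero_smul]
    rw [Finset.sum_sub_distrib, Finset.sum_sub_distrib,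
      Finset.sum_ite_eq', Finset.sum_ite_eq', if_pos hu, if_pos hv, hwp, ← hx]
    module

theorem split_hull (hu : u ∈ s) (hv : v ∈ s) (huv : u ≠ v) (h0 : 0 < θ) (h1 : θ < 1)
    (hx : θ • u + (1 - θ) • v = x) (hxs : x ∉ s) (hp : p ∈ cell s) :
    p ∈ conv ((insert x (s.erase u) : Finset E2) : Set E2) ∨
      p ∈ conv ((insert x (s.erase v) : Finset E2) : Set E2) := by
  obtain ⟨w, hw, hw0, hw1, hwp⟩ := (mem_hull_iff_weights subset_rfl).1 hp
  rcases le_total (w u / θ) (w v / (1 - θ)) with h | h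
  · exact Or.inl (split_hull_aux hu hv huv h0 h1 hx hxs hw hw0 hw1 hwp h)
  · refine Or.inr (split_hull_aux (θ := 1 - θ) hv hu huv.symm (by linarith) (by linarith) ?_ hxs
      hw hw0 hw1 hwp (by simpa using h))
    rw [← hx]; module

theorem notMem_of_edge (he : {u, v} ∈ K.faces) (huv : u ≠ v) (h0 : 0 < θ) (h1 : θ < 1)
    (hx : θ • u + (1 - θ) • v = x) : ∀ s ∈ K.faces, x ∉ s := by
  intro s hs hxs
  have hx1 : {x} ∈ K.faces := K.down_closed hs (by simpa using hxs) (by simp)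
  have hseg : x ∈ segment ℝ u v := ⟨θ, 1 - θ, h0.le, by linarith, by ring, hx⟩
  have : x ∈ ({u, v} : Finset E2) := by
    refine (vertex_mem_convexHull_iff hx1 he).1 ?_
    simp_all
  have huv' : u - v ≠ 0 := sub_ne_zero.2 huv
  rw [Finset.mem_insert, Finset.mem_singleton] at this
  rcases this with h | h
  · have : (1 - θ) • (u - v) = 0 := by
      rw [show (1 - θ) • (u - v) = u - (θ • u + (1 - θ) • v) by module, hx, h, sub_self]
    exact (smul_eq_zero.1 this).elim (fun h => by linarith) huv'
  · have : θ • (u - v) = 0 := by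
      rw [show θ • (u - v) = (θ • u + (1 - θ) • v) - v by module, hx, h, sub_self]
    simp_all

theorem uniqRep_stellar {V : Finset E2} (hV : ∀ s ∈ K.faces, s ⊆ V) (he : {u, v} ∈ K.faces)
    (huv : u ≠ v) (h0 : 0 < θ) (h1 : θ < 1) (hx : θ • u + (1 - θ) • v = x) :
    UniqRep (insert x V) (stellarFaces K x u v) := by
  classical
  have hxK := notMem_of_edge he huv h0 h1 hx
  have huV : u ∈ V := hV _ he (by simp)
  have hvV : v ∈ V := hV _ he (by simp)
  have hxu : x ≠ u := fun h => hxK _ he (by simp [h])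
  have hxv : x ≠ v := fun h => hxK _ he (by simp [h])
  have key : ∀ w p, BRep (insert x V) (stellarFaces K x u v) w p → (w u = 0 ∨ w v = 0) ∧
      BRep (insert x V) K.faces (fun q => (if q = x then 0 else w q) +
        w x * (if q = u then θ else 0) + w x * (if q = v then 1 - θ else 0)) p := by
    intro w p hw
    refine ⟨?_, ?_, fun q => ?_, ?_, ?_⟩
    · obtain ⟨s, ⟨-, hs⟩ | ⟨r, hr, -, rfl⟩, hws⟩ := hw.supp
      · grind
      · by_contra! hc
        exact hr ⟨by_contra fun h => hc.1 (hws u (by simp [h, hxu.symm])),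
          by_contra fun h => hc.2 (hws v (by simp [h, hxv.symm]))⟩
    · obtain ⟨s, ⟨hs, -⟩ | ⟨r, -, hr, rfl⟩, hws⟩ := hw.supp
      · refine ⟨s, hs, fun q hq => ?_⟩
        simp_all
      · refine ⟨_, hr, fun q hq => ?_⟩
        simp only [Finset.mem_union, Finset.mem_insert, Finset.mem_singleton, not_or] at hq
        simp_all
    · have := hw.nonneg q
      have := hw.nonneg x
      have : 0 ≤ (if q = x then 0 else w q) := by split_ifs <;> simp_all
      have : 0 ≤ (if q = u then θ else 0) := by grind
      have : 0 ≤ (if q = v then 1 - θ else 0) := by grind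
      positivity
    · have e : ∀ q, (if q = x then 0 else w q) = w q - if q = x then w q else 0 := fun q => by
        split_ifs <;> simp
      simp only [e]
      rw [Finset.sum_add_distrib, Finset.sum_add_distrib, Finset.sum_sub_distrib, ← Finset.mul_sum,
        ← Finset.mul_sum, Finset.sum_ite_eq', Finset.sum_ite_eq', Finset.sum_ite_eq', hw.sum]
      simp [huV, hvV]; ring
    · have e : ∀ q, ((if q = x then 0 else w q) + w x * (if q = u then θ else 0) +
          w x * (if q = v then 1 - θ else 0)) • q = w q • q - (if q = x then w q • q else 0) +
          (if q = u then (w x * θ) • q else 0) + (if q = v then (w x * (1 - θ)) • q else 0) := by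
        intro q
        split_ifs <;> module
      simp only [e]
      rw [Finset.sum_add_distrib, Finset.sum_add_distrib, Finset.sum_sub_distrib,
        Finset.sum_ite_eq', Finset.sum_ite_eq', Finset.sum_ite_eq', hw.pos]
      simp only [Finset.mem_insert, huV, hvV, or_true, true_or, if_true]
      rw [← hx]; module
  refine ⟨?_, fun w w' p hw hw' => ?_⟩
  · rintro s (⟨hs, -⟩ | ⟨r, -, hr, rfl⟩)
    · grind
    · exact Finset.insert_subset_insert _ (Finset.subset_union_left.trans (hV _ hr))
  · obtain ⟨a, b⟩ := key w p hw
    obtain ⟨a', b'⟩ := key w' p hw'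
    have hE := (uniqRep_faces K fun s hs => (hV s hs).trans (Finset.subset_insert x V)).uniq _ _ _
      b b'
    have eu := congrFun hE u
    have ev := congrFun hE v
    simp only [hxu.symm, hxv.symm, huv, huv.symm, if_true, if_false, mul_zero, add_zero] at eu ev
    have hxx : w x = w' x := by
      have n1 := hw.nonneg u
      have n2 := hw'.nonneg u
      have n3 := hw.nonneg v
      have n4 := hw'.nonneg v
      have le : ∀ {A B X Y c : ℝ}, 0 < c → A + X * c = B + Y * c → A = 0 → 0 ≤ B → Y ≤ X :=
        fun hc h hA hB => le_of_mul_le_mul_right (by linarith) hc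
      have h1' : 0 < 1 - θ := by linarith
      exact le_antisymm (a'.elim (fun a => le h0 eu.symm a n1) fun a => le h1' ev.symm a n3)
        (a.elim (fun a => le h0 eu a n2) fun a => le h1' ev a n4)
    funext q
    by_cases hq : q = x
    · rw [hq, hxx]
    · have := congrFun hE q
      grind

/-- `K'` triangulates `Ω` and refines `K`. -/
def RefinesOn (K' K : SimplicialComplex ℝ E2) (Ω : Set E2) : Prop :=
  IsTriangulation K' Ω ∧
    ∀ s ∈ K'.faces, ∃ t ∈ K.faces, cell s ⊆ cell t

theorem exists_stellar {Ω : Set E2} (hK : IsTriangulation K Ω) (he : {u, v} ∈ K.faces)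
    (huv : u ≠ v) (h0 : 0 < θ) (h1 : θ < 1) (hx : θ • u + (1 - θ) • v = x) :
    ∃ K' : SimplicialComplex ℝ E2, K'.faces = stellarFaces K x u v ∧ RefinesOn K' K Ω := by
  classical
  have hxK := notMem_of_edge he huv h0 h1 hx
  set V : Finset E2 := hK.1.toFinset.biUnion id
  have hV : ∀ s ∈ K.faces, s ⊆ V := fun s hs =>
    Finset.subset_biUnion_of_mem id (hK.1.mem_toFinset.2 hs)
  have hU := uniqRep_stellar hV he huv h0 h1 hx
  have hdown : ∀ s ∈ stellarFaces K x u v, ∀ t ⊆ s, t.Nonempty → t ∈ stellarFaces K x u v := by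
    rintro s (⟨hs, hs'⟩ | ⟨r, hr, hr', rfl⟩) t ht ht0
    · exact Or.inl ⟨K.down_closed hs ht ht0, fun h => hs' ⟨ht h.1, ht h.2⟩⟩
    · have hsub : t.erase x ⊆ r := by
        intro q hq
        rw [Finset.mem_erase] at hq
        exact (Finset.mem_insert.1 (ht hq.2)).resolve_left hq.1
      by_cases hxt : x ∈ t
      · exact Or.inr ⟨t.erase x, fun h => hr ⟨hsub h.1, hsub h.2⟩, K.down_closed hr'
          (Finset.union_subset_union_left hsub) (by simp), (Finset.insert_erase hxt).symm⟩
      · rw [Finset.erase_eq_of_notMem hxt] at hsub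
        exact Or.inl ⟨K.down_closed hr' (hsub.trans Finset.subset_union_left) ht0,
          fun h => hr ⟨hsub h.1, hsub h.2⟩⟩
  refine ⟨hU.complex ?_ hdown, rfl, ⟨?_, fun s hs => card_le_three _ hs, ?_, ?_⟩, ?_⟩
  · rintro s (⟨hs, -⟩ | ⟨r, -, -, rfl⟩)
    · exact nonempty_of_mem_faces hs
    · simp
  · exact (Finset.finite_toSet (insert x V).powerset).subset fun s hs =>
      Finset.mem_coe.2 (Finset.mem_powerset.2 (hU.sub s hs))
  all_goals
    have hnew : ∀ t ∈ K.faces, u ∈ t → v ∈ t → insert x (t.erase u) ∈ stellarFaces K x u v ∧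
        insert x (t.erase v) ∈ stellarFaces K x u v := by
      intro t ht hu hv
      refine ⟨Or.inr ⟨_, by simp, ?_, rfl⟩, Or.inr ⟨_, by simp, ?_, rfl⟩⟩ <;>
      · convert ht using 1
        ext q
        simp only [Finset.mem_union, Finset.mem_erase, Finset.mem_insert, Finset.mem_singleton]
        by_cases e1 : q = u
        · simp [e1, hu]
        · by_cases e2 : q = v <;> simp [e1, e2, hv]
    have hsub : ∀ s ∈ stellarFaces K x u v, ∃ t ∈ K.faces,
        cell s ⊆ cell t := by
      rintro s (⟨hs, -⟩ | ⟨r, -, hr, rfl⟩)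
      · exact ⟨s, hs, subset_rfl⟩
      · refine ⟨_, hr, convexHull_min ?_ (convex_convexHull ℝ _)⟩
        rw [Finset.coe_insert, insert_subset_iff]
        refine ⟨?_, (Finset.coe_subset.2 Finset.subset_union_left).trans (subset_convexHull ℝ _)⟩
        exact (convex_convexHull ℝ _).segment_subset (subset_convexHull ℝ _ (by simp))
          (subset_convexHull ℝ _ (by simp)) ⟨θ, 1 - θ, h0.le, by linarith, by ring, hx⟩
  · rw [← hK.2.2.1]
    ext p
    simp only [mem_space_iff]
    constructor
    · rintro ⟨s, hs, hp⟩
      obtain ⟨t, ht, hst⟩ := hsub s hs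
      exact ⟨t, ht, hst hp⟩
    · rintro ⟨s, hs, hp⟩
      by_cases h : u ∈ s ∧ v ∈ s
      · rcases split_hull h.1 h.2 huv h0 h1 hx (hxK s hs) hp with hp | hp
        · exact ⟨_, (hnew s hs h.1 h.2).1, hp⟩
        · exact ⟨_, (hnew s hs h.1 h.2).2, hp⟩
      · exact ⟨s, Or.inl ⟨hs, h⟩, hp⟩
  · have hcard : ∀ t ∈ K.faces, t.card = 3 → ∀ q ∈ t, (insert x (t.erase q)).card = 3 := by
      intro t ht h3 q hq
      rw [Finset.card_insert_of_notMem fun h => hxK t ht (Finset.mem_of_mem_erase h),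
        Finset.card_erase_of_mem hq, h3]
    have hpure : ∀ s t : Finset E2, t ∈ K.faces → t.card = 3 → u ∈ t → v ∈ t → s ⊆ t →
        ¬ (u ∈ s ∧ v ∈ s) → ∃ t' ∈ stellarFaces K x u v, insert x s ⊆ t' ∧ t'.card = 3 := by
      intro s t ht h3 hu hv hst hs
      by_cases h : u ∈ s
      · refine ⟨_, (hnew t ht hu hv).2, Finset.insert_subset_insert _ fun q hq => ?_,
          hcard t ht h3 v hv⟩
        exact Finset.mem_erase.2 ⟨fun h' => hs ⟨h, h' ▸ hq⟩, hst hq⟩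
      · refine ⟨_, (hnew t ht hu hv).1, Finset.insert_subset_insert _ fun q hq => ?_,
          hcard t ht h3 u hu⟩
        exact Finset.mem_erase.2 ⟨fun h' => h (h' ▸ hq), hst hq⟩
    rintro s (⟨hs, hs'⟩ | ⟨r, hr, hr', rfl⟩)
    · obtain ⟨t, ht, hst, h3⟩ := hK.2.2.2 s hs
      by_cases h : u ∈ t ∧ v ∈ t
      · obtain ⟨t', h1, h2, h3⟩ := hpure s t ht h3 h.1 h.2 hst hs'
        exact ⟨t', h1, (Finset.subset_insert _ _).trans h2, h3⟩
      · exact ⟨t, Or.inl ⟨ht, h⟩, hst, h3⟩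
    · obtain ⟨t, ht, hst, h3⟩ := hK.2.2.2 _ hr'
      exact hpure r t ht h3 (hst (by simp)) (hst (by simp))
        (Finset.subset_union_left.trans hst) hr
  · exact hsub

theorem exists_refines_functional {Ω : Set E2} (a : E2 →ᵃ[ℝ] ℝ) (hK : IsTriangulation K Ω) :
    ∃ K' : SimplicialComplex ℝ E2, RefinesOn K' K Ω ∧ ∀ s ∈ K'.faces,
      (∀ x ∈ cell s, 0 ≤ a x) ∨ ∀ x ∈ cell s, a x ≤ 0 := by
  classical
  have hfin : ∀ K : SimplicialComplex ℝ E2, IsTriangulation K Ω →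
      {e : E2 × E2 | {e.1, e.2} ∈ K.faces ∧ a e.1 < 0 ∧ 0 < a e.2}.Finite := by
    intro K hK
    set V : Finset E2 := hK.1.toFinset.biUnion id
    have hV : ∀ s ∈ K.faces, s ⊆ V := fun s hs =>
      Finset.subset_biUnion_of_mem id (hK.1.mem_toFinset.2 hs)
    exact (Finset.finite_toSet (V ×ˢ V)).subset fun e he =>
      Finset.mem_coe.2 (Finset.mem_product.2 ⟨hV _ he.1 (by simp), hV _ he.1 (by simp)⟩)
  induction hn : {e : E2 × E2 | {e.1, e.2} ∈ K.faces ∧ a e.1 < 0 ∧ 0 < a e.2}.ncard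
    using Nat.strong_induction_on generalizing K with
  | _ n ih =>
    by_cases hne : ∃ e : E2 × E2, {e.1, e.2} ∈ K.faces ∧ a e.1 < 0 ∧ 0 < a e.2
    · obtain ⟨⟨u, v⟩, he, hu, hv⟩ := hne
      dsimp only at he hu hv
      have huv : u ≠ v := by rintro rfl; linarith
      have hpos : 0 < a v - a u := by linarith
      set θ := a v / (a v - a u)
      have h0 : 0 < θ := div_pos hv hpos
      have h1 : θ < 1 := (div_lt_one hpos).2 (by linarith)
      have hax : a (θ • u + (1 - θ) • v) = 0 := by
        have := Convex.combo_affine_apply (f := a) (x := u) (y := v) (a := θ) (b := 1 - θ) (by ring)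
        rw [this, smul_eq_mul, smul_eq_mul]
        simp only [θ]; field_simp; ring
      obtain ⟨K₁, hf, hK₁, hr⟩ := exists_stellar hK he huv h0 h1 rfl
      have hlt : {e : E2 × E2 | {e.1, e.2} ∈ K₁.faces ∧ a e.1 < 0 ∧ 0 < a e.2}.ncard < n := by
        rw [← hn]
        refine Set.ncard_lt_ncard ⟨?_, fun h => ?_⟩ (hfin K hK)
        · rintro ⟨p, q⟩ ⟨hpq, hp, hq⟩
          rw [hf] at hpq
          rcases hpq with ⟨h, -⟩ | ⟨r, -, -, h⟩
          · exact ⟨h, hp, hq⟩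
          · have : θ • u + (1 - θ) • v ∈ ({p, q} : Finset E2) := h ▸ Finset.mem_insert_self _ _
            rw [Finset.mem_insert, Finset.mem_singleton] at this
            rcases this with rfl | rfl
            · exact absurd hax hp.ne
            · exact absurd hax hq.ne'
        · have := (h (a := (u, v)) ⟨he, hu, hv⟩).1
          rw [hf] at this
          rcases this with ⟨-, h⟩ | ⟨r, -, -, h⟩
          · simp at h
          · have h' : θ • u + (1 - θ) • v ∈ ({u, v} : Finset E2) := h ▸ Finset.mem_insert_self _ _
            exact notMem_of_edge he huv h0 h1 rfl _ he h'
      obtain ⟨K', hK', h'⟩ := ih _ hlt hK₁ rfl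
      refine ⟨K', ⟨hK'.1, fun s hs => ?_⟩, h'⟩
      obtain ⟨t, ht, hst⟩ := hK'.2 s hs
      obtain ⟨t', ht', htt⟩ := hr t ht
      exact ⟨t', ht', hst.trans htt⟩
    · push Not at hne
      refine ⟨K, ⟨hK, fun s hs => ⟨s, hs, subset_rfl⟩⟩, fun s hs => ?_⟩
      by_cases hneg : ∃ u ∈ s, a u < 0
      · obtain ⟨u, hu, hau⟩ := hneg
        refine Or.inr fun x hx => convexHull_min (s := (s : Set E2)) (t := a ⁻¹' Iic 0)
          (fun v hv => ?_) ((convex_Iic 0).affine_preimage a) hx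
        exact hne (u, v) (K.down_closed hs (by simp [Finset.insert_subset_iff, hu,
          Finset.mem_coe.1 hv]) (by simp)) hau
      · push Not at hneg
        exact Or.inl fun x hx => convexHull_min (s := (s : Set E2)) (t := a ⁻¹' Ici 0)
          (fun v hv => hneg v hv) ((convex_Ici 0).affine_preimage a) hx

theorem exists_refines {Ω : Set E2} {Φ : Set (E2 →ᵃ[ℝ] ℝ)} (hΦ : Φ.Finite)
    (hK : IsTriangulation K Ω) :
    ∃ K' : SimplicialComplex ℝ E2, RefinesOn K' K Ω ∧ ∀ s ∈ K'.faces, ∀ a ∈ Φ,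
      (∀ x ∈ cell s, 0 ≤ a x) ∨ ∀ x ∈ cell s, a x ≤ 0 := by
  induction Φ, hΦ using Set.Finite.induction_on with
  | empty => exact ⟨K, ⟨hK, fun s hs => ⟨s, hs, subset_rfl⟩⟩, fun s _ a ha => ha.elim⟩
  | @insert a Φ _ _ ih =>
    obtain ⟨K₁, h1, h1'⟩ := ih
    obtain ⟨K₂, h2, h2'⟩ := exists_refines_functional a h1.1
    refine ⟨K₂, ⟨h2.1, fun s hs => ?_⟩, fun s hs b hb => ?_⟩
    · obtain ⟨t, ht, hst⟩ := h2.2 s hs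
      obtain ⟨t', ht', htt⟩ := h1.2 t ht
      exact ⟨t', ht', hst.trans htt⟩
    · rcases hb with rfl | hb
      · exact h2' s hs
      · obtain ⟨t, ht, hst⟩ := h2.2 s hs
        exact (h1' t ht b hb).imp (fun h x hx => h x (hst hx)) fun h x hx => h x (hst hx)

/-- A map which is piecewise linear on the triangles of a triangulation is piecewise affine over
some triangulation. -/
theorem exists_piecewiseAffineOn {Ω : Set E2} {f : E2 → E2} (hK : IsTriangulation K Ω)
    (hf : ∀ s ∈ K.faces, s.card = 3 → PLOn f (cell s)) :
    ∃ K' : SimplicialComplex ℝ E2, IsTriangulation K' Ω ∧ PiecewiseAffineOn f K' := by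
  choose! Φ hΦ hΦ' using hf
  have hfin : (⋃ s ∈ {s ∈ K.faces | s.card = 3}, Φ s).Finite :=
    (hK.1.subset (sep_subset _ _)).biUnion fun s hs => hΦ s hs.1 hs.2
  obtain ⟨K', h1, h2⟩ := exists_refines hfin hK
  refine ⟨K', h1.1, fun s hs => ?_⟩
  obtain ⟨t, ht, hst⟩ := h1.2 s hs
  obtain ⟨t', ht', htt, h3⟩ := hK.2.2.2 t ht
  exact hΦ' t' ht' h3 _ (hst.trans (convexHull_mono (Finset.coe_subset.2 htt)))
    (convex_convexHull ℝ _) fun φ hφ => h2 s hs φ (mem_biUnion (show t' ∈ _ from ⟨ht', h3⟩) hφ)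

end

/-- `Λ` is a `C`-Lipschitz system of barycentric coordinates on `Ω` with respect to the triangles
`𝓢` with vertices `P`. -/
structure Bary {ι : Type*} [Fintype ι] (P : ι → E2) (𝓢 : Set (Finset ι)) (Ω : Set E2)
    (Λ : E2 → ι → ℝ) (C : ℝ) : Prop where
  card : ∀ S ∈ 𝓢, S.card = 3
  mem : ∀ x ∈ Ω, ∃ S ∈ 𝓢, ∀ v ∉ S, Λ x v = 0
  nonneg : ∀ x ∈ Ω, ∀ v, 0 ≤ Λ x v
  sum : ∀ x ∈ Ω, ∑ v, Λ x v = 1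
  pos : ∀ x ∈ Ω, ∑ v, Λ x v • P v = x
  uniq : ∀ S ∈ 𝓢, ∀ d : ι → ℝ, (∀ v ∉ S, d v = 0) → (∀ v, 0 ≤ d v) → ∑ v, d v = 1 →
    (∑ v, d v • P v) ∈ Ω ∧ Λ (∑ v, d v • P v) = d
  lip : ∀ x ∈ Ω, ∀ y ∈ Ω, ‖Λ x - Λ y‖ ≤ C * ‖x - y‖

theorem exists_bary {K : SimplicialComplex ℝ E2} {Ω : Set E2} (hK : IsTriangulation K Ω) :
    ∃ (V : Finset E2) (𝓢 : Set (Finset V)) (Λ : E2 → V → ℝ) (C : ℝ), 0 < C ∧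
      Bary (fun v : V => (v : E2)) 𝓢 Ω Λ C := by
  classical
  set V : Finset E2 := hK.1.toFinset.biUnion id
  have hV : ∀ s ∈ K.faces, s ⊆ V := fun s hs =>
    Finset.subset_biUnion_of_mem id (hK.1.mem_toFinset.2 hs)
  have hU := uniqRep_faces K hV
  set 𝓢 : Set (Finset V) := {S | S.map (Function.Embedding.subtype _) ∈ K.faces ∧ S.card = 3}
  have ext : ∀ d : V → ℝ, ∃ d' : E2 → ℝ, (∀ v : V, d' v = d v) ∧
      (∀ v, v ∉ V → d' v = 0) ∧ ∑ v ∈ V, d' v = ∑ v, d v ∧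
      ∑ v ∈ V, d' v • v = ∑ v, d v • (v : E2) := by
    intro d
    have h : ∀ v : V, (fun q => if h : q ∈ V then d ⟨q, h⟩ else 0) v = d v := fun v => by simp
    refine ⟨fun q => if h : q ∈ V then d ⟨q, h⟩ else 0, h, fun v hv => by simp [hv], ?_, ?_⟩
    · rw [← Finset.sum_coe_sort]
      grind
    · rw [← Finset.sum_coe_sort]
      grind
  have cone : ∀ S ∈ 𝓢, ∀ T ∈ 𝓢, ∀ d : V → ℝ, (∀ v ∉ S, d v ≤ 0) → (∀ v ∉ T, 0 ≤ d v) →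
      ∑ v, d v = 0 → ∑ v, d v • (v : E2) = 0 → d = 0 := by
    intro S hS T hT d h1 h2 h3 h4
    obtain ⟨d', e, e0, e1, e2⟩ := ext d
    have := hU.cone (d := d') hS.1 hT.1 (fun q hq => ?_) (fun q hq => ?_) (e1.trans h3)
      (e2.trans h4)
    · funext v
      rw [← e v, this]; rfl
    all_goals
      by_cases hqV : q ∈ V
      · rw [show q = ((⟨q, hqV⟩ : V) : E2) from rfl, e]
        first
          | exact h1 _ fun h => hq (Finset.mem_map.2 ⟨_, h, rfl⟩)
          | exact h2 _ fun h => hq (Finset.mem_map.2 ⟨_, h, rfl⟩)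
      · rw [e0 q hqV]
  have hrep : ∀ x ∈ Ω, ∃ d : V → ℝ, (∃ S ∈ 𝓢, ∀ v ∉ S, d v = 0) ∧ (∀ v, 0 ≤ d v) ∧
      ∑ v, d v = 1 ∧ ∑ v, d v • (v : E2) = x := by
    intro x hx
    rw [← hK.2.2.1, mem_space_iff] at hx
    obtain ⟨s, hs, hxs⟩ := hx
    obtain ⟨t, ht, hst, h3⟩ := hK.2.2.2 s hs
    obtain ⟨w, hw, hw0⟩ := hU.exists_rep ht (convexHull_mono (Finset.coe_subset.2 hst) hxs)
    have hm : (t.subtype (· ∈ V)).map (Function.Embedding.subtype _) = t := by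
      rw [Finset.subtype_map]
      exact Finset.filter_true_of_mem (hV t ht)
    refine ⟨fun v => w v, ⟨t.subtype (· ∈ V), ⟨?_, ?_⟩, fun v hv => hw0 v (by simpa using hv)⟩,
      fun v => hw.nonneg v, ?_, ?_⟩
    · rw [hm]; exact ht
    · rw [← h3, ← Finset.card_map (Function.Embedding.subtype (· ∈ V)), hm]
    · rw [Finset.sum_coe_sort V w]; exact hw.sum
    · rw [Finset.sum_coe_sort V fun v => w v • v]; exact hw.pos
  choose! Λ h1 h2 h3 h4 using hrep
  set B : Set (V → ℝ) := ⋃ S ∈ 𝓢, ⋃ T ∈ 𝓢, {d | (∀ v ∉ S, d v ≤ 0) ∧ (∀ v ∉ T, 0 ≤ d v) ∧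
    ∑ v, d v = 0} ∩ sphere 0 1
  have hB : IsCompact B := by
    refine (Set.toFinite 𝓢).isCompact_biUnion fun S _ =>
      (Set.toFinite 𝓢).isCompact_biUnion fun T _ => (isCompact_sphere _ _).inter_left ?_
    simp only [ofPred_and, ofPred_forall]
    refine (isClosed_iInter fun v => isClosed_iInter fun _ => ?_).inter
      ((isClosed_iInter fun v => isClosed_iInter fun _ => ?_).inter ?_)
    · exact isClosed_le (continuous_apply v) continuous_const
    · exact isClosed_le continuous_const (continuous_apply v)
    · exact isClosed_eq (by fun_prop) continuous_const
  obtain ⟨c, hc, hcB⟩ := hB.exists_forall_le' (f := fun d : V → ℝ => ‖∑ v : V, d v • (v : E2)‖) (a := 0)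
    (Continuous.continuousOn (by fun_prop)) (by
      intro d hd
      simp only [B, mem_iUnion] at hd
      obtain ⟨S, hS, T, hT, ⟨g1, g2, g3⟩, g4⟩ := hd
      refine norm_pos_iff.2 fun h => ?_
      rw [cone S hS T hT d g1 g2 g3 h] at g4
      simp at g4)
  refine ⟨V, 𝓢, Λ, c⁻¹, inv_pos.2 hc, fun S hS => hS.2, h1, h2, h3, h4, ?_, ?_⟩
  · intro S hS d g1 g2 g3
    obtain ⟨d', e, e0, e1, e2⟩ := ext d
    have hmem : (∑ v, d v • (v : E2)) ∈ Ω := by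
      rw [← hK.2.2.1, mem_space_iff]
      refine ⟨_, hS.1, (mem_hull_iff_weights (hV _ hS.1)).2 ⟨d', fun q hq => ?_, fun q => ?_,
        e1.trans g3, e2⟩⟩
      all_goals
        by_cases hqV : q ∈ V
        · rw [show q = ((⟨q, hqV⟩ : V) : E2) from rfl, e]
          first | exact g2 _ | exact g1 _ fun h => hq (Finset.mem_map.2 ⟨_, h, rfl⟩)
        · rw [e0 q hqV]
    refine ⟨hmem, ?_⟩
    obtain ⟨T, hT, hT'⟩ := h1 _ hmem
    refine sub_eq_zero.1 (cone T hT S hS _ (fun v hv => ?_) (fun v hv => ?_) ?_ ?_)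
    · rw [Pi.sub_apply, hT' v hv, zero_sub]; exact neg_nonpos.2 (g2 v)
    · rw [Pi.sub_apply, g1 v hv, sub_zero]; exact h2 _ hmem v
    · simp only [Pi.sub_apply, Finset.sum_sub_distrib, h3 _ hmem, g3, sub_self]
    · simp only [Pi.sub_apply, sub_smul, Finset.sum_sub_distrib, h4 _ hmem, sub_self]
  · intro x hx y hy
    obtain ⟨S, hS, hS'⟩ := h1 x hx
    obtain ⟨T, hT, hT'⟩ := h1 y hy
    rcases eq_or_ne (Λ x - Λ y) 0 with h0 | h0
    · rw [h0, norm_zero]; positivity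
    · have hn := norm_pos_iff.2 h0
      have hi := (inv_pos.2 hn).le
      have := hcB (‖Λ x - Λ y‖⁻¹ • (Λ x - Λ y)) (by
        simp only [B, mem_iUnion]
        refine ⟨S, hS, T, hT, ⟨fun v hv => ?_, fun v hv => ?_, ?_⟩, ?_⟩
        · simp only [Pi.smul_apply, Pi.sub_apply, hS' v hv, zero_sub, smul_eq_mul]
          exact mul_nonpos_of_nonneg_of_nonpos hi (neg_nonpos.2 (h2 y hy v))
        · simp only [Pi.smul_apply, Pi.sub_apply, hT' v hv, sub_zero, smul_eq_mul]
          exact mul_nonneg hi (h2 x hx v)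
        · simp only [Pi.smul_apply, Pi.sub_apply, smul_eq_mul, ← Finset.mul_sum,
            Finset.sum_sub_distrib, h3 x hx, h3 y hy, sub_self, mul_zero]
        · rw [mem_sphere_zero_iff_norm, norm_smul, norm_inv, norm_norm, inv_mul_cancel₀ hn.ne'])
      simp only [Pi.smul_apply, smul_assoc, ← Finset.smul_sum, Pi.sub_apply, sub_smul,
        Finset.sum_sub_distrib, h4 x hx, h4 y hy] at this
      rw [norm_smul, norm_inv, norm_norm, inv_mul_eq_div, le_div_iff₀ hn] at this
      rw [inv_mul_eq_div, le_div_iff₀ hc, mul_comm]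
      exact this

open scoped Classical in
/-- The barycentric coordinates of a vertex of a triangle of the lattice of mesh `1 / n`. -/
def triCoord {ι : Type*} (n : ℕ) (m : ι → ℤ) (σ : ℤ) (u v : ι) : ℝ :=
  ((m v + if v = u then σ else 0 : ℤ) : ℝ) / n

/-- A vertex of a triangle of the lattice of mesh `1 / n`. -/
def triPt {ι : Type*} [Fintype ι] (P : ι → E2) (n : ℕ) (m : ι → ℤ) (σ : ℤ) (u : ι) : E2 :=
  ∑ v, triCoord n m σ u v • P v

open scoped Classical in
/-- The vertices of a triangle of the lattice of mesh `1 / n`. -/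
def triSet {ι : Type*} [Fintype ι] (P : ι → E2) (n : ℕ) (S : Finset ι) (m : ι → ℤ) (σ : ℤ) :
    Finset E2 := S.image (triPt P n m σ)

/-- The parameters of a triangle of the lattice of mesh `1 / n` inside the triangle `S`. -/
structure FineTri {ι : Type*} [Fintype ι] (n : ℕ) (𝓢 : Set (Finset ι)) (S : Finset ι) (m : ι → ℤ)
    (σ : ℤ) : Prop where
  mem : S ∈ 𝓢
  sgn : σ = 1 ∨ σ = -1
  off : ∀ v ∉ S, m v = 0
  nonneg : ∀ v ∈ S, 0 ≤ m v ∧ 0 ≤ m v + σ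
  sum : ∑ v, m v = n - σ

section

variable {ι : Type*} [Fintype ι] {P : ι → E2} {𝓢 : Set (Finset ι)} {Ω : Set E2}
  {Λ : E2 → ι → ℝ} {C : ℝ} {n : ℕ} {S : Finset ι} {m : ι → ℤ} {σ : ℤ}

theorem triPt_eq (u : ι) : triPt P n m σ u = ∑ v, ((m v : ℝ) / n) • P v + ((σ : ℝ) / n) • P u := by
  classical
  have : ∀ v, triCoord n m σ u v • P v = ((m v : ℝ) / n) • P v +
      if v = u then ((σ : ℝ) / n) • P v else 0 := by
    intro v
    unfold triCoord
    split_ifs <;> push_cast <;> module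
  simp only [triPt, this, Finset.sum_add_distrib, Finset.sum_ite_eq', Finset.mem_univ, if_true]

theorem Bary.coord_triPt (hb : Bary P 𝓢 Ω Λ C) (hn : 0 < n) (ht : FineTri n 𝓢 S m σ) {u : ι}
    (hu : u ∈ S) : triPt P n m σ u ∈ Ω ∧ Λ (triPt P n m σ u) = triCoord n m σ u := by
  classical
  refine hb.uniq S ht.mem _ (fun v hv => ?_) (fun v => div_nonneg (Int.cast_nonneg ?_)
    (Nat.cast_nonneg n)) ?_
  · rw [triCoord, ht.off v hv, if_neg (ne_of_mem_of_not_mem hu hv).symm]; simp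
  · by_cases hv : v ∈ S
    · have := ht.nonneg v hv
      split_ifs <;> omega
    · rw [ht.off v hv, if_neg (ne_of_mem_of_not_mem hu hv).symm]; simp
  · simp only [triCoord]
    rw [← Finset.sum_div, ← Int.cast_sum, Finset.sum_add_distrib, Finset.sum_ite_eq',
      if_pos (Finset.mem_univ _), ht.sum]
    push_cast; field_simp; ring

theorem Bary.comb (hb : Bary P 𝓢 Ω Λ C) (hS : S ∈ 𝓢) {F : Finset E2}
    (hF : ∀ p ∈ F, p ∈ Ω ∧ ∀ v ∉ S, Λ p v = 0) {w : E2 → ℝ} (h0 : ∀ p, 0 ≤ w p)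
    (h1 : ∑ p ∈ F, w p = 1) :
    (∑ p ∈ F, w p • p) ∈ Ω ∧ ∀ v, Λ (∑ p ∈ F, w p • p) v = ∑ p ∈ F, w p * Λ p v := by
  have e : ∑ v, (∑ p ∈ F, w p * Λ p v) • P v = ∑ p ∈ F, w p • p := by
    simp only [Finset.sum_smul]
    rw [Finset.sum_comm]
    refine Finset.sum_congr rfl fun p hp => ?_
    simp only [mul_smul, ← Finset.smul_sum, hb.pos p (hF p hp).1]
  have := hb.uniq S hS (fun v => ∑ p ∈ F, w p * Λ p v)
    (fun v hv => Finset.sum_eq_zero fun p hp => by grind)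
    (fun v => Finset.sum_nonneg fun p hp => mul_nonneg (h0 p) (hb.nonneg p (hF p hp).1 v)) (by
      rw [Finset.sum_comm]
      simp only [← Finset.mul_sum]
      rw [← h1]
      exact Finset.sum_congr rfl fun p hp => by rw [hb.sum p (hF p hp).1, mul_one])
  simp_all

theorem Bary.triSet_mem (hb : Bary P 𝓢 Ω Λ C) (hn : 0 < n) (ht : FineTri n 𝓢 S m σ) :
    ∀ p ∈ triSet P n S m σ, p ∈ Ω ∧ (∃ k : ι → ℤ, ∀ v, n * Λ p v = k v) ∧ ∀ v ∉ S, Λ p v = 0 := by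
  classical
  intro p hp
  obtain ⟨u, hu, rfl⟩ := Finset.mem_image.1 hp
  obtain ⟨h1, h2⟩ := hb.coord_triPt hn ht hu
  have hn' : (n : ℝ) ≠ 0 := by positivity
  refine ⟨h1, ⟨fun v => m v + if v = u then σ else 0, fun v => ?_⟩, fun v hv => ?_⟩
  · rw [h2]; exact mul_div_cancel₀ _ hn'
  · rw [h2, triCoord, ht.off v hv, if_neg (ne_of_mem_of_not_mem hu hv).symm]; simp

/-- The hat function of the lattice point `q`. -/
def latHat (Λ : E2 → ι → ℝ) (n : ℕ) (q x : E2) : ℝ := max 0 (1 - n * ‖Λ x - Λ q‖)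

theorem Bary.separate (hb : Bary P 𝓢 Ω Λ C) (hn : 0 < n) (ht : FineTri n 𝓢 S m σ) {q : E2}
    (hq : q ∈ Ω) {k : ι → ℤ} (hk : ∀ v, n * Λ q v = k v) :
    ∃ v, ∃ τ : ℝ, |τ| = 1 ∧ ∀ p ∈ triSet P n S m σ, p ≠ q → 1 ≤ τ * (n * Λ p v - n * Λ q v) := by
  classical
  have hn' : (n : ℝ) ≠ 0 := by positivity
  have hc : ∀ u ∈ S, ∀ v, n * Λ (triPt P n m σ u) v = ((m v + if v = u then σ else 0 : ℤ) : ℝ) :=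
    fun u hu v => by rw [(hb.coord_triPt hn ht hu).2]; exact mul_div_cancel₀ _ hn'
  suffices h : ∃ v, ∃ τ : ℤ, (τ = 1 ∨ τ = -1) ∧ ∀ u ∈ S, triPt P n m σ u ≠ q →
      1 ≤ τ * ((m v + if v = u then σ else 0) - k v) by
    obtain ⟨v, τ, h1, h2⟩ := h
    refine ⟨v, τ, by rcases h1 with rfl | rfl <;> simp, fun p hp hpq => ?_⟩
    obtain ⟨u, hu, rfl⟩ := Finset.mem_image.1 hp
    rw [hc u hu, hk]
    exact_mod_cast h2 u hu hpq
  have hσ := ht.sgn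
  by_cases h1 : ∃ v, σ * (k v - m v) ≤ -1
  · obtain ⟨v, hv⟩ := h1
    refine ⟨v, σ, hσ, fun u _ _ => ?_⟩
    grind
  by_cases h2 : ∃ v, 2 ≤ σ * (k v - m v)
  · obtain ⟨v, hv⟩ := h2
    refine ⟨v, -σ, by omega, fun u _ _ => ?_⟩
    grind
  push Not at h1 h2
  have hs : ∑ v, σ * (k v - m v) = 1 := by
    have h3 : ∑ v, k v = n := by
      have := congrArg (fun t => (n : ℝ) * t) (hb.sum q hq)
      simp only [Finset.mul_sum, hk, mul_one] at this
      exact_mod_cast this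
    rw [← Finset.mul_sum, Finset.sum_sub_distrib, h3, ht.sum]
    grind
  obtain ⟨u, hu⟩ : ∃ u, 0 < σ * (k u - m u) := by
    by_contra! hc
    have := Finset.sum_nonpos fun v (_ : v ∈ Finset.univ) => hc v
    omega
  have hz : ∀ v, v ≠ u → k v = m v := by
    intro v hv
    have := Finset.add_le_sum (f := fun v => σ * (k v - m v)) (s := Finset.univ)
      (fun v _ => by have := h1 v; omega) (Finset.mem_univ v) (Finset.mem_univ u) hv
    grind
  have hku : k u = m u + σ := by
    grind
  by_cases huS : u ∈ S
  · refine ⟨u, -σ, by omega, fun u' hu' hne => ?_⟩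
    have : u ≠ u' := by
      rintro rfl
      refine hne ?_
      rw [← hb.pos q hq, ← hb.pos _ (hb.coord_triPt hn ht huS).1]
      refine Finset.sum_congr rfl fun v _ => ?_
      congr 1
      refine mul_left_cancel₀ hn' ?_
      rw [hc u huS, hk]
      by_cases h : v = u
      · rw [h, if_pos rfl, hku]
      · rw [if_neg h, hz v h, add_zero]
    grind
  · refine ⟨u, -1, Or.inr rfl, fun u' hu' _ => ?_⟩
    have hne : u ≠ u' := fun h => huS (h ▸ hu')
    have h0 : (0 : ℤ) ≤ k u := by
      have : (0 : ℝ) ≤ k u := by rw [← hk]; exact mul_nonneg (Nat.cast_nonneg n) (hb.nonneg q hq u)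
      exact_mod_cast this
    have := ht.off u huS
    rw [if_neg hne]
    omega

theorem Bary.latHat_comb (hb : Bary P 𝓢 Ω Λ C) (hn : 0 < n) (ht : FineTri n 𝓢 S m σ) {w : E2 → ℝ}
    (hw : ∀ p ∉ triSet P n S m σ, w p = 0) (h0 : ∀ p, 0 ≤ w p)
    (h1 : ∑ p ∈ triSet P n S m σ, w p = 1) {q : E2} (hq : q ∈ Ω)
    (hk : ∃ k : ι → ℤ, ∀ v, n * Λ q v = k v) :
    latHat Λ n q (∑ p ∈ triSet P n S m σ, w p • p) = w q := by
  classical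
  have hn0 : (0 : ℝ) ≤ n := Nat.cast_nonneg n
  have hT := hb.triSet_mem hn ht
  set T := triSet P n S m σ
  obtain ⟨-, hx⟩ := hb.comb ht.mem (fun p hp => ⟨(hT p hp).1, (hT p hp).2.2⟩) h0 h1
  set x := ∑ p ∈ T, w p • p
  have hd : ∀ v, n * (Λ x v - Λ q v) = ∑ p ∈ T, w p * (n * Λ p v - n * Λ q v) := by
    intro v
    simp only [mul_sub, Finset.sum_sub_distrib, ← Finset.sum_mul, h1, hx, Finset.mul_sum]
    grind
  have hsum : ∑ p ∈ T, (if p = q then 0 else w p) = 1 - w q := by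
    have : ∀ p, (if p = q then 0 else w p) = w p - if p = q then w p else 0 := fun p => by
      split_ifs <;> simp
    simp only [this, Finset.sum_sub_distrib, h1, Finset.sum_ite_eq']
    split_ifs with h
    · rfl
    · rw [hw q h]
  obtain ⟨k, hk⟩ := hk
  obtain ⟨v, τ, hτ, hsep⟩ := hb.separate hn ht hq hk
  have hlow : 1 - w q ≤ n * ‖Λ x - Λ q‖ := calc
    1 - w q ≤ ∑ p ∈ T, w p * (τ * (n * Λ p v - n * Λ q v)) := by
        rw [← hsum]
        refine Finset.sum_le_sum fun p hp => ?_
        split_ifs with h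
        · rw [h]; simp
        · exact le_mul_of_one_le_right (h0 p) (hsep p hp h)
    _ = τ * (n * (Λ x v - Λ q v)) := by
        rw [hd, Finset.mul_sum]
        exact Finset.sum_congr rfl fun p _ => by ring
    _ ≤ |τ * (n * (Λ x v - Λ q v))| := le_abs_self _
    _ = n * ‖(Λ x - Λ q) v‖ := by
        rw [abs_mul, hτ, one_mul, abs_mul, abs_of_nonneg hn0, norm_eq_abs, Pi.sub_apply]
    _ ≤ _ := mul_le_mul_of_nonneg_left (norm_le_pi_norm _ v) hn0
  by_cases hqT : q ∈ T
  · have hup : ‖Λ x - Λ q‖ ≤ (1 - w q) / n := by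
      have hnp : (0 : ℝ) < n := by positivity
      refine (pi_norm_le_iff_of_nonneg (div_nonneg ?_ hn0)).2 fun v => ?_
      · rw [← hsum]; exact Finset.sum_nonneg fun p _ => by split_ifs <;> simp [h0]
      rw [le_div_iff₀ hnp, mul_comm, norm_eq_abs, Pi.sub_apply, ← abs_of_nonneg hn0, ← abs_mul,
        hd, ← hsum]
      refine (Finset.abs_sum_le_sum_abs _ _).trans (Finset.sum_le_sum fun p hp => ?_)
      rw [abs_mul, abs_of_nonneg (h0 p)]
      split_ifs with h
      · rw [h]; simp
      · refine mul_le_of_le_one_right (h0 p) ?_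
        obtain ⟨u, hu, rfl⟩ := Finset.mem_image.1 hp
        obtain ⟨u', hu', rfl⟩ := Finset.mem_image.1 hqT
        rw [(hb.coord_triPt hn ht hu).2, (hb.coord_triPt hn ht hu').2, triCoord, triCoord,
          mul_div_cancel₀ _ hnp.ne', mul_div_cancel₀ _ hnp.ne']
        norm_cast
        have := ht.sgn
        rw [abs_le]
        split_ifs <;> omega
    have := (le_div_iff₀ (by positivity : (0 : ℝ) < n)).1 hup
    rw [latHat, show 1 - n * ‖Λ x - Λ q‖ = w q by linarith, max_eq_right (h0 q)]
  · rw [hw q hqT] at hlow ⊢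
    exact max_eq_left (by linarith)

theorem Bary.exists_fineTri (hb : Bary P 𝓢 Ω Λ C) (hn : 0 < n) {x : E2} (hx : x ∈ Ω) :
    ∃ S m σ, FineTri n 𝓢 S m σ ∧ x ∈ conv (triSet P n S m σ : Set E2) := by
  classical
  have hnp : (0 : ℝ) < n := by positivity
  obtain ⟨S, hS, hoff⟩ := hb.mem x hx
  suffices h : ∃ m : ι → ℤ, ∃ σ : ℤ, FineTri n 𝓢 S m σ ∧ ∀ u ∈ S, 0 ≤ σ * (n * Λ x u - m u) by
    obtain ⟨m, σ, ht, hg⟩ := h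
    refine ⟨S, m, σ, ht, ?_⟩
    have hσ : (σ : ℝ) * σ = 1 := by rcases ht.sgn with h | h <;> rw [h] <;> norm_num
    have hsS : ∀ f : ι → ℝ, (∀ v ∉ S, f v = 0) → ∑ v ∈ S, f v = ∑ v, f v := fun f hf =>
      Finset.sum_subset (Finset.subset_univ _) fun v _ hv => hf v hv
    have hg1 : ∑ u ∈ S, σ * (n * Λ x u - m u) = 1 := by
      rw [hsS _ fun v hv => by rw [hoff v hv, ht.off v hv]; simp]
      rw [← Finset.mul_sum, Finset.sum_sub_distrib, ← Finset.mul_sum, hb.sum x hx, ← Int.cast_sum,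
        ht.sum]
      push_cast
      linear_combination hσ
    have e : ∑ u ∈ S, (σ * (n * Λ x u - m u)) • triPt P n m σ u = x := by
      simp only [triPt_eq, smul_add, Finset.sum_add_distrib, ← Finset.sum_smul, hg1, one_smul,
        smul_smul]
      rw [Finset.sum_subset (Finset.subset_univ S) fun v _ hv => by
        rw [hoff v hv, ht.off v hv]; simp, ← Finset.sum_add_distrib]
      conv_rhs => rw [← hb.pos x hx]
      refine Finset.sum_congr rfl fun v _ => ?_
      rw [← add_smul]
      grind
    rw [← e]
    exact (convex_convexHull ℝ _).sum_mem hg hg1 fun u hu =>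
      subset_convexHull ℝ _ (Finset.mem_coe.2 (Finset.mem_image_of_mem _ hu))
  have hfoff : ∀ v ∉ S, ⌊n * Λ x v⌋ = 0 := fun v hv => by rw [hoff v hv]; simp
  have hf0 : ∀ v, 0 ≤ ⌊n * Λ x v⌋ := fun v => Int.floor_nonneg.2
    (mul_nonneg hnp.le (hb.nonneg x hx v))
  have hfr : ∑ v ∈ S, Int.fract (n * Λ x v) = n - ((∑ v, ⌊n * Λ x v⌋ : ℤ) : ℝ) := by
    rw [Finset.sum_subset (Finset.subset_univ S) fun v _ hv => by rw [hoff v hv]; simp]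
    simp only [Int.fract, Finset.sum_sub_distrib, ← Finset.mul_sum, hb.sum x hx]
    push_cast; ring
  have hlt : ∑ v ∈ S, Int.fract (n * Λ x v) < 3 := by
    refine (Finset.sum_lt_sum_of_nonempty (Finset.card_pos.1 (by rw [hb.card S hS]; norm_num))
      fun v _ => Int.fract_lt_one _).trans_eq ?_
    simp [hb.card S hS]
  have hge : 0 ≤ ∑ v ∈ S, Int.fract (n * Λ x v) := Finset.sum_nonneg fun v _ => Int.fract_nonneg _
  rw [hfr] at hlt hge
  have hr : (n : ℤ) - ∑ v, ⌊n * Λ x v⌋ < 3 ∧ 0 ≤ (n : ℤ) - ∑ v, ⌊n * Λ x v⌋ :=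
    ⟨by exact_mod_cast hlt, by exact_mod_cast hge⟩
  have hcases : (n : ℤ) - ∑ v, ⌊n * Λ x v⌋ = 0 ∨ (n : ℤ) - ∑ v, ⌊n * Λ x v⌋ = 1 ∨
    (n : ℤ) - ∑ v, ⌊n * Λ x v⌋ = 2 := by omega
  rcases hcases with h | h | h
  · obtain ⟨v, hv⟩ : ∃ v, 0 < ⌊n * Λ x v⌋ := by
      by_contra! hc
      have := Finset.sum_nonpos fun v (_ : v ∈ Finset.univ) => hc v
      omega
    have hz : ∀ u ∈ S, Int.fract (n * Λ x u) = 0 := by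
      refine (Finset.sum_eq_zero_iff_of_nonneg fun v _ => Int.fract_nonneg _).1 ?_
      rw [hfr]; exact_mod_cast h
    refine ⟨fun u => ⌊n * Λ x u⌋ - if u = v then 1 else 0, 1, ⟨hS, Or.inl rfl, fun u hu => ?_,
      fun u _ => ?_, ?_⟩, fun u hu => ?_⟩
    · grind
    · grind
    · rw [Finset.sum_sub_distrib, Finset.sum_ite_eq', if_pos (Finset.mem_univ _)]; omega
    · have := hz u hu
      rw [Int.fract] at this
      push_cast
      split_ifs <;> linarith
  · refine ⟨fun u => ⌊n * Λ x u⌋, 1, ⟨hS, Or.inl rfl, hfoff, fun u _ => ?_, by omega⟩,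
      fun u _ => ?_⟩
    · have := hf0 u; omega
    · have := Int.fract_nonneg (n * Λ x u)
      positivity
  · refine ⟨fun u => ⌊n * Λ x u⌋ + if u ∈ S then 1 else 0, -1, ⟨hS, Or.inr rfl, fun u hu => ?_,
      fun u hu => ?_, ?_⟩, fun u hu => ?_⟩
    · simp [hfoff u hu, hu]
    · grind
    · rw [Finset.sum_add_distrib, Finset.sum_ite_mem, Finset.univ_inter, Finset.sum_const,
        hb.card S hS, nsmul_eq_mul]
      omega
    · have := Int.fract_lt_one (n * Λ x u)
      rw [Int.fract] at this
      simp only [hu, if_true]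
      push_cast; linarith

end

/-- `K` is a triangulation of `Ω` by triangles of size `1 / n`, with controlled hat functions. -/
structure FineComplex (K : SimplicialComplex ℝ E2) (Ω : Set E2) (n : ℕ) (C : ℝ) : Prop where
  tri : IsTriangulation K Ω
  diam : ∀ s ∈ K.faces, ∀ x ∈ cell s, ∀ y ∈ cell s,
    ‖x - y‖ ≤ C / n
  hat : ∃ ψ : E2 → E2 → ℝ, (∀ q, ∀ x ∈ Ω, ∀ y ∈ Ω, |ψ q x - ψ q y| ≤ C * n * ‖x - y‖) ∧
    ∀ s ∈ K.faces, ∀ w : E2 → ℝ, (∀ p ∉ s, w p = 0) → (∀ p, 0 ≤ w p) → ∑ p ∈ s, w p = 1 →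
      ∀ t ∈ K.faces, ∀ q ∈ t, ψ q (∑ p ∈ s, w p • p) = w q

section

variable {ι : Type*} [Fintype ι] {P : ι → E2} {𝓢 : Set (Finset ι)} {Ω : Set E2}
  {Λ : E2 → ι → ℝ} {C : ℝ} {n : ℕ}

theorem Bary.finite_lattice (hb : Bary P 𝓢 Ω Λ C) (hn : 0 < n) :
    {q ∈ Ω | ∃ k : ι → ℤ, ∀ v, n * Λ q v = k v}.Finite := by
  have hnp : (0 : ℝ) < n := by positivity
  refine Set.Finite.of_injOn (f := Λ)
    (t := Set.univ.pi fun _ => (fun k : ℤ => (k : ℝ) / n) '' Icc 0 (n : ℤ)) ?_ ?_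
    (Set.Finite.pi fun _ => (Set.finite_Icc _ _).image _)
  · rintro q ⟨hq, k, hk⟩ v -
    have h0 := hb.nonneg q hq
    have h1 : Λ q v ≤ 1 := by
      rw [← hb.sum q hq]
      exact Finset.single_le_sum (fun v _ => h0 v) (Finset.mem_univ v)
    refine ⟨k v, ⟨?_, ?_⟩, ?_⟩
    · have : (0 : ℝ) ≤ k v := hk v ▸ mul_nonneg hnp.le (h0 v)
      exact_mod_cast this
    · have : (k v : ℝ) ≤ n := hk v ▸ mul_le_of_le_one_right hnp.le h1
      exact_mod_cast this
    grind
  · rintro x ⟨hx, -⟩ y ⟨hy, -⟩ hxy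
    rw [← hb.pos x hx, hxy, hb.pos y hy]

theorem Bary.exists_fineComplex (hb : Bary P 𝓢 Ω Λ C) (hC : 0 < C) :
    ∃ C' > 0, ∀ n : ℕ, 0 < n → ∃ K, FineComplex K Ω n C' := by
  classical
  have hPn : ∀ u, ‖P u‖ ≤ ∑ u, ‖P u‖ := fun u =>
    Finset.single_le_sum (fun u _ => norm_nonneg (P u)) (Finset.mem_univ u)
  set B := ∑ u, ‖P u‖
  have hB : 0 ≤ B := Finset.sum_nonneg fun u _ => norm_nonneg _
  refine ⟨2 * B + C, by positivity, fun n hn => ?_⟩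
  have hnp : (0 : ℝ) < n := by positivity
  set V := (hb.finite_lattice hn).toFinset
  set 𝓕 : Set (Finset E2) := {s | s.Nonempty ∧ ∃ S m σ, FineTri n 𝓢 S m σ ∧ s ⊆ triSet P n S m σ}
  have hTV : ∀ {S m σ}, FineTri n 𝓢 S m σ → triSet P n S m σ ⊆ V := fun ht p hp =>
    (Set.Finite.mem_toFinset _).2 ⟨(hb.triSet_mem hn ht p hp).1, (hb.triSet_mem hn ht p hp).2.1⟩
  have hsub : ∀ s ∈ 𝓕, s ⊆ V := fun s ⟨_, S, m, σ, ht, hs⟩ => hs.trans (hTV ht)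
  have hhat : ∀ s ∈ 𝓕, ∀ U, s ⊆ U → ∀ w : E2 → ℝ, (∀ p ∉ s, w p = 0) → (∀ p, 0 ≤ w p) →
      ∑ p ∈ U, w p = 1 → ∀ q ∈ V, latHat Λ n q (∑ p ∈ U, w p • p) = w q := by
    rintro s ⟨-, S, m, σ, ht, hs⟩ U hsU w hw h0 h1 q hq
    rw [Set.Finite.mem_toFinset] at hq
    have e1 := Finset.sum_subset hs fun p _ hp => hw p hp
    have e2 := Finset.sum_subset hs (f := fun p => w p • p) fun p _ hp => by rw [hw p hp, zero_smul]
    rw [← Finset.sum_subset hsU fun p _ hp => hw p hp, e1] at h1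
    rw [← Finset.sum_subset hsU fun p _ hp => by rw [hw p hp, zero_smul], e2]
    exact hb.latHat_comb hn ht (fun p hp => hw p fun h => hp (hs h)) h0 h1 hq.1 hq.2
  have hU : UniqRep V 𝓕 := ⟨hsub, fun w w' x h h' => by
    have key : ∀ w, BRep V 𝓕 w x → w = fun q => if q ∈ V then latHat Λ n q x else 0 := by
      intro w h
      obtain ⟨s, hs, hw⟩ := h.supp
      ext q
      split_ifs with hq
      · rw [← h.pos]; exact (hhat s hs V (hsub s hs) w hw h.nonneg h.sum q hq).symm
      · exact hw q fun h => hq (hsub s hs h)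
    rw [key w h, key w' h']⟩
  have hface : ∀ s ∈ 𝓕, ∀ t ⊆ s, t.Nonempty → t ∈ 𝓕 := fun s ⟨_, S, m, σ, ht, hs⟩ t hts h0 =>
    ⟨h0, S, m, σ, ht, hts.trans hs⟩
  set K := hU.complex (fun s hs => hs.1) hface
  have hne : ∀ {S m σ}, FineTri n 𝓢 S m σ → (triSet P n S m σ).card = 3 := by
    intro S m σ ht
    rw [triSet, Finset.card_image_of_injOn, hb.card S ht.mem]
    intro u hu u' hu' h
    have := congrArg (Λ · u) h
    simp only [(hb.coord_triPt hn ht hu).2, (hb.coord_triPt hn ht hu').2, triCoord] at this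
    rw [div_left_inj' hnp.ne', Int.cast_inj, if_pos trivial] at this
    by_contra hne
    rw [if_neg hne] at this
    have := ht.sgn
    omega
  have hT : ∀ {S m σ}, FineTri n 𝓢 S m σ → triSet P n S m σ ∈ 𝓕 := fun ht =>
    ⟨Finset.card_pos.1 (by rw [hne ht]; norm_num), _, _, _, ht, Finset.Subset.rfl⟩
  refine ⟨K, ⟨V.powerset.finite_toSet.subset fun s hs => by simpa using hsub s hs,
    fun s hs => card_le_three K hs, Subset.antisymm ?_ ?_,
    fun s ⟨_, S, m, σ, ht, hs⟩ => ⟨_, hT ht, hs, hne ht⟩⟩, ?_, latHat Λ n, ?_, ?_⟩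
  · intro x hx
    obtain ⟨s, ⟨-, S, m, σ, ht, hs⟩, hxs⟩ := (mem_space_iff).1 hx
    obtain ⟨w, -, h0, h1, rfl⟩ := (mem_hull_iff_weights Finset.Subset.rfl).1
      (convexHull_mono (Finset.coe_subset.2 hs) hxs)
    exact (hb.comb ht.mem (fun p hp => ⟨(hb.triSet_mem hn ht p hp).1,
      (hb.triSet_mem hn ht p hp).2.2⟩) h0 h1).1
  · intro x hx
    obtain ⟨S, m, σ, ht, hxs⟩ := hb.exists_fineTri hn hx
    exact mem_space_iff.2 ⟨_, hT ht, hxs⟩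
  · rintro s ⟨-, S, m, σ, ht, hs⟩ x hx y hy
    obtain ⟨a, ha, b, hb', hab⟩ := convexHull_exists_dist_ge2 hx hy
    obtain ⟨u, -, rfl⟩ := Finset.mem_image.1 (hs ha)
    obtain ⟨u', -, rfl⟩ := Finset.mem_image.1 (hs hb')
    have hσ : |(σ : ℝ)| = 1 := by rcases ht.sgn with rfl | rfl <;> simp
    rw [dist_eq_norm, dist_eq_norm, triPt_eq, triPt_eq, add_sub_add_left_eq_sub, ← smul_sub,
      norm_smul, norm_div, norm_eq_abs, hσ, RCLike.norm_natCast] at hab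
    refine hab.trans ?_
    rw [one_div_mul_eq_div]
    gcongr
    linarith [norm_sub_le (P u) (P u'), hPn u, hPn u']
  · intro q x hx y hy
    simp only [latHat, max_comm (0 : ℝ)]
    refine (abs_max_sub_max_le_abs _ _ _).trans ?_
    rw [sub_sub_sub_cancel_left, ← mul_sub, abs_mul, abs_of_pos hnp]
    calc _ ≤ n * ‖Λ x - Λ y‖ := by
          gcongr
          rw [abs_sub_comm]
          exact (abs_norm_sub_norm_le _ _).trans_eq (by rw [sub_sub_sub_cancel_right])
      _ ≤ n * (C * ‖x - y‖) := by gcongr; exact hb.lip x hx y hy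
      _ ≤ _ := by
          have := mul_nonneg (mul_nonneg hB hnp.le) (norm_nonneg (x - y))
          linarith
  · exact fun s hs w hw h0 h1 t ht q hq =>
      hhat s hs s Finset.Subset.rfl w hw h0 h1 q (hsub t ht hq)

end

section

variable {K : SimplicialComplex ℝ E2} {Ω : Set E2} {C : ℝ} {n : ℕ} {s t : Finset E2} {x y : E2}

theorem FineComplex.mem_of_hull (hK : FineComplex K Ω n C) (hs : s ∈ K.faces)
    (hx : x ∈ cell s) : x ∈ Ω :=
  hK.tri.2.2.1 ▸ mem_space_iff.2 ⟨s, hs, hx⟩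

open scoped Classical in
theorem FineComplex.exists_weights (hK : FineComplex K Ω n C) (hC : 0 ≤ C) (hs : s ∈ K.faces)
    (ht : t ∈ K.faces) (hx : x ∈ cell s) (hy : y ∈ cell t) :
    ∃ w : E2 → ℝ, (∀ p, 0 ≤ w p) ∧ ∑ p ∈ s, w p = 1 ∧ ∑ p ∈ s, w p • p = x ∧
      ∑ p ∈ s \ t, w p ≤ 3 * C * n * ‖x - y‖ := by
  obtain ⟨ψ, hl, hψ⟩ := hK.hat
  obtain ⟨w, hw, h0, h1, hwx⟩ := (mem_hull_iff_weights Finset.Subset.rfl).1 hx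
  obtain ⟨w', hw', h0', h1', hwy⟩ := (mem_hull_iff_weights Finset.Subset.rfl).1 hy
  refine ⟨w, h0, h1, hwx, ?_⟩
  have hb : ∀ p ∈ s \ t, w p ≤ C * n * ‖x - y‖ := fun p hp => by
    rw [Finset.mem_sdiff] at hp
    have e := hl p x (hK.mem_of_hull hs hx) y (hK.mem_of_hull ht hy)
    rw [← hwx, ← hwy, hψ s hs w hw h0 h1 s hs p hp.1, hψ t ht w' hw' h0' h1' s hs p hp.1,
      hw' p hp.2, hwx, hwy] at e
    linarith [le_abs_self (w p - 0)]
  refine (Finset.sum_le_card_nsmul _ _ _ hb).trans ?_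
  have h3 : ((s \ t).card : ℝ) ≤ 3 := by
    exact_mod_cast (Finset.card_le_card Finset.sdiff_subset).trans (hK.tri.2.1 s hs)
  rw [nsmul_eq_mul, mul_assoc 3, mul_assoc 3]
  exact mul_le_mul_of_nonneg_right h3 (by positivity)

theorem FineComplex.separated (hK : FineComplex K Ω n C) (hC : 0 ≤ C) (hs : s ∈ K.faces)
    (ht : t ∈ K.faces) (hst : Disjoint s t) (hx : x ∈ cell s)
    (hy : y ∈ cell t) : 1 ≤ 3 * C * n * ‖x - y‖ := by
  classical
  obtain ⟨w, -, h1, -, h⟩ := hK.exists_weights hC hs ht hx hy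
  rwa [sdiff_eq_left.2 hst, h1] at h

open scoped Classical in
theorem FineComplex.retract (hK : FineComplex K Ω n C) (hC : 0 ≤ C) (hn : 0 < n) (hs : s ∈ K.faces)
    (ht : t ∈ K.faces) (hst : ¬Disjoint s t) (hx : x ∈ cell s) (hy : y ∈ cell t) :
    ∃ z ∈ conv ((s ∩ t : Finset E2) : Set E2), ‖x - z‖ ≤ 3 * C ^ 2 * ‖x - y‖ := by
  obtain ⟨w, h0, h1, hwx, h⟩ := hK.exists_weights hC hs ht hx hy
  rw [← Finset.sum_inter_add_sum_sdiff s t] at h1 hwx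
  obtain ⟨z, hz, hzs⟩ : ∃ z ∈ conv ((s ∩ t : Finset E2) : Set E2),
      ∑ p ∈ s ∩ t, w p • p = (∑ p ∈ s ∩ t, w p) • z := by
    by_cases h : ∑ p ∈ s ∩ t, w p = 0
    · obtain ⟨p, hp⟩ := Finset.not_disjoint_iff_nonempty_inter.1 hst
      refine ⟨p, subset_convexHull ℝ _ hp, ?_⟩
      rw [h, zero_smul]
      refine Finset.sum_eq_zero fun p hp => ?_
      rw [(Finset.sum_eq_zero_iff_of_nonneg fun p _ => h0 p).1 h p hp, zero_smul]
    · refine ⟨_, Finset.centerMass_mem_convexHull (s ∩ t) (z := id) (fun p _ => h0 p)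
        ((Finset.sum_nonneg fun p _ => h0 p).lt_of_ne' h) fun p hp => hp, ?_⟩
      rw [Finset.centerMass, smul_inv_smul₀ h]; rfl
  refine ⟨z, hz, ?_⟩
  have hzs' := convexHull_mono (Finset.coe_subset.2 Finset.inter_subset_left) hz
  have e : x - z = ∑ p ∈ s \ t, w p • (p - z) := by
    simp only [smul_sub, Finset.sum_sub_distrib, ← Finset.sum_smul]
    rw [← hwx, hzs, eq_sub_of_add_eq h1]
    module
  calc ‖x - z‖ ≤ ∑ p ∈ s \ t, w p * (C / n) := by
        rw [e]
        refine norm_sum_le_of_le _ fun p hp => ?_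
        rw [norm_smul, norm_eq_abs, abs_of_nonneg (h0 p)]
        exact mul_le_mul_of_nonneg_left (hK.diam s hs _ (subset_convexHull ℝ _
          (Finset.mem_sdiff.1 hp).1) _ hzs') (h0 p)
    _ ≤ 3 * C * n * ‖x - y‖ * (C / n) := by
        rw [← Finset.sum_mul]; gcongr
    _ = _ := by field_simp

theorem FineComplex.exists_chart (hK : FineComplex K Ω n C) {a b c : E2} (hab : a ≠ b) (hbc : b ≠ c)
    (hca : c ≠ a) (hs : {a, b, c} ∈ K.faces) :
    ∃ T : E2 →ᵃ[ℝ] ℂ, T a = 0 ∧ T b = 1 ∧ T c = Complex.I ∧ Function.Injective T ∧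
      ∀ x ∈ conv {a, b, c}, ∀ y ∈ conv {a, b, c}, ‖T x - T y‖ ≤ 2 * C * n * ‖x - y‖ := by
  classical
  have hi : AffineIndependent ℝ ![a, b, c] := by
    have hf : ∀ i, ![a, b, c] i ∈ ({a, b, c} : Finset E2) := by intro i; fin_cases i <;> simp
    have hinj : Function.Injective ![a, b, c] := by
      intro i j h
      fin_cases i <;> fin_cases j <;> simp_all
    have := (K.indep hs).comp_embedding ⟨fun i => ⟨![a, b, c] i, hf i⟩,
      fun i j h => hinj (congrArg Subtype.val h)⟩
    exact this
  rw [affineIndependent_iff_linearIndependent_vsub ℝ _ (0 : Fin 3)] at hi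
  have hl : LinearIndependent ℝ ![b - a, c - a] := by
    have := hi.comp (fun i : Fin 2 => ⟨i.succ, Fin.succ_ne_zero i⟩)
      (fun i j h => Fin.succ_injective _ (congrArg Subtype.val h))
    rwa [show _ ∘ _ = ![b - a, c - a] from funext fun i => by fin_cases i <;> rfl] at this
  set B := basisOfLinearIndependentOfCardEqFinrank hl (by simp)
  have hB : ⇑B = ![b - a, c - a] := coe_basisOfLinearIndependentOfCardEqFinrank hl _
  set L := B.equiv Complex.basisOneI (Equiv.refl _)
  have hLb : L (b - a) = 1 := by
    have := B.equiv_apply (b' := Complex.basisOneI) 0 (Equiv.refl _)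
    simpa [hB] using this
  have hLc : L (c - a) = Complex.I := by
    have := B.equiv_apply (b' := Complex.basisOneI) 1 (Equiv.refl _)
    simpa [hB] using this
  obtain ⟨ψ, hlip, hψ⟩ := hK.hat
  set T : E2 →ᵃ[ℝ] ℂ := L.toLinearMap.toAffineMap.comp (AffineMap.id ℝ E2 - AffineMap.const ℝ E2 a)
  have hT : ∀ x, T x = L (x - a) := fun x => rfl
  have hTx : ∀ x ∈ conv {a, b, c}, T x = ψ b x + ψ c x * Complex.I := by
    intro x hx
    obtain ⟨w, hw, h0, h1, rfl⟩ := (mem_hull_iff_weights (s := {a, b, c}) Finset.Subset.rfl).1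
      (by simpa using hx)
    rw [hψ _ hs w hw h0 h1 _ hs b (by simp), hψ _ hs w hw h0 h1 _ hs c (by simp), hT]
    have hs3 : ∀ {M : Type} [AddCommMonoid M] (f : E2 → M), ∑ p ∈ {a, b, c}, f p =
        f a + (f b + f c) := fun f => by
      rw [Finset.sum_insert (by simp [hab, hca.symm]), Finset.sum_pair hbc]
    rw [hs3] at h1 ⊢
    rw [show w a • a + (w b • b + w c • c) - a = w b • (b - a) + w c • (c - a) by
      rw [eq_sub_of_add_eq h1]; module, map_add, map_smul, map_smul, hLb, hLc]
    simp
  refine ⟨T, by rw [hT, sub_self, map_zero], hLb, hLc, fun x y h => ?_, fun x hx y hy => ?_⟩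
  · exact sub_left_injective (L.injective h)
  · have hxΩ := hK.mem_of_hull hs (by simpa using hx)
    have hyΩ := hK.mem_of_hull hs (by simpa using hy)
    rw [hTx x hx, hTx y hy]
    have := hlip b x hxΩ y hyΩ
    have := hlip c x hxΩ y hyΩ
    calc _ = ‖((ψ b x - ψ b y : ℝ) : ℂ) + ((ψ c x - ψ c y : ℝ) : ℂ) * Complex.I‖ := by
          congr 1; push_cast; ring
      _ ≤ |ψ b x - ψ b y| + |ψ c x - ψ c y| := by
          refine (norm_add_le _ _).trans_eq ?_
          rw [norm_mul, Complex.norm_I, mul_one, Complex.norm_real, Complex.norm_real]; rfl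
      _ ≤ _ := by linarith

end

/-- `g` and its inverse are Hölder continuous. -/
structure BiHolder (g : E2 → ℂ) (Ω : Set E2) (H α α' : ℝ) : Prop where
  upper : ∀ x ∈ Ω, ∀ y ∈ Ω, ‖g x - g y‖ ≤ H * ‖x - y‖ ^ α
  lower : ∀ x ∈ Ω, ∀ y ∈ Ω, ‖x - y‖ ≤ H * ‖g x - g y‖ ^ α'

section

variable {K : SimplicialComplex ℝ E2} {Ω : Set E2} {C : ℝ} {n : ℕ} {s t : Finset E2} {x y : E2}
  {g : E2 → ℂ} {H α α' ϱ κ : ℝ}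

theorem BiHolder.trans (hg : BiHolder g Ω H α α') (hH : 0 ≤ H) (hα : 0 ≤ α) (hα1 : α ≤ 1) {B d : ℝ}
    (hB : 1 ≤ B) (hx : x ∈ Ω) (hy : y ∈ Ω) (hd : d ≤ B * ‖x - y‖) (hd0 : 0 ≤ d) {r : ℝ}
    (hr : ‖g x - g y‖ ≤ r) (hα' : 0 ≤ α') : H * d ^ α ≤ B * (H * H ^ α) * r ^ (α * α') := by
  have hr0 := (norm_nonneg _).trans hr
  calc H * d ^ α ≤ H * (B * (H * r ^ α')) ^ α := by
        gcongr
        refine hd.trans (mul_le_mul_of_nonneg_left ((hg.lower x hx y hy).trans ?_) (by linarith))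
        gcongr
    _ = B ^ α * (H * H ^ α) * r ^ (α * α') := by
        rw [mul_rpow (by linarith) (by positivity), mul_rpow hH (by positivity), ← rpow_mul hr0,
          mul_comm α' α]
        ring
    _ ≤ _ := by
        gcongr
        exact (rpow_le_rpow_of_exponent_le hB hα1).trans_eq (rpow_one B)

theorem BiHolder.far (hg : BiHolder g Ω H α α') (hK : FineComplex K Ω n C) (hH : 0 < H) (hC : 0 < C)
    (hα' : 0 < α') (hn : 0 < n) (h1 : 3 * C * n * (H * ϱ ^ α') ≤ 1)
    (hs : s ∈ K.faces) (ht : t ∈ K.faces) (hst : Disjoint s t) (hx : x ∈ cell s) (hy : y ∈ cell t) :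
    ϱ ≤ ‖g x - g y‖ := by
  by_contra! hlt
  have h2 := hK.separated hC.le hs ht hst hx hy
  have h3 := hg.lower x (hK.mem_of_hull hs hx) y (hK.mem_of_hull ht hy)
  have h4 := rpow_lt_rpow (norm_nonneg _) hlt hα'
  have : 3 * C * n * ‖x - y‖ < 3 * C * n * (H * ϱ ^ α') := by
    refine mul_lt_mul_of_pos_left (h3.trans_lt ?_) (by positivity)
    simp_all
  linarith

theorem pair_inter [DecidableEq E2] {a b a' b' z : E2} (h1 : ¬ (a = a' ∧ b = b'))
    (h2 : ¬ (a = b' ∧ b = a')) (hz : z ∈ conv (({a, b} ∩ {a', b'} : Finset E2) : Set E2)) :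
    (z = a ∨ z = b) ∧ (z = a' ∨ z = b') := by
  have hsub : (({a, b} ∩ {a', b'} : Finset E2) : Set E2).Subsingleton := by
    intro p hp q hq
    simp only [Finset.coe_inter, Finset.coe_pair, mem_inter_iff, mem_insert_iff,
      mem_singleton_iff] at hp hq
    grind
  rw [hsub.convex.convexHull_eq] at hz
  simpa using hz

theorem FineComplex.exists_map (hK : FineComplex K Ω n C) (hC : 1 ≤ C) (hn : 0 < n)
    (hg : BiHolder g Ω H α α') (hgc : ContinuousOn g Ω) (hH : 1 ≤ H) (hα : 0 < α) (hα1 : α ≤ 1)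
    (hα' : 0 < α') (hκ : 0 < κ) {R : ℤ} (hR : 20 ≤ R) {M : ℕ} (hM : 0 < M)
    (h1 : 3 * C * n * (H * ϱ ^ α') ≤ 1) (h2 : 100 * (R * κ) ≤ ϱ)
    (h3 : 1 * (H * H ^ α) * (3 * (R * κ)) ^ (α * α') ≤ ϱ / 8)
    (h4 : 3 * C ^ 2 * (H * H ^ α) * (10 * κ) ^ (α * α') ≤ R * κ / 2)
    (h5 : H * (C / n / M) ^ α ≤ κ) :
    ∃ f : E2 → ℂ, InjOn f Ω ∧ (∀ x ∈ Ω, ‖f x - g x‖ ≤ H * (C / n) ^ α + 3 * κ) ∧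
      ∀ s ∈ K.faces, s.card = 3 → PLOn f (cell s) ∧ ∀ x ∈ cell s, ∀ y ∈ cell s,
          ‖f x - f y‖ ≤ 32 * (H * (C / n) ^ α + 6 * κ) *
            (50 * (2 * M + 2) ^ 3) * (2 * C * n) * ‖x - y‖ := by
  classical
  have hH0 : 0 < H := by linarith
  have hC0 : 0 < C := by linarith
  have hRp : (20 : ℝ) ≤ R := mod_cast hR
  have hpair : ∀ a b : E2, ((({a, b} : Finset E2)) : Set E2) = {a, b} := fun a b => by simp
  have hseg : ∀ {a b x : E2}, x ∈ segment ℝ a b ↔ x ∈ conv (({a, b} : Finset E2) : Set E2) :=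
    fun {a b x} => by rw [hpair, convexHull_pair]
  set G : E2 → ℂ := fun x => κ⁻¹ • g x
  have hG : ∀ x y, ‖G x - G y‖ = ‖g x - g y‖ / κ := fun x y => by
    rw [← smul_sub, norm_smul, norm_inv, norm_eq_abs, abs_of_pos hκ, inv_mul_eq_div]
  have hfar : ∀ s ∈ K.faces, ∀ t ∈ K.faces, Disjoint s t → ∀ x ∈ cell s,
      ∀ y ∈ cell t, ϱ / κ ≤ ‖G x - G y‖ := fun s hs t ht hst x hx y hy => by
    rw [hG]
    gcongr
    exact hg.far hK hH0 hC0 hα' hn h1 hs ht hst hx hy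
  have hρ : 100 * (R : ℝ) ≤ ϱ / κ := by rw [le_div_iff₀ hκ]; linarith
  have hfarv : ∀ s ∈ K.faces, ∀ v, {v} ∈ K.faces → v ∉ s → ∀ x ∈ cell s,
      ϱ / κ ≤ ‖G x - G v‖ := fun s hs v hv hvs x hx =>
    hfar s hs _ hv (Finset.disjoint_singleton_right.2 hvs) x hx v (by simp)
  have hvert : ∀ {a b}, K.EdgeAdj a b → {a} ∈ K.faces := fun h =>
    K.down_closed h.2 (by simp) (by simp)
  have hcell : ∀ s ∈ K.faces, ∀ x ∈ cell s, ∀ y ∈ cell s,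
      ‖g x - g y‖ ≤ H * (C / n) ^ α := fun s hs x hx y hy =>
    (hg.upper x (hK.mem_of_hull hs hx) y (hK.mem_of_hull hs hy)).trans (by
      gcongr; exact hK.diam s hs x hx y hy)
  have hsymm : ∀ a b, K.EdgeAdj a b → K.EdgeAdj b a := fun a b h =>
    ⟨h.1.symm, by rw [Finset.pair_comm]; exact h.2⟩
  have hdraw : ∃ D len, Drawing K.EdgeAdj G R (2 * M + 2) D len := by
    refine exists_drawing hsymm (fun a h => h.1 rfl) (fun a b a' b' h h' e1 e2 x hx hx' =>
      pair_inter e1 e2 (mem_hull_inter h.2 h'.2 (hseg.1 hx) (hseg.1 hx'))) hR hM ?_ ?_ ?_ ?_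
    · intro a b h i hi
      have hMp : (0 : ℝ) < M := by positivity
      have hi1 : (i : ℝ) + 1 ≤ M := mod_cast hi
      have hm : ∀ τ ∈ Icc (0 : ℝ) 1, AffineMap.lineMap a b τ ∈ Ω := fun τ hτ =>
        hK.mem_of_hull h.2 ((convex_convexHull ℝ _).lineMap_mem (subset_convexHull ℝ _ (by simp))
          (subset_convexHull ℝ _ (by simp)) hτ)
      rw [hG, div_le_one hκ]
      refine (hg.upper _ (hm _ ⟨by positivity, by rw [div_le_one hMp]; linarith⟩) _
        (hm _ ⟨by positivity, by rwa [div_le_one hMp]⟩)).trans (le_trans ?_ h5)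
      gcongr
      rw [← dist_eq_norm, dist_lineMap_lineMap, dist_eq_norm, dist_eq_norm, ← sub_div,
        sub_add_cancel_left, norm_div, norm_neg, norm_one, RCLike.norm_natCast, one_div_mul_eq_div]
      gcongr
      exact hK.diam _ h.2 _ (subset_convexHull ℝ _ (by simp)) _ (subset_convexHull ℝ _ (by simp))
    · intro a b h
      have := hfarv {a} (hvert h) b (hvert (hsymm a b h)) (by simpa using h.1.symm) a (by simp)
      linarith
    · intro a b v w h hv ha hb x hx
      have := hfarv _ h.2 v (hvert hv) (by simp [ha, hb]) x (hseg.1 hx)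
      linarith
    · intro a b a' b' h h' e1 e2 x hx x' hx' hxx
      rw [hseg] at hx hx'
      have hd : ¬Disjoint ({a, b} : Finset E2) {a', b'} := fun hd => by
        have := hfar _ h.2 _ h'.2 hd x hx x' hx'
        linarith
      obtain ⟨z, hz, hxz⟩ := hK.retract hC0.le hn h.2 h'.2 hd hx hx'
      have hv := pair_inter e1 e2 hz
      refine ⟨z, hv.1, hv.2, ?_⟩
      rw [hG, div_le_iff₀ hκ] at hxx ⊢
      have hxΩ := hK.mem_of_hull h.2 hx
      have hzΩ := hK.mem_of_hull h.2 (convexHull_mono (Finset.coe_subset.2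
        Finset.inter_subset_left) hz)
      refine (hg.upper x hxΩ z hzΩ).trans ((hg.trans hH0.le hα.le hα1 ?_ hxΩ
        (hK.mem_of_hull h'.2 hx') hxz (norm_nonneg _) hxx hα'.le).trans (by linarith))
      nlinarith
  have hcontr : ∀ s ∈ K.faces, ∀ a ∈ s, ∀ x ∈ cell s,
      ∀ y ∈ cell s, ‖G x - G y‖ ≤ 3 * R → ∀ t ∈ Icc (0 : ℝ) 1,
        ‖G (AffineMap.lineMap x a t) - G (AffineMap.lineMap y a t)‖ ≤ ϱ / κ / 8 := by
    intro s hs a ha x hx y hy hxy τ hτ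
    have hc := convex_convexHull ℝ (s : Set E2)
    have ha' := subset_convexHull ℝ _ ha
    have hxΩ := hK.mem_of_hull hs hx
    have hyΩ := hK.mem_of_hull hs hy
    rw [hG, div_le_iff₀ hκ] at hxy
    rw [hG, div_div, mul_comm κ, ← div_div]
    refine div_le_div_of_nonneg_right ?_ hκ.le
    refine (hg.upper _ (hK.mem_of_hull hs (hc.lineMap_mem hx ha' hτ)) _
      (hK.mem_of_hull hs (hc.lineMap_mem hy ha' hτ))).trans
      ((hg.trans hH0.le hα.le hα1 le_rfl hxΩ hyΩ ?_ (norm_nonneg _) (by linarith) hα'.le).trans h3)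
    rw [AffineMap.lineMap_apply_module, AffineMap.lineMap_apply_module, add_sub_add_right_eq_sub,
      ← smul_sub, norm_smul, norm_eq_abs, abs_of_nonneg (by linarith [hτ.2])]
    exact mul_le_mul_of_nonneg_right (by linarith [hτ.1]) (norm_nonneg _)
  obtain ⟨D, len, hD⟩ := hdraw
  have hspace : K.space = Ω := hK.tri.2.2.1
  obtain ⟨f, hf1, hf2, hf3⟩ := hD.exists_glue hRp hK.tri.2.2.2
    (by rw [hspace]; exact hgc.const_smul κ⁻¹) hρ hfarv hcontr
    (κ := (1 / ((2 * M + 2 : ℕ) : ℝ)) ^ 3 / 50) (by positivity)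
    (fun n₁ n₂ n₃ p1 p2 p3 k1 k2 k3 => exists_bump p1 p2 p3 k1 k2 k3)
    (L := H * (C / n) ^ α / κ) (fun s hs x hx y hy => by
      rw [hG]; gcongr; exact hcell s hs x hx y hy)
    (fun a b c hab hbc hca hs => hK.exists_chart hab hbc hca hs)
  · rw [hspace] at hf1 hf2
    refine ⟨fun x => κ • f x, fun x hx y hy hxy => hf1 hx hy (smul_right_injective ℂ hκ.ne' hxy),
      fun x hx => ?_, fun s hs h3 => ⟨?_, fun x hx y hy => ?_⟩⟩
    · have : κ • f x - g x = κ • (f x - G x) := by rw [smul_sub, smul_inv_smul₀ hκ.ne']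
      rw [this, norm_smul, norm_eq_abs, abs_of_pos hκ]
      refine (mul_le_mul_of_nonneg_left (hf2 x hx) hκ.le).trans_eq ?_
      field_simp
    · exact (hf3 s hs h3).1.affine_comp (κ • LinearMap.id (R := ℝ) (M := ℂ)).toAffineMap
    · simp only
      rw [← smul_sub, norm_smul, norm_eq_abs, abs_of_pos hκ]
      refine (mul_le_mul_of_nonneg_left ((hf3 s hs h3).2 x hx y hy) hκ.le).trans_eq ?_
      push_cast
      field_simp

end

section

variable {C H α α' : ℝ}

theorem rpow_root {x t c : ℝ} (hx : 0 ≤ x) (ht : 0 < t) (ht1 : t ≤ 1) (hc : 1 ≤ c) :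
    (c * x ^ (1 / t)) ^ t ≤ c * x := by
  rw [mul_rpow (by linarith) (by positivity), ← rpow_mul hx, one_div_mul_cancel ht.ne', rpow_one]
  gcongr
  exact (rpow_le_rpow_of_exponent_le hc ht1).trans_eq (rpow_one c)

theorem exists_scales (hC : 1 ≤ C) (hH : 1 ≤ H) (hα : 0 < α) (hα1 : α ≤ 1) (hα' : 0 < α')
    (hα'1 : α' ≤ 1) :
    ∃ B > 0, ∀ n : ℕ, 0 < n → ∃ (ϱ κ : ℝ) (R : ℤ) (M : ℕ), 0 < κ ∧ 20 ≤ R ∧ 0 < M ∧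
      3 * C * n * (H * ϱ ^ α') ≤ 1 ∧ 100 * (R * κ) ≤ ϱ ∧
      1 * (H * H ^ α) * (3 * (R * κ)) ^ (α * α') ≤ ϱ / 8 ∧
      3 * C ^ 2 * (H * H ^ α) * (10 * κ) ^ (α * α') ≤ R * κ / 2 ∧
      H * (C / n / M) ^ α ≤ κ ∧ κ ≤ 1 / n ∧ M ≤ B * (n : ℝ) ^ ((1 / (α * α')) ^ 3 - 1) := by
  have ht : 0 < α * α' := by positivity
  have ht1 : α * α' ≤ 1 := mul_le_one₀ hα1 hα'.le hα'1
  set t := α * α'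
  have hu : 1 ≤ 1 / t := by rwa [le_div_iff₀ ht, one_mul]
  have ha' : 1 ≤ 1 / α' := by rwa [le_div_iff₀ hα', one_mul]
  have hH0 : 0 < H := by linarith
  have hHα : 1 ≤ H ^ α := one_le_rpow hH hα.le
  have hHH : 1 ≤ H * H ^ α := by nlinarith
  have hE1 : H * H ^ α ≤ 3 * C ^ 2 * (H * H ^ α) := le_mul_of_one_le_left (by linarith)
    (by nlinarith)
  set E := 3 * C ^ 2 * (H * H ^ α)
  have hE : 1 ≤ E := hHH.trans hE1
  set u := 1 / t
  set c₀ := 1 / (3 * C * H)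
  have hc0 : 0 < c₀ := by positivity
  have hc01 : c₀ ≤ 1 := by rw [div_le_one (by positivity)]; nlinarith
  set c₁ := c₀ ^ (1 / α')
  set c₂ := (c₁ / (100 * E)) ^ u
  set c₃ := (c₂ / (20 * E)) ^ u
  have hc3 : 0 < c₃ := by positivity
  refine ⟨C * (22 * H / c₃) ^ (1 / α) + 1, by positivity, fun n hn => ?_⟩
  have hX : (1 : ℝ) ≤ n := mod_cast hn
  set X := (n : ℝ)
  have hX0 : 0 < X := by linarith
  set ϱ := (c₀ / X) ^ (1 / α')
  set r := (ϱ / (100 * E)) ^ u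
  set κ₀ := (r / (20 * E)) ^ u
  have hϱ : 0 < ϱ := by positivity
  have hr : 0 < r := by positivity
  have hκ₀ : 0 < κ₀ := by positivity
  have hself : ∀ {x p : ℝ}, 0 < x → x ≤ 1 → 1 ≤ p → x ^ p ≤ x := fun h0 h1 hp =>
    (rpow_le_rpow_of_exponent_ge h0 h1 hp).trans_eq (rpow_one _)
  have hcX : c₀ / X ≤ 1 / X := by gcongr
  have hX1 : 1 / X ≤ 1 := by rwa [div_le_one hX0]
  have hϱX : ϱ ≤ 1 / X := (hself (by positivity) (hcX.trans hX1) ha').trans hcX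
  have hdiv : ∀ {x c : ℝ}, 0 < x → 1 ≤ c → x / (c * E) ≤ x / c := fun h hc => by
    gcongr; nlinarith
  have hr1 : r ≤ ϱ / 100 := (hself (by positivity) ((hdiv hϱ (by norm_num)).trans (by linarith))
    hu).trans (hdiv hϱ (by norm_num))
  have hκ1 : κ₀ ≤ r / 20 := (hself (by positivity) ((hdiv hr (by norm_num)).trans (by linarith))
    hu).trans (hdiv hr (by norm_num))
  have hcast : (((⌈r / κ₀⌉ + 20 : ℤ)) : ℝ) = ⌈r / κ₀⌉ + 20 := by push_cast; rfl
  have hceil := Int.le_ceil (r / κ₀)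
  have hceil' := Int.ceil_lt_add_one (r / κ₀)
  have hceil0 : 0 < ⌈r / κ₀⌉ := Int.ceil_pos.2 (by positivity)
  set R := ⌈r / κ₀⌉ + 20
  have hRr : r / κ₀ ≤ R := by linarith
  have hR0 : (0 : ℝ) < R := (div_pos hr hκ₀).trans_le hRr
  have hRκ : R * (r / R) = r := mul_div_cancel₀ _ hR0.ne'
  have hκle : r / R ≤ κ₀ := by rw [div_le_iff₀ hR0]; rwa [div_le_iff₀' hκ₀] at hRr
  have hκge : κ₀ / 22 ≤ r / R := by
    rw [div_le_div_iff₀ (by norm_num) hR0]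
    have : 1 ≤ r / κ₀ := by rw [le_div_iff₀ hκ₀]; linarith
    calc κ₀ * R ≤ κ₀ * (22 * (r / κ₀)) := by gcongr; linarith
      _ = _ := by field_simp
  have hκ : 0 < r / R := by positivity
  set κ := r / R
  set Y := C / X * (H / κ) ^ (1 / α)
  have hY : 0 < Y := by positivity
  have hMY := Nat.le_ceil Y
  refine ⟨ϱ, κ, R, ⌈Y⌉₊, hκ, by omega, Nat.ceil_pos.2 hY, ?_, ?_, ?_, ?_, ?_, by linarith, ?_⟩
  · rw [← rpow_mul (by positivity), one_div_mul_cancel hα'.ne', rpow_one]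
    refine le_of_eq ?_
    simp only [c₀]
    field_simp
  · rw [hRκ]; linarith
  · rw [hRκ, one_mul]
    calc _ ≤ E * (3 * (ϱ / (100 * E))) := by
          gcongr
          exact rpow_root (by positivity) ht ht1 (by norm_num)
      _ = 3 / 100 * ϱ := by field_simp
      _ ≤ _ := by linarith
  · rw [hRκ]
    calc _ ≤ E * (10 * (r / (20 * E))) := by
          gcongr
          refine le_trans ?_ (rpow_root (by positivity) ht ht1 (by norm_num : (1 : ℝ) ≤ 10))
          gcongr
      _ = _ := by field_simp; norm_num
  · have h1 : C / X / ⌈Y⌉₊ ≤ (κ / H) ^ (1 / α) := by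
      rw [div_le_iff₀ (hY.trans_le hMY)]
      calc C / X = (κ / H) ^ (1 / α) * Y := by
            rw [mul_left_comm, ← mul_rpow (by positivity) (by positivity), div_mul_div_cancel₀ hH0.ne',
              div_self hκ.ne', one_rpow, mul_one]
        _ ≤ _ := by gcongr
    calc _ ≤ H * ((κ / H) ^ (1 / α)) ^ α := by gcongr
      _ = κ := by
        rw [← rpow_mul (by positivity), one_div_mul_cancel hα.ne', rpow_one]
        field_simp
  · have hpow : ∀ {c p q : ℝ}, 0 < c → (c * X ^ p) ^ q = c ^ q * X ^ (p * q) := fun hc => by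
      rw [mul_rpow hc.le (by positivity), rpow_mul hX0.le]
    have e1 : ϱ = c₁ * X ^ (-(1 / α')) := by
      rw [show ϱ = _ from div_rpow hc0.le hX0.le _, rpow_neg hX0.le]; rfl
    have e2 : κ₀ = c₃ * X ^ (-(1 / α') * u * u) := by
      have : r = c₂ * X ^ (-(1 / α') * u) := by
        rw [← hpow (by positivity), div_mul_eq_mul_div, ← e1]
      rw [← hpow (by positivity), div_mul_eq_mul_div, ← this]
    have hYB : Y ≤ C * (22 * H / c₃) ^ (1 / α) * X ^ (u ^ 3 - 1) := by
      calc Y ≤ C / X * (22 * H / c₃ * X ^ (1 / α' * u * u)) ^ (1 / α) := by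
            have : H / κ ≤ 22 * H / c₃ * X ^ (1 / α' * u * u) := by
              rw [div_le_iff₀ hκ]
              calc H = 22 * H / c₃ * X ^ (1 / α' * u * u) * (κ₀ / 22) := by
                    rw [e2, neg_mul, neg_mul, rpow_neg hX0.le]
                    field_simp
                _ ≤ _ := by gcongr
            exact mul_le_mul_of_nonneg_left (rpow_le_rpow (by positivity) this (by positivity))
              (by positivity)
        _ = _ := by
            rw [hpow (by positivity), show 1 / α' * u * u * (1 / α) = u ^ 3 by
              simp only [u, t]; field_simp, rpow_sub hX0, rpow_one]
            ring
    have h1 : 1 ≤ X ^ (u ^ 3 - 1) := one_le_rpow hX (by linarith [one_le_pow₀ (n := 3) hu])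
    linarith [Nat.ceil_lt_add_one hY.le]

end

section

variable {K : SimplicialComplex ℝ E2} {Ω : Set E2} {C : ℝ} {n : ℕ} {g : E2 → ℂ}
  {H α α' β : ℝ}

theorem exists_fine_maps {K : SimplicialComplex ℝ E2} (hK : IsTriangulation K Ω)
    (hg : BiHolder g Ω H α α') (hgc : ContinuousOn g Ω) (hH : 1 ≤ H) (hα : 0 < α) (hα1 : α ≤ 1)
    (hα' : 0 < α') (hα'1 : α' ≤ 1) :
    ∃ C > 0, ∃ B₁ > 0, ∃ B₂ > 0, ∀ n : ℕ, 0 < n → ∃ K, FineComplex K Ω n C ∧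
      ∃ f : E2 → ℂ, InjOn f Ω ∧ (∀ x ∈ Ω, ‖f x - g x‖ ≤ B₁ * (n : ℝ) ^ (-α)) ∧
        ∀ s ∈ K.faces, s.card = 3 → PLOn f (cell s) ∧ ∀ x ∈ cell s, ∀ y ∈ cell s, ‖f x - f y‖ ≤
            B₂ * (n : ℝ) ^ (1 - α + 3 * ((1 / (α * α')) ^ 3 - 1)) * ‖x - y‖ := by
  obtain ⟨V, 𝓢, Λ, C₀, hC₀, hb⟩ := exists_bary hK
  obtain ⟨C₁, hC₁, hfine⟩ := hb.exists_fineComplex hC₀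
  set C := max 1 C₁
  have hC : 1 ≤ C := le_max_left _ _
  obtain ⟨B, hB, hsc⟩ := exists_scales hC hH hα hα1 hα' hα'1
  refine ⟨C, by linarith, H * C + 3, by positivity,
    32 * (H * C + 6) * (50 * (4 * B) ^ 3) * (2 * C), by positivity, fun n hn => ?_⟩
  have hX : (1 : ℝ) ≤ n := mod_cast hn
  have hX0 : (0 : ℝ) < n := by linarith
  obtain ⟨K, hK⟩ := hfine n hn
  have hK : FineComplex K Ω n C := by
    obtain ⟨h1, h2, ψ, h3, h4⟩ := hK
    refine ⟨h1, fun s hs x hx y hy => (h2 s hs x hx y hy).trans ?_, ψ,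
      fun q x hx y hy => (h3 q x hx y hy).trans ?_, h4⟩ <;> gcongr <;> exact le_max_right _ _
  obtain ⟨ϱ, κ, R, M, hκ, hR, hM, h1, h2, h3, h4, h5, h6, h7⟩ := hsc n hn
  obtain ⟨f, hf, hfg, hcell⟩ := hK.exists_map hC hn hg hgc hH hα hα1 hα' hκ hR hM h1 h2 h3 h4 h5
  have e1 : H * (C / n) ^ α ≤ H * C * (n : ℝ) ^ (-α) := by
    rw [div_rpow (by linarith) hX0.le, rpow_neg hX0.le, mul_assoc, div_eq_mul_inv]
    gcongr
    exact (rpow_le_rpow_of_exponent_le hC hα1).trans_eq (rpow_one C)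
  have e2 : κ ≤ (n : ℝ) ^ (-α) := h6.trans (by
    rw [one_div, ← rpow_neg_one]
    exact rpow_le_rpow_of_exponent_le hX (by linarith))
  refine ⟨K, hK, f, hf, fun x hx => (hfg x hx).trans (by linarith), fun s hs hs3 =>
    ⟨(hcell s hs hs3).1, fun x hx y hy => ((hcell s hs hs3).2 x hx y hy).trans ?_⟩⟩
  have hM1 : (1 : ℝ) ≤ M := mod_cast hM
  refine mul_le_mul_of_nonneg_right ?_ (norm_nonneg _)
  calc _ ≤ 32 * ((H * C + 6) * (n : ℝ) ^ (-α)) *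
        (50 * (4 * (B * (n : ℝ) ^ ((1 / (α * α')) ^ 3 - 1))) ^ 3) * (2 * C * n) := by
        gcongr
        · linarith
        · linarith
    _ = _ := by
        have e3 : (n : ℝ) ^ (1 - α + 3 * ((1 / (α * α')) ^ 3 - 1)) =
            n * (n : ℝ) ^ (-α) * ((n : ℝ) ^ ((1 / (α * α')) ^ 3 - 1)) ^ 3 := by
          rw [rpow_add hX0, sub_eq_add_neg 1 α, rpow_add hX0, rpow_one, mul_comm (3 : ℝ),
            rpow_mul hX0.le]
          norm_cast
        rw [e3]
        ring

theorem exponents {γ : ℝ} (hα : 0 < α) (hα1 : α ≤ 1) (hα' : 0 < α') (hα'1 : α' ≤ 1)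
    (hγ : γ = α ^ 4 * α' ^ 3 /
      (3 + 6 * α * α' - 6 * α ^ 2 * α' ^ 2 - α ^ 3 * α' ^ 3 - α ^ 4 * α' ^ 3))
    (hβ0 : 0 < β) (hβγ : β < γ) :
    ∃ σ > 0, 0 < α - σ * β ∧ 0 < σ * (1 - β) - (1 - α + 3 * ((1 / (α * α')) ^ 3 - 1)) ∧ β < α := by
  have ht : 0 < α * α' := by positivity
  have ht1 : α * α' ≤ 1 := mul_le_one₀ hα1 hα'.le hα'1
  rw [show α ^ 4 * α' ^ 3 = α * (α * α') ^ 3 by ring, show 3 + 6 * α * α' - 6 * α ^ 2 * α' ^ 2 -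
    α ^ 3 * α' ^ 3 - α * (α * α') ^ 3 = 3 + 6 * (α * α') - 6 * (α * α') ^ 2 - (α * α') ^ 3 -
      α * (α * α') ^ 3 by ring] at hγ
  set t := α * α'
  set d := 3 + 6 * t - 6 * t ^ 2 - t ^ 3 - α * t ^ 3
  have ht3 : t ^ 3 ≤ 1 := pow_le_one₀ ht.le ht1
  have ht30 : 0 < t ^ 3 := by positivity
  have hd : 3 - 2 * t ^ 3 ≤ d := by
    simp only [d]
    nlinarith
  have hγα : γ ≤ α := by
    rw [hγ, div_le_iff₀ (by linarith)]
    gcongr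
    linarith
  have hγ0 : 0 < γ := hβ0.trans hβγ
  have hag : α / γ = d / t ^ 3 := by
    rw [hγ]; field_simp
  obtain ⟨σ, h1, h2⟩ := exists_between (div_lt_div_of_pos_left hα hβ0 hβγ)
  rw [lt_div_iff₀ hβ0] at h2
  refine ⟨σ, (div_pos hα hγ0).trans h1, by linarith, ?_, hβγ.trans_le hγα⟩
  have : 3 * (1 / t) ^ 3 - 2 ≤ α / γ := by
    rw [hag, le_div_iff₀ ht30, one_div, inv_pow, sub_mul, mul_assoc, inv_mul_cancel₀ ht30.ne']
    linarith
  linarith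

theorem FineComplex.holder_bound (hK : FineComplex K Ω n C) (hC : 0 < C) (hn : 0 < n)
    (hg : ∀ x ∈ Ω, ∀ y ∈ Ω, ‖g x - g y‖ ≤ H * ‖x - y‖ ^ α) (hH : 0 ≤ H) (hβ : 0 < β) (hβα : β < α)
    (hα1 : α ≤ 1) {f : E2 → ℂ} {L η ε d₀ : ℝ} (hη : ∀ x ∈ Ω, ‖f x - g x‖ ≤ η) (hL : 0 ≤ L)
    (hcell : ∀ s ∈ K.faces, s.card = 3 → ∀ x ∈ cell s,
      ∀ y ∈ cell s, ‖f x - f y‖ ≤ L * ‖x - y‖) (hd₀ : 0 < d₀)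
    (h1 : 2 * η ≤ ε * d₀ ^ β) (h2 : L * d₀ ^ (1 - β) ≤ ε) (h3 : H * d₀ ^ (α - β) ≤ ε)
    (h4 : 2 * η * (3 * C * n) ^ β ≤ ε) :
    ∀ x ∈ Ω, ∀ y ∈ Ω, ‖f x - g x - (f y - g y)‖ ≤ 4 * (1 + 3 * C ^ 2) * ε * ‖x - y‖ ^ β := by
  have hε : 0 ≤ ε := le_trans (by positivity) h2
  have hfar : ∀ x ∈ Ω, ∀ y ∈ Ω, ‖f x - g x - (f y - g y)‖ ≤ 2 * η := fun x hx y hy =>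
    (norm_sub_le _ _).trans (by linarith [hη x hx, hη y hy])
  have hin : ∀ s ∈ K.faces, s.card = 3 → ∀ x ∈ cell s,
      ∀ y ∈ cell s, ‖f x - g x - (f y - g y)‖ ≤ 2 * ε * ‖x - y‖ ^ β := by
    intro s hs hs3 x hx y hy
    have hxΩ := hK.mem_of_hull hs hx
    have hyΩ := hK.mem_of_hull hs hy
    have hn0 := norm_nonneg (x - y)
    rcases le_total d₀ ‖x - y‖ with h | h
    · refine (hfar x hxΩ y hyΩ).trans (h1.trans ?_)
      have := rpow_le_rpow hd₀.le h hβ.le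
      have := mul_le_mul_of_nonneg_left this hε
      have := mul_nonneg hε (rpow_nonneg hn0 β)
      linarith
    · rcases hn0.eq_or_lt with h0 | h0
      · rw [norm_sub_eq_zero_iff.1 h0.symm, sub_self, norm_zero]; positivity
      have hp : ∀ {c q : ℝ}, 0 ≤ c → β ≤ q → c * d₀ ^ (q - β) ≤ ε →
          c * ‖x - y‖ ^ q ≤ ε * ‖x - y‖ ^ β := fun {c q} hc hq h' => by
        have : ‖x - y‖ ^ q = ‖x - y‖ ^ (q - β) * ‖x - y‖ ^ β := by
          rw [← rpow_add h0, sub_add_cancel]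
        rw [this, ← mul_assoc]
        refine mul_le_mul_of_nonneg_right (le_trans ?_ h') (by positivity)
        exact mul_le_mul_of_nonneg_left (rpow_le_rpow hn0 h (by linarith)) hc
      have e1 := hp hL (by linarith) h2
      rw [rpow_one] at e1
      have e2 := hp hH hβα.le h3
      rw [sub_sub_sub_comm]
      refine (norm_sub_le _ _).trans ?_
      linarith [hcell s hs hs3 x hx y hy, hg x hxΩ y hyΩ]
  have hmem : ∀ x ∈ Ω, ∃ s ∈ K.faces, s.card = 3 ∧ x ∈ cell s := fun x hx => by
    rw [← hK.tri.2.2.1, mem_space_iff] at hx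
    obtain ⟨s, hs, hxs⟩ := hx
    obtain ⟨t, ht, hst, h3⟩ := hK.tri.2.2.2 s hs
    exact ⟨t, ht, h3, convexHull_mono (Finset.coe_subset.2 hst) hxs⟩
  intro x hx y hy
  obtain ⟨s, hs, hs3, hxs⟩ := hmem x hx
  obtain ⟨t, ht, ht3, hyt⟩ := hmem y hy
  have hn0 := norm_nonneg (x - y)
  by_cases hst : Disjoint s t
  · have h5 := hK.separated hC.le hs ht hst hxs hyt
    have hη0 : 0 ≤ 2 * η := (norm_nonneg _).trans (hfar x hx y hy)
    calc _ ≤ 2 * η * 1 := by grind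
      _ ≤ 2 * η * (3 * C * n * ‖x - y‖) ^ β := by gcongr; exact one_le_rpow h5 hβ.le
      _ = 2 * η * (3 * C * n) ^ β * ‖x - y‖ ^ β := by
          rw [mul_rpow (by positivity) hn0]; ring
      _ ≤ ε * ‖x - y‖ ^ β := by gcongr
      _ ≤ _ := by
          gcongr
          nlinarith [sq_nonneg C]
  · classical
    obtain ⟨z, hz, hxz⟩ := hK.retract hC.le hn hs ht hst hxs hyt
    have hzs := convexHull_mono (Finset.coe_subset.2 Finset.inter_subset_left) hz
    have hzt := convexHull_mono (Finset.coe_subset.2 Finset.inter_subset_right) hz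
    have hzy : ‖z - y‖ ≤ (1 + 3 * C ^ 2) * ‖x - y‖ := by
      have := norm_sub_le_norm_sub_add_norm_sub z x y
      rw [norm_sub_rev z x] at this
      linarith
    have hA : 1 ≤ 1 + 3 * C ^ 2 := by nlinarith [sq_nonneg C]
    have hpow : ∀ {v : E2}, ‖v‖ ≤ (1 + 3 * C ^ 2) * ‖x - y‖ →
        2 * ε * ‖v‖ ^ β ≤ 2 * ε * ((1 + 3 * C ^ 2) * ‖x - y‖ ^ β) := fun {v} hv => by
      gcongr
      refine (rpow_le_rpow (norm_nonneg v) hv hβ.le).trans ?_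
      rw [mul_rpow (by linarith) hn0]
      gcongr
      exact (rpow_le_rpow_of_exponent_le hA (by linarith)).trans_eq (rpow_one _)
    have := norm_sub_le_norm_sub_add_norm_sub (f x - g x) (f z - g z) (f y - g y)
    have := hin s hs hs3 x hxs z hzs
    have := hin t ht ht3 z hzt y hyt
    have := hpow (v := x - z) (by linarith)
    have := hpow hzy
    linarith

end

theorem exists_holder_const {a : ℝ} {S : Set E2} {u : E2 → E2}
    (h : BddAbove (holderRatioSet a S u)) :
    ∃ H ≥ 1, ∀ x ∈ S, ∀ y ∈ S, ‖u x - u y‖ ≤ H * ‖x - y‖ ^ a := by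
  obtain ⟨H, hH⟩ := h
  refine ⟨max 1 H, le_max_left _ _, fun x hx y hy => ?_⟩
  by_cases hxy : x = y
  · subst hxy
    rw [sub_self, norm_zero]
    positivity
  · have h0 : 0 < ‖x - y‖ ^ a := rpow_pos_of_pos (norm_pos_iff.2 (sub_ne_zero.2 hxy)) a
    rw [← div_le_iff₀ h0]
    exact (hH ⟨x, hx, y, hy, hxy, rfl⟩).trans (le_max_right _ _)

theorem holderSeminorm_le {a c : ℝ} {S : Set E2} {u : E2 → E2} (hc : 0 ≤ c)
    (h : ∀ x ∈ S, ∀ y ∈ S, ‖u x - u y‖ ≤ c * ‖x - y‖ ^ a) : holderSeminorm a S u ≤ c := by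
  refine Real.sSup_le ?_ hc
  rintro _ ⟨x, hx, y, hy, hxy, rfl⟩
  rw [div_le_iff₀ (rpow_pos_of_pos (norm_pos_iff.2 (sub_ne_zero.2 hxy)) a)]
  exact h x hx y hy

theorem continuousOn_of_holder {a c : ℝ} (ha : 0 < a) {S : Set E2} {u : E2 → E2}
    (h : ∀ x ∈ S, ∀ y ∈ S, ‖u x - u y‖ ≤ c * ‖x - y‖ ^ a) : ContinuousOn u S := by
  intro x hx
  rw [ContinuousWithinAt, tendsto_iff_norm_sub_tendsto_zero]
  refine squeeze_zero' (.of_forall fun _ => norm_nonneg _)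
    (eventually_nhdsWithin_of_forall fun y hy => h y hy x hx) ?_
  have : Continuous fun y : E2 => c * ‖y - x‖ ^ a :=
    continuous_const.mul ((continuous_id.sub continuous_const).norm.rpow_const
      fun _ => Or.inr ha.le)
  have := (this.tendsto x).mono_left (nhdsWithin_le_nhds (s := S))
  simpa [zero_rpow ha.ne'] using this

theorem isHomeoOn_of_isCompact {S : Set E2} (hS : IsCompact S) {f : E2 → E2}
    (hf : ContinuousOn f S) (hi : InjOn f S) : IsHomeoOn f S := by
  refine ⟨hf, hi, continuousOn_iff_isClosed.2 fun t ht => ⟨f '' (S ∩ t), ?_, ?_⟩⟩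
  · exact ((hS.inter_right ht).image_of_continuousOn (hf.mono inter_subset_left)).isClosed
  · ext y
    constructor
    · rintro ⟨hy, x, hx, rfl⟩
      rw [mem_preimage, hi.leftInvOn_invFunOn hx] at hy
      exact ⟨⟨x, ⟨hx, hy⟩, rfl⟩, x, hx, rfl⟩
    · rintro ⟨⟨x, ⟨hx, hxt⟩, rfl⟩, -⟩
      refine ⟨?_, x, hx, rfl⟩
      rwa [mem_preimage, hi.leftInvOn_invFunOn hx]

theorem eventually_mul_rpow_neg_le (W : ℝ) {e ε : ℝ} (he : 0 < e) (hε : 0 < ε) :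
    ∀ᶠ n : ℕ in Filter.atTop, W * (n : ℝ) ^ (-e) ≤ ε := by
  have := ((tendsto_rpow_neg_atTop he).comp tendsto_natCast_atTop_atTop).const_mul W
  rw [mul_zero] at this
  exact (this.eventually (gt_mem_nhds hε)).mono fun n hn => hn.le

/-- quantitative Hölder approximation with explicit exponent `γ`. -/
theorem statement1 (Ω : Set E2) (hΩ : IsClosedPolygon Ω)
    (α α' : ℝ) (hα0 : 0 < α) (hα1 : α ≤ 1) (hα'0 : 0 < α') (hα'1 : α' ≤ 1)
    (h : E2 → E2) (hhom : IsHomeoOn h Ω) (hH : BddAbove (holderRatioSet α Ω h))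
    (hH' : BddAbove (holderRatioSet α' (h '' Ω) (Function.invFunOn h Ω))) (γ : ℝ)
    (hγ : γ = α ^ 4 * α' ^ 3 /
      (3 + 6 * α * α' - 6 * α ^ 2 * α' ^ 2 - α ^ 3 * α' ^ 3 - α ^ 4 * α' ^ 3))
    (β : ℝ) (hβ0 : 0 < β) (hβγ : β < γ) : ∃ ε₀ > (0 : ℝ), ∃ D > (0 : ℝ), ∀ ε : ℝ, 0 < ε → ε ≤ ε₀ →
      ∃ (K : SimplicialComplex ℝ E2) (f : E2 → E2),
        IsTriangulation K Ω ∧ IsHomeoOn f Ω ∧ PiecewiseAffineOn f K ∧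
        supNorm Ω (fun x => f x - h x) ≤ ε ∧
        holderSeminorm β Ω (fun x => f x - h x) ≤ D * ε ^ (1 - β / γ) := by
  obtain ⟨hc, K₀, hK₀⟩ := hΩ
  obtain ⟨H₁, hH₁, hup⟩ := exists_holder_const hH
  obtain ⟨H₂, -, hlo⟩ := exists_holder_const hH'
  set J : ℂ ≃ₗᵢ[ℝ] E2 := Complex.orthonormalBasisOneI.repr
  set g : E2 → ℂ := fun x => J.symm (h x)
  have hJg : ∀ x, J (g x) = h x := fun x => J.apply_symm_apply _
  have hgn : ∀ x y, ‖g x - g y‖ = ‖h x - h y‖ := fun x y => by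
    rw [← J.norm_map, map_sub, hJg, hJg]
  have hg : BiHolder g Ω (max H₁ H₂) α α' := by
    refine ⟨fun x hx y hy => ?_, fun x hx y hy => ?_⟩
    · rw [hgn]
      exact (hup x hx y hy).trans (by gcongr; exact le_max_left _ _)
    · have := hlo (h x) ⟨x, hx, rfl⟩ (h y) ⟨y, hy, rfl⟩
      rw [hhom.2.1.leftInvOn_invFunOn hx, hhom.2.1.leftInvOn_invFunOn hy] at this
      rw [hgn]
      exact this.trans (by gcongr; exact le_max_right _ _)
  have hH1 : 1 ≤ max H₁ H₂ := hH₁.trans (le_max_left _ _)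
  set H := max H₁ H₂
  obtain ⟨C, hC, B₁, hB₁, B₂, hB₂, hmaps⟩ := exists_fine_maps hK₀ hg
    (J.symm.continuous.comp_continuousOn hhom.1) hH1 hα0 hα1 hα'0 hα'1
  obtain ⟨σ, hσ, hσ1, hσ2, hβα⟩ := exponents hα0 hα1 hα'0 hα'1 hγ hβ0 hβγ
  set p := 1 - α + 3 * ((1 / (α * α')) ^ 3 - 1)
  refine ⟨1, one_pos, 1, one_pos, fun ε hε _ => ?_⟩
  rw [one_mul]
  obtain ⟨δ, hδ, hδ1, hδ2⟩ : ∃ δ > 0, δ ≤ ε ∧ δ ≤ ε ^ (1 - β / γ) :=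
    ⟨min ε (ε ^ (1 - β / γ)), by positivity, min_le_left _ _, min_le_right _ _⟩
  have hA : 0 < 4 * (1 + 3 * C ^ 2) := by positivity
  have hδA : 0 < δ / (4 * (1 + 3 * C ^ 2)) := div_pos hδ hA
  obtain ⟨n, hn, h1, h2, h3, h4, h5⟩ := ((Filter.eventually_gt_atTop 0).and <|
    (eventually_mul_rpow_neg_le (2 * B₁) hσ1 hδA).and <|
    (eventually_mul_rpow_neg_le B₂ hσ2 hδA).and <|
    (eventually_mul_rpow_neg_le H (mul_pos hσ (sub_pos.2 hβα)) hδA).and <|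
    (eventually_mul_rpow_neg_le (2 * B₁ * (3 * C) ^ β) (sub_pos.2 hβα) hδA).and <|
    eventually_mul_rpow_neg_le B₁ hα0 hδ).exists
  have hX : (0 : ℝ) < n := mod_cast hn
  obtain ⟨K, hK, f, hfi, hfg, hcell⟩ := hmaps n hn
  have hpow : ∀ q : ℝ, ((n : ℝ) ^ (-σ)) ^ q = (n : ℝ) ^ (-(σ * q)) := fun q => by
    rw [← rpow_mul hX.le, neg_mul]
  have hd : ∀ x ∈ Ω, ∀ y ∈ Ω, ‖f x - g x - (f y - g y)‖ ≤ δ * ‖x - y‖ ^ β := by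
    have := hK.holder_bound (d₀ := (n : ℝ) ^ (-σ)) hC hn hg.upper (by linarith) hβ0 hβα hα1 hfg
      (L := B₂ * (n : ℝ) ^ p) (by positivity) (fun s hs hs3 => (hcell s hs hs3).2)
      (ε := δ / (4 * (1 + 3 * C ^ 2))) (by positivity)
    rw [mul_div_cancel₀ _ hA.ne'] at this
    refine this ?_ ?_ ?_ ?_
    · have e : (n : ℝ) ^ (-α) = (n : ℝ) ^ (-(α - σ * β)) * ((n : ℝ) ^ (-σ)) ^ β := by
        rw [hpow, ← rpow_add hX]
        ring_nf
      rw [e, ← mul_assoc, ← mul_assoc]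
      gcongr
    · rw [hpow, mul_assoc, ← rpow_add hX]
      convert h2 using 3
      ring
    · rwa [hpow]
    · rw [mul_rpow (by positivity) hX.le]
      convert h4 using 1
      rw [neg_sub, sub_eq_add_neg, rpow_add hX]
      ring
  have hdJ : ∀ x ∈ Ω, ∀ y ∈ Ω, ‖J (f x) - h x - (J (f y) - h y)‖ ≤ δ * ‖x - y‖ ^ β :=
    fun x hx y hy => by
      rw [← hJg x, ← hJg y, ← map_sub, ← map_sub, ← map_sub, J.norm_map]
      exact hd x hx y hy
  obtain ⟨K', hK', hpl⟩ := exists_piecewiseAffineOn (f := fun x => J (f x)) hK.tri fun s hs hs3 =>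
    (hcell s hs hs3).1.affine_comp J.toLinearEquiv.toLinearMap.toAffineMap
  refine ⟨K', fun x => J (f x), hK', isHomeoOn_of_isCompact hc ?_ ?_, hpl, ?_, ?_⟩
  · exact ((continuousOn_of_holder hβ0 hdJ).add hhom.1).congr fun x _ => (sub_add_cancel _ _).symm
  · exact fun x hx y hy hxy => hfi hx hy (J.injective hxy)
  · refine Real.sSup_le ?_ hε.le
    rintro _ ⟨x, hx, rfl⟩
    have e : ‖J (f x) - h x‖ = ‖f x - g x‖ := by rw [← hJg x, ← map_sub, J.norm_map]
    exact e.trans_le ((hfg x hx).trans (h5.trans hδ1))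
  · exact holderSeminorm_le (by positivity) fun x hx y hy =>
      (hdJ x hx y hy).trans (by gcongr)

end
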